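/- Let 1 < p, q ≤ ∞ be exponents, define r by 1/r = 1/p + 1/q, and assume 0 < 1/r < 3/2. Then there exists a constant C = C(p,q,r) such that for every sequence (I_n)_{n∈ℤ} of intervals of ℝ (no disjointness or overlap assumption) and all sequences (f_n)_{n∈ℤ}, (g_n)_{n∈ℤ} of Schwartz functions on ℝ with all but finitely many terms identically zero, ‖ ( Σ_{n∈ℤ} |π_{I_n}(f_n,g_n)|² )^{1/2} ‖_{L^r(ℝ)} ≤ C ‖ ( Σ_{n∈ℤ} |f_n|² )^{1/2} ‖_{L^p(ℝ)} ‖ ( Σ_{n∈ℤ} |g_n|² )^{1/2} ‖_{L^q(ℝ)}. -/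

import Mathlib

open MeasureTheory Real Set
open scoped ENNReal

/-- The Fourier transform `f̂(ξ) = ∫ f(t) e^{-2πitξ} dt`. -/
noncomputable def FT (f : ℝ → ℂ) (ξ : ℝ) : ℂ :=
  ∫ t : ℝ, Complex.exp (((-2 * Real.pi * t * ξ : ℝ) : ℂ) * Complex.I) * f t

/-- The bilinear multiplier
`π_A(f,g)(x) = ∫∫ e^{2πix(ξ₁+ξ₂)} f̂(ξ₁) ĝ(ξ₂) 1_A(ξ₂-ξ₁) dξ₁ dξ₂`. -/
noncomputable def biMul (A : Set ℝ) (f g : ℝ → ℂ) (x : ℝ) : ℂ :=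
  ∫ ξ : ℝ × ℝ, Complex.exp (((2 * Real.pi * x * (ξ.1 + ξ.2) : ℝ) : ℂ) * Complex.I) *
    FT f ξ.1 * FT g ξ.2 * A.indicator 1 (ξ.2 - ξ.1)

namespace BHT

open scoped FourierTransform SchwartzMap ContDiff ComplexConjugate

/-- A smooth bump function supported in `[-1, 1]`. -/
noncomputable def bump : ContDiffBump (0 : ℝ) := ⟨1 / 2, 1, by norm_num, by norm_num⟩

noncomputable def chi (x : ℝ) : ℝ := bump x

lemma chi_nonneg (x : ℝ) : 0 ≤ chi x := bump.nonneg
lemma chi_le_one (x : ℝ) : chi x ≤ 1 := bump.le_one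
lemma chi_zero : chi 0 = 1 := bump.one_of_mem_closedBall (by simp [bump])
lemma chi_eq_zero {x : ℝ} (h : 1 ≤ |x|) : chi x = 0 :=
  bump.zero_of_le_dist (by simpa [bump, Real.dist_eq] using h)
lemma chi_contDiff : ContDiff ℝ ∞ chi := bump.contDiff
lemma chi_continuous : Continuous chi := bump.continuous
/-- The wave packet on the frequency side, at scale `t`, frequency `ξ`, position `y`. -/
noncomputable def apk (t ξ y w : ℝ) : ℂ :=
  chi (t * (w - ξ)) * Complex.exp ((2 * π * w * y : ℝ) * Complex.I)

lemma apk_contDiff (t ξ y : ℝ) : ContDiff ℝ ∞ (apk t ξ y) := by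
  unfold apk
  have h1 : ContDiff ℝ ∞ fun w : ℝ => chi (t * (w - ξ)) :=
    chi_contDiff.comp (by fun_prop)
  have h2 : ContDiff ℝ ∞ fun w : ℝ => (2 * π * w * y : ℝ) := by fun_prop
  exact (Complex.ofRealCLM.contDiff.comp h1).mul
    ((((Complex.ofRealCLM.contDiff.comp h2)).mul contDiff_const).cexp)

lemma apk_hasCompactSupport {t : ℝ} (ht : 0 < t) (ξ y : ℝ) : HasCompactSupport (apk t ξ y) := by
  apply HasCompactSupport.of_support_subset_isCompact (isCompact_Icc (a := ξ - 1 / t) (b := ξ + 1 / t))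
  intro w hw
  by_contra hn
  apply hw
  have : 1 ≤ |t * (w - ξ)| := by
    by_contra! h1
    rw [abs_mul, abs_of_pos ht, mul_comm, ← lt_div_iff₀ ht, abs_lt] at h1
    exact hn ⟨by linarith, by linarith⟩
  simp [apk, chi_eq_zero this]

/-- The wave packet on the frequency side, as a Schwartz function. -/
noncomputable def apkS (t : ℝ) (ht : 0 < t) (ξ y : ℝ) : 𝓢(ℝ, ℂ) :=
  (apk_hasCompactSupport ht ξ y).toSchwartzMap (apk_contDiff t ξ y)

lemma apkS_apply (t : ℝ) (ht : 0 < t) (ξ y w : ℝ) : apkS t ht ξ y w = apk t ξ y w := rfl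

noncomputable def psiS : 𝓢(ℝ, ℂ) := 𝓕 (apkS 1 one_pos 0 0)

/-- The mother wave packet. -/
noncomputable def psi (x : ℝ) : ℂ := psiS (-x)

/-- The wave packet at scale `t`, frequency `ξ` and position `y`. -/
noncomputable def pk (t ξ y x : ℝ) : ℂ :=
  (t : ℂ)⁻¹ * psi ((y - x) / t) * Complex.exp ((2 * π * ξ * (y - x) : ℝ) * Complex.I)

lemma psi_eq (x : ℝ) :
    psi x = ∫ w : ℝ, Complex.exp ((2 * π * w * x : ℝ) * Complex.I) * chi w := by
  unfold psi psiS
  rw [SchwartzMap.fourier_coe, Real.fourier_real_eq_integral_exp_smul]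
  congr 1; ext w
  simp [apkS_apply, apk]

lemma pk_eq_fourier {t : ℝ} (ht : 0 < t) (ξ y : ℝ) (x : ℝ) :
    𝓕 (apk t ξ y) x = pk t ξ y x := by
  rw [Real.fourier_real_eq_integral_exp_smul, pk, psi_eq]
  have e1 : ∀ w : ℝ, Complex.exp (↑(-2 * π * w * x) * Complex.I) • apk t ξ y w =
      (fun u : ℝ => Complex.exp ((2 * π * ξ * (y - x) : ℝ) * Complex.I) *
        (Complex.exp ((2 * π * u * ((y - x) / t) : ℝ) * Complex.I) * chi u)) (t * (w - ξ)) := by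
    intro w
    simp only [apk, smul_eq_mul]
    rw [mul_left_comm, ← mul_assoc, ← mul_assoc, mul_comm _ (Complex.exp _), mul_assoc, mul_comm (chi _ : ℂ),
      ← mul_assoc, ← Complex.exp_add, ← Complex.exp_add]
    congr 2
    push_cast
    have : (t : ℂ) ≠ 0 := by exact_mod_cast ht.ne'
    field_simp
    ring
  simp_rw [e1]
  set H : ℝ → ℂ := fun u : ℝ => Complex.exp ((2 * π * ξ * (y - x) : ℝ) * Complex.I) *
        (Complex.exp ((2 * π * u * ((y - x) / t) : ℝ) * Complex.I) * chi u) with hH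
  rw [integral_sub_right_eq_self (μ := volume) (fun w : ℝ => H (t * w)) ξ,
    Measure.integral_comp_mul_left H t, hH, integral_const_mul]
  rw [abs_of_pos (inv_pos.2 ht), Complex.real_smul]
  push_cast
  ring

lemma pk_coe {t : ℝ} (ht : 0 < t) (ξ y : ℝ) : ⇑(𝓕 (apkS t ht ξ y) : 𝓢(ℝ, ℂ)) = pk t ξ y := by
  rw [SchwartzMap.fourier_coe]
  ext x
  exact pk_eq_fourier ht ξ y x

lemma pk_continuous {t : ℝ} (ht : 0 < t) (ξ y : ℝ) : Continuous (pk t ξ y) := by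
  rw [← pk_coe ht]; exact SchwartzMap.continuous _

lemma pk_integrable {t : ℝ} (ht : 0 < t) (ξ y : ℝ) : Integrable (pk t ξ y) := by
  rw [← pk_coe ht]; exact SchwartzMap.integrable _

lemma apk_integrable {t : ℝ} (ht : 0 < t) (ξ y : ℝ) : Integrable (apk t ξ y) :=
  (apkS t ht ξ y).integrable

/-- Orthogonality of wave packets with separated frequencies. -/
lemma pk_inner_eq_zero {t t' ξ ξ' : ℝ} (ht : 0 < t) (ht' : 0 < t') (y y' : ℝ)
    (h : 1 / t + 1 / t' ≤ |ξ - ξ'|) :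
    ∫ x, pk t ξ y x * conj (pk t' ξ' y' x) = 0 := by
  have := SchwartzMap.integral_inner_fourier_fourier (apkS t' ht' ξ' y') (apkS t ht ξ y)
  rw [pk_coe, pk_coe] at this
  simp only [RCLike.inner_apply] at this
  rw [this]
  have : ∀ w, apkS t ht ξ y w * conj (apkS t' ht' ξ' y' w) = 0 := by
    intro w
    simp only [apkS_apply, apk]
    by_cases h1 : 1 ≤ |t * (w - ξ)|
    · simp [chi_eq_zero h1]
    · have : 1 ≤ |t' * (w - ξ')| := by
        by_contra! h2
        push Not at h1
        rw [abs_mul, abs_of_pos ht, mul_comm, ← lt_div_iff₀ ht] at h1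
        rw [abs_mul, abs_of_pos ht', mul_comm, ← lt_div_iff₀ ht'] at h2
        have := abs_sub_le ξ w ξ'
        rw [abs_sub_comm ξ w] at this
        linarith
      simp [chi_eq_zero this]
  simp [this]

/-- Polynomially decaying weight. -/
noncomputable def br (N : ℕ) (s u : ℝ) : ℝ := ((1 + |u| / s) ^ N)⁻¹

lemma psi_decay (N : ℕ) : ∃ C : ℝ, 0 < C ∧ ∀ x, ‖psi x‖ ≤ C * br N 1 x := by
  have := psiS.one_add_le_sup_seminorm_apply (𝕜 := ℝ) (m := (N, 0)) (k := N) (n := 0) le_rfl le_rfl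
  generalize (2 : ℝ) ^ (N, 0).1 * _ = B at this
  refine ⟨|B| + 1, by positivity, fun x => ?_⟩
  have h := this (-x)
  rw [norm_iteratedFDeriv_zero] at h
  unfold br psi
  rw [← div_eq_mul_inv, le_div_iff₀ (by positivity)]
  simp only [norm_neg, Real.norm_eq_abs] at h
  rw [mul_comm, div_one]
  exact h.trans (by linarith [le_abs_self B])

lemma psi_differentiable : Differentiable ℝ psi := by
  unfold psi
  exact psiS.differentiable.comp differentiable_neg

lemma psi_deriv_decay (N : ℕ) : ∃ C : ℝ, 0 < C ∧ ∀ x, ‖deriv psi x‖ ≤ C * br N 1 x := by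
  have := (SchwartzMap.derivCLM ℝ ℂ psiS).one_add_le_sup_seminorm_apply (𝕜 := ℝ) (m := (N, 0)) (k := N) (n := 0) le_rfl le_rfl
  generalize (2 : ℝ) ^ (N, 0).1 * _ = B at this
  refine ⟨|B| + 1, by positivity, fun x => ?_⟩
  have h := this (-x)
  rw [norm_iteratedFDeriv_zero, SchwartzMap.derivCLM_apply] at h
  have e : deriv psi x = - deriv psiS (-x) := by
    unfold psi
    exact deriv_comp_neg psiS x
  rw [e, norm_neg]
  unfold br
  rw [← div_eq_mul_inv, le_div_iff₀ (by positivity)]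
  simp only [norm_neg, Real.norm_eq_abs] at h
  rw [mul_comm, div_one]
  exact h.trans (by linarith [le_abs_self B])

lemma br_pos (N : ℕ) {s : ℝ} (hs : 0 < s) (u : ℝ) : 0 < br N s u := by
  unfold br; positivity

lemma br_nonneg (N : ℕ) {s : ℝ} (hs : 0 < s) (u : ℝ) : 0 ≤ br N s u := (br_pos N hs u).le

lemma br_le_one (N : ℕ) {s : ℝ} (hs : 0 < s) (u : ℝ) : br N s u ≤ 1 := by
  unfold br
  have : 0 ≤ |u| / s := by positivity
  exact inv_le_one_of_one_le₀ (one_le_pow₀ (by linarith))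

lemma br_mono_scale (N : ℕ) {s s' : ℝ} (hs : 0 < s) (h : s ≤ s') (u : ℝ) :
    br N s u ≤ br N s' u := by
  have hs' := hs.trans_le h
  unfold br
  gcongr

lemma br_anti (N : ℕ) {s u v : ℝ} (hs : 0 < s) (h : |u| ≤ |v|) : br N s v ≤ br N s u := by
  unfold br
  gcongr

lemma br_add (M N : ℕ) (s u : ℝ) : br (M + N) s u = br M s u * br N s u := by
  unfold br; rw [pow_add, mul_inv]

lemma br_anti_exp {M N : ℕ} (h : M ≤ N) {s : ℝ} (hs : 0 < s) (u : ℝ) : br N s u ≤ br M s u := by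
  obtain ⟨k, rfl⟩ := Nat.exists_eq_add_of_le h
  rw [br_add]
  exact mul_le_of_le_one_right (br_nonneg _ hs _) (br_le_one _ hs _)

lemma br_neg (N : ℕ) (s u : ℝ) : br N s (-u) = br N s u := by simp [br]

lemma br_sub_comm (N : ℕ) (s u v : ℝ) : br N s (u - v) = br N s (v - u) := by
  rw [← br_neg]; simp

lemma br_mul_le (N : ℕ) {s : ℝ} (hs : 0 < s) (u v w : ℝ) :
    br N s (u - v) * br N s (v - w) ≤ br N s (u - w) := by
  unfold br
  rw [← mul_inv, ← mul_pow]
  have h := abs_sub_le u v w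
  have : |u - w| / s ≤ |u - v| / s + |v - w| / s := by rw [← add_div]; gcongr
  have h2 : 0 ≤ |u - v| / s * (|v - w| / s) := by positivity
  gcongr
  nlinarith

lemma br_scale (N : ℕ) {s : ℝ} (hs : 0 < s) (u : ℝ) : br N s u = br N 1 (u / s) := by
  simp [br, abs_div, abs_of_pos hs]

lemma br_continuous (N : ℕ) {s : ℝ} (hs : 0 < s) : Continuous (br N s) := by
  unfold br
  refine Continuous.inv₀ (by fun_prop) fun u => ?_
  positivity

lemma br_two_integrable : Integrable (br 2 1) := by
  have := integrable_one_add_norm (E := ℝ) (μ := volume) (r := 2) (by simp)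
  refine this.congr (ae_of_all _ fun x => ?_)
  simp only [br, Real.norm_eq_abs, div_one]
  rw [Real.rpow_neg (by positivity)]
  norm_num

/-- The integral of the basic weight. -/
noncomputable def I0 : ℝ := ∫ x, br 2 1 x

lemma I0_nonneg : 0 ≤ I0 := integral_nonneg fun _ => br_nonneg _ one_pos _

lemma br_integrable_sub {s : ℝ} (hs : 0 < s) (y : ℝ) : Integrable fun x => br 2 s (x - y) := by
  have := (br_two_integrable.comp_div hs.ne').comp_sub_right y
  exact this.congr (ae_of_all _ fun x => (br_scale 2 hs (x - y)).symm)

lemma br_integral_sub {s : ℝ} (hs : 0 < s) (y : ℝ) : ∫ x, br 2 s (x - y) = s * I0 := by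
  rw [integral_sub_right_eq_self (fun x => br 2 s x) y]
  simp_rw [br_scale 2 hs]
  rw [Measure.integral_comp_div, abs_of_pos hs, I0, smul_eq_mul]

lemma br_integrable_of_two_le {N : ℕ} (hN : 2 ≤ N) {s : ℝ} (hs : 0 < s) (y : ℝ) :
    Integrable fun x => br N s (x - y) := by
  refine (br_integrable_sub hs y).mono' ((br_continuous N hs).comp (by fun_prop)).aestronglyMeasurable
    (ae_of_all _ fun x => ?_)
  rw [Real.norm_of_nonneg (br_nonneg _ hs _)]
  exact br_anti_exp hN hs _

lemma br_integral_le {N : ℕ} (hN : 2 ≤ N) {s : ℝ} (hs : 0 < s) (y : ℝ) :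
    ∫ x, br N s (x - y) ≤ s * I0 := by
  rw [← br_integral_sub hs y]
  exact integral_mono (br_integrable_of_two_le hN hs y) (br_integrable_sub hs y)
    fun x => br_anti_exp hN hs _

lemma pk_bound (N : ℕ) : ∃ C : ℝ, 0 < C ∧ ∀ t ξ y x : ℝ, 0 < t →
    ‖pk t ξ y x‖ ≤ C * (t⁻¹ * br N t (y - x)) := by
  obtain ⟨C, hC, h⟩ := psi_decay N
  refine ⟨C, hC, fun t ξ y x ht => ?_⟩
  have := h ((y - x) / t)
  rw [← br_scale N ht] at this
  rw [pk, norm_mul, norm_mul, Complex.norm_exp_ofReal_mul_I, mul_one, norm_inv, Complex.norm_real,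
    Real.norm_of_nonneg ht.le]
  calc t⁻¹ * ‖psi ((y - x) / t)‖ ≤ t⁻¹ * (C * br N t (y - x)) := by gcongr
    _ = _ := by ring

lemma br_conv_le (N : ℕ) {t t' : ℝ} (ht : 0 < t) (h : t ≤ t') (y y' : ℝ) :
    ∫ x, (t⁻¹ * br (N + 2) t (y - x)) * (t'⁻¹ * br (N + 2) t' (y' - x)) ≤
      I0 * (t'⁻¹ * br N t' (y - y')) := by
  have ht' := ht.trans_le h
  have key : ∀ x, (t⁻¹ * br (N + 2) t (y - x)) * (t'⁻¹ * br (N + 2) t' (y' - x)) ≤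
      (t⁻¹ * t'⁻¹ * br N t' (y - y')) * br 2 t (x - y) := by
    intro x
    have h1 : br (N + 2) t (y - x) ≤ br N t' (y - x) * br 2 t (x - y) := by
      rw [br_add, br_sub_comm 2 t]
      exact mul_le_mul_of_nonneg_right (br_mono_scale _ ht h _) (br_nonneg _ ht _)
    have h2 : br (N + 2) t' (y' - x) ≤ br N t' (x - y') := by
      rw [br_sub_comm N]; exact br_anti_exp (by omega) ht' _
    have h3 := br_mul_le N ht' y x y'
    have n1 := br_nonneg 2 ht (x - y)
    have n2 := br_nonneg N ht' (y - x)
    have n3 := br_nonneg N ht' (x - y')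
    calc _ = t⁻¹ * t'⁻¹ * (br (N + 2) t (y - x) * br (N + 2) t' (y' - x)) := by ring
      _ ≤ t⁻¹ * t'⁻¹ * ((br N t' (y - x) * br 2 t (x - y)) * br N t' (x - y')) := by
        gcongr
        exact br_nonneg _ ht' _
      _ = t⁻¹ * t'⁻¹ * ((br N t' (y - x) * br N t' (x - y')) * br 2 t (x - y)) := by ring
      _ ≤ t⁻¹ * t'⁻¹ * (br N t' (y - y') * br 2 t (x - y)) := by gcongr
      _ = _ := by ring
  calc _ ≤ ∫ x, (t⁻¹ * t'⁻¹ * br N t' (y - y')) * br 2 t (x - y) := by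
        apply integral_mono_of_nonneg (ae_of_all _ fun x => ?_)
          ((br_integrable_sub ht y).const_mul _) (ae_of_all _ key)
        have := br_nonneg (N + 2) ht (y - x)
        have := br_nonneg (N + 2) ht' (y' - x)
        positivity
    _ = _ := by
        rw [integral_const_mul, br_integral_sub ht]
        field_simp

lemma pk_bound_bounded {t : ℝ} (ht : 0 < t) (ξ y : ℝ) : ∃ C, ∀ x, ‖pk t ξ y x‖ ≤ C := by
  obtain ⟨C, hC, h⟩ := pk_bound 0
  refine ⟨C * t⁻¹, fun x => (h t ξ y x ht).trans ?_⟩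
  simp [br]

lemma pk_mul_integrable {t t' : ℝ} (ht : 0 < t) (ht' : 0 < t') (ξ ξ' y y' : ℝ) :
    Integrable fun x => pk t ξ y x * conj (pk t' ξ' y' x) := by
  obtain ⟨C, h⟩ := pk_bound_bounded ht' ξ' y'
  refine (pk_integrable ht ξ y).mul_bdd (c := C) ?_ (ae_of_all _ fun x => ?_)
  · exact (Complex.continuous_conj.comp (pk_continuous ht' ξ' y')).aestronglyMeasurable
  · simpa using h x

/-- Decay of the inner product of two wave packets. -/
lemma pk_inner_bound (N : ℕ) : ∃ C : ℝ, 0 < C ∧ ∀ t t' ξ ξ' y y' : ℝ, 0 < t → 0 < t' →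
    ‖∫ x, pk t ξ y x * conj (pk t' ξ' y' x)‖ ≤
      C * ((max t t')⁻¹ * br N (max t t') (y - y')) := by
  obtain ⟨C, hC, h⟩ := pk_bound (N + 2)
  refine ⟨C * C * (I0 + 1), by have := I0_nonneg; positivity, ?_⟩
  have step : ∀ t t' ξ ξ' y y' : ℝ, 0 < t → t ≤ t' →
      ∫ x, ‖pk t ξ y x‖ * ‖pk t' ξ' y' x‖ ≤ C * C * (I0 + 1) * (t'⁻¹ * br N t' (y - y')) := by
    intro t t' ξ ξ' y y' ht htt
    have ht' := ht.trans_le htt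
    have n := br_nonneg N ht' (y - y')
    calc ∫ x, ‖pk t ξ y x‖ * ‖pk t' ξ' y' x‖
        ≤ ∫ x, (C * C) * ((t⁻¹ * br (N + 2) t (y - x)) * (t'⁻¹ * br (N + 2) t' (y' - x))) := by
          apply integral_mono_of_nonneg (ae_of_all _ fun x => by positivity)
          · refine Integrable.const_mul ?_ _
            have : Integrable fun x => t⁻¹ * br (N + 2) t (y - x) := by
              simp_rw [br_sub_comm _ _ y]
              exact (br_integrable_of_two_le (by omega) ht y).const_mul _
            refine this.mul_bdd (c := t'⁻¹) ?_ (ae_of_all _ fun x => ?_)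
            · exact (((br_continuous _ ht').comp (by fun_prop : Continuous fun x => y' - x)).const_smul
                t'⁻¹).aestronglyMeasurable
            · have := br_nonneg (N + 2) ht' (y' - x)
              rw [Real.norm_of_nonneg (by positivity)]
              exact mul_le_of_le_one_right (by positivity) (br_le_one _ ht' _)
          · refine ae_of_all _ fun x => ?_
            have h1 := h t ξ y x ht
            have h2 := h t' ξ' y' x ht'
            calc ‖pk t ξ y x‖ * ‖pk t' ξ' y' x‖ ≤ _ := mul_le_mul h1 h2 (by positivity)
                  ((norm_nonneg _).trans h1)
              _ = _ := by ring
      _ ≤ (C * C) * (I0 * (t'⁻¹ * br N t' (y - y'))) := by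
          rw [integral_const_mul]
          gcongr
          exact br_conv_le N ht htt y y'
      _ ≤ _ := by
          have : 0 ≤ C * C * (t'⁻¹ * br N t' (y - y')) := by positivity
          nlinarith
  intro t t' ξ ξ' y y' ht ht'
  refine (norm_integral_le_integral_norm _).trans ?_
  simp_rw [norm_mul, RCLike.norm_conj]
  rcases le_total t t' with hle | hle
  · rw [max_eq_right hle]
    exact step t t' ξ ξ' y y' ht hle
  · rw [max_eq_left hle]
    have := step t' t ξ' ξ y' y ht' hle
    rw [br_sub_comm] at this
    simpa only [mul_comm] using this

/-- Lipschitz bound for demodulated wave packets. -/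
lemma pk_lipschitz (N : ℕ) (R : ℝ) (hR : 0 ≤ R) : ∃ C : ℝ, 0 < C ∧ ∀ t ξ w y x x' B : ℝ, 0 < t →
    |ξ - w| ≤ R / t → (∀ u ∈ uIcc x x', br N t (y - u) ≤ B) →
    ‖pk t ξ y x * Complex.exp ((2 * π * w * x : ℝ) * Complex.I) -
      pk t ξ y x' * Complex.exp ((2 * π * w * x' : ℝ) * Complex.I)‖ ≤
      C * (t⁻¹ * t⁻¹ * B) * |x - x'| := by
  obtain ⟨C1, hC1, h1⟩ := psi_decay N
  obtain ⟨C2, hC2, h2⟩ := psi_deriv_decay N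
  refine ⟨C2 + C1 * (2 * π * R), by positivity, ?_⟩
  intro t ξ w y x x' B ht hξ hB
  set q : ℝ → ℂ := fun u => pk t ξ y u * Complex.exp ((2 * π * w * u : ℝ) * Complex.I) with hq
  have hqe : q = fun u => ((t : ℂ)⁻¹ * Complex.exp ((2 * π * ξ * y : ℝ) * Complex.I)) *
      (psi ((y - u) / t) * Complex.exp ((2 * π * (w - ξ) * u : ℝ) * Complex.I)) := by
    ext u
    simp only [hq, pk]
    rw [mul_mul_mul_comm _ _ (psi _), ← Complex.exp_add, mul_assoc ((t : ℂ)⁻¹ * _), ← Complex.exp_add]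
    congr 2
    push_cast
    ring
  have hd : ∀ u, HasDerivAt q (((t : ℂ)⁻¹ * Complex.exp ((2 * π * ξ * y : ℝ) * Complex.I)) *
      ((-1 / t : ℝ) • deriv psi ((y - u) / t) * Complex.exp ((2 * π * (w - ξ) * u : ℝ) * Complex.I) +
      psi ((y - u) / t) * (Complex.exp ((2 * π * (w - ξ) * u : ℝ) * Complex.I) *
        (((2 * π * (w - ξ) * 1 : ℝ) : ℂ) * Complex.I)))) u := by
    intro u
    rw [hqe]
    refine HasDerivAt.const_mul _ (HasDerivAt.mul ?_ ?_)
    · have : HasDerivAt (fun u : ℝ => (y - u) / t) (-1 / t) u :=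
        ((hasDerivAt_id u).const_sub y).div_const t
      exact (psi_differentiable _).hasDerivAt.scomp u this
    · exact (((hasDerivAt_id u).const_mul (2 * π * (w - ξ))).ofReal_comp.mul_const Complex.I).cexp
  have hbd : ∀ u ∈ uIcc x x', ‖deriv q u‖ ≤ (C2 + C1 * (2 * π * R)) * (t⁻¹ * t⁻¹ * B) := by
    intro u hu
    rw [(hd u).deriv]
    have b1 := h1 ((y - u) / t)
    have b2 := h2 ((y - u) / t)
    rw [← br_scale N ht] at b1 b2
    have hb := hB u hu
    rw [norm_mul, norm_mul, Complex.norm_exp_ofReal_mul_I, mul_one, norm_inv, Complex.norm_real,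
      Real.norm_of_nonneg ht.le]
    have e2 : ‖(-1 / t : ℝ) • deriv psi ((y - u) / t) * Complex.exp ((2 * π * (w - ξ) * u : ℝ) * Complex.I)‖
        ≤ t⁻¹ * (C2 * B) := by
      rw [norm_mul, Complex.norm_exp_ofReal_mul_I, mul_one, norm_smul, norm_div, norm_neg, norm_one,
        Real.norm_of_nonneg ht.le, one_div]
      gcongr
      exact b2.trans (by gcongr)
    have e3 : ‖psi ((y - u) / t) * (Complex.exp ((2 * π * (w - ξ) * u : ℝ) * Complex.I) *
        (((2 * π * (w - ξ) * 1 : ℝ) : ℂ) * Complex.I))‖ ≤ (C1 * B) * (2 * π * (R / t)) := by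
      rw [norm_mul, norm_mul, Complex.norm_exp_ofReal_mul_I, one_mul, norm_mul, Complex.norm_I, mul_one,
        Complex.norm_real, mul_one, Real.norm_eq_abs, abs_mul, abs_of_pos (by positivity : 0 < 2 * π),
        abs_sub_comm]
      have : 0 ≤ C1 * B := (norm_nonneg _).trans (b1.trans (by gcongr))
      gcongr
      exact b1.trans (by gcongr)
    calc _ ≤ t⁻¹ * (t⁻¹ * (C2 * B) + (C1 * B) * (2 * π * (R / t))) := by
          gcongr
          exact (norm_add_le _ _).trans (add_le_add e2 e3)
      _ = _ := by field_simp
  have := (convex_uIcc x x').norm_image_sub_le_of_norm_deriv_le (𝕜 := ℝ)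
    (fun u _ => (hd u).differentiableAt) hbd right_mem_uIcc left_mem_uIcc
  simpa only [Real.norm_eq_abs] using this

/-- Parameters of a discrete model: frequency directions `a`, frequency shifts `b`, and the
dilation, translation and modulation of the dyadic grid. -/
structure Par where
  a : Fin 3 → ℝ
  b : Fin 3 → ℝ
  τ : ℝ
  ν : ℝ
  μ : ℝ
  ha1 : ∀ j, 1 ≤ |a j|
  ha2 : ∀ j, |a j| ≤ 2
  hκ1 : ∀ i j, i ≠ j → 100 ≤ |b j - a j * b i / a i|
  hκ2 : ∀ i j, i ≠ j → |b j - a j * b i / a i| ≤ 200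
  hτ : 0 < τ
  hν0 : 0 ≤ ν
  hν1 : ν < 1

/-- A tile: scale index, position index, frequency index. -/
abbrev Tile := ℤ × ℤ × ℤ

/-- The top of a tree: scale index, position index, frequency. -/
abbrev Top := ℤ × ℤ × ℝ

namespace Par

variable (D : Par)

noncomputable def sc (k : ℤ) : ℝ := D.τ * 2 ^ k
noncomputable def yv (k n : ℤ) : ℝ := D.sc k * (n + D.ν)
noncomputable def yy (P : Tile) : ℝ := D.yv P.1 P.2.1
noncomputable def fr (j : Fin 3) (P : Tile) : ℝ := (D.a j * (P.2.2 + D.μ) + D.b j) / D.sc P.1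
def dy (k n : ℤ) : Set ℝ := Ico (D.sc k * n) (D.sc k * (n + 1))
noncomputable def κ (i j : Fin 3) : ℝ := D.b j - D.a j * D.b i / D.a i

/-- The condition for a tile to belong to the `i`-tree with top `T`. -/
def inTree (i : Fin 3) (T : Top) (P : Tile) : Prop :=
  P.1 ≤ T.1 ∧ D.yy P ∈ D.dy T.1 T.2.1 ∧ |D.fr i P - D.a i * T.2.2| ≤ 10 / D.sc P.1

/-- The wave packet coefficient of `f` at the tile `P`. -/
noncomputable def co (j : Fin 3) (f : ℝ → ℂ) (P : Tile) : ℂ :=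
  ∫ x, f x * pk (D.sc P.1) (D.fr j P) (D.yy P) x

lemma sc_pos (k : ℤ) : 0 < D.sc k := mul_pos D.hτ (by positivity)

lemma sc_mono {k l : ℤ} (h : k ≤ l) : D.sc k ≤ D.sc l := by
  unfold sc
  have := D.hτ
  gcongr
  norm_num

lemma sc_add (k l : ℤ) : D.sc (k + l) = D.sc k * 2 ^ l := by
  unfold sc; rw [zpow_add₀ two_ne_zero]; ring

lemma a_ne (j : Fin 3) : D.a j ≠ 0 := by
  intro h
  have := D.ha1 j
  rw [h] at this
  norm_num at this

lemma measurableSet_dy (k n : ℤ) : MeasurableSet (D.dy k n) := measurableSet_Ico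

lemma volume_dy (k n : ℤ) : volume (D.dy k n) = ENNReal.ofReal (D.sc k) := by
  unfold dy; rw [Real.volume_Ico]; congr 1; ring

lemma measureReal_dy (k n : ℤ) : volume.real (D.dy k n) = D.sc k := by
  rw [Measure.real, volume_dy, ENNReal.toReal_ofReal (D.sc_pos k).le]

lemma mem_dy_iff (k n : ℤ) (x : ℝ) : x ∈ D.dy k n ↔ ⌊x / D.sc k⌋ = n := by
  have := D.sc_pos k
  rw [Int.floor_eq_iff, dy, mem_Ico, le_div_iff₀ this, div_lt_iff₀ this, mul_comm, mul_comm (D.sc k)]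

lemma dy_disjoint (k : ℤ) : Pairwise (Function.onFun Disjoint (D.dy k)) := by
  intro n m h
  rw [Function.onFun, Set.disjoint_left]
  intro x hx hx'
  rw [mem_dy_iff] at hx hx'
  exact h (hx.symm.trans hx')

lemma dy_nested {k K n N : ℤ} {x y : ℝ} (h : k ≤ K) (hx : x ∈ D.dy k n) (hy : y ∈ D.dy k n)
    (hX : x ∈ D.dy K N) : y ∈ D.dy K N := by
  obtain ⟨d, rfl⟩ := Int.exists_add_of_le h
  have hs := D.sc_pos k
  have e : D.sc (k + d) = D.sc k * ((2 ^ d : ℕ) : ℝ) := by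
    rw [D.sc_add]; push_cast; simp
  unfold dy at *
  rw [e] at hX ⊢
  simp only [mem_Ico, mul_assoc] at *
  have h1 : ((2 ^ d : ℕ) : ℤ) * N ≤ n := by
    have : (((2 ^ d : ℕ) : ℤ) * N : ℤ) < n + 1 := by
      have := lt_of_mul_lt_mul_left (hX.1.trans_lt hx.2) hs.le
      exact_mod_cast this
    omega
  have h2 : n + 1 ≤ ((2 ^ d : ℕ) : ℤ) * (N + 1) := by
    have : n < ((2 ^ d : ℕ) : ℤ) * (N + 1) := by
      have := lt_of_mul_lt_mul_left (hx.1.trans_lt hX.2) hs.le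
      exact_mod_cast this
    omega
  constructor
  · refine le_trans ?_ hy.1
    gcongr
    exact_mod_cast h1
  · refine hy.2.trans_le ?_
    gcongr
    exact_mod_cast h2

lemma yv_mem_dy (k n : ℤ) : D.yv k n ∈ D.dy k n := by
  have hs := D.sc_pos k
  have := D.hν0
  have := D.hν1
  unfold yv dy
  constructor <;> gcongr
  linarith

lemma yy_mem_dy (P : Tile) : D.yy P ∈ D.dy P.1 P.2.1 := D.yv_mem_dy _ _

lemma abs_sub_lt_of_mem_dy {k n : ℤ} {x y : ℝ} (hx : x ∈ D.dy k n) (hy : y ∈ D.dy k n) :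
    |x - y| < D.sc k := by
  unfold dy at *
  simp only [mem_Ico, mul_add, mul_one] at *
  rw [abs_lt]
  constructor <;> linarith

/-- A point of the dyadic interval of a tile of an `i`-tree lies in the top interval. -/
lemma inTree.dy_subset {D : Par} {i : Fin 3} {T : Top} {P : Tile} (h : D.inTree i T P) :
    D.dy P.1 P.2.1 ⊆ D.dy T.1 T.2.1 := fun _ hx =>
  D.dy_nested h.1 (D.yy_mem_dy P) hx h.2.1

lemma fr_eq (i j : Fin 3) (P : Tile) (ζ : ℝ) : D.fr j P - D.a j * ζ - D.κ i j / D.sc P.1 =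
    D.a j / D.a i * (D.fr i P - D.a i * ζ) := by
  have := D.a_ne i
  have := (D.sc_pos P.1).ne'
  unfold fr κ
  field_simp
  ring

lemma abs_fr_le (i j : Fin 3) (P : Tile) (ζ e : ℝ) (h : |D.fr i P - D.a i * ζ| ≤ e) :
    |D.fr j P - D.a j * ζ - D.κ i j / D.sc P.1| ≤ 2 * e := by
  rw [D.fr_eq i j, abs_mul, abs_div]
  have h1 := D.ha1 i
  have h2 := D.ha2 j
  have : |D.a j| / |D.a i| ≤ 2 := by
    rw [div_le_iff₀ (by linarith)]; linarith
  gcongr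

lemma card_freq_le (R : ℕ) {a : ℝ} (ha : 1 ≤ |a|) (c : ℝ) (S : Finset ℤ)
    (h : ∀ m ∈ S, |a * m - c| ≤ R) : (S.card : ℝ) ≤ 2 * R + 1 := by
  have ha0 : a ≠ 0 := by rintro rfl; norm_num at ha
  have h2 : ∀ m ∈ S, |(m : ℝ) - c / a| ≤ R := by
    intro m hm
    have : a * m - c = a * (m - c / a) := by field_simp
    have h1 := h m hm
    rw [this, abs_mul] at h1
    have := abs_nonneg ((m : ℝ) - c / a)
    nlinarith
  have hsub : S ⊆ Finset.Icc ⌈c / a - R⌉ ⌊c / a + R⌋ := by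
    intro m hm
    have := abs_le.1 (h2 m hm)
    rw [Finset.mem_Icc, Int.ceil_le, Int.le_floor]
    constructor <;> linarith
  have hc := Finset.card_le_card hsub
  rw [Int.card_Icc] at hc
  rcases S.eq_empty_or_nonempty with rfl | ⟨m, hm⟩
  · simp; positivity
  have h3 := Finset.mem_Icc.1 (hsub hm)
  have h4 : (S.card : ℤ) ≤ ⌊c / a + R⌋ + 1 - ⌈c / a - R⌉ := by
    have : (0 : ℤ) ≤ ⌊c / a + R⌋ + 1 - ⌈c / a - R⌉ := by omega
    omega
  have h5 : (S.card : ℝ) ≤ ⌊c / a + R⌋ + 1 - ⌈c / a - R⌉ := by exact_mod_cast h4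
  have := Int.floor_le (c / a + R)
  have := Int.le_ceil (c / a - R)
  linarith

/-- Passing from a sum over tiles to a sum over time intervals, when the frequencies are
localised. -/
lemma sum_tiles_le (j : Fin 3) (R : ℕ) (Q : Finset Tile) (w : ℤ → ℤ → ℝ)
    (h : ∀ P ∈ Q, |D.fr j P - w P.1 P.2.1| ≤ R / D.sc P.1) (v : ℤ × ℤ → ℝ) (hv : ∀ p, 0 ≤ v p) :
    ∑ P ∈ Q, v (P.1, P.2.1) ≤ (2 * R + 1) * ∑ p ∈ Q.image (fun P => (P.1, P.2.1)), v p := by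
  classical
  rw [← Finset.sum_fiberwise_of_maps_to (g := fun P : Tile => (P.1, P.2.1))
    (t := Q.image (fun P => (P.1, P.2.1))) (fun P hP => Finset.mem_image_of_mem _ hP), Finset.mul_sum]
  refine Finset.sum_le_sum fun p _ => ?_
  have e : ∑ P ∈ Q with (P.1, P.2.1) = p, v (P.1, P.2.1) =
      (Q.filter fun P => (P.1, P.2.1) = p).card * v p := by
    rw [Finset.sum_congr rfl (g := fun _ => v p), Finset.sum_const, nsmul_eq_mul]
    intro P hP
    rw [(Finset.mem_filter.1 hP).2]
  rw [e]
  refine mul_le_mul_of_nonneg_right ?_ (hv p)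
  have hinj : Set.InjOn (fun P : Tile => P.2.2) (Q.filter fun P => (P.1, P.2.1) = p) := by
    rintro ⟨k, n, m⟩ hP ⟨k', n', m'⟩ hP' hm
    have h1 := (Finset.mem_filter.1 (Finset.mem_coe.1 hP)).2
    have h2 := (Finset.mem_filter.1 (Finset.mem_coe.1 hP')).2
    simp only at h1 h2 hm
    rw [← h2, Prod.mk.injEq] at h1
    simp [h1.1, h1.2, hm]
  rw [← Finset.card_image_of_injOn hinj]
  apply card_freq_le R (D.ha1 j) (D.sc p.1 * w p.1 p.2 - D.a j * D.μ - D.b j)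
  intro m hm
  obtain ⟨P, hP, rfl⟩ := Finset.mem_image.1 hm
  obtain ⟨hPQ, rfl⟩ := Finset.mem_filter.1 hP
  have h1 := h P hPQ
  have hs := D.sc_pos P.1
  rw [le_div_iff₀ hs] at h1
  refine le_trans (le_of_eq ?_) h1
  rw [← abs_of_pos hs, ← abs_mul, abs_of_pos hs]
  congr 1
  unfold fr
  field_simp
  ring

end Par

lemma br_le_of_abs_sub_le (N : ℕ) {s : ℝ} (hs : 0 < s) {z y u : ℝ} (h : |u - y| ≤ s) :
    br N s (z - y) ≤ 2 ^ N * br N s (z - u) := by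
  unfold br
  rw [← div_eq_mul_inv, le_div_iff₀ (by positivity), inv_mul_le_iff₀ (by positivity), ← mul_pow]
  refine pow_le_pow_left₀ (by positivity) ?_ _
  have h1 : |z - u| / s ≤ |z - y| / s + 1 := by
    rw [div_add_one hs.ne']
    gcongr
    have := abs_sub_le z y u
    rw [abs_sub_comm y u] at this
    linarith
  have : 0 ≤ |z - y| / s := by positivity
  linarith

/-- Sums over finitely many disjoint measurable sets are bounded by the integral. -/
lemma sum_setIntegral_le {ι : Type*} (S : Finset ι) (A : ι → Set ℝ) {B : Set ℝ} {g : ℝ → ℝ}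
    (hA : ∀ i ∈ S, MeasurableSet (A i)) (hd : (S : Set ι).Pairwise (Function.onFun Disjoint A))
    (hs : ∀ i ∈ S, A i ⊆ B) (hg : IntegrableOn g B) (h0 : ∀ x, 0 ≤ g x) :
    ∑ i ∈ S, ∫ x in A i, g x ≤ ∫ x in B, g x := by
  rw [← integral_biUnion_finset S hA hd fun i hi => hg.mono_set (hs i hi)]
  exact setIntegral_mono_set hg (ae_of_all _ h0) (ae_of_all _ (iUnion₂_subset hs))

namespace Par
variable (D : Par)

lemma sc_mul_br_le (N : ℕ) (hN : 2 ≤ N) (k n : ℤ) (z : ℝ) {s : ℝ} (hs : D.sc k ≤ s) :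
    D.sc k * br N s (z - D.yv k n) ≤ 2 ^ N * ∫ x in D.dy k n, br N s (x - z) := by
  have hs0 : 0 < s := (D.sc_pos k).trans_le hs
  rw [← integral_const_mul]
  have : D.sc k * br N s (z - D.yv k n) = ∫ _ in D.dy k n, br N s (z - D.yv k n) := by
    rw [setIntegral_const, D.measureReal_dy, smul_eq_mul]
  rw [this]
  refine setIntegral_mono_on ?_ ?_ (D.measurableSet_dy k n) fun x hx => ?_
  · exact integrableOn_const (by rw [D.volume_dy]; exact ENNReal.ofReal_ne_top)
  · exact ((br_integrable_of_two_le hN hs0 z).const_mul _).integrableOn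
  · rw [br_sub_comm N s x]
    exact br_le_of_abs_sub_le N hs0
      ((D.abs_sub_lt_of_mem_dy hx (D.yv_mem_dy k n)).le.trans hs)

/-- Sum over all positions at one scale. -/
lemma sum_br_le (N : ℕ) (hN : 2 ≤ N) (k : ℤ) (Z : Finset ℤ) (z : ℝ) {s : ℝ} (hs : D.sc k ≤ s) :
    ∑ n ∈ Z, D.sc k * br N s (z - D.yv k n) ≤ 2 ^ N * (s * I0) := by
  have hs0 : 0 < s := (D.sc_pos k).trans_le hs
  calc _ ≤ ∑ n ∈ Z, 2 ^ N * ∫ x in D.dy k n, br N s (x - z) :=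
        Finset.sum_le_sum fun n _ => D.sc_mul_br_le N hN k n z hs
    _ ≤ 2 ^ N * ∫ x in univ, br N s (x - z) := by
        rw [← Finset.mul_sum]
        gcongr
        exact sum_setIntegral_le Z (D.dy k) (fun n _ => D.measurableSet_dy k n)
          (fun a _ b _ h => D.dy_disjoint k h) (fun _ _ => subset_univ _)
          (br_integrable_of_two_le hN hs0 z).integrableOn (fun x => br_nonneg N hs0 _)
    _ ≤ _ := by
        rw [setIntegral_univ]
        gcongr
        exact br_integral_le hN hs0 z

end Par

open scoped Classical

/-- Bounded measurable functions with bounded support. -/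
def Nice (f : ℝ → ℂ) : Prop :=
  Measurable f ∧ (∃ B : ℝ, ∀ x, ‖f x‖ ≤ B) ∧ ∃ R : ℝ, ∀ x, R < |x| → f x = 0

lemma Nice.integrable_of_bound {f : ℝ → ℂ} (hf : Nice f) {g : ℝ → ℝ} (hg : Measurable g) {B : ℝ}
    (hB : ∀ x, |g x| ≤ B) (h0 : ∀ x, f x = 0 → g x = 0) : Integrable g := by
  obtain ⟨-, -, R, hR⟩ := hf
  have hs : Function.support g ⊆ Icc (-R) R := by
    intro x hx
    by_contra h
    apply hx
    apply h0 _ (hR _ _)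
    by_contra! h2
    exact h (abs_le.1 h2)
  rw [← integrableOn_iff_integrable_of_support_subset hs]
  refine Measure.integrableOn_of_bounded (M := B) ?_ hg.aestronglyMeasurable (ae_of_all _ hB)
  simp

lemma Nice.integrable {f : ℝ → ℂ} (hf : Nice f) : Integrable f := by
  obtain ⟨B, hB⟩ := hf.2.1
  rw [← integrable_norm_iff hf.1.aestronglyMeasurable]
  exact hf.integrable_of_bound hf.1.norm (B := B) (fun x => by simpa using hB x) (fun x h => by simp [h])

lemma Nice.integrable_sq {f : ℝ → ℂ} (hf : Nice f) : Integrable fun x => ‖f x‖ ^ 2 := by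
  obtain ⟨B, hB⟩ := hf.2.1
  refine hf.integrable_of_bound (hf.1.norm.pow_const 2) (B := B ^ 2) (fun x => ?_) (fun x h => by simp [h])
  rw [abs_of_nonneg (by positivity)]
  exact pow_le_pow_left₀ (norm_nonneg _) (hB x) 2

lemma Nice.mul {f : ℝ → ℂ} (hf : Nice f) {g : ℝ → ℂ} (hg : Measurable g) {B : ℝ}
    (hB : ∀ x, ‖g x‖ ≤ B) : Nice fun x => f x * g x := by
  obtain ⟨h1, ⟨B', h2⟩, R, h3⟩ := hf
  refine ⟨h1.mul hg, ⟨B' * B, fun x => ?_⟩, R, fun x hx => by simp [h3 x hx]⟩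
  rw [norm_mul]
  exact mul_le_mul (h2 x) (hB x) (norm_nonneg _) ((norm_nonneg _).trans (h2 x))

lemma Nice.indicator {f : ℝ → ℂ} (hf : Nice f) {A : Set ℝ} (hA : MeasurableSet A) :
    Nice (A.indicator f) := by
  obtain ⟨h1, ⟨B', h2⟩, R, h3⟩ := hf
  refine ⟨h1.indicator hA, ⟨B', fun x => (norm_indicator_le_norm_self f x).trans (h2 x)⟩, R,
    fun x hx => ?_⟩
  by_cases h : x ∈ A <;> simp [h, h3 x hx]

lemma Nice.add {f g : ℝ → ℂ} (hf : Nice f) (hg : Nice g) : Nice fun x => f x + g x := by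
  obtain ⟨h1, ⟨B, h2⟩, R, h3⟩ := hf
  obtain ⟨h1', ⟨B', h2'⟩, R', h3'⟩ := hg
  refine ⟨h1.add h1', ⟨B + B', fun x => (norm_add_le _ _).trans (add_le_add (h2 x) (h2' x))⟩,
    max R R', fun x hx => ?_⟩
  simp only [h3 x ((le_max_left _ _).trans_lt hx), h3' x ((le_max_right _ _).trans_lt hx), add_zero]

/-- Cauchy-Schwarz. -/
lemma norm_integral_mul_sq_le {α : Type*} [MeasurableSpace α] {μ : Measure α} {f g : α → ℂ}
    (hf : AEStronglyMeasurable f μ) (hg : AEStronglyMeasurable g μ)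
    (hf2 : Integrable (fun x => ‖f x‖ ^ 2) μ) (hg2 : Integrable (fun x => ‖g x‖ ^ 2) μ) :
    ‖∫ x, f x * g x ∂μ‖ ^ 2 ≤ (∫ x, ‖f x‖ ^ 2 ∂μ) * ∫ x, ‖g x‖ ^ 2 ∂μ := by
  have mf : MemLp (fun x => ‖f x‖) (ENNReal.ofReal 2) μ := by
    rw [ENNReal.ofReal_ofNat]
    exact ((memLp_two_iff_integrable_sq_norm hf).2 hf2).norm
  have mg : MemLp (fun x => ‖g x‖) (ENNReal.ofReal 2) μ := by
    rw [ENNReal.ofReal_ofNat]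
    exact ((memLp_two_iff_integrable_sq_norm hg).2 hg2).norm
  have h := integral_mul_le_Lp_mul_Lq_of_nonneg (p := 2) (q := 2) Real.HolderConjugate.two_two
    (ae_of_all μ fun x => norm_nonneg (f x)) (ae_of_all μ fun x => norm_nonneg (g x)) mf mg
  simp only [Real.rpow_two, ← Real.sqrt_eq_rpow] at h
  have h1 : ‖∫ x, f x * g x ∂μ‖ ≤ √(∫ x, ‖f x‖ ^ 2 ∂μ) * √(∫ x, ‖g x‖ ^ 2 ∂μ) := by
    refine (norm_integral_le_integral_norm _).trans ?_
    simpa only [norm_mul] using h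
  have := pow_le_pow_left₀ (norm_nonneg _) h1 2
  rwa [mul_pow, Real.sq_sqrt (integral_nonneg fun _ => by positivity),
    Real.sq_sqrt (integral_nonneg fun _ => by positivity)] at this

lemma sum_geom_le (S : Finset ℤ) (K : ℤ) (h : ∀ k ∈ S, k ≤ K) {r : ℝ} (h0 : 0 ≤ r) (h1 : r < 1) :
    ∑ k ∈ S, r ^ (K - k).toNat ≤ (1 - r)⁻¹ := by
  have hinj : Set.InjOn (fun k : ℤ => (K - k).toNat) S := by
    intro a ha b hb hab
    have := h a ha
    have := h b hb
    simp only at hab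
    omega
  rw [← Finset.sum_image (f := fun n : ℕ => r ^ n) hinj, ← tsum_geometric_of_lt_one h0 h1]
  exact (summable_geometric_of_lt_one h0 h1).sum_le_tsum _ fun _ _ => by positivity

namespace Par
variable (D : Par)

lemma sum_sc_le (S : Finset ℤ) (K : ℤ) (h : ∀ k ∈ S, k ≤ K) : ∑ k ∈ S, D.sc k ≤ 2 * D.sc K := by
  have e : ∀ k ∈ S, D.sc k = D.sc K * (1 / 2 : ℝ) ^ (K - k).toNat := by
    intro k hk
    obtain ⟨d, hd⟩ := Int.exists_add_of_le (h k hk)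
    rw [hd, D.sc_add]
    have : (k + (d : ℤ) - k).toNat = d := by omega
    rw [this, mul_assoc, zpow_natCast, ← mul_pow]
    norm_num
  rw [Finset.sum_congr rfl e, ← Finset.mul_sum, mul_comm]
  have := sum_geom_le S K h (r := 1 / 2) (by norm_num) (by norm_num)
  have := D.sc_pos K
  gcongr
  norm_num at *
  assumption

/-- The size of the coefficients `E` is at most `S`. -/
def SizeLE (j : Fin 3) (Q : Finset Tile) (E : Tile → ℝ) (S : ℝ) : Prop :=
  ∀ i, i ≠ j → ∀ T : Top, ∑ P ∈ Q with D.inTree i T P, D.sc P.1 * E P ^ 2 ≤ S ^ 2 * D.sc T.1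

variable {D}

lemma SizeLE.mono {j : Fin 3} {Q Q' : Finset Tile} {E : Tile → ℝ} {S : ℝ} (h : D.SizeLE j Q E S)
    (hQ : Q' ⊆ Q) : D.SizeLE j Q' E S := by
  intro i hi T
  refine le_trans ?_ (h i hi T)
  refine Finset.sum_le_sum_of_subset_of_nonneg (Finset.filter_subset_filter _ hQ) fun P _ _ => ?_
  have := D.sc_pos P.1
  positivity

lemma inTree_self (D : Par) (i : Fin 3) (P : Tile) :
    D.inTree i (P.1, P.2.1, D.fr i P / D.a i) P := by
  refine ⟨le_rfl, D.yy_mem_dy P, ?_⟩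
  have := D.sc_pos P.1
  have h := D.a_ne i
  simp only
  rw [mul_div_cancel₀ _ h, sub_self, abs_zero]
  positivity

lemma SizeLE.le {j : Fin 3} {Q : Finset Tile} {E : Tile → ℝ} {S : ℝ} (h : D.SizeLE j Q E S)
    (hS : 0 ≤ S) {P : Tile} (hP : P ∈ Q) : E P ≤ S := by
  obtain ⟨i, hi⟩ : ∃ i : Fin 3, i ≠ j := exists_ne j
  have h1 := h i hi (P.1, P.2.1, D.fr i P / D.a i)
  have h2 : D.sc P.1 * E P ^ 2 ≤ S ^ 2 * D.sc P.1 := by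
    refine le_trans ?_ h1
    refine Finset.single_le_sum (f := fun P : Tile => D.sc P.1 * E P ^ 2) (fun P _ => ?_)
      (Finset.mem_filter.2 ⟨hP, D.inTree_self i P⟩)
    have := D.sc_pos P.1
    positivity
  rw [mul_comm, mul_le_mul_iff_left₀ (D.sc_pos _)] at h2
  exact le_of_sq_le_sq h2 hS

variable (D)

lemma tree_estimate_aux {i j l : Fin 3} (hij : i ≠ j) (hil : i ≠ l) {Q : Finset Tile}
    {E F G : Tile → ℝ} {S1 S2 S3 : ℝ} (hF : ∀ P, 0 ≤ F P) (hG : ∀ P, 0 ≤ G P)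
    (h1 : D.SizeLE i Q E S1) (h2 : D.SizeLE j Q F S2) (h3 : D.SizeLE l Q G S3)
    (hS1 : 0 ≤ S1) (hS2 : 0 ≤ S2) (hS3 : 0 ≤ S3) (T : Top) :
    ∑ P ∈ Q with D.inTree i T P, D.sc P.1 * (E P * F P * G P) ≤ S1 * S2 * S3 * D.sc T.1 := by
  have hs := fun P : Tile => (D.sc_pos P.1).le
  have hT := (D.sc_pos T.1).le
  have hFG : ∑ P ∈ Q with D.inTree i T P, D.sc P.1 * (F P * G P) ≤ S2 * S3 * D.sc T.1 := by
    refine le_of_sq_le_sq ?_ (by positivity)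
    have := Finset.sum_mul_sq_le_sq_mul_sq (Q.filter (D.inTree i T))
      (fun P => √(D.sc P.1) * F P) (fun P => √(D.sc P.1) * G P)
    simp only [mul_pow, Real.sq_sqrt (hs _)] at this
    have e : ∀ P, √(D.sc P.1) * F P * (√(D.sc P.1) * G P) = D.sc P.1 * (F P * G P) := by
      intro P; rw [mul_mul_mul_comm, Real.mul_self_sqrt (hs P)]
    simp only [e] at this
    refine this.trans ?_
    calc _ ≤ (S2 ^ 2 * D.sc T.1) * (S3 ^ 2 * D.sc T.1) := by
          refine mul_le_mul (h2 i hij T) (h3 i hil T) (Finset.sum_nonneg fun P _ => ?_) (by positivity)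
          have := hs P
          positivity
      _ = _ := by ring
  calc _ ≤ ∑ P ∈ Q with D.inTree i T P, S1 * (D.sc P.1 * (F P * G P)) := by
        refine Finset.sum_le_sum fun P hP => ?_
        have := h1.le hS1 (Finset.mem_filter.1 hP).1
        have := hs P
        have := hF P
        have := hG P
        calc _ = E P * (D.sc P.1 * (F P * G P)) := by ring
          _ ≤ _ := by gcongr
    _ ≤ S1 * (S2 * S3 * D.sc T.1) := by rw [← Finset.mul_sum]; gcongr
    _ = _ := by ring

/-- The single tree estimate. -/
lemma tree_estimate (i : Fin 3) {Q : Finset Tile} {E : Fin 3 → Tile → ℝ} {S : Fin 3 → ℝ}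
    (hE : ∀ j P, 0 ≤ E j P) (h : ∀ j, D.SizeLE j Q (E j) (S j)) (hS : ∀ j, 0 ≤ S j) (T : Top) :
    ∑ P ∈ Q with D.inTree i T P, D.sc P.1 * (E 0 P * E 1 P * E 2 P) ≤
      S 0 * S 1 * S 2 * D.sc T.1 := by
  fin_cases i
  · exact D.tree_estimate_aux (i := 0) (j := 1) (l := 2) (by decide) (by decide) (hE 1) (hE 2)
      (h 0) (h 1) (h 2) (hS 0) (hS 1) (hS 2) T
  · have := D.tree_estimate_aux (i := 1) (j := 0) (l := 2) (by decide) (by decide) (hE 0) (hE 2)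
      (h 1) (h 0) (h 2) (hS 1) (hS 0) (hS 2) T
    simp only [mul_comm (E 1 _), mul_comm (S 1)] at this
    exact this
  · have := D.tree_estimate_aux (i := 2) (j := 0) (l := 1) (by decide) (by decide) (hE 0) (hE 1)
      (h 2) (h 0) (h 1) (hS 2) (hS 0) (hS 1) T
    refine le_trans (le_of_eq (Finset.sum_congr rfl fun P _ => ?_)) (this.trans (le_of_eq ?_)) <;> ring

/-- The inner product of two packets of slot `j`. -/
noncomputable def ip (j : Fin 3) (P P' : Tile) : ℂ :=
  ∫ x, pk (D.sc P.1) (D.fr j P) (D.yy P) x * conj (pk (D.sc P'.1) (D.fr j P') (D.yy P') x)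

lemma norm_ip_comm (j : Fin 3) (P P' : Tile) : ‖D.ip j P P'‖ = ‖D.ip j P' P‖ := by
  unfold ip
  rw [← RCLike.norm_conj, ← integral_conj]
  simp [mul_comm]

lemma bessel_abs {f : ℝ → ℂ} (hf : Nice f) (j : Fin 3) (Q : Finset Tile) :
    (∑ P ∈ Q, D.sc P.1 * ‖D.co j f P‖ ^ 2) ^ 2 ≤ (∫ x, ‖f x‖ ^ 2) *
      ∑ P ∈ Q, ∑ P' ∈ Q, D.sc P.1 * D.sc P'.1 * (‖D.co j f P‖ * ‖D.co j f P'‖ * ‖D.ip j P P'‖) := by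
  set φ : Tile → ℝ → ℂ := fun P => pk (D.sc P.1) (D.fr j P) (D.yy P) with hφ
  set c : Tile → ℂ := fun P => D.sc P.1 * conj (D.co j f P) with hc
  set G : ℝ → ℂ := fun x => ∑ P ∈ Q, c P * φ P x with hG
  have hφc : ∀ P, Continuous (φ P) := fun P => pk_continuous (D.sc_pos _) _ _
  have hφi : ∀ P P', Integrable fun x => φ P x * conj (φ P' x) := fun P P' =>
    pk_mul_integrable (D.sc_pos _) (D.sc_pos _) _ _ _ _
  have hGc : Continuous G := by
    apply continuous_finsetSum
    intro P _
    exact continuous_const.mul (hφc P)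
  have hexp : ∀ x, ((‖G x‖ ^ 2 : ℝ) : ℂ) =
      ∑ P ∈ Q, ∑ P' ∈ Q, (c P * conj (c P')) * (φ P x * conj (φ P' x)) := by
    intro x
    rw [Complex.ofReal_pow, ← Complex.mul_conj', hG]
    simp only [map_sum, Finset.sum_mul_sum, map_mul]
    refine Finset.sum_congr rfl fun P _ => Finset.sum_congr rfl fun P' _ => by ring
  have hintc : Integrable fun x => ((‖G x‖ ^ 2 : ℝ) : ℂ) := by
    simp_rw [hexp]
    exact integrable_finsetSum _ fun P _ => integrable_finsetSum _ fun P' _ => (hφi P P').const_mul _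
  have hG2 : Integrable fun x => ‖G x‖ ^ 2 := by
    exact hintc.re
  have hGn : ∫ x, ‖G x‖ ^ 2 ≤ ∑ P ∈ Q, ∑ P' ∈ Q,
      D.sc P.1 * D.sc P'.1 * (‖D.co j f P‖ * ‖D.co j f P'‖ * ‖D.ip j P P'‖) := by
    have e1 : ((∫ x, ‖G x‖ ^ 2 : ℝ) : ℂ) =
        ∑ P ∈ Q, ∑ P' ∈ Q, (c P * conj (c P')) * D.ip j P P' := by
      rw [← integral_complex_ofReal]
      simp_rw [hexp]
      rw [integral_finsetSum _ fun P _ => integrable_finsetSum _ fun P' _ => (hφi P P').const_mul _]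
      refine Finset.sum_congr rfl fun P _ => ?_
      rw [integral_finsetSum _ fun P' _ => (hφi P P').const_mul _]
      refine Finset.sum_congr rfl fun P' _ => ?_
      rw [integral_const_mul]
      rfl
    have e2 : ∫ x, ‖G x‖ ^ 2 ≤ ‖((∫ x, ‖G x‖ ^ 2 : ℝ) : ℂ)‖ := by
      rw [Complex.norm_real]; exact Real.le_norm_self _
    rw [e1] at e2
    refine e2.trans ((norm_sum_le _ _).trans (Finset.sum_le_sum fun P _ => (norm_sum_le _ _).trans
      (Finset.sum_le_sum fun P' _ => le_of_eq ?_)))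
    simp only [hc, norm_mul, RCLike.norm_conj, Complex.norm_real,
      Real.norm_of_nonneg (D.sc_pos _).le]
    ring
  have hfG : ((∑ P ∈ Q, D.sc P.1 * ‖D.co j f P‖ ^ 2 : ℝ) : ℂ) = ∫ x, f x * G x := by
    have : ∀ x, f x * G x = ∑ P ∈ Q, c P * (f x * φ P x) := by
      intro x
      rw [hG, Finset.mul_sum]
      exact Finset.sum_congr rfl fun P _ => by ring
    simp_rw [this]
    rw [integral_finsetSum]
    · push_cast
      refine Finset.sum_congr rfl fun P _ => ?_
      rw [integral_const_mul, hc]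
      change _ = (D.sc P.1 * conj (D.co j f P)) * D.co j f P
      rw [mul_assoc, Complex.conj_mul']
    · intro P _
      obtain ⟨B, hB⟩ := pk_bound_bounded (D.sc_pos P.1) (D.fr j P) (D.yy P)
      exact (hf.mul (hφc P).measurable hB).integrable.const_mul _
  have hCS := norm_integral_mul_sq_le hf.1.aestronglyMeasurable hGc.aestronglyMeasurable
    hf.integrable_sq hG2 (μ := volume)
  rw [← hfG, Complex.norm_real, Real.norm_eq_abs, sq_abs] at hCS
  exact hCS.trans (mul_le_mul_of_nonneg_left hGn (integral_nonneg fun _ => by positivity))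

end Par

namespace Par
variable (D : Par)

/-- Contribution of pairs of tiles at comparable scales: one row. -/
lemma near_row : ∃ C : ℝ, 0 < C ∧ ∀ (D : Par) (j : Fin 3) (Q : Finset Tile) (P : Tile),
    ∑ P' ∈ Q with |P.1 - P'.1| < 5, D.sc P'.1 * ‖D.ip j P P'‖ ≤ C := by
  obtain ⟨C, hC, hip⟩ := pk_inner_bound 2
  refine ⟨35 * (C * (36 * (I0 + 1))), by have := I0_nonneg; positivity, fun D j Q P => ?_⟩
  set Q' := Q.filter fun P' => |P.1 - P'.1| < 5 ∧
    |D.fr j P' - D.fr j P| < 1 / D.sc P.1 + 1 / D.sc P'.1 with hQ'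
  set v : ℤ × ℤ → ℝ := fun p => D.sc p.1 * (C * ((max (D.sc P.1) (D.sc p.1))⁻¹ *
    br 2 (max (D.sc P.1) (D.sc p.1)) (D.yy P - D.yv p.1 p.2))) with hv
  have hmax : ∀ k, 0 < max (D.sc P.1) (D.sc k) := fun k => (D.sc_pos _).trans_le (le_max_left _ _)
  have hv0 : ∀ p, 0 ≤ v p := by
    intro p
    have := (D.sc_pos p.1).le
    have := hmax p.1
    have := br_nonneg 2 (hmax p.1) (D.yy P - D.yv p.1 p.2)
    positivity
  have s1 : ∑ P' ∈ Q with |P.1 - P'.1| < 5, D.sc P'.1 * ‖D.ip j P P'‖ ≤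
      ∑ P' ∈ Q', v (P'.1, P'.2.1) := by
    rw [hQ', ← Finset.filter_filter]
    conv_rhs => rw [Finset.sum_filter]
    refine Finset.sum_le_sum fun P' _ => ?_
    have hs := (D.sc_pos P'.1).le
    split_ifs with h
    · exact mul_le_mul_of_nonneg_left (hip _ _ _ _ _ _ (D.sc_pos _) (D.sc_pos _)) hs
    · push Not at h
      rw [abs_sub_comm] at h
      rw [ip, pk_inner_eq_zero (D.sc_pos _) (D.sc_pos _) _ _ h, norm_zero, mul_zero]
  have s2 := D.sum_tiles_le j 17 Q' (fun _ _ => D.fr j P) (fun P' hP' => by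
    obtain ⟨-, h1, h2⟩ := Finset.mem_filter.1 hP'
    refine h2.le.trans ?_
    have hs := D.sc_pos P.1
    have hs' := D.sc_pos P'.1
    rw [abs_lt] at h1
    have : D.sc P'.1 ≤ D.sc P.1 * 16 := by
      have := D.sc_mono (show P'.1 ≤ P.1 + 4 by omega)
      rw [D.sc_add] at this
      norm_num at this
      exact this
    rw [div_add_div _ _ hs.ne' hs'.ne', div_le_div_iff₀ (by positivity) hs']
    push_cast
    nlinarith) v hv0
  refine s1.trans (s2.trans ?_)
  set im := Q'.image fun P : Tile => (P.1, P.2.1)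
  have hsub : im ⊆ Finset.Icc (P.1 - 4) (P.1 + 4) ×ˢ im.image Prod.snd := by
    intro p hp
    rw [Finset.mem_product]
    refine ⟨?_, Finset.mem_image_of_mem _ hp⟩
    obtain ⟨P', hP', rfl⟩ := Finset.mem_image.1 hp
    obtain ⟨-, h1, h2⟩ := Finset.mem_filter.1 hP'
    rw [abs_lt] at h1
    rw [Finset.mem_Icc]
    simp only
    omega
  have s3 : ∑ p ∈ im, v p ≤ C * (36 * (I0 + 1)) := by
    refine (Finset.sum_le_sum_of_subset_of_nonneg hsub fun p _ _ => hv0 p).trans ?_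
    rw [Finset.sum_product]
    have : ∀ k ∈ Finset.Icc (P.1 - 4) (P.1 + 4), ∑ n ∈ im.image Prod.snd, v (k, n) ≤
        C * (4 * (I0 + 1)) := by
      intro k _
      have h1 := D.sum_br_le 2 le_rfl k (im.image Prod.snd) (D.yy P) (le_max_right (D.sc P.1) (D.sc k))
      have hm := hmax k
      have hI := I0_nonneg
      calc _ = C * (max (D.sc P.1) (D.sc k))⁻¹ * ∑ n ∈ im.image Prod.snd, D.sc k *
            br 2 (max (D.sc P.1) (D.sc k)) (D.yy P - D.yv k n) := by
            rw [Finset.mul_sum]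
            refine Finset.sum_congr rfl fun n _ => ?_
            simp only [hv]
            ring
        _ ≤ C * (max (D.sc P.1) (D.sc k))⁻¹ * (2 ^ 2 * (max (D.sc P.1) (D.sc k) * I0)) := by gcongr
        _ = C * (4 * I0) := by field_simp; ring
        _ ≤ _ := by gcongr; linarith
    refine (Finset.sum_le_sum this).trans ?_
    rw [Finset.sum_const, Int.card_Icc]
    have : (P.1 + 4 + 1 - (P.1 - 4)).toNat = 9 := by omega
    rw [this, nsmul_eq_mul]
    push_cast
    linarith
  calc _ ≤ (2 * ((17 : ℕ) : ℝ) + 1) * (C * (36 * (I0 + 1))) := by gcongr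
    _ = _ := by norm_num

lemma near_sum : ∃ C : ℝ, 0 < C ∧ ∀ (D : Par) (j : Fin 3) (Q : Finset Tile) (F : Tile → ℝ),
    ∑ P ∈ Q, ∑ P' ∈ Q with |P.1 - P'.1| < 5,
      D.sc P.1 * D.sc P'.1 * (F P * F P' * ‖D.ip j P P'‖) ≤ C * ∑ P ∈ Q, D.sc P.1 * F P ^ 2 := by
  obtain ⟨C, hC, h⟩ := near_row
  refine ⟨C, hC, fun D j Q F => ?_⟩
  have hs := fun P : Tile => (D.sc_pos P.1).le
  have h1 : ∑ P ∈ Q, ∑ P' ∈ Q with |P.1 - P'.1| < 5,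
      D.sc P.1 * D.sc P'.1 * (F P ^ 2 * ‖D.ip j P P'‖) ≤ C * ∑ P ∈ Q, D.sc P.1 * F P ^ 2 := by
    rw [Finset.mul_sum]
    refine Finset.sum_le_sum fun P _ => ?_
    calc _ = D.sc P.1 * F P ^ 2 * ∑ P' ∈ Q with |P.1 - P'.1| < 5, D.sc P'.1 * ‖D.ip j P P'‖ := by
          rw [Finset.mul_sum]
          exact Finset.sum_congr rfl fun P' _ => by ring
      _ ≤ D.sc P.1 * F P ^ 2 * C := by
          have := hs P
          gcongr
          exact h D j Q P
      _ = _ := by ring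
  have h2 : ∑ P ∈ Q, ∑ P' ∈ Q with |P.1 - P'.1| < 5,
      D.sc P.1 * D.sc P'.1 * (F P' ^ 2 * ‖D.ip j P P'‖) =
      ∑ P ∈ Q, ∑ P' ∈ Q with |P.1 - P'.1| < 5,
      D.sc P.1 * D.sc P'.1 * (F P ^ 2 * ‖D.ip j P P'‖) := by
    simp only [Finset.sum_filter]
    rw [Finset.sum_comm]
    refine Finset.sum_congr rfl fun P _ => Finset.sum_congr rfl fun P' _ => ?_
    rw [abs_sub_comm, D.norm_ip_comm j P' P, mul_comm (D.sc P'.1)]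
  have h3 : ∑ P ∈ Q, ∑ P' ∈ Q with |P.1 - P'.1| < 5,
      D.sc P.1 * D.sc P'.1 * (F P * F P' * ‖D.ip j P P'‖) ≤
      (∑ P ∈ Q, ∑ P' ∈ Q with |P.1 - P'.1| < 5,
      D.sc P.1 * D.sc P'.1 * (F P ^ 2 * ‖D.ip j P P'‖) + ∑ P ∈ Q, ∑ P' ∈ Q with |P.1 - P'.1| < 5,
      D.sc P.1 * D.sc P'.1 * (F P' ^ 2 * ‖D.ip j P P'‖)) / 2 := by
    rw [← Finset.sum_add_distrib, Finset.sum_div]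
    refine Finset.sum_le_sum fun P _ => ?_
    rw [← Finset.sum_add_distrib, Finset.sum_div]
    refine Finset.sum_le_sum fun P' _ => ?_
    have hab : F P * F P' ≤ (F P ^ 2 + F P' ^ 2) / 2 := by nlinarith [sq_nonneg (F P - F P')]
    have hn : 0 ≤ D.sc P.1 * D.sc P'.1 * ‖D.ip j P P'‖ := by
      have := hs P
      have := hs P'
      positivity
    nlinarith
  linarith

lemma sum_overlap_le (im : Finset (ℤ × ℤ)) {B : Set ℝ} {g : ℝ → ℝ}
    (hB : ∀ p ∈ im, D.dy p.1 p.2 ⊆ B) (hg : Integrable g) (h0 : ∀ x, 0 ≤ g x)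
    (hd : ∀ p ∈ im, ∀ p' ∈ im, p'.1 + 5 ≤ p.1 → Disjoint (D.dy p.1 p.2) (D.dy p'.1 p'.2)) :
    ∑ p ∈ im, ∫ x in D.dy p.1 p.2, g x ≤ 5 * ∫ x in B, g x := by
  have hm : ∀ p ∈ im, p.1 % 5 ∈ Finset.Ico (0 : ℤ) 5 := fun p _ => by
    rw [Finset.mem_Ico]; omega
  rw [← Finset.sum_fiberwise_of_maps_to hm]
  have : ∀ r ∈ Finset.Ico (0 : ℤ) 5, ∑ p ∈ im with p.1 % 5 = r, ∫ x in D.dy p.1 p.2, g x ≤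
      ∫ x in B, g x := by
    intro r _
    refine sum_setIntegral_le _ (fun p : ℤ × ℤ => D.dy p.1 p.2) (fun p _ => D.measurableSet_dy _ _) ?_
      (fun p hp => hB p (Finset.mem_filter.1 hp).1) hg.integrableOn h0
    rintro ⟨k, n⟩ hp ⟨k', n'⟩ hp' hne
    obtain ⟨hp, h1⟩ := Finset.mem_filter.1 (Finset.mem_coe.1 hp)
    obtain ⟨hp', h2⟩ := Finset.mem_filter.1 (Finset.mem_coe.1 hp')
    simp only at h1 h2
    rcases lt_trichotomy k k' with h | h | h
    · exact (hd _ hp' _ hp (by simp only; omega)).symm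
    · subst h
      exact D.dy_disjoint k (fun h => hne (by simpa using h))
    · exact hd _ hp _ hp' (by simp only; omega)
  refine (Finset.sum_le_sum this).trans ?_
  simp

lemma outside_sum (K N : ℤ) (im : Finset (ℤ × ℤ))
    (h : ∀ p ∈ im, p.1 ≤ K ∧ D.yv p.1 p.2 ∈ D.dy K N) :
    ∑ p ∈ im, ∫ x in (D.dy K N)ᶜ, br 4 (D.sc p.1) (x - D.yv p.1 p.2) ≤ 16 * I0 ^ 2 * D.sc K := by
  set A := D.sc K * N
  set B := D.sc K * (N + 1)
  set h' : ℤ → ℝ → ℝ := fun k x => br 2 (D.sc k) (x - A) + br 2 (D.sc k) (x - B) with hh'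
  have hh0 : ∀ k x, 0 ≤ h' k x := fun k x =>
    add_nonneg (br_nonneg _ (D.sc_pos k) _) (br_nonneg _ (D.sc_pos k) _)
  have hhi : ∀ k, Integrable (h' k) := fun k =>
    (br_integrable_sub (D.sc_pos k) A).add (br_integrable_sub (D.sc_pos k) B)
  set v : ℤ × ℤ → ℝ := fun p => ∫ x, h' p.1 x * br 2 (D.sc p.1) (D.yv p.1 p.2 - x) with hv
  have hvi : ∀ p : ℤ × ℤ, Integrable fun x => h' p.1 x * br 2 (D.sc p.1) (D.yv p.1 p.2 - x) := by
    intro p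
    refine (hhi p.1).mul_bdd (c := 1) ?_ (ae_of_all _ fun x => ?_)
    · exact ((br_continuous 2 (D.sc_pos p.1)).comp
        (by fun_prop : Continuous fun x => D.yv p.1 p.2 - x)).aestronglyMeasurable
    · rw [Real.norm_of_nonneg (br_nonneg _ (D.sc_pos _) _)]
      exact br_le_one _ (D.sc_pos _) _
  have hv0 : ∀ p, 0 ≤ v p := fun p => integral_nonneg fun x =>
    mul_nonneg (hh0 _ _) (br_nonneg _ (D.sc_pos _) _)
  have s1 : ∀ p ∈ im, ∫ x in (D.dy K N)ᶜ, br 4 (D.sc p.1) (x - D.yv p.1 p.2) ≤ v p := by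
    intro p hp
    have hs := D.sc_pos p.1
    refine le_trans ?_ (setIntegral_le_integral (s := (D.dy K N)ᶜ) (hvi p) (ae_of_all _ fun x =>
      mul_nonneg (hh0 _ _) (br_nonneg _ (D.sc_pos _) _)))
    refine setIntegral_mono_on (br_integrable_of_two_le (by norm_num) hs _).integrableOn
      (hvi p).integrableOn (D.measurableSet_dy K N).compl fun x hx => ?_
    rw [show 4 = 2 + 2 from rfl, br_add, br_sub_comm 2 _ (D.yv p.1 p.2)]
    refine mul_le_mul_of_nonneg_right ?_ (br_nonneg _ hs _)
    obtain ⟨h1, h2⟩ := (h p hp).2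
    have : x < A ∨ B ≤ x := by
      by_contra! hcon
      exact hx ⟨hcon.1, hcon.2⟩
    rcases this with hx | hx
    · refine (br_anti 2 hs ?_).trans (le_add_of_nonneg_right (br_nonneg _ hs _))
      rw [abs_of_neg (by linarith), abs_of_neg (by linarith)]
      linarith
    · refine (br_anti 2 hs ?_).trans (le_add_of_nonneg_left (br_nonneg _ hs _))
      have : D.yv p.1 p.2 < B := h2
      rw [abs_of_nonneg (by linarith), abs_of_nonneg (by linarith)]
      linarith
  refine (Finset.sum_le_sum s1).trans ?_
  have hsub : im ⊆ im.image Prod.fst ×ˢ im.image Prod.snd := fun p hp => by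
    rw [Finset.mem_product]
    exact ⟨Finset.mem_image_of_mem _ hp, Finset.mem_image_of_mem _ hp⟩
  refine (Finset.sum_le_sum_of_subset_of_nonneg hsub fun p _ _ => hv0 p).trans ?_
  rw [Finset.sum_product]
  have s2 : ∀ k ∈ im.image Prod.fst, ∑ n ∈ im.image Prod.snd, v (k, n) ≤ 8 * I0 ^ 2 * D.sc k := by
    intro k _
    have hs := D.sc_pos k
    have hI := I0_nonneg
    simp only [hv]
    rw [← integral_finsetSum _ fun n _ => hvi (k, n)]
    have : ∀ x, ∑ n ∈ im.image Prod.snd, h' k x * br 2 (D.sc k) (D.yv k n - x) ≤ h' k x * (4 * I0) := by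
      intro x
      rw [← Finset.mul_sum]
      refine mul_le_mul_of_nonneg_left ?_ (hh0 _ _)
      have := D.sum_br_le 2 le_rfl k (im.image Prod.snd) x le_rfl
      rw [← Finset.mul_sum] at this
      simp_rw [br_sub_comm 2 _ _ x]
      have e : (2 : ℝ) ^ 2 * (D.sc k * I0) = D.sc k * (4 * I0) := by ring
      rw [e] at this
      exact le_of_mul_le_mul_left this hs
    calc _ ≤ ∫ x, h' k x * (4 * I0) :=
          integral_mono (integrable_finsetSum _ fun n _ => hvi (k, n)) ((hhi k).mul_const _) this
      _ = _ := by
          rw [integral_mul_const, hh', integral_add (br_integrable_sub hs A) (br_integrable_sub hs B),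
            br_integral_sub hs, br_integral_sub hs]
          ring
  refine (Finset.sum_le_sum s2).trans ?_
  rw [← Finset.mul_sum]
  have := D.sum_sc_le (im.image Prod.fst) K (fun k hk => by
    obtain ⟨p, hp, rfl⟩ := Finset.mem_image.1 hk
    exact (h p hp).1)
  calc _ ≤ 8 * I0 ^ 2 * (2 * D.sc K) := by gcongr
    _ = _ := by ring

/-- Contribution of pairs of tiles at separated scales: one row. -/
lemma far_row : ∃ C : ℝ, 0 < C ∧ ∀ (D : Par) (j : Fin 3) (Q : Finset Tile) (t : Tile → Top)
    (i : Fin 3), (∀ P ∈ Q, D.inTree i (t P) P) →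
    (∀ P ∈ Q, ∀ P' ∈ Q, P'.1 + 5 ≤ P.1 →
      |D.fr j P - D.fr j P'| ≤ 2 * (1 / D.sc P.1 + 1 / D.sc P'.1) →
      D.yy P' ∉ D.dy (t P).1 (t P).2.1) → ∀ P ∈ Q,
    ∑ P' ∈ Q with P'.1 + 5 ≤ P.1, D.sc P.1 * (D.sc P'.1 * ‖D.ip j P P'‖) ≤
      C * ∫ x in (D.dy (t P).1 (t P).2.1)ᶜ, br 4 (D.sc P.1) (x - D.yy P) := by
  obtain ⟨C, hC, hip⟩ := pk_inner_bound 4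
  refine ⟨400 * C, by positivity, fun D j Q t i htree hsep P hP => ?_⟩
  have hsP := D.sc_pos P.1
  set Q' := Q.filter fun P' => P'.1 + 5 ≤ P.1 ∧
    |D.fr j P' - D.fr j P| < 1 / D.sc P.1 + 1 / D.sc P'.1 with hQ'
  set v : ℤ × ℤ → ℝ := fun p => 2 ^ 4 * ∫ x in D.dy p.1 p.2, br 4 (D.sc P.1) (x - D.yy P) with hv
  have hv0 : ∀ p, 0 ≤ v p := fun p =>
    mul_nonneg (by norm_num) (integral_nonneg fun x => br_nonneg _ hsP _)
  have s1 : ∑ P' ∈ Q with P'.1 + 5 ≤ P.1, D.sc P.1 * (D.sc P'.1 * ‖D.ip j P P'‖) ≤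
      C * ∑ P' ∈ Q', v (P'.1, P'.2.1) := by
    rw [hQ', ← Finset.filter_filter]
    conv_rhs => rw [Finset.sum_filter, Finset.mul_sum]
    refine Finset.sum_le_sum fun P' hP' => ?_
    have hs := (D.sc_pos P'.1)
    have hle : D.sc P'.1 ≤ D.sc P.1 := D.sc_mono (by have := (Finset.mem_filter.1 hP').2; omega)
    split_ifs with h
    · have h1 := hip (D.sc P.1) (D.sc P'.1) (D.fr j P) (D.fr j P') (D.yy P) (D.yy P') hsP hs
      rw [max_eq_left hle] at h1
      have h2 := D.sc_mul_br_le 4 (by norm_num) P'.1 P'.2.1 (D.yy P) hle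
      calc _ ≤ D.sc P.1 * (D.sc P'.1 * (C * ((D.sc P.1)⁻¹ * br 4 (D.sc P.1) (D.yy P - D.yy P')))) := by
            gcongr
            exact h1
        _ = C * (D.sc P'.1 * br 4 (D.sc P.1) (D.yy P - D.yy P')) := by field_simp
        _ ≤ _ := by gcongr; exact h2
    · push Not at h
      rw [abs_sub_comm] at h
      rw [ip, pk_inner_eq_zero (D.sc_pos _) (D.sc_pos _) _ _ h, norm_zero, mul_zero, mul_zero, mul_zero]
  have hfr : ∀ P' ∈ Q', |D.fr j P' - D.fr j P| ≤ 2 / D.sc P'.1 := by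
    intro P' hP'
    obtain ⟨-, h1, h2⟩ := Finset.mem_filter.1 hP'
    have : 1 / D.sc P.1 ≤ 1 / D.sc P'.1 := one_div_le_one_div_of_le (D.sc_pos _) (D.sc_mono (by omega))
    refine h2.le.trans ?_
    rw [show (2 : ℝ) / D.sc P'.1 = 1 / D.sc P'.1 + 1 / D.sc P'.1 by ring]
    linarith
  have s2 := D.sum_tiles_le j 2 Q' (fun _ _ => D.fr j P) (fun P' hP' => by
    exact_mod_cast hfr P' hP') v hv0
  have s3 := D.sum_overlap_le (Q'.image fun P : Tile => (P.1, P.2.1))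
    (B := (D.dy (t P).1 (t P).2.1)ᶜ) (g := fun x => br 4 (D.sc P.1) (x - D.yy P)) (fun p hp => by
      obtain ⟨P', hP', rfl⟩ := Finset.mem_image.1 hp
      obtain ⟨hPQ, h1, h2⟩ := Finset.mem_filter.1 hP'
      intro x hx hxT
      have h3 : (1 : ℝ) / D.sc P.1 + 1 / D.sc P'.1 ≤ 2 * (1 / D.sc P.1 + 1 / D.sc P'.1) := by
        have := D.sc_pos P.1
        have := D.sc_pos P'.1
        have : 0 ≤ 1 / D.sc P.1 + 1 / D.sc P'.1 := by positivity
        linarith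
      rw [abs_sub_comm] at h2
      refine hsep P hP P' hPQ h1 (h2.le.trans h3) ?_
      exact D.dy_nested (by have := (htree P hP).1; simp only; omega) hx (D.yy_mem_dy P') hxT)
    (br_integrable_of_two_le (by norm_num) hsP _) (fun x => br_nonneg _ hsP _) (fun p hp p' hp' hle => by
      obtain ⟨P', hP', rfl⟩ := Finset.mem_image.1 hp
      obtain ⟨P'', hP'', rfl⟩ := Finset.mem_image.1 hp'
      rw [Set.disjoint_left]
      intro x hx hx'
      simp only at hle hx hx'
      refine hsep P' (Finset.mem_filter.1 hP').1 P'' (Finset.mem_filter.1 hP'').1 hle ?_ ?_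
      · have h1 := hfr P' hP'
        have h2 := hfr P'' hP''
        have h3 := abs_sub_le (D.fr j P') (D.fr j P) (D.fr j P'')
        rw [abs_sub_comm (D.fr j P)] at h3
        calc _ ≤ 2 / D.sc P'.1 + 2 / D.sc P''.1 := by linarith
          _ = _ := by ring
      · have := D.dy_nested (by omega) hx' (D.yy_mem_dy P'') hx
        exact (htree P' (Finset.mem_filter.1 hP').1).dy_subset this)
  calc _ ≤ C * ∑ P' ∈ Q', v (P'.1, P'.2.1) := s1
    _ ≤ C * ((2 * ((2 : ℕ) : ℝ) + 1) * ∑ p ∈ Q'.image fun P : Tile => (P.1, P.2.1), v p) := by gcongr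
    _ ≤ C * ((2 * ((2 : ℕ) : ℝ) + 1) * (2 ^ 4 *
        (5 * ∫ x in (D.dy (t P).1 (t P).2.1)ᶜ, br 4 (D.sc P.1) (x - D.yy P)))) := by
      rw [hv, ← Finset.mul_sum]
      gcongr
    _ = _ := by push_cast; ring

/-- Bessel inequality for a family of strongly disjoint trees. -/
lemma bessel_trees : ∃ C : ℝ, 0 < C ∧ ∀ (D : Par) (j : Fin 3) (f : ℝ → ℂ), Nice f →
    ∀ (Q : Finset Tile) (J : Finset ℕ) (t : Tile → ℕ) (T : ℕ → Top) (i : Fin 3) (S : ℝ), 0 ≤ S →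
    (∀ P ∈ Q, t P ∈ J) → (∀ P ∈ Q, D.inTree i (T (t P)) P) →
    (∀ P ∈ Q, ‖D.co j f P‖ ≤ S) →
    (∀ P ∈ Q, ∀ P' ∈ Q, P'.1 + 5 ≤ P.1 →
      |D.fr j P - D.fr j P'| ≤ 2 * (1 / D.sc P.1 + 1 / D.sc P'.1) →
      D.yy P' ∉ D.dy (T (t P)).1 (T (t P)).2.1) →
    (∑ P ∈ Q, D.sc P.1 * ‖D.co j f P‖ ^ 2) ^ 2 ≤ C * (∫ x, ‖f x‖ ^ 2) *
      (∑ P ∈ Q, D.sc P.1 * ‖D.co j f P‖ ^ 2 + S ^ 2 * ∑ n ∈ J, D.sc (T n).1) := by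
  obtain ⟨C1, hC1, hnear⟩ := near_sum
  obtain ⟨C2, hC2, hfar⟩ := far_row
  have hI := I0_nonneg
  refine ⟨C1 + 2 * (C2 * (21 * (16 * I0 ^ 2))), by positivity, ?_⟩
  intro D j f hf Q J t T i S hS htJ htree hFS hsep
  set F : Tile → ℝ := fun P => ‖D.co j f P‖ with hF
  have hF0 : ∀ P, 0 ≤ F P := fun P => norm_nonneg _
  set b : Tile → Tile → ℝ := fun P P' => D.sc P.1 * D.sc P'.1 * (F P * F P' * ‖D.ip j P P'‖) with hb
  have hb0 : ∀ P P', 0 ≤ b P P' := fun P P' => by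
    have := (D.sc_pos P.1).le
    have := (D.sc_pos P'.1).le
    have := hF0 P
    have := hF0 P'
    positivity
  have hbsymm : ∀ P P', b P P' = b P' P := fun P P' => by
    simp only [hb, D.norm_ip_comm j P P']
    ring
  have hsplit : ∑ P ∈ Q, ∑ P' ∈ Q, b P P' ≤ ∑ P ∈ Q, ∑ P' ∈ Q with |P.1 - P'.1| < 5, b P P' +
      2 * ∑ P ∈ Q, ∑ P' ∈ Q with P'.1 + 5 ≤ P.1, b P P' := by
    have h2 : ∑ P ∈ Q, ∑ P' ∈ Q with P'.1 + 5 ≤ P.1, b P P' =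
        ∑ P ∈ Q, ∑ P' ∈ Q with P.1 + 5 ≤ P'.1, b P P' := by
      simp only [Finset.sum_filter]
      rw [Finset.sum_comm]
      refine Finset.sum_congr rfl fun P _ => Finset.sum_congr rfl fun P' _ => ?_
      rw [hbsymm]
    rw [two_mul]
    nth_rewrite 2 [h2]
    rw [← Finset.sum_add_distrib, ← Finset.sum_add_distrib]
    refine Finset.sum_le_sum fun P _ => ?_
    simp only [Finset.sum_filter]
    rw [← Finset.sum_add_distrib, ← Finset.sum_add_distrib]
    refine Finset.sum_le_sum fun P' _ => ?_
    have := hb0 P P'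
    by_cases h1 : |P.1 - P'.1| < 5
    · rw [if_pos h1]
      split_ifs <;> linarith
    · rw [if_neg h1]
      rcases le_or_gt (P'.1 + 5) P.1 with h3 | h3
      · rw [if_pos h3]
        split_ifs <;> linarith
      · rw [abs_lt] at h1
        have : P.1 + 5 ≤ P'.1 := by omega
        rw [if_pos this]
        split_ifs <;> linarith
  have hfarsum : ∑ P ∈ Q, ∑ P' ∈ Q with P'.1 + 5 ≤ P.1, b P P' ≤
      S ^ 2 * (C2 * (21 * (16 * I0 ^ 2)) * ∑ n ∈ J, D.sc (T n).1) := by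
    set v : Tile → ℝ := fun P => ∫ x in (D.dy (T (t P)).1 (T (t P)).2.1)ᶜ,
      br 4 (D.sc P.1) (x - D.yy P) with hv
    have h1 : ∀ P ∈ Q, ∑ P' ∈ Q with P'.1 + 5 ≤ P.1, b P P' ≤ S ^ 2 * (C2 * v P) := by
      intro P hP
      refine le_trans ?_ (mul_le_mul_of_nonneg_left (hfar D j Q (fun P => T (t P)) i htree hsep P hP)
        (by positivity))
      rw [Finset.mul_sum]
      refine Finset.sum_le_sum fun P' hP' => ?_
      have hss : 0 ≤ D.sc P.1 * D.sc P'.1 := mul_nonneg (D.sc_pos _).le (D.sc_pos _).le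
      have hFF : F P * F P' ≤ S ^ 2 := by
        rw [sq]
        exact mul_le_mul (hFS P hP) (hFS P' (Finset.mem_filter.1 hP').1) (hF0 _) hS
      calc _ = (F P * F P') * (D.sc P.1 * (D.sc P'.1 * ‖D.ip j P P'‖)) := by simp only [hb]; ring
        _ ≤ _ := mul_le_mul_of_nonneg_right hFF (by rw [← mul_assoc]; positivity)
    refine (Finset.sum_le_sum h1).trans ?_
    rw [← Finset.mul_sum, ← Finset.mul_sum]
    have h2 : ∑ P ∈ Q, v P ≤ (21 * (16 * I0 ^ 2)) * ∑ n ∈ J, D.sc (T n).1 := by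
      rw [← Finset.sum_fiberwise_of_maps_to htJ, Finset.mul_sum]
      refine Finset.sum_le_sum fun n _ => ?_
      set Qn := Q.filter fun P => t P = n
      set w : ℤ × ℤ → ℝ := fun p => ∫ x in (D.dy (T n).1 (T n).2.1)ᶜ,
        br 4 (D.sc p.1) (x - D.yv p.1 p.2) with hw
      have htr : ∀ P ∈ Qn, D.inTree i (T n) P := by
        intro P hP
        obtain ⟨hPQ, rfl⟩ := Finset.mem_filter.1 hP
        exact htree P hPQ
      have e : ∑ P ∈ Qn, v P = ∑ P ∈ Qn, w (P.1, P.2.1) := by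
        refine Finset.sum_congr rfl fun P hP => ?_
        simp only [hv, hw, (Finset.mem_filter.1 hP).2]
        rfl
      rw [e]
      have h3 := D.sum_tiles_le i 10 Qn (fun _ _ => D.a i * (T n).2.2) (fun P hP => by
        exact_mod_cast (htr P hP).2.2) w (fun p => integral_nonneg fun x => br_nonneg _ (D.sc_pos _) _)
      refine h3.trans ?_
      have h4 := D.outside_sum (T n).1 (T n).2.1 (Qn.image fun P : Tile => (P.1, P.2.1)) (fun p hp => by
        obtain ⟨P, hP, rfl⟩ := Finset.mem_image.1 hp
        exact ⟨(htr P hP).1, (htr P hP).2.1⟩)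
      calc _ ≤ (2 * ((10 : ℕ) : ℝ) + 1) * (16 * I0 ^ 2 * D.sc (T n).1) := by gcongr
        _ = _ := by push_cast; ring
    rw [mul_assoc C2]
    gcongr
  have hB := D.bessel_abs hf j Q
  have hn := hnear D j Q F
  have hf0 : 0 ≤ ∫ x, ‖f x‖ ^ 2 := integral_nonneg fun _ => by positivity
  have hJ0 : 0 ≤ ∑ n ∈ J, D.sc (T n).1 := Finset.sum_nonneg fun n _ => (D.sc_pos _).le
  have hQ0 : 0 ≤ ∑ P ∈ Q, D.sc P.1 * F P ^ 2 := Finset.sum_nonneg fun P _ => by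
    have := (D.sc_pos P.1).le
    positivity
  calc _ ≤ (∫ x, ‖f x‖ ^ 2) * ∑ P ∈ Q, ∑ P' ∈ Q, b P P' := hB
    _ ≤ (∫ x, ‖f x‖ ^ 2) * (C1 * ∑ P ∈ Q, D.sc P.1 * F P ^ 2 +
        2 * (S ^ 2 * (C2 * (21 * (16 * I0 ^ 2)) * ∑ n ∈ J, D.sc (T n).1))) := by
      gcongr
      linarith
    _ ≤ (∫ x, ‖f x‖ ^ 2) * ((C1 + 2 * (C2 * (21 * (16 * I0 ^ 2)))) *
        (∑ P ∈ Q, D.sc P.1 * F P ^ 2 + S ^ 2 * ∑ n ∈ J, D.sc (T n).1)) := by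
      refine mul_le_mul_of_nonneg_left ?_ hf0
      have e1 : 0 ≤ C2 * (21 * (16 * I0 ^ 2)) * ∑ P ∈ Q, D.sc P.1 * F P ^ 2 := by positivity
      have e2 : 0 ≤ C1 * (S ^ 2 * ∑ n ∈ J, D.sc (T n).1) := by positivity
      linarith
    _ = _ := by ring

end Par

namespace Par
variable (D : Par)

/-- Greedy selection of trees. -/
lemma greedy (i j : Fin 3) (s σ ε : ℝ) (hs : |s| ≤ 1) (hσ : 0 ≤ σ) (hε : 0 < ε) (F : Tile → ℝ)
    (Q : Finset Tile) :
    ∃ (m : ℕ) (T : ℕ → Top) (B : ℕ → Finset Tile) (Q' : Finset Tile), Q' ⊆ Q ∧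
      (∀ n < m, B n ⊆ Q ∧ (∀ P ∈ B n, D.inTree i (T n) P) ∧
        σ * D.sc (T n).1 < ∑ P ∈ B n, D.sc P.1 * F P ^ 2) ∧
      (∀ a b, a < b → b < m → s * (D.a j * (T b).2.2) ≤ s * (D.a j * (T a).2.2) + ε ∧
        ∀ P ∈ B b, ¬ D.inTree i (T a) P ∧ ¬ D.inTree j (T a) P) ∧
      (∀ T, ∑ P ∈ Q' with D.inTree i T P, D.sc P.1 * F P ^ 2 ≤ σ * D.sc T.1) ∧
      ∀ P ∈ Q, P ∉ Q' → ∃ n < m, D.inTree i (T n) P ∨ D.inTree j (T n) P := by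
  induction Q using Finset.strongInduction with
  | H Q ih =>
    by_cases hgood : ∀ T, ∑ P ∈ Q with D.inTree i T P, D.sc P.1 * F P ^ 2 ≤ σ * D.sc T.1
    · exact ⟨0, fun _ => (0, 0, 0), fun _ => ∅, Q, subset_rfl, by simp, by simp, hgood,
        fun P h h' => absurd h h'⟩
    push Not at hgood
    set bad : Set Top :=
      {T | σ * D.sc T.1 < ∑ P ∈ Q with D.inTree i T P, D.sc P.1 * F P ^ 2} with hbad
    set V : Set ℝ := Set.image (fun T : Top => s * (D.a j * T.2.2)) bad with hV
    have hne : V.Nonempty := by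
      obtain ⟨T, hT⟩ := hgood
      exact ⟨_, T, hT, rfl⟩
    have hbd : BddAbove V := by
      refine ⟨2 * ∑ P ∈ Q, (|D.fr i P| + 10 / D.sc P.1), ?_⟩
      rintro _ ⟨T, hT, rfl⟩
      have hTne : (Q.filter (D.inTree i T)).Nonempty := by
        rw [Finset.nonempty_iff_ne_empty]
        intro h
        rw [hbad, mem_ofPred_eq, h, Finset.sum_empty] at hT
        have := D.sc_pos T.1
        have : 0 ≤ σ * D.sc T.1 := by positivity
        linarith
      obtain ⟨P, hP⟩ := hTne
      obtain ⟨hPQ, hPT⟩ := Finset.mem_filter.1 hP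
      have h1 : |D.a i * T.2.2| ≤ |D.fr i P| + 10 / D.sc P.1 := by
        have h2 := abs_sub_abs_le_abs_sub (D.a i * T.2.2) (D.fr i P)
        rw [abs_sub_comm] at h2
        linarith [hPT.2.2]
      have h2 : |D.fr i P| + 10 / D.sc P.1 ≤ ∑ P ∈ Q, (|D.fr i P| + 10 / D.sc P.1) :=
        Finset.single_le_sum (f := fun P => |D.fr i P| + 10 / D.sc P.1) (fun P _ => by
          have := D.sc_pos P.1
          positivity) hPQ
      rw [abs_mul] at h1
      have h3 := D.ha1 i
      have h4 := D.ha2 j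
      have h5 := abs_nonneg T.2.2
      simp only
      calc s * (D.a j * T.2.2) ≤ |s * (D.a j * T.2.2)| := le_abs_self _
        _ = |s| * (|D.a j| * |T.2.2|) := by rw [abs_mul, abs_mul]
        _ ≤ 1 * (2 * |T.2.2|) := by gcongr
        _ ≤ _ := by nlinarith
    obtain ⟨_, ⟨T0, hT0, rfl⟩, hsup⟩ := exists_lt_of_lt_csSup hne
      (show sSup V - ε < sSup V by linarith)
    simp only at hsup
    set Q1 := Q.filter fun P => ¬ D.inTree i T0 P ∧ ¬ D.inTree j T0 P with hQ1
    have hss : Q1 ⊂ Q := by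
      refine Finset.filter_ssubset.2 ?_
      have hTne : (Q.filter (D.inTree i T0)).Nonempty := by
        rw [Finset.nonempty_iff_ne_empty]
        intro h
        rw [hbad, mem_ofPred_eq, h, Finset.sum_empty] at hT0
        have := D.sc_pos T0.1
        have : 0 ≤ σ * D.sc T0.1 := by positivity
        linarith
      obtain ⟨P, hP⟩ := hTne
      obtain ⟨hPQ, hPT⟩ := Finset.mem_filter.1 hP
      exact ⟨P, hPQ, fun h => h.1 hPT⟩
    obtain ⟨m, T, B, Q', hQ', hB, hord, hg, hcov⟩ := ih Q1 hss
    refine ⟨m + 1, fun n => n.casesOn T0 T, fun n => n.casesOn (Q.filter (D.inTree i T0)) B, Q',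
      hQ'.trans hss.subset, ?_, ?_, hg, ?_⟩
    · rintro (_ | n) hn
      · exact ⟨Finset.filter_subset _ _, fun P hP => (Finset.mem_filter.1 hP).2, hT0⟩
      · obtain ⟨h1, h2, h3⟩ := hB n (by omega)
        exact ⟨h1.trans hss.subset, h2, h3⟩
    · rintro (_ | a) (_ | b) hab hb
      · omega
      · obtain ⟨h1, h2, h3⟩ := hB b (by omega)
        refine ⟨?_, fun P hP => (Finset.mem_filter.1 (h1 hP)).2⟩
        have : T b ∈ bad := by
          refine h3.trans_le (Finset.sum_le_sum_of_subset_of_nonneg (fun P hP => ?_) fun P _ _ => ?_)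
          · exact Finset.mem_filter.2 ⟨hss.subset (h1 hP), h2 P hP⟩
          · have := D.sc_pos P.1
            positivity
        have := le_csSup hbd (mem_image_of_mem _ this)
        change s * (D.a j * (T b).2.2) ≤ s * (D.a j * T0.2.2) + ε
        linarith
      · omega
      · exact hord a b (by omega) (by omega)
    · intro P hP hP'
      by_cases h : P ∈ Q1
      · obtain ⟨n, hn, h⟩ := hcov P h hP'
        exact ⟨n + 1, by omega, h⟩
      · refine ⟨0, by omega, ?_⟩
        by_contra hcon
        rw [not_or] at hcon
        exact h (Finset.mem_filter.2 ⟨hP, hcon⟩)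

/-- Frequency separation of two tiles of different scales in two `i`-trees. -/
lemma freq_sep {i j : Fin 3} (hij : i ≠ j) {P P' : Tile} {ζ ζ' s : ℝ}
    (hs : s * D.κ i j = |D.κ i j|) (hs1 : |s| ≤ 1)
    (h : |D.fr i P - D.a i * ζ| ≤ 10 / D.sc P.1)
    (h' : |D.fr i P' - D.a i * ζ'| ≤ 10 / D.sc P'.1) (hk : P'.1 + 5 ≤ P.1)
    (hn : |D.fr j P - D.fr j P'| ≤ 2 * (1 / D.sc P.1 + 1 / D.sc P'.1)) :
    s * (D.a j * ζ') + 70 / D.sc P'.1 ≤ s * (D.a j * ζ) ∧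
      |D.fr j P' - D.a j * ζ| ≤ 10 / D.sc P'.1 := by
  have h1 := D.abs_fr_le i j P ζ _ h
  have h2 := D.abs_fr_le i j P' ζ' _ h'
  have hκ1 : 100 ≤ |D.κ i j| := D.hκ1 i j hij
  have hκ2 : |D.κ i j| ≤ 200 := D.hκ2 i j hij
  have hsP := D.sc_pos P.1
  have hsP' := D.sc_pos P'.1
  have h32 : 1 / D.sc P.1 ≤ 1 / D.sc P'.1 / 32 := by
    have := D.sc_mono hk
    rw [D.sc_add] at this
    norm_num at this
    rw [div_div]
    exact one_div_le_one_div_of_le (by positivity) this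
  set u := 1 / D.sc P.1 with hu
  set v := 1 / D.sc P'.1 with hv
  have hu0 : 0 < u := by positivity
  have hv0 : 0 < v := by positivity
  rw [show D.κ i j / D.sc P.1 = D.κ i j * u by rw [hu]; ring,
    show 2 * (10 / D.sc P.1) = 20 * u by rw [hu]; ring] at h1
  rw [show D.κ i j / D.sc P'.1 = D.κ i j * v by rw [hv]; ring,
    show 2 * (10 / D.sc P'.1) = 20 * v by rw [hv]; ring] at h2
  rw [show 70 / D.sc P'.1 = 70 * v by rw [hv]; ring, show 10 / D.sc P'.1 = 10 * v by rw [hv]; ring]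
  constructor
  · set X := (D.fr j P - D.a j * ζ - D.κ i j * u) - (D.fr j P' - D.a j * ζ' - D.κ i j * v) -
      (D.fr j P - D.fr j P') with hX
    have hXle : |X| ≤ 20 * u + 20 * v + 2 * (u + v) := by
      refine (abs_sub _ _).trans (add_le_add ((abs_sub _ _).trans (add_le_add h1 h2)) hn)
    have hsX : |s * X| ≤ 20 * u + 20 * v + 2 * (u + v) := by
      rw [abs_mul]
      refine le_trans ?_ hXle
      have := abs_nonneg X
      nlinarith
    have e : s * X = s * (D.a j * ζ') - s * (D.a j * ζ) + |D.κ i j| * (v - u) := by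
      rw [← hs, hX]; ring
    rw [e] at hsX
    have := (abs_le.1 hsX).2
    nlinarith
  · have e : D.fr j P' - D.a j * ζ = (D.fr j P - D.a j * ζ - D.κ i j * u) + D.κ i j * u -
      (D.fr j P - D.fr j P') := by ring
    rw [e]
    refine (abs_sub _ _).trans ((add_le_add ((abs_add_le _ _).trans (add_le_add h1 le_rfl)) hn).trans ?_)
    rw [abs_mul, abs_of_pos hu0]
    nlinarith

/-- Selection of the `i`-trees on which slot `j` has large size. -/
lemma select_one : ∃ C : ℝ, 0 < C ∧ ∀ (D : Par) (i j : Fin 3), i ≠ j → ∀ (f : ℝ → ℂ), Nice f →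
    ∀ (S : ℝ), 0 < S → ∀ Q : Finset Tile, (∀ P ∈ Q, ‖D.co j f P‖ ≤ S) →
    ∃ (Q' : Finset Tile) (L : List (Fin 3 × Top)), Q' ⊆ Q ∧
      (∀ T, ∑ P ∈ Q' with D.inTree i T P, D.sc P.1 * ‖D.co j f P‖ ^ 2 ≤ (S / 2) ^ 2 * D.sc T.1) ∧
      (∀ P ∈ Q, P ∉ Q' → ∃ x ∈ L, D.inTree x.1 x.2 P) ∧
      (L.map fun x => D.sc x.2.1).sum ≤ C * (∫ x, ‖f x‖ ^ 2) / S ^ 2 := by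
  obtain ⟨C, hC, hbes⟩ := bessel_trees
  refine ⟨2 * (20 * C), by positivity, fun D i j hij f hf S hS Q hQS => ?_⟩
  obtain ⟨s, hs, hs1⟩ : ∃ s : ℝ, s * D.κ i j = |D.κ i j| ∧ |s| ≤ 1 := by
    rcases le_total 0 (D.κ i j) with h | h
    · exact ⟨1, by rw [abs_of_nonneg h, one_mul], by simp⟩
    · exact ⟨-1, by rw [abs_of_nonpos h]; ring, by simp⟩
  obtain ⟨ε, hε, hεQ⟩ : ∃ ε : ℝ, 0 < ε ∧ ∀ P ∈ Q, ε ≤ 1 / D.sc P.1 := by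
    have h0 : 0 ≤ ∑ P ∈ Q, D.sc P.1 := Finset.sum_nonneg fun P _ => (D.sc_pos _).le
    refine ⟨1 / (1 + ∑ P ∈ Q, D.sc P.1), by positivity, fun P hP => ?_⟩
    have := Finset.single_le_sum (f := fun P : Tile => D.sc P.1) (fun P _ => (D.sc_pos P.1).le) hP
    refine one_div_le_one_div_of_le (D.sc_pos _) (by linarith)
  set F : Tile → ℝ := fun P => ‖D.co j f P‖ with hF
  obtain ⟨m, T, B, Q', hQ', hB, hord, hg, hcov⟩ :=
    D.greedy i j s ((S / 2) ^ 2) ε hs1 (by positivity) hε F Q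
  set L : List (Fin 3 × Top) := (List.range m).map (fun n => (i, T n)) ++
    (List.range m).map (fun n => (j, T n)) with hL
  refine ⟨Q', L, hQ', hg, ?_, ?_⟩
  · intro P hP hP'
    obtain ⟨n, hn, h | h⟩ := hcov P hP hP'
    · exact ⟨(i, T n), List.mem_append_left _ (List.mem_map_of_mem (List.mem_range.2 hn)), h⟩
    · exact ⟨(j, T n), List.mem_append_right _ (List.mem_map_of_mem (List.mem_range.2 hn)), h⟩
  have hLsum : (L.map fun x => D.sc x.2.1).sum = 2 * ∑ n ∈ Finset.range m, D.sc (T n).1 := by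
    rw [hL, List.map_append, List.sum_append, List.map_map, List.map_map, two_mul]
    simp [Finset.sum, Finset.range, Multiset.range, Function.comp_def]
  rw [hLsum]
  set t : Tile → ℕ := fun P => if h : ∃ n < m, P ∈ B n then h.choose else 0 with ht
  set QB := (Finset.range m).biUnion B with hQB
  have ht1 : ∀ P ∈ QB, t P < m ∧ P ∈ B (t P) := by
    intro P hP
    have h : ∃ n < m, P ∈ B n := by simpa [hQB] using hP
    simp only [ht, dif_pos h]
    exact h.choose_spec
  have hdisj : ∀ a < m, ∀ b < m, a < b → Disjoint (B a) (B b) := by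
    intro a ha b hb hab
    rw [Finset.disjoint_left]
    intro P hPa hPb
    exact ((hord a b hab hb).2 P hPb).1 ((hB a ha).2.1 P hPa)
  have hb := hbes D j f hf QB (Finset.range m) t T i S hS.le
    (fun P hP => Finset.mem_range.2 (ht1 P hP).1)
    (fun P hP => (hB _ (ht1 P hP).1).2.1 P (ht1 P hP).2)
    (fun P hP => hQS P ((hB _ (ht1 P hP).1).1 (ht1 P hP).2)) (by
      intro P hP P' hP' hk hn hy
      obtain ⟨hm, hPB⟩ := ht1 P hP
      obtain ⟨hm', hPB'⟩ := ht1 P' hP'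
      have hPT := (hB _ hm).2.1 P hPB
      have hPT' := (hB _ hm').2.1 P' hPB'
      obtain ⟨h1, h2⟩ := D.freq_sep hij hs hs1 hPT.2.2 hPT'.2.2 hk hn
      have h3 := hεQ P' ((hB _ hm').1 hPB')
      have hsP' := D.sc_pos P'.1
      have h4 : 1 / D.sc P'.1 < 70 / D.sc P'.1 := by gcongr; norm_num
      rcases lt_trichotomy (t P) (t P') with hlt | heq | hlt
      · exact ((hord _ _ hlt hm').2 P' hPB').2 ⟨by have := hPT.1; omega, hy, h2⟩
      · rw [heq] at h1
        linarith
      · have := (hord _ _ hlt hm).1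
        linarith)
  set A := ∑ P ∈ QB, D.sc P.1 * ‖D.co j f P‖ ^ 2 with hA
  have hlow : (S / 2) ^ 2 * ∑ n ∈ Finset.range m, D.sc (T n).1 ≤ A := by
    rw [hA, hQB, Finset.sum_biUnion, Finset.mul_sum]
    · exact Finset.sum_le_sum fun n hn => (hB n (Finset.mem_range.1 hn)).2.2.le
    · intro a ha b hb hab
      have ha := Finset.mem_range.1 (Finset.mem_coe.1 ha)
      have hb := Finset.mem_range.1 (Finset.mem_coe.1 hb)
      rcases lt_or_gt_of_ne hab with h | h
      · exact hdisj a ha b hb h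
      · exact (hdisj b hb a ha h).symm
  set W := ∑ n ∈ Finset.range m, D.sc (T n).1 with hW
  have hW0 : 0 ≤ W := Finset.sum_nonneg fun n _ => (D.sc_pos _).le
  have hf0 : 0 ≤ ∫ x, ‖f x‖ ^ 2 := integral_nonneg fun _ => by positivity
  have hA0 : 0 ≤ A := le_trans (by positivity) hlow
  have hA5 : A ≤ 5 * C * ∫ x, ‖f x‖ ^ 2 := by
    rcases hA0.eq_or_lt with h | h
    · rw [← h]; positivity
    · have : A * A ≤ (5 * C * ∫ x, ‖f x‖ ^ 2) * A := by
        calc A * A = A ^ 2 := by ring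
          _ ≤ _ := hb
          _ ≤ C * (∫ x, ‖f x‖ ^ 2) * (A + 4 * A) :=
            mul_le_mul_of_nonneg_left (by linarith) (by positivity)
          _ = _ := by ring
      exact le_of_mul_le_mul_right this h
  rw [le_div_iff₀ (by positivity)]
  nlinarith

/-- Selection of the trees on which slot `j` has large size. -/
lemma select : ∃ C : ℝ, 0 < C ∧ ∀ (D : Par) (j : Fin 3) (f : ℝ → ℂ), Nice f →
    ∀ (S : ℝ), 0 < S → ∀ Q : Finset Tile, D.SizeLE j Q (fun P => ‖D.co j f P‖) S →
    ∃ (Q' : Finset Tile) (L : List (Fin 3 × Top)), Q' ⊆ Q ∧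
      D.SizeLE j Q' (fun P => ‖D.co j f P‖) (S / 2) ∧
      (∀ P ∈ Q, P ∉ Q' → ∃ x ∈ L, D.inTree x.1 x.2 P) ∧
      (L.map fun x => D.sc x.2.1).sum ≤ C * (∫ x, ‖f x‖ ^ 2) / S ^ 2 := by
  obtain ⟨C, hC, h⟩ := select_one
  refine ⟨2 * C, by positivity, fun D j f hf S hS Q hQ => ?_⟩
  obtain ⟨i1, i2, h1, h2, h12⟩ : ∃ i1 i2 : Fin 3, i1 ≠ j ∧ i2 ≠ j ∧ ∀ i, i ≠ j → i = i1 ∨ i = i2 := by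
    clear hQ; revert j; decide
  obtain ⟨Q1, L1, hQ1, hg1, hc1, hL1⟩ := h D i1 j h1 f hf S hS Q (fun P hP => hQ.le hS.le hP)
  obtain ⟨Q2, L2, hQ2, hg2, hc2, hL2⟩ := h D i2 j h2 f hf S hS Q1
    (fun P hP => hQ.le hS.le (hQ1 hP))
  refine ⟨Q2, L1 ++ L2, hQ2.trans hQ1, fun i hi T => ?_, fun P hP hP2 => ?_, ?_⟩
  · rcases h12 i hi with rfl | rfl
    · refine le_trans ?_ (hg1 T)
      refine Finset.sum_le_sum_of_subset_of_nonneg (Finset.filter_subset_filter _ hQ2) fun P _ _ => ?_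
      have := D.sc_pos P.1
      positivity
    · exact hg2 T
  · by_cases hP1 : P ∈ Q1
    · obtain ⟨x, hx, h⟩ := hc2 P hP1 hP2
      exact ⟨x, List.mem_append_right _ hx, h⟩
    · obtain ⟨x, hx, h⟩ := hc1 P hP hP1
      exact ⟨x, List.mem_append_left _ hx, h⟩
  · rw [List.map_append, List.sum_append]
    calc _ ≤ C * (∫ x, ‖f x‖ ^ 2) / S ^ 2 + C * (∫ x, ‖f x‖ ^ 2) / S ^ 2 := add_le_add hL1 hL2
      _ = _ := by ring

end Par

lemma sum_two_rpow_abs_le {γ : ℝ} (hγ : 0 < γ) : ∃ C : ℝ, 0 < C ∧ ∀ (x : ℝ) (S : Finset ℤ),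
    ∑ n ∈ S, (2 : ℝ) ^ (-γ * |n + x|) ≤ C := by
  have hr : (2 : ℝ) ^ (-γ) < 1 := Real.rpow_lt_one_of_one_lt_of_neg (by norm_num) (by linarith)
  have hs : Summable fun n : ℤ => ((2 : ℝ) ^ (-γ)) ^ n.natAbs := by
    refine Summable.of_nat_of_neg ?_ ?_ <;> simpa using summable_geometric_of_lt_one (by positivity) hr
  refine ⟨2 ^ γ * ∑' n : ℤ, ((2 : ℝ) ^ (-γ)) ^ n.natAbs,
    mul_pos (by positivity) (hs.tsum_pos (fun n => by positivity) 0 (by positivity)), fun x S => ?_⟩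
  have h1 : ∀ n : ℤ, (2 : ℝ) ^ (-γ * |n + x|) ≤ 2 ^ γ * ((2 : ℝ) ^ (-γ)) ^ (n + ⌊x⌋).natAbs := by
    intro n
    rw [← Real.rpow_natCast, ← Real.rpow_mul (by norm_num), ← Real.rpow_add (by norm_num)]
    refine Real.rpow_le_rpow_of_exponent_le (by norm_num) ?_
    have h2 : (((n + ⌊x⌋).natAbs : ℕ) : ℝ) = |(n : ℝ) + ⌊x⌋| := by
      rw [Nat.cast_natAbs]; push_cast; rfl
    rw [h2]
    have h3 : |(n : ℝ) + ⌊x⌋| ≤ |n + x| + 1 := by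
      have e : (n : ℝ) + ⌊x⌋ = (n + x) - Int.fract x := by rw [Int.fract]; ring
      rw [e]
      refine (abs_sub _ _).trans ?_
      rw [abs_of_nonneg (Int.fract_nonneg x)]
      linarith [Int.fract_lt_one x]
    nlinarith
  refine (Finset.sum_le_sum fun n _ => h1 n).trans ?_
  rw [← Finset.mul_sum]
  gcongr
  have h4 := (Equiv.addRight ⌊x⌋).summable_iff.2 hs
  have h5 := (Equiv.addRight ⌊x⌋).tsum_eq fun n : ℤ => ((2 : ℝ) ^ (-γ)) ^ n.natAbs
  rw [← h5]
  exact h4.sum_le_tsum S fun n _ => by positivity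

lemma min_le_two_rpow {θ : ℝ} (h0 : 0 < θ) (h1 : θ < 1) {a b : ℝ} (ha : 0 < a) (hb : 0 < b) :
    min a b ≤ a ^ θ * b ^ (1 - θ) * 2 ^ (-(min θ (1 - θ)) * |Real.logb 2 (b / a)|) := by
  have e : ∀ x : ℝ, 0 < x → (2 : ℝ) ^ Real.logb 2 x = x := fun x hx =>
    Real.rpow_logb (by norm_num) (by norm_num) hx
  set x := Real.logb 2 a
  set y := Real.logb 2 b
  have hx : a = 2 ^ x := (e a ha).symm
  have hy : b = 2 ^ y := (e b hb).symm
  rw [Real.logb_div hb.ne' ha.ne']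
  change _ ≤ _ * 2 ^ (-(min θ (1 - θ)) * |y - x|)
  rw [hx, hy, ← Real.rpow_mul (by norm_num), ← Real.rpow_mul (by norm_num),
    ← Real.rpow_add (by norm_num), ← Real.rpow_add (by norm_num)]
  have m1 := min_le_left θ (1 - θ)
  have m2 := min_le_right θ (1 - θ)
  rcases le_total x y with h | h
  · refine (min_le_left _ _).trans (Real.rpow_le_rpow_of_exponent_le (by norm_num) ?_)
    rw [abs_of_nonneg (by linarith)]
    nlinarith
  · refine (min_le_right _ _).trans (Real.rpow_le_rpow_of_exponent_le (by norm_num) ?_)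
    rw [abs_of_nonpos (by linarith)]
    nlinarith

namespace Par
variable (D : Par)

/-- The absolute trilinear sum. -/
noncomputable def tri (f : Fin 3 → ℝ → ℂ) (Q : Finset Tile) : ℝ :=
  ∑ P ∈ Q, D.sc P.1 * (‖D.co 0 (f 0) P‖ * ‖D.co 1 (f 1) P‖ * ‖D.co 2 (f 2) P‖)

lemma tri_term_nonneg (f : Fin 3 → ℝ → ℂ) (P : Tile) :
    0 ≤ D.sc P.1 * (‖D.co 0 (f 0) P‖ * ‖D.co 1 (f 1) P‖ * ‖D.co 2 (f 2) P‖) := by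
  have := D.sc_pos P.1
  positivity

lemma tri_nonneg (f : Fin 3 → ℝ → ℂ) (Q : Finset Tile) : 0 ≤ D.tri f Q :=
  Finset.sum_nonneg fun P _ => D.tri_term_nonneg f P

lemma tri_list_le (f : Fin 3 → ℝ → ℂ) (S : Fin 3 → ℝ) (hS : ∀ j, 0 ≤ S j) (Q Q' : Finset Tile)
    (h : ∀ j, D.SizeLE j Q (fun P => ‖D.co j (f j) P‖) (S j)) (L : List (Fin 3 × Top))
    (hL : ∀ P ∈ Q, P ∉ Q' → ∃ x ∈ L, D.inTree x.1 x.2 P) :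
    D.tri f Q ≤ D.tri f Q' + S 0 * S 1 * S 2 * (L.map fun x => D.sc x.2.1).sum := by
  induction L generalizing Q' with
  | nil =>
    simp only [List.map_nil, List.sum_nil, mul_zero, add_zero]
    refine Finset.sum_le_sum_of_subset_of_nonneg (fun P hP => ?_) fun P _ _ => D.tri_term_nonneg f P
    by_contra hP'
    simpa using hL P hP hP'
  | cons x L ih =>
    have h1 := ih (Q' ∪ Q.filter (D.inTree x.1 x.2)) (fun P hP hP' => by
      rw [Finset.mem_union, not_or] at hP'
      obtain ⟨y, hy, hyP⟩ := hL P hP hP'.1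
      rcases List.mem_cons.1 hy with rfl | hy
      · exact absurd (Finset.mem_filter.2 ⟨hP, hyP⟩) hP'.2
      · exact ⟨y, hy, hyP⟩)
    have h2 : D.tri f (Q' ∪ Q.filter (D.inTree x.1 x.2)) ≤ D.tri f Q' + S 0 * S 1 * S 2 * D.sc x.2.1 := by
      have h3 := D.tree_estimate x.1 (fun _ _ => norm_nonneg _) h hS x.2
      have h4 := Finset.sum_union_inter (s₁ := Q') (s₂ := Q.filter (D.inTree x.1 x.2))
        (f := fun P => D.sc P.1 * (‖D.co 0 (f 0) P‖ * ‖D.co 1 (f 1) P‖ * ‖D.co 2 (f 2) P‖))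
      have h5 := D.tri_nonneg f (Q' ∩ Q.filter (D.inTree x.1 x.2))
      unfold tri at *
      linarith
    rw [List.map_cons, List.sum_cons, mul_add]
    linarith

lemma energy_step : ∃ C : ℝ, 0 < C ∧ ∀ (D : Par) (f : Fin 3 → ℝ → ℂ), (∀ j, Nice (f j)) →
    ∀ (S E : Fin 3 → ℝ), (∀ j, 0 < S j) → (∀ j, 0 < E j) → (∀ j, ∫ x, ‖f j x‖ ^ 2 ≤ E j ^ 2) →
    ∀ (ρ : ℝ), 0 < ρ → ∀ (Q : Finset Tile),
    (∀ j, D.SizeLE j Q (fun P => ‖D.co j (f j) P‖) (min (S j) (ρ * E j))) →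
    ∃ Q' ⊆ Q, (∀ j, D.SizeLE j Q' (fun P => ‖D.co j (f j) P‖) (min (S j) (ρ / 2 * E j))) ∧
      D.tri f Q ≤ D.tri f Q' + C / ρ ^ 2 *
        (min (S 0) (ρ * E 0) * min (S 1) (ρ * E 1) * min (S 2) (ρ * E 2)) := by
  obtain ⟨C, hC, hsel⟩ := select
  refine ⟨3 * C, by positivity, fun D f hf S E hS hE hfE ρ hρ Q hQ => ?_⟩
  have key : ∀ (j : Fin 3) (Q1 : Finset Tile), Q1 ⊆ Q → ∃ (Q' : Finset Tile) (L : List (Fin 3 × Top)),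
      Q' ⊆ Q1 ∧ D.SizeLE j Q' (fun P => ‖D.co j (f j) P‖) (min (S j) (ρ / 2 * E j)) ∧
      (∀ P ∈ Q1, P ∉ Q' → ∃ x ∈ L, D.inTree x.1 x.2 P) ∧
      (L.map fun x => D.sc x.2.1).sum ≤ C / ρ ^ 2 := by
    intro j Q1 hQ1
    have hEj := hE j
    have h1 := (hQ j).mono hQ1
    rcases le_or_gt (S j) (ρ / 2 * E j) with h | h
    · refine ⟨Q1, [], subset_rfl, ?_, fun P h h' => absurd h h', ?_⟩
      · rw [min_eq_left h]
        rwa [min_eq_left (by nlinarith)] at h1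
      · simp only [List.map_nil, List.sum_nil]
        positivity
    · have h2 : D.SizeLE j Q1 (fun P => ‖D.co j (f j) P‖) (ρ * E j) := by
        intro i hi T
        refine (h1 i hi T).trans ?_
        have := (D.sc_pos T.1).le
        have := (hS j).le
        gcongr
        exact min_le_right _ _
      obtain ⟨Q', L, hQ', hs, hc, hL⟩ := hsel D j (f j) (hf j) (ρ * E j) (by positivity) Q1 h2
      refine ⟨Q', L, hQ', ?_, hc, hL.trans ?_⟩
      · rw [min_eq_right h.le]
        convert hs using 1
        ring
      · rw [div_le_div_iff₀ (by positivity) (by positivity), mul_pow]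
        have := hfE j
        calc _ ≤ C * E j ^ 2 * ρ ^ 2 := by gcongr
          _ = _ := by ring
  obtain ⟨Q0, L0, hs0, hz0, hc0, hL0⟩ := key 0 Q subset_rfl
  obtain ⟨Q1, L1, hs1, hz1, hc1, hL1⟩ := key 1 Q0 hs0
  obtain ⟨Q2, L2, hs2, hz2, hc2, hL2⟩ := key 2 Q1 (hs1.trans hs0)
  refine ⟨Q2, hs2.trans (hs1.trans hs0), fun j => ?_, ?_⟩
  · fin_cases j
    · exact hz0.mono (hs2.trans hs1)
    · exact hz1.mono hs2
    · exact hz2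
  · have hm : ∀ j, 0 ≤ min (S j) (ρ * E j) := fun j =>
      le_min (hS j).le (mul_nonneg hρ.le (hE j).le)
    have h := D.tri_list_le f _ hm Q Q2 hQ (L0 ++ (L1 ++ L2)) (fun P hP hP2 => by
      by_cases h0 : P ∈ Q0
      · by_cases h1 : P ∈ Q1
        · obtain ⟨x, hx, h⟩ := hc2 P h1 hP2
          exact ⟨x, by simp [hx], h⟩
        · obtain ⟨x, hx, h⟩ := hc1 P h0 h1
          exact ⟨x, by simp [hx], h⟩
      · obtain ⟨x, hx, h⟩ := hc0 P hP h0
        exact ⟨x, by simp [hx], h⟩)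
    refine h.trans (add_le_add le_rfl ?_)
    rw [mul_comm]
    have h3 := mul_nonneg (mul_nonneg (hm 0) (hm 1)) (hm 2)
    refine mul_le_mul_of_nonneg_right ?_ h3
    simp only [List.map_append, List.sum_append]
    calc _ ≤ C / ρ ^ 2 + (C / ρ ^ 2 + C / ρ ^ 2) := by gcongr
      _ = _ := by ring

lemma energy_iter : ∃ C : ℝ, 0 < C ∧ ∀ (D : Par) (f : Fin 3 → ℝ → ℂ), (∀ j, Nice (f j)) →
    ∀ (S E : Fin 3 → ℝ), (∀ j, 0 < S j) → (∀ j, 0 < E j) → (∀ j, ∫ x, ‖f j x‖ ^ 2 ≤ E j ^ 2) →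
    ∀ (n0 : ℤ) (Q : Finset Tile),
    (∀ j, D.SizeLE j Q (fun P => ‖D.co j (f j) P‖) (min (S j) (2 ^ n0 * E j))) → ∀ M : ℕ,
    ∃ Q' ⊆ Q, (∀ j, D.SizeLE j Q' (fun P => ‖D.co j (f j) P‖) (min (S j) (2 ^ (n0 - M) * E j))) ∧
      D.tri f Q ≤ D.tri f Q' + ∑ m ∈ Finset.range M, C / ((2 : ℝ) ^ (n0 - m)) ^ 2 *
        (min (S 0) (2 ^ (n0 - m) * E 0) * min (S 1) (2 ^ (n0 - m) * E 1) *
          min (S 2) (2 ^ (n0 - m) * E 2)) := by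
  obtain ⟨C, hC, hstep⟩ := energy_step
  refine ⟨C, hC, fun D f hf S E hS hE hfE n0 Q hQ M => ?_⟩
  induction M with
  | zero => exact ⟨Q, subset_rfl, by simpa using hQ, by simp⟩
  | succ M ih =>
    obtain ⟨Q1, hQ1, h1, h2⟩ := ih
    obtain ⟨Q', hQ', h3, h4⟩ := hstep D f hf S E hS hE hfE _ (by positivity) Q1 h1
    refine ⟨Q', hQ'.trans hQ1, fun j => ?_, ?_⟩
    · have e : (2 : ℝ) ^ (n0 - ((M + 1 : ℕ) : ℤ)) = 2 ^ (n0 - (M : ℤ)) / 2 := by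
        rw [show n0 - ((M + 1 : ℕ) : ℤ) = (n0 - M) - 1 by push_cast; ring, zpow_sub_one₀ two_ne_zero]
        ring
      rw [e]
      exact h3 j
    · rw [Finset.sum_range_succ]
      linarith

/-- The size-energy estimate. -/
lemma size_energy (θ : Fin 3 → ℝ) (h0 : ∀ j, 0 < θ j) (h1 : ∀ j, θ j < 1)
    (hθ : θ 0 + θ 1 + θ 2 = 1) : ∃ C : ℝ, 0 < C ∧ ∀ (D : Par) (f : Fin 3 → ℝ → ℂ),
    (∀ j, Nice (f j)) → ∀ (S E : Fin 3 → ℝ), (∀ j, 0 < S j) → (∀ j, 0 < E j) →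
    (∀ j, ∫ x, ‖f j x‖ ^ 2 ≤ E j ^ 2) → ∀ (Q : Finset Tile),
    (∀ j, D.SizeLE j Q (fun P => ‖D.co j (f j) P‖) (S j)) →
    D.tri f Q ≤ C * ∏ j, (S j ^ θ j * E j ^ (1 - θ j)) := by
  obtain ⟨C, hC, hit⟩ := energy_iter
  set γ := min (θ 0) (1 - θ 0) with hγ
  have hγ0 : 0 < γ := lt_min (h0 0) (by linarith [h1 0])
  obtain ⟨C', hC', hsum⟩ := sum_two_rpow_abs_le hγ0
  refine ⟨C * C', by positivity, fun D f hf S E hS hE hfE Q hQ => ?_⟩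
  obtain ⟨n0, hn0⟩ : ∃ n0 : ℤ, ∀ j, S j ≤ 2 ^ n0 * E j := by
    obtain ⟨n, hn⟩ := pow_unbounded_of_one_lt (∑ j, S j / E j) (by norm_num : (1 : ℝ) < 2)
    refine ⟨n, fun j => ?_⟩
    have h2 : S j / E j ≤ ∑ j, S j / E j := Finset.single_le_sum (f := fun j => S j / E j)
      (fun j _ => (div_pos (hS j) (hE j)).le) (Finset.mem_univ j)
    rw [← div_le_iff₀ (hE j)]
    simpa using h2.trans hn.le
  set W := ∏ j, (S j ^ θ j * E j ^ (1 - θ j)) with hW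
  have hW0 : 0 ≤ W := Finset.prod_nonneg fun j _ => by
    have := hS j
    have := hE j
    positivity
  have hterm : ∀ n : ℤ, C / ((2 : ℝ) ^ n) ^ 2 * (min (S 0) (2 ^ n * E 0) * min (S 1) (2 ^ n * E 1) *
      min (S 2) (2 ^ n * E 2)) ≤ C * W * 2 ^ (-γ * |n + Real.logb 2 (E 0 / S 0)|) := by
    intro n
    have hn : (0 : ℝ) < 2 ^ n := by positivity
    have hb : ∀ j, 0 < (2 : ℝ) ^ n * E j := fun j => mul_pos hn (hE j)
    have hm : ∀ j, 0 ≤ min (S j) ((2 : ℝ) ^ n * E j) := fun j => le_min (hS j).le (hb j).le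
    have e0 := min_le_two_rpow (h0 0) (h1 0) (hS 0) (hb 0)
    have e : ∀ j, min (S j) ((2 : ℝ) ^ n * E j) ≤ S j ^ θ j * ((2 : ℝ) ^ n * E j) ^ (1 - θ j) := by
      intro j
      refine (min_le_two_rpow (h0 j) (h1 j) (hS j) (hb j)).trans (mul_le_of_le_one_right ?_ ?_)
      · have := hS j
        have := hb j
        positivity
      · refine Real.rpow_le_one_of_one_le_of_nonpos (by norm_num) ?_
        have := abs_nonneg (Real.logb 2 (2 ^ n * E j / S j))
        have : 0 < min (θ j) (1 - θ j) := lt_min (h0 j) (by linarith [h1 j])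
        nlinarith
    have e1 := e 1
    have e2 := e 2
    have hl : Real.logb 2 (2 ^ n * E 0 / S 0) = n + Real.logb 2 (E 0 / S 0) := by
      rw [mul_div_assoc, Real.logb_mul hn.ne' (div_pos (hE 0) (hS 0)).ne', ← Real.rpow_intCast,
        Real.logb_rpow (by norm_num) (by norm_num)]
    rw [hl] at e0
    have hp : ∀ j, 0 ≤ S j ^ θ j * ((2 : ℝ) ^ n * E j) ^ (1 - θ j) := fun j => (hm j).trans (e j)
    calc _ ≤ C / ((2 : ℝ) ^ n) ^ 2 * ((S 0 ^ θ 0 * ((2 : ℝ) ^ n * E 0) ^ (1 - θ 0) *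
          2 ^ (-γ * |n + Real.logb 2 (E 0 / S 0)|)) * (S 1 ^ θ 1 * ((2 : ℝ) ^ n * E 1) ^ (1 - θ 1)) *
          (S 2 ^ θ 2 * ((2 : ℝ) ^ n * E 2) ^ (1 - θ 2))) := by
          gcongr
          · exact hm 2
          · exact mul_nonneg (mul_nonneg (hp 0) (by positivity)) (hp 1)
          · exact hm 1
          · exact mul_nonneg (hp 0) (by positivity)
      _ = _ := by
          have hz : ((2 : ℝ) ^ n) ^ (1 - θ 0) * ((2 : ℝ) ^ n) ^ (1 - θ 1) * ((2 : ℝ) ^ n) ^ (1 - θ 2) =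
              ((2 : ℝ) ^ n) ^ 2 := by
            rw [← Real.rpow_add hn, ← Real.rpow_add hn, ← Real.rpow_natCast]
            congr 1
            push_cast
            linarith
          rw [Real.mul_rpow hn.le (hE 0).le, Real.mul_rpow hn.le (hE 1).le,
            Real.mul_rpow hn.le (hE 2).le, hW, Fin.prod_univ_three]
          rw [div_mul_eq_mul_div, div_eq_iff (by positivity), ← hz]
          ring
  have hM : ∀ M : ℕ, D.tri f Q ≤ (∑ P ∈ Q, D.sc P.1 * (S 0 * S 1 * (E 2 * 2 ^ n0))) * (2⁻¹ : ℝ) ^ M +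
      C * C' * W := by
    intro M
    obtain ⟨Q', hQ', h2, h3⟩ := hit D f hf S E hS hE hfE n0 Q
      (fun j => by rw [min_eq_left (hn0 j)]; exact hQ j) M
    refine h3.trans (add_le_add ?_ ?_)
    · rw [Finset.sum_mul]
      have hc : ∀ P ∈ Q', D.sc P.1 * (‖D.co 0 (f 0) P‖ * ‖D.co 1 (f 1) P‖ * ‖D.co 2 (f 2) P‖) ≤
          D.sc P.1 * (S 0 * S 1 * (E 2 * 2 ^ n0)) * (2⁻¹ : ℝ) ^ M := by
        intro P hP
        have hs := (D.sc_pos P.1).le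
        have c0 := (hQ 0).le (hS 0).le (hQ' hP)
        have c1 := (hQ 1).le (hS 1).le (hQ' hP)
        have c2 := ((h2 2).le (le_min (hS 2).le (by have := hE 2; positivity)) hP).trans
          (min_le_right _ _)
        have e : (2 : ℝ) ^ (n0 - (M : ℤ)) * E 2 = E 2 * 2 ^ n0 * (2⁻¹ : ℝ) ^ M := by
          rw [zpow_sub₀ two_ne_zero, inv_pow, zpow_natCast]
          ring
        rw [e] at c2
        have := hS 0
        have := hS 1
        calc _ ≤ D.sc P.1 * (S 0 * S 1 * (E 2 * 2 ^ n0 * (2⁻¹ : ℝ) ^ M)) := by gcongr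
          _ = _ := by ring
      refine (Finset.sum_le_sum hc).trans ?_
      refine Finset.sum_le_sum_of_subset_of_nonneg hQ' fun P _ _ => ?_
      have := D.sc_pos P.1
      have := hS 0
      have := hS 1
      have := hE 2
      positivity
    · refine (Finset.sum_le_sum fun (m : ℕ) _ => hterm (n0 - (m : ℤ))).trans ?_
      rw [← Finset.mul_sum]
      have hinj : Set.InjOn (fun m : ℕ => n0 - (m : ℤ)) (Finset.range M) := by
        intro a _ b _ h
        simp only at h
        omega
      have h4 := hsum (Real.logb 2 (E 0 / S 0)) ((Finset.range M).image fun m : ℕ => n0 - (m : ℤ))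
      rw [Finset.sum_image hinj] at h4
      calc _ ≤ C * W * C' := by gcongr
        _ = _ := by ring
  have hlim : Filter.Tendsto (fun M : ℕ => (∑ P ∈ Q, D.sc P.1 * (S 0 * S 1 * (E 2 * 2 ^ n0))) *
      (2⁻¹ : ℝ) ^ M + C * C' * W) Filter.atTop (nhds (C * C' * W)) := by
    have := (tendsto_pow_atTop_nhds_zero_of_lt_one (by norm_num : (0 : ℝ) ≤ 2⁻¹) (by norm_num)).const_mul
      (∑ P ∈ Q, D.sc P.1 * (S 0 * S 1 * (E 2 * 2 ^ n0)))
    simpa using this.add_const (C * C' * W)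
  exact ge_of_tendsto' hlim hM

end Par

lemma Nice.integrableOn_norm {f : ℝ → ℂ} (hf : Nice f) (A : Set ℝ) :
    IntegrableOn (fun x => ‖f x‖) A := hf.integrable.norm.integrableOn

lemma br_two_le_sum {s u : ℝ} (hs : 0 < s) {M : ℕ} (hM : |u| ≤ 2 ^ M * s) :
    br 2 s u ≤ ∑ d ∈ Finset.range (M + 1), 4 * (1 / 4 : ℝ) ^ d * (if |u| ≤ 2 ^ d * s then 1 else 0) := by
  induction M with
  | zero =>
    rw [zero_add, Finset.sum_range_one, if_pos hM]
    have := br_le_one 2 hs u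
    norm_num
    linarith
  | succ M ih =>
    by_cases h : |u| ≤ 2 ^ M * s
    · rw [Finset.sum_range_succ]
      have := ih h
      have : (0 : ℝ) ≤ 4 * (1 / 4 : ℝ) ^ (M + 1) * (if |u| ≤ 2 ^ (M + 1) * s then 1 else 0) := by
        split_ifs <;> positivity
      linarith
    · rw [Finset.sum_range_succ, if_pos hM]
      have h0 : 0 ≤ ∑ d ∈ Finset.range (M + 1),
          4 * (1 / 4 : ℝ) ^ d * (if |u| ≤ 2 ^ d * s then 1 else 0) :=
        Finset.sum_nonneg fun d _ => by split_ifs <;> positivity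
      have h1 : br 2 s u ≤ 4 * (1 / 4 : ℝ) ^ (M + 1) * 1 := by
        unfold br
        have e : 4 * (1 / 4 : ℝ) ^ (M + 1) * 1 = ((2 ^ M) ^ 2)⁻¹ := by
          rw [← pow_mul, pow_succ, mul_comm M 2, pow_mul, one_div, inv_pow]
          norm_num
          ring
        rw [e]
        push Not at h
        have : 2 ^ M ≤ |u| / s := by rw [le_div_iff₀ hs]; exact h.le
        gcongr
        linarith
      linarith

lemma integral_mul_br_le {f : ℝ → ℂ} (hf : Nice f) {s y l : ℝ} (hs : 0 < s) (hl : 0 ≤ l)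
    (h : ∀ r, s ≤ r → ∫ x in Metric.closedBall y r, ‖f x‖ ≤ l * r) :
    ∫ x, ‖f x‖ * br 2 s (y - x) ≤ 8 * l * s := by
  obtain ⟨R, hR⟩ := hf.2.2
  obtain ⟨M, hM⟩ : ∃ M : ℕ, (|y| + |R|) / s ≤ 2 ^ M :=
    (pow_unbounded_of_one_lt ((|y| + |R|) / s) one_lt_two).imp fun _ h => h.le
  rw [div_le_iff₀ hs] at hM
  have h1 : ∀ x, ‖f x‖ * br 2 s (y - x) ≤ ∑ d ∈ Finset.range (M + 1), 4 * (1 / 4 : ℝ) ^ d *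
      (Metric.closedBall y (2 ^ d * s)).indicator (fun x => ‖f x‖) x := by
    intro x
    by_cases hx : f x = 0
    · rw [hx, norm_zero, zero_mul]
      exact Finset.sum_nonneg fun d _ => mul_nonneg (by positivity)
        (indicator_nonneg (fun _ _ => norm_nonneg _) _)
    have hxR : |x| ≤ R := by by_contra! h; exact hx (hR x h)
    have h2 := br_two_le_sum hs (M := M) (u := y - x)
      ((abs_sub _ _).trans ((add_le_add le_rfl (hxR.trans (le_abs_self _))).trans hM))
    refine (mul_le_mul_of_nonneg_left h2 (norm_nonneg _)).trans (le_of_eq ?_)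
    rw [Finset.mul_sum]
    refine Finset.sum_congr rfl fun d _ => ?_
    rw [Set.indicator_apply, Metric.mem_closedBall, Real.dist_eq, abs_sub_comm]
    split_ifs <;> ring
  have hi : ∀ d : ℕ, Integrable fun x => 4 * (1 / 4 : ℝ) ^ d *
      (Metric.closedBall y (2 ^ d * s)).indicator (fun x => ‖f x‖) x := fun d =>
    (hf.integrable.norm.indicator Metric.isClosed_closedBall.measurableSet).const_mul _
  refine (integral_mono_of_nonneg (ae_of_all _ fun x => mul_nonneg (norm_nonneg _)
    (br_nonneg _ hs _)) (integrable_finsetSum _ fun d _ => hi d) (ae_of_all _ h1)).trans ?_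
  rw [integral_finsetSum _ fun d _ => hi d]
  have h3 : ∀ d ∈ Finset.range (M + 1), ∫ x, 4 * (1 / 4 : ℝ) ^ d *
      (Metric.closedBall y (2 ^ d * s)).indicator (fun x => ‖f x‖) x ≤ 4 * l * s * (1 / 2) ^ d := by
    intro d _
    rw [integral_const_mul, integral_indicator Metric.isClosed_closedBall.measurableSet]
    have h4 := h (2 ^ d * s) (le_mul_of_one_le_left hs.le (one_le_pow₀ one_le_two))
    refine (mul_le_mul_of_nonneg_left h4 (by positivity)).trans (le_of_eq ?_)
    have : (1 / 2 : ℝ) ^ d = (1 / 4) ^ d * 2 ^ d := by rw [← mul_pow]; norm_num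
    rw [this]; ring
  refine (Finset.sum_le_sum h3).trans ?_
  rw [← Finset.mul_sum]
  have h5 : ∑ d ∈ Finset.range (M + 1), (1 / 2 : ℝ) ^ d ≤ 2 := sum_geometric_two_le _
  calc _ ≤ 4 * l * s * 2 := by gcongr
    _ = _ := by ring

/-- Density of `f` at the tiles of `Q`. -/
def Par.Dens (D : Par) (f : ℝ → ℂ) (Q : Finset Tile) (l : ℝ) : Prop :=
  ∀ P ∈ Q, ∀ r, D.sc P.1 ≤ r → ∫ x in Metric.closedBall (D.yy P) r, ‖f x‖ ≤ l * r

lemma Par.Dens.of_norm_le {D : Par} {f g : ℝ → ℂ} {Q : Finset Tile} {l : ℝ} (h : D.Dens f Q l)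
    (hf : Nice f) (hg : ∀ x, ‖g x‖ ≤ ‖f x‖) : D.Dens g Q l := fun P hP r hr =>
  (integral_mono_of_nonneg (ae_of_all _ fun _ => norm_nonneg _) (hf.integrableOn_norm _)
    (ae_of_all _ hg)).trans (h P hP r hr)

lemma Par.Dens.mono {D : Par} {f : ℝ → ℂ} {Q Q' : Finset Tile} {l : ℝ} (h : D.Dens f Q l)
    (hQ : Q' ⊆ Q) : D.Dens f Q' l := fun P hP => h P (hQ hP)

/-- Pointwise bound for coefficients. -/
lemma co_le (N : ℕ) : ∃ C : ℝ, 0 < C ∧ ∀ (D : Par) (j : Fin 3) (f : ℝ → ℂ), Nice f →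
    ∀ (l : ℝ), 0 ≤ l → ∀ Q : Finset Tile, D.Dens f Q l → ∀ P ∈ Q, ∀ d : ℝ, 0 ≤ d →
    (∀ x, |D.yy P - x| < d → f x = 0) → ‖D.co j f P‖ ≤ C * l * br N (D.sc P.1) d := by
  obtain ⟨C, hC, h⟩ := pk_bound (N + 2)
  refine ⟨8 * C, by positivity, fun D j f hf l hl Q hQ P hP d hd h0 => ?_⟩
  have hs := D.sc_pos P.1
  set s := D.sc P.1 with hs'
  have h1 : ∀ x, ‖f x * pk s (D.fr j P) (D.yy P) x‖ ≤
      (C * s⁻¹ * br N s d) * (‖f x‖ * br 2 s (D.yy P - x)) := by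
    intro x
    by_cases hx : f x = 0
    · simp [hx]
    have hx2 : d ≤ |D.yy P - x| := by by_contra! hh; exact hx (h0 x hh)
    rw [norm_mul]
    refine (mul_le_mul_of_nonneg_left (h s _ _ x hs) (norm_nonneg _)).trans ?_
    rw [br_add]
    have h2 : br N s (D.yy P - x) ≤ br N s d := br_anti N hs (by rwa [abs_of_nonneg hd])
    have := br_nonneg 2 hs (D.yy P - x)
    calc _ = (C * s⁻¹) * (‖f x‖ * br 2 s (D.yy P - x)) * br N s (D.yy P - x) := by ring
      _ ≤ (C * s⁻¹) * (‖f x‖ * br 2 s (D.yy P - x)) * br N s d := by gcongr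
      _ = _ := by ring
  have hInt : Integrable fun x => ‖f x‖ * br 2 s (D.yy P - x) := by
    obtain ⟨B, hB⟩ := hf.2.1
    refine hf.integrable_of_bound (hf.1.norm.mul
      ((br_continuous 2 hs).comp (continuous_const.sub continuous_id)).measurable) (B := B)
      (fun x => ?_) (fun x hx => by simp [hx])
    rw [abs_of_nonneg (mul_nonneg (norm_nonneg _) (br_nonneg _ hs _))]
    exact (mul_le_of_le_one_right (norm_nonneg _) (br_le_one _ hs _)).trans (hB x)
  refine (norm_integral_le_of_norm_le (hInt.const_mul _) (ae_of_all _ h1)).trans ?_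
  rw [integral_const_mul]
  have h3 := integral_mul_br_le hf hs hl (hQ P hP)
  have := br_nonneg N hs d
  calc _ ≤ (C * s⁻¹ * br N s d) * (8 * l * s) := by gcongr
    _ = _ := by field_simp

namespace Par

/-- Summation over a tree of quantities that decay geometrically at each point. -/
lemma tree_sum_geom (D : Par) (i : Fin 3) (T : Top) (Q : Finset Tile) (hQ : ∀ P ∈ Q, D.inTree i T P)
    (w : Tile → ℝ) {A B : ℝ} (hA : 0 ≤ A) (hB : 0 ≤ B)
    (h : ∀ x ∈ D.dy T.1 T.2.1, ∃ d : ℝ, ∀ P ∈ Q, x ∈ D.dy P.1 P.2.1 →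
      D.sc P.1 ≤ A * d ∧ w P * d ≤ B * D.sc P.1) :
    ∑ P ∈ Q, D.sc P.1 * w P ≤ 42 * A * B * D.sc T.1 := by
  have e : ∀ P ∈ Q, D.sc P.1 * w P =
      ∫ x in D.dy T.1 T.2.1, (D.dy P.1 P.2.1).indicator (fun _ => w P) x := by
    intro P hP
    rw [setIntegral_indicator (D.measurableSet_dy _ _), inter_eq_right.2 (hQ P hP).dy_subset,
      setIntegral_const, D.measureReal_dy, smul_eq_mul]
  have hfin : volume (D.dy T.1 T.2.1) ≠ ⊤ := by rw [D.volume_dy]; exact ENNReal.ofReal_ne_top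
  have hInt : ∀ P ∈ Q, IntegrableOn ((D.dy P.1 P.2.1).indicator (fun _ => w P))
      (D.dy T.1 T.2.1) := fun P _ =>
    (integrableOn_const hfin).indicator (D.measurableSet_dy _ _)
  rw [Finset.sum_congr rfl e, ← integral_finsetSum _ hInt]
  have hp : ∀ x ∈ D.dy T.1 T.2.1,
      ∑ P ∈ Q, (D.dy P.1 P.2.1).indicator (fun _ => w P) x ≤ 42 * A * B := by
    intro x hx
    obtain ⟨d, hd⟩ := h x hx
    have e2 : ∑ P ∈ Q, (D.dy P.1 P.2.1).indicator (fun _ => w P) x =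
        ∑ P ∈ Q with x ∈ D.dy P.1 P.2.1, w P := by
      rw [Finset.sum_filter]
      exact Finset.sum_congr rfl fun P _ => by rw [Set.indicator_apply]
    rw [e2]
    set Q' := Q.filter fun P => x ∈ D.dy P.1 P.2.1 with hQ'
    have hQ'2 : ∀ P ∈ Q', P ∈ Q ∧ x ∈ D.dy P.1 P.2.1 := fun P hP => Finset.mem_filter.1 hP
    rcases Q'.eq_empty_or_nonempty with h0 | ⟨P0, hP0⟩
    · rw [h0, Finset.sum_empty]; positivity
    have hdpos : 0 < d := by
      have h1 := (hd P0 (hQ'2 P0 hP0).1 (hQ'2 P0 hP0).2).1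
      have := D.sc_pos P0.1
      by_contra! h2
      have := mul_nonpos_of_nonneg_of_nonpos hA h2
      linarith
    have h2 : ∀ P ∈ Q', w P ≤ B / d * D.sc (P.1, P.2.1).1 := by
      intro P hP
      have := (hd P (hQ'2 P hP).1 (hQ'2 P hP).2).2
      rw [div_mul_eq_mul_div, le_div_iff₀ hdpos]
      exact this
    refine (Finset.sum_le_sum h2).trans ?_
    have h3 := D.sum_tiles_le i 10 Q' (fun _ _ => D.a i * T.2.2)
      (fun P hP => by exact_mod_cast (hQ P (hQ'2 P hP).1).2.2)
      (fun p => B / d * D.sc p.1) (fun p => mul_nonneg (by positivity) (D.sc_pos _).le)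
    refine h3.trans ?_
    set Z := Q'.image fun P => (P.1, P.2.1) with hZ
    have hZ2 : ∀ p ∈ Z, x ∈ D.dy p.1 p.2 ∧ D.sc p.1 ≤ A * d := by
      intro p hp
      obtain ⟨P, hP, rfl⟩ := Finset.mem_image.1 hp
      exact ⟨(hQ'2 P hP).2, (hd P (hQ'2 P hP).1 (hQ'2 P hP).2).1⟩
    have hinj : Set.InjOn (fun p : ℤ × ℤ => p.1) Z := by
      rintro ⟨k, n⟩ h1 ⟨k', n'⟩ h2 h3
      simp only at h3
      subst h3
      have h4 := (D.mem_dy_iff _ _ _).1 (hZ2 _ h1).1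
      have h5 := (D.mem_dy_iff _ _ _).1 (hZ2 _ h2).1
      simp only at h4 h5
      rw [← h4, h5]
    rw [← Finset.mul_sum, ← Finset.sum_image (f := fun k => D.sc k) hinj]
    have hne : (Z.image fun p => p.1).Nonempty :=
      ⟨P0.1, Finset.mem_image.2 ⟨(P0.1, P0.2.1), Finset.mem_image_of_mem _ hP0, rfl⟩⟩
    have h4 := D.sum_sc_le (Z.image fun p => p.1) ((Z.image fun p => p.1).max' hne)
      (fun k hk => Finset.le_max' _ k hk)
    obtain ⟨p, hp, hp2⟩ := Finset.mem_image.1 (Finset.max'_mem _ hne)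
    have h5 : ∑ k ∈ Z.image fun p => p.1, D.sc k ≤ 2 * (A * d) := by
      refine h4.trans ?_
      rw [← hp2]
      have := (hZ2 p hp).2
      linarith
    calc _ ≤ (2 * ((10 : ℕ) : ℝ) + 1) * (B / d * (2 * (A * d))) := by gcongr
      _ = 42 * A * B := by field_simp; push_cast; ring
  calc _ ≤ ∫ x in D.dy T.1 T.2.1, (42 * A * B : ℝ) :=
        setIntegral_mono_on (integrable_finsetSum _ hInt) (integrableOn_const hfin)
          (D.measurableSet_dy _ _) hp
    _ = _ := by rw [setIntegral_const, D.measureReal_dy, smul_eq_mul]; ring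

end Par

lemma br_mul_dist_le {s d : ℝ} (hs : 0 < s) (hd : 0 ≤ d) : br 1 s d * d ≤ s := by
  unfold br
  rw [abs_of_nonneg hd, pow_one, inv_mul_le_iff₀ (by positivity)]
  have : (1 + d / s) * s = s + d := by field_simp
  linarith

/-- Trees whose time intervals are far away from the support. -/
lemma tree_vanish (N : ℕ) : ∃ C : ℝ, 0 < C ∧ ∀ (D : Par) (j i : Fin 3) (T : Top) (f : ℝ → ℂ), Nice f →
    ∀ (l : ℝ), 0 ≤ l → ∀ Q : Finset Tile, D.Dens f Q l → (∀ P ∈ Q, D.inTree i T P) →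
    ∀ e : ℕ, 1 ≤ e → (∀ P ∈ Q, ∀ x, |D.yy P - x| < 2 ^ e * D.sc P.1 → f x = 0) →
    ∑ P ∈ Q, D.sc P.1 * ‖D.co j f P‖ ^ 2 ≤ C * (l / 2 ^ (N * e)) ^ 2 * D.sc T.1 := by
  obtain ⟨C, hC, hco⟩ := co_le (N + 1)
  refine ⟨84 * C ^ 2, by positivity, fun D j i T f hf l hl Q hQ hT e he h0 => ?_⟩
  rcases (Function.support f).eq_empty_or_nonempty with hemp | hne
  · have : f = 0 := by rwa [Function.support_eq_empty_iff] at hemp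
    have h1 : ∀ P, D.co j f P = 0 := by intro P; simp [Par.co, this]
    simp only [h1, norm_zero, ne_eq, OfNat.ofNat_ne_zero, not_false_eq_true, zero_pow, mul_zero,
      Finset.sum_const_zero]
    have := D.sc_pos T.1
    positivity
  set δ : ℝ → ℝ := fun x => Metric.infDist x (Function.support f) with hδ
  have hδ0 : ∀ x, 0 ≤ δ x := fun x => Metric.infDist_nonneg
  have hvan : ∀ y x, |y - x| < δ y → f x = 0 := by
    intro y x h
    by_contra hx
    have := Metric.infDist_le_dist_of_mem (x := y) (show x ∈ Function.support f from hx)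
    rw [Real.dist_eq] at this
    exact absurd h (not_lt.2 this)
  have hbig : ∀ P ∈ Q, 2 ^ e * D.sc P.1 ≤ δ (D.yy P) := by
    intro P hP
    refine (Metric.le_infDist hne).2 fun x hx => ?_
    rw [Real.dist_eq]
    by_contra! h
    exact hx (h0 P hP x h)
  have key := D.tree_sum_geom i T Q hT (fun P => ‖D.co j f P‖ ^ 2) (A := 1)
    (B := 2 * (C * l / 2 ^ (N * e)) ^ 2) zero_le_one (by positivity) ?_
  · refine key.trans (le_of_eq ?_); ring
  intro x _
  refine ⟨δ x, fun P hP hxP => ?_⟩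
  have hs := D.sc_pos P.1
  have h1 := hbig P hP
  have h2 : |x - D.yy P| ≤ D.sc P.1 := (D.abs_sub_lt_of_mem_dy hxP (D.yy_mem_dy P)).le
  have h3 : δ (D.yy P) ≤ δ x + |x - D.yy P| := by
    have := Metric.infDist_le_infDist_add_dist (s := Function.support f) (x := D.yy P) (y := x)
    rwa [dist_comm, Real.dist_eq] at this
  have h4 : δ x ≤ δ (D.yy P) + |x - D.yy P| := by
    have := Metric.infDist_le_infDist_add_dist (s := Function.support f) (x := x) (y := D.yy P)
    rwa [Real.dist_eq] at this
  have h5 : (2 : ℝ) ≤ 2 ^ e := by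
    calc (2 : ℝ) = 2 ^ 1 := by norm_num
      _ ≤ _ := pow_le_pow_right₀ one_le_two he
  have h6 : 2 * D.sc P.1 ≤ δ (D.yy P) := (mul_le_mul_of_nonneg_right h5 hs.le).trans h1
  refine ⟨by linarith, ?_⟩
  set d := δ (D.yy P) with hd
  have hd0 : 0 ≤ d := hδ0 _
  have h7 := hco D j f hf l hl Q hQ P hP d hd0 (hvan _)
  rw [br_add] at h7
  set s := D.sc P.1 with hs'
  have h8 : br N s d ≤ (2 ^ (N * e))⁻¹ := by
    unfold br
    rw [abs_of_nonneg hd0, mul_comm N e, pow_mul]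
    have : 2 ^ e ≤ d / s := by rwa [le_div_iff₀ hs]
    gcongr
    linarith
  have hb1 := br_nonneg 1 hs d
  have hbN := br_nonneg N hs d
  have hb1' := br_le_one 1 hs d
  have h9 : ‖D.co j f P‖ ≤ C * l / 2 ^ (N * e) * br 1 s d := by
    refine h7.trans ?_
    rw [div_eq_mul_inv, ← mul_assoc]
    gcongr
  have h10 : ‖D.co j f P‖ ^ 2 ≤ (C * l / 2 ^ (N * e)) ^ 2 * br 1 s d := by
    refine (pow_le_pow_left₀ (norm_nonneg _) h9 2).trans ?_
    rw [mul_pow]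
    gcongr
    nlinarith
  have h11 : br 1 s d * δ x ≤ 2 * s := by
    have := br_mul_dist_le hs hd0
    have h12 : δ x ≤ 2 * d := by linarith
    nlinarith
  calc _ ≤ (C * l / 2 ^ (N * e)) ^ 2 * br 1 s d * δ x := by
        gcongr
        exact hδ0 x
    _ = (C * l / 2 ^ (N * e)) ^ 2 * (br 1 s d * δ x) := by ring
    _ ≤ (C * l / 2 ^ (N * e)) ^ 2 * (2 * s) := by gcongr
    _ = _ := by ring

/-- The contribution of the part of the function away from the top interval. -/
lemma tree_far : ∃ C : ℝ, 0 < C ∧ ∀ (D : Par) (j i : Fin 3) (T : Top) (f : ℝ → ℂ), Nice f →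
    ∀ (l : ℝ), 0 ≤ l → ∀ Q : Finset Tile, D.Dens f Q l → (∀ P ∈ Q, D.inTree i T P) →
    (∀ x, |x - D.yv T.1 T.2.1| ≤ 2 * D.sc T.1 → f x = 0) →
    ∑ P ∈ Q, D.sc P.1 * ‖D.co j f P‖ ^ 2 ≤ C * l ^ 2 * D.sc T.1 := by
  obtain ⟨C, hC, hco⟩ := co_le 1
  refine ⟨42 * C ^ 2, by positivity, fun D j i T f hf l hl Q hQ hT h0 => ?_⟩
  have key := D.tree_sum_geom i T Q hT (fun P => ‖D.co j f P‖ ^ 2) (A := 1)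
    (B := (C * l) ^ 2) zero_le_one (by positivity) ?_
  · refine key.trans (le_of_eq ?_); ring
  intro x _
  refine ⟨D.sc T.1, fun P hP hxP => ⟨by rw [one_mul]; exact D.sc_mono (hT P hP).1, ?_⟩⟩
  have hs := D.sc_pos P.1
  have hK := D.sc_pos T.1
  have h1 : |D.yy P - D.yv T.1 T.2.1| < D.sc T.1 :=
    D.abs_sub_lt_of_mem_dy (hT P hP).2.1 (D.yv_mem_dy _ _)
  have h7 := hco D j f hf l hl Q hQ P hP (D.sc T.1) hK.le (fun z hz => by
    apply h0
    have := abs_sub_le z (D.yy P) (D.yv T.1 T.2.1)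
    rw [abs_sub_comm z (D.yy P)] at this
    linarith)
  have hb := br_nonneg 1 hs (D.sc T.1)
  have hb1 := br_le_one 1 hs (D.sc T.1)
  have hb2 := br_mul_dist_le hs hK.le
  have h10 : ‖D.co j f P‖ ^ 2 ≤ (C * l) ^ 2 * br 1 (D.sc P.1) (D.sc T.1) := by
    refine (pow_le_pow_left₀ (norm_nonneg _) h7 2).trans ?_
    rw [mul_pow]
    gcongr
    nlinarith
  calc _ ≤ (C * l) ^ 2 * br 1 (D.sc P.1) (D.sc T.1) * D.sc T.1 := by gcongr
    _ = (C * l) ^ 2 * (br 1 (D.sc P.1) (D.sc T.1) * D.sc T.1) := by ring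
    _ ≤ _ := by gcongr

/-- Normalised averaging kernel at variable scale `ρ`. -/
noncomputable def avk (ρ : ℝ → ℝ) (z x : ℝ) : ℝ := if |x - z| < ρ z / 4 then 2 / ρ z else 0

lemma avk_eq (ρ : ℝ → ℝ) (z : ℝ) :
    avk ρ z = (Ioo (z - ρ z / 4) (z + ρ z / 4)).indicator fun _ => 2 / ρ z := by
  ext x
  unfold avk
  rw [Set.indicator_apply]
  refine if_congr ?_ rfl rfl
  rw [mem_Ioo, abs_lt]
  constructor <;> rintro ⟨h1, h2⟩ <;> constructor <;> linarith

lemma avk_nonneg {ρ : ℝ → ℝ} {z : ℝ} (h : 0 < ρ z) (x : ℝ) : 0 ≤ avk ρ z x := by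
  unfold avk; split_ifs <;> positivity

lemma avk_integrable (ρ : ℝ → ℝ) (z : ℝ) : Integrable (avk ρ z) := by
  rw [avk_eq, integrable_indicator_iff measurableSet_Ioo]
  exact integrableOn_const (by simp)

lemma avk_integral {ρ : ℝ → ℝ} {z : ℝ} (h : 0 < ρ z) : ∫ x, avk ρ z x = 1 := by
  rw [avk_eq, integral_indicator measurableSet_Ioo, setIntegral_const, measureReal_def,
    Real.volume_Ioo, ENNReal.toReal_ofReal (by linarith), smul_eq_mul]
  field_simp
  ring

lemma avk_measurable {ρ : ℝ → ℝ} (h : Continuous ρ) : Measurable fun p : ℝ × ℝ => avk ρ p.1 p.2 := by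
  unfold avk
  refine Measurable.ite (measurableSet_lt ?_ ?_) ?_ measurable_const
  · fun_prop
  · fun_prop
  · have := h.measurable
    fun_prop

lemma avk_prod_integrable {f b : ℝ → ℂ} (hf : Nice f) {ρ : ℝ → ℝ} (hρ : Continuous ρ)
    (h0 : ∀ z, 0 < ρ z) (hb : Measurable b) {B : ℝ} (hB : ∀ x, ‖b x‖ ≤ B) :
    Integrable (fun p : ℝ × ℝ => f p.1 * (avk ρ p.1 p.2 * b p.2)) (volume.prod volume) := by
  have hm : Measurable fun p : ℝ × ℝ => f p.1 * (avk ρ p.1 p.2 * b p.2) :=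
    (hf.1.comp measurable_fst).mul
      ((Complex.measurable_ofReal.comp (avk_measurable hρ)).mul (hb.comp measurable_snd))
  have hz : ∀ z, Integrable fun x => f z * (avk ρ z x * b x) := fun z =>
    ((avk_integrable ρ z).ofReal.mul_bdd hb.aestronglyMeasurable (ae_of_all _ hB)).const_mul _
  rw [integrable_prod_iff hm.aestronglyMeasurable]
  refine ⟨ae_of_all _ hz, ?_⟩
  refine (hf.integrable.norm.mul_const B).mono'
    hm.norm.stronglyMeasurable.integral_prod_right.aestronglyMeasurable (ae_of_all _ fun z => ?_)
  rw [Real.norm_of_nonneg (integral_nonneg fun x => norm_nonneg _)]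
  have h1 : ∀ x, ‖f z * (avk ρ z x * b x)‖ ≤ ‖f z‖ * B * avk ρ z x := by
    intro x
    have := avk_nonneg (h0 z) x
    rw [norm_mul, norm_mul, Complex.norm_real, Real.norm_of_nonneg this, mul_assoc]
    have := mul_le_mul_of_nonneg_left (hB x) this
    exact mul_le_mul_of_nonneg_left (by linarith) (norm_nonneg _)
  refine (integral_mono (hz z).norm ((avk_integrable ρ z).const_mul _) h1).trans (le_of_eq ?_)
  rw [integral_const_mul, avk_integral (h0 z), mul_one]

lemma norm_exp_real_mul_I (a : ℝ) : ‖Complex.exp ((a : ℂ) * Complex.I)‖ = 1 :=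
  Complex.norm_exp_ofReal_mul_I a

/-- The variable-scale average of `f` after modulation by `w`. -/
noncomputable def avf (ρ : ℝ → ℝ) (w : ℝ) (f : ℝ → ℂ) (x : ℝ) : ℂ :=
  Complex.exp ((2 * π * w * x : ℝ) * Complex.I) *
    ∫ z, f z * Complex.exp ((-(2 * π * w * z) : ℝ) * Complex.I) * avk ρ z x

lemma measurable_exp_real (w : ℝ) : Measurable fun x : ℝ =>
    Complex.exp ((2 * π * w * x : ℝ) * Complex.I) := by fun_prop

lemma Nice.modulate {f : ℝ → ℂ} (hf : Nice f) (w : ℝ) :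
    Nice fun z => f z * Complex.exp ((-(2 * π * w * z) : ℝ) * Complex.I) :=
  hf.mul (B := 1) (by fun_prop) (fun z => (norm_exp_real_mul_I _).le)

lemma avf_measurable {f : ℝ → ℂ} (hf : Nice f) {ρ : ℝ → ℝ} (hρ : Continuous ρ) (w : ℝ) :
    Measurable (avf ρ w f) := by
  have hm : Measurable fun p : ℝ × ℝ =>
      f p.2 * Complex.exp ((-(2 * π * w * p.2) : ℝ) * Complex.I) * avk ρ p.2 p.1 :=
    ((hf.modulate w).1.comp measurable_snd).mul
      (Complex.measurable_ofReal.comp ((avk_measurable hρ).comp measurable_swap))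
  exact (measurable_exp_real w).mul hm.stronglyMeasurable.integral_prod_right.measurable

lemma avf_error (R : ℝ) (hR : 0 ≤ R) : ∃ C : ℝ, 0 < C ∧ ∀ (f : ℝ → ℂ), Nice f → ∀ (ρ : ℝ → ℝ),
    Continuous ρ → (∀ z, 0 < ρ z) → ∀ w t ξ y : ℝ, 0 < t → |ξ - w| ≤ R / t →
    (∀ z, ρ z ≤ |z - y| + t) →
    ‖(∫ x, f x * pk t ξ y x) - ∫ x, avf ρ w f x * pk t ξ y x‖ ≤
      C * ∫ z, ‖f z‖ * (t⁻¹ * t⁻¹ * ρ z * br 4 t (y - z)) := by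
  obtain ⟨C, hC, hlip⟩ := pk_lipschitz 4 R hR
  refine ⟨C, by positivity, fun f hf ρ hρ h0 w t ξ y ht hw hρy => ?_⟩
  set E : ℝ → ℂ := fun x => Complex.exp ((2 * π * w * x : ℝ) * Complex.I) with hE
  set W : ℝ → ℂ := fun z => f z * Complex.exp ((-(2 * π * w * z) : ℝ) * Complex.I) with hW
  set b : ℝ → ℂ := fun x => pk t ξ y x * E x with hb
  have hWE : ∀ z, W z * E z = f z := by
    intro z
    simp only [hW, hE]
    rw [mul_assoc, ← Complex.exp_add]
    have : (↑(-(2 * π * w * z)) * Complex.I + ↑(2 * π * w * z) * Complex.I : ℂ) = 0 := by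
      push_cast; ring
    rw [this, Complex.exp_zero, mul_one]
  have hWn : ∀ z, ‖W z‖ = ‖f z‖ := by
    intro z; simp only [hW, norm_mul, norm_exp_real_mul_I, mul_one]
  obtain ⟨B, hB⟩ := pk_bound_bounded ht ξ y
  have hbm : Measurable b := (pk_continuous ht ξ y).measurable.mul (measurable_exp_real w)
  have hbB : ∀ x, ‖b x‖ ≤ B := by
    intro x; simp only [hb, hE, norm_mul, norm_exp_real_mul_I, mul_one]; exact hB x
  have hWnice : Nice W := hf.modulate w
  have hprod := avk_prod_integrable hWnice hρ h0 hbm hbB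
  have e1 : ∫ x, avf ρ w f x * pk t ξ y x = ∫ z, ∫ x, W z * (avk ρ z x * b x) := by
    rw [integral_integral_swap hprod]
    refine integral_congr_ae (ae_of_all _ fun x => ?_)
    simp only [avf]
    rw [mul_comm, ← mul_assoc, mul_comm, ← integral_mul_const]
    refine integral_congr_ae (ae_of_all _ fun z => ?_)
    simp only [hb, hW, hE]
    ring
  have hi1 : Integrable fun z => W z * b z := by
    have := hWnice.mul hbm hbB
    exact this.integrable
  have e2 : ∫ x, f x * pk t ξ y x = ∫ z, W z * b z := by
    refine integral_congr_ae (ae_of_all _ fun z => ?_)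
    simp only [hb]
    rw [mul_comm (pk t ξ y z), ← mul_assoc, hWE]
  have hi2 : Integrable fun z => ∫ x, W z * (avk ρ z x * b x) := hprod.integral_prod_left
  rw [e1, e2, ← integral_sub hi1 hi2]
  have hbr : ∀ z, ∀ u, |u - z| ≤ ρ z / 4 → br 4 t (y - u) ≤ 4 * br 4 t (y - z) := by
    intro z u hu
    have h1 := hρy z
    have h2 : |y - z| ≤ |y - u| + |u - z| := abs_sub_le _ _ _
    rw [abs_sub_comm z y] at h1
    unfold br
    rw [← div_eq_mul_inv, le_div_iff₀ (by positivity), inv_mul_le_iff₀ (by positivity)]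
    have h3 : 3 / 4 * (1 + |y - z| / t) ≤ 1 + |y - u| / t := by
      have : |y - z| / t ≤ |y - u| / t + (|y - z| / t + 1) / 4 := by
        have e : |y - u| / t + (|y - z| / t + 1) / 4 = (|y - u| + (|y - z| + t) / 4) / t := by
          field_simp
        rw [e]
        gcongr
        linarith
      linarith
    have h4 := pow_le_pow_left₀ (by positivity) h3 4
    rw [mul_pow] at h4
    have : 0 ≤ (1 + |y - z| / t) ^ 4 := by positivity
    nlinarith
  rw [← integral_const_mul]
  refine norm_integral_le_of_norm_le ?_ (ae_of_all _ fun z => ?_)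
  · refine Integrable.const_mul ?_ C
    obtain ⟨Bf, hBf⟩ := hf.2.1
    refine hf.integrable_of_bound (B := Bf * (t⁻¹ * 1)) ?_ (fun x => ?_) (fun x hx => by simp [hx])
    · have := hρ.measurable
      have h2 := (br_continuous 4 ht).measurable
      have h3 := hf.1
      fun_prop
    · have hx := hρy x
      have h2 := br_nonneg 4 ht (y - x)
      have h1 : ρ x * br 4 t (y - x) ≤ t := by
        have e : ρ x ≤ t * (1 + |y - x| / t) := by
          rw [mul_add, mul_div_cancel₀ _ ht.ne', abs_sub_comm]; linarith
        have e3 := br_nonneg 3 ht (y - x)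
        have e4 := br_le_one 3 ht (y - x)
        have e5 : (1 + |y - x| / t) * br 4 t (y - x) = br 3 t (y - x) := by
          have : (1 + |y - x| / t) ≠ 0 := by positivity
          unfold br; field_simp
        calc _ ≤ t * (1 + |y - x| / t) * br 4 t (y - x) := by gcongr
          _ = t * br 3 t (y - x) := by rw [mul_assoc, e5]
          _ ≤ t * 1 := by gcongr
          _ = t := mul_one t
      have := h0 x
      rw [abs_of_nonneg (by positivity)]
      have hB0 := (norm_nonneg (f x)).trans (hBf x)
      refine mul_le_mul (hBf x) ?_ (by positivity) hB0
      calc _ = t⁻¹ * (t⁻¹ * (ρ x * br 4 t (y - x))) := by ring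
        _ ≤ t⁻¹ * (t⁻¹ * t) := by gcongr
        _ = _ := by field_simp
  · have e3 : ∫ x, W z * (avk ρ z x * b x) = W z * ∫ x, avk ρ z x * b x := integral_const_mul _ _
    have e4 : b z = ∫ x, avk ρ z x * b z := by
      rw [integral_mul_const, integral_complex_ofReal, avk_integral (h0 z)]; simp
    have i1 : Integrable fun x => (avk ρ z x : ℂ) * b z := (avk_integrable ρ z).ofReal.mul_const _
    have i2 : Integrable fun x => (avk ρ z x : ℂ) * b x :=
      (avk_integrable ρ z).ofReal.mul_bdd hbm.aestronglyMeasurable (ae_of_all _ hbB)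
    rw [e3, ← mul_sub, norm_mul, hWn]
    nth_rewrite 1 [e4]
    rw [← integral_sub i1 i2]
    have hz := h0 z
    have h5 : ‖∫ x, ((avk ρ z x : ℂ) * b z - avk ρ z x * b x)‖ ≤
        ∫ x, (C * (t⁻¹ * t⁻¹ * (4 * br 4 t (y - z))) * (ρ z / 4)) * avk ρ z x := by
      refine norm_integral_le_of_norm_le ((avk_integrable ρ z).const_mul _) (ae_of_all _ fun x => ?_)
      have h6 := avk_nonneg hz x
      rw [← mul_sub, norm_mul, Complex.norm_real, Real.norm_of_nonneg h6, mul_comm]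
      by_cases hx : |x - z| < ρ z / 4
      · refine mul_le_mul_of_nonneg_right ?_ h6
        rw [norm_sub_rev]
        refine (hlip t ξ w y x z (4 * br 4 t (y - z)) ht hw fun u hu => hbr z u ?_).trans ?_
        · refine le_trans ?_ hx.le
          rw [abs_sub_comm x z, abs_sub_comm u z]
          have := Set.abs_sub_left_of_mem_uIcc (uIcc_comm x z ▸ hu)
          rw [abs_sub_comm]
          rwa [abs_sub_comm z x]
        · have := br_nonneg 4 ht (y - z)
          gcongr
      · have : avk ρ z x = 0 := if_neg hx
        rw [this]; simp
    rw [integral_const_mul, avk_integral hz] at h5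
    calc _ ≤ ‖f z‖ * (C * (t⁻¹ * t⁻¹ * (4 * br 4 t (y - z))) * (ρ z / 4) * 1) := by gcongr
      _ = _ := by ring

lemma mul_br_two_le {r s u : ℝ} (hs : 0 < s) (hr : 0 < r) (h : r ≤ |u| + s) :
    r / s * br 2 s u ≤ min (r / s) (s / r) := by
  refine le_min (mul_le_of_le_one_right (by positivity) (br_le_one 2 hs u)) ?_
  unfold br
  rw [← div_eq_mul_inv, div_le_iff₀ (by positivity)]
  have h1 : r / s ≤ 1 + |u| / s := by
    rw [div_le_iff₀ hs, add_mul, div_mul_cancel₀ _ hs.ne']; linarith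
  have h2 := pow_le_pow_left₀ (by positivity) h1 2
  calc r / s = s / r * (r / s) ^ 2 := by field_simp
    _ ≤ _ := by gcongr

/-- Summation over the tiles of a tree at a fixed point. -/
lemma tree_point_sum : ∃ C : ℝ, 0 < C ∧ ∀ (D : Par) (i : Fin 3) (T : Top) (Q : Finset Tile),
    (∀ P ∈ Q, D.inTree i T P) → ∀ z r : ℝ, 0 < r → (∀ P ∈ Q, r ≤ |z - D.yy P| + D.sc P.1) →
    ∑ P ∈ Q, r / D.sc P.1 * br 4 (D.sc P.1) (D.yy P - z) ≤ C := by
  obtain ⟨C, hC, hγ⟩ := sum_two_rpow_abs_le one_pos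
  have hI := I0_nonneg
  refine ⟨21 * (4 * I0 * C) + 1, by positivity, fun D i T Q hT z r hr hz => ?_⟩
  set m : ℤ → ℝ := fun k => min (r / D.sc k) (D.sc k / r) with hm
  have hm0 : ∀ k, 0 ≤ m k := fun k => by
    have := D.sc_pos k
    exact le_min (by positivity) (by positivity)
  obtain ⟨v, hv⟩ : ∃ v : ℤ × ℤ → ℝ, ∀ k n, v (k, n) = m k * br 2 (D.sc k) (z - D.yv k n) :=
    ⟨fun p => m p.1 * br 2 (D.sc p.1) (z - D.yv p.1 p.2), fun _ _ => rfl⟩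
  have hv0 : ∀ p, 0 ≤ v p := by
    rintro ⟨k, n⟩
    rw [hv]
    exact mul_nonneg (hm0 _) (br_nonneg _ (D.sc_pos _) _)
  have h1 : ∀ P ∈ Q, r / D.sc P.1 * br 4 (D.sc P.1) (D.yy P - z) ≤ v (P.1, P.2.1) := by
    intro P hP
    have hs := D.sc_pos P.1
    have h := hz P hP
    rw [br_sub_comm, hv]
    change _ ≤ m P.1 * br 2 (D.sc P.1) (z - D.yy P)
    rw [show 4 = 2 + 2 from rfl, br_add, ← mul_assoc]
    exact mul_le_mul_of_nonneg_right (mul_br_two_le hs hr h) (br_nonneg _ hs _)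
  refine (Finset.sum_le_sum h1).trans ?_
  refine (D.sum_tiles_le i 10 Q (fun _ _ => D.a i * T.2.2)
      (fun P hP => by exact_mod_cast (hT P hP).2.2) v hv0).trans ?_
  set Z := Q.image fun P => (P.1, P.2.1) with hZ
  have h2 : ∑ p ∈ Z, v p ≤ ∑ p ∈ Z.image Prod.fst ×ˢ Z.image Prod.snd, v p :=
    Finset.sum_le_sum_of_subset_of_nonneg
      (fun p hp => Finset.mem_product.2 ⟨Finset.mem_image_of_mem _ hp, Finset.mem_image_of_mem _ hp⟩)
      fun p _ _ => hv0 p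
  have h3 : ∀ k, ∑ n ∈ Z.image Prod.snd, v (k, n) ≤
      4 * I0 * (2 : ℝ) ^ (-1 * |(k : ℝ) + Real.logb 2 (D.τ / r)|) := by
    intro k
    have hs := D.sc_pos k
    have h4 := D.sum_br_le 2 le_rfl k (Z.image Prod.snd) z le_rfl
    simp only [hv]
    rw [← Finset.mul_sum] at h4 ⊢
    have h5 : ∑ n ∈ Z.image Prod.snd, br 2 (D.sc k) (z - D.yv k n) ≤ 4 * I0 := by
      have : D.sc k * ∑ n ∈ Z.image Prod.snd, br 2 (D.sc k) (z - D.yv k n) ≤ D.sc k * (4 * I0) := by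
        linarith
      exact le_of_mul_le_mul_left this hs
    have h6 : m k ≤ (2 : ℝ) ^ (-1 * |(k : ℝ) + Real.logb 2 (D.τ / r)|) := by
      have hτ := D.hτ
      have e : D.sc k / r = 2 ^ ((k : ℝ) + Real.logb 2 (D.τ / r)) := by
        rw [Real.rpow_add two_pos, Real.rpow_logb two_pos (by norm_num) (by positivity),
          Real.rpow_intCast, Par.sc]
        ring
      have e' : r / D.sc k = 2 ^ (-((k : ℝ) + Real.logb 2 (D.τ / r))) := by
        rw [Real.rpow_neg two_pos.le, ← e, inv_div]
      rw [hm]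
      simp only
      rcases abs_cases ((k : ℝ) + Real.logb 2 (D.τ / r)) with h | h
      · rw [h.1, neg_one_mul, ← e']; exact min_le_left _ _
      · rw [h.1, neg_one_mul, neg_neg, ← e]; exact min_le_right _ _
    calc _ ≤ (2 : ℝ) ^ (-1 * |(k : ℝ) + Real.logb 2 (D.τ / r)|) * (4 * I0) := by
          refine mul_le_mul h6 h5 (Finset.sum_nonneg fun n _ => br_nonneg _ hs _) (by positivity)
      _ = _ := mul_comm _ _
  have h7 : ∑ p ∈ Z, v p ≤ 4 * I0 * C := by
    refine h2.trans ?_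
    rw [Finset.sum_product]
    refine (Finset.sum_le_sum fun k _ => h3 k).trans ?_
    rw [← Finset.mul_sum]
    have := hγ (Real.logb 2 (D.τ / r)) (Z.image Prod.fst)
    gcongr
  have : (2 * ((10 : ℕ) : ℝ) + 1) = 21 := by norm_num
  rw [this]
  linarith

lemma le_add_of_sq_le {X A B : ℝ} (hA : 0 ≤ A) (hB : 0 ≤ B) (h : X ^ 2 ≤ A * (X + B)) : X ≤ A + B := by
  by_contra! hx
  nlinarith

/-- A function `ρ` measuring the distance to the tiles of a finite collection. -/
lemma exists_rho (D : Par) (Q : Finset Tile) (hQ : Q.Nonempty) : ∃ ρ : ℝ → ℝ,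
    (∀ P ∈ Q, ∀ z, ρ z ≤ |z - D.yy P| + D.sc P.1) ∧
    (∀ z, ∃ P ∈ Q, ρ z = |z - D.yy P| + D.sc P.1) ∧ (∀ x z, ρ x ≤ ρ z + |x - z|) ∧
    Continuous ρ ∧ ∀ z, 0 < ρ z := by
  set ρ : ℝ → ℝ := fun z => Q.inf' hQ fun P => |z - D.yy P| + D.sc P.1 with hρ
  have h1 : ∀ P ∈ Q, ∀ z, ρ z ≤ |z - D.yy P| + D.sc P.1 := fun P hP z =>
    Finset.inf'_le (f := fun P => |z - D.yy P| + D.sc P.1) hP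
  have h2 : ∀ z, ∃ P ∈ Q, ρ z = |z - D.yy P| + D.sc P.1 := fun z =>
    Finset.exists_mem_eq_inf' hQ _
  have h3 : ∀ x z, ρ x ≤ ρ z + |x - z| := by
    intro x z
    obtain ⟨P, hP, e⟩ := h2 z
    rw [e]
    have := h1 P hP x
    have := abs_sub_le x z (D.yy P)
    linarith
  refine ⟨ρ, h1, h2, h3, ?_, fun z => ?_⟩
  · refine (LipschitzWith.of_dist_le_mul (K := 1) fun x z => ?_).continuous
    rw [Real.dist_eq, Real.dist_eq, NNReal.coe_one, one_mul, abs_le]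
    have := h3 x z
    have := h3 z x
    rw [abs_sub_comm z x] at this
    constructor <;> linarith
  · obtain ⟨P, hP, e⟩ := h2 z
    rw [e]
    have := D.sc_pos P.1
    positivity

lemma avf_norm_le {D : Par} {Q : Finset Tile} {ρ : ℝ → ℝ}
    (h2 : ∀ z, ∃ P ∈ Q, ρ z = |z - D.yy P| + D.sc P.1) (h3 : ∀ x z, ρ x ≤ ρ z + |x - z|)
    (h4 : ∀ z, 0 < ρ z) {f : ℝ → ℂ} (hf : Nice f) {l : ℝ} (hl : 0 ≤ l) (hd : D.Dens f Q l) (w x : ℝ) :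
    ‖avf ρ w f x‖ ≤ 4 * l := by
  unfold avf
  rw [norm_mul, norm_exp_real_mul_I, one_mul]
  obtain ⟨P, hP, e⟩ := h2 x
  have hx := h4 x
  set A := Metric.closedBall (D.yy P) (4 / 3 * ρ x) with hA
  have hmA : MeasurableSet A := Metric.isClosed_closedBall.measurableSet
  have h5 : ∀ z, ‖f z * Complex.exp ((-(2 * π * w * z) : ℝ) * Complex.I) * avk ρ z x‖ ≤
      5 / 2 / ρ x * A.indicator (fun z => ‖f z‖) z := by
    intro z
    rw [norm_mul, norm_mul, norm_exp_real_mul_I, mul_one, Complex.norm_real, Real.norm_of_nonneg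
      (avk_nonneg (h4 z) x)]
    by_cases hz : |x - z| < ρ z / 4
    · have h6 := h3 x z
      have h7 := h3 z x
      have hz0 := h4 z
      rw [abs_sub_comm] at h7
      have hzA : z ∈ A := by
        rw [hA, Metric.mem_closedBall, Real.dist_eq]
        have := abs_sub_le z x (D.yy P)
        rw [abs_sub_comm z x] at this
        have := D.sc_pos P.1
        linarith
      rw [Set.indicator_of_mem hzA, mul_comm]
      refine mul_le_mul_of_nonneg_right ?_ (norm_nonneg _)
      unfold avk
      rw [if_pos hz, div_le_div_iff₀ hz0 hx]
      linarith
    · have : avk ρ z x = 0 := if_neg hz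
      rw [this, mul_zero]
      exact mul_nonneg (by positivity) (indicator_nonneg (fun _ _ => norm_nonneg _) _)
  refine (norm_integral_le_of_norm_le ((hf.integrable.norm.indicator hmA).const_mul _)
    (ae_of_all _ h5)).trans ?_
  rw [integral_const_mul, integral_indicator hmA]
  have h6 := hd P hP (4 / 3 * ρ x) (by rw [e]; have := abs_nonneg (x - D.yy P); linarith [D.sc_pos P.1])
  calc _ ≤ 5 / 2 / ρ x * (l * (4 / 3 * ρ x)) := by gcongr
    _ = 10 / 3 * l := by field_simp; ring
    _ ≤ _ := by linarith

/-- The contribution of the part of the function near the top interval. -/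
lemma tree_near : ∃ C : ℝ, 0 < C ∧ ∀ (D : Par) (j i : Fin 3), i ≠ j → ∀ (T : Top) (f : ℝ → ℂ), Nice f →
    ∀ (l : ℝ), 0 ≤ l → ∀ Q : Finset Tile, D.Dens f Q l → (∀ P ∈ Q, D.inTree i T P) →
    (∀ x, 2 * D.sc T.1 < |x - D.yv T.1 T.2.1| → f x = 0) →
    ∑ P ∈ Q, D.sc P.1 * ‖D.co j f P‖ ^ 2 ≤ C * l ^ 2 * D.sc T.1 := by
  obtain ⟨C1, hC1, herr⟩ := avf_error 220 (by norm_num)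
  obtain ⟨C2, hC2, hpt⟩ := tree_point_sum
  obtain ⟨C3, hC3, hbes⟩ := Par.bessel_trees
  obtain ⟨C4, hC4, hco⟩ := co_le 0
  set C5 := C4 + C1 * 8 with hC5
  refine ⟨2 * ((C1 * 8) * (C1 * C2 * 3)) + 2 * (C3 * 96 + C5 ^ 2), by positivity,
    fun D j i hij T f hf l hl Q hQ hT h0 => ?_⟩
  have hK := D.sc_pos T.1
  rcases Q.eq_empty_or_nonempty with hemp | hne
  · rw [hemp, Finset.sum_empty]; positivity
  obtain ⟨ρ, hρ1, hρ2, hρ3, hρc, hρ0⟩ := exists_rho D Q hne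
  set w := D.a j * T.2.2 with hw
  set g := avf ρ w f with hg
  obtain ⟨P0, hP0⟩ := hne
  set c := D.yv T.1 T.2.1 with hc
  have hyc : ∀ P ∈ Q, |D.yy P - c| < D.sc T.1 := fun P hP =>
    D.abs_sub_lt_of_mem_dy (hT P hP).2.1 (D.yv_mem_dy _ _)
  have hgb : ∀ x, ‖g x‖ ≤ 4 * l := avf_norm_le hρ2 hρ3 hρ0 hf hl hQ w
  have hgs : ∀ x, 3 * D.sc T.1 < |x - c| → g x = 0 := by
    intro x hx
    rw [hg, avf, integral_eq_zero_of_ae (ae_of_all _ fun z => ?_), mul_zero]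
    by_cases hz : 2 * D.sc T.1 < |z - c|
    · simp [h0 z hz]
    · have h1 := hρ1 P0 hP0 z
      have h2 := abs_sub_le z c (D.yy P0)
      have h3 := hyc P0 hP0
      have h4 := D.sc_mono (hT P0 hP0).1
      have h5 := abs_sub_le x z c
      rw [abs_sub_comm c] at h2
      have : avk ρ z x = 0 := if_neg (by push Not; push Not at hz; linarith)
      simp [this]
  have hgm : Measurable g := avf_measurable hf hρc w
  have hgn : Nice g := by
    refine ⟨hgm, ⟨_, hgb⟩, |c| + 3 * D.sc T.1, fun x hx => hgs x ?_⟩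
    have := abs_sub_abs_le_abs_sub x c
    linarith
  set E : Tile → ℝ := fun P => C1 * ∫ z, ‖f z‖ *
    ((D.sc P.1)⁻¹ * (D.sc P.1)⁻¹ * ρ z * br 4 (D.sc P.1) (D.yy P - z)) with hE
  have hfr : ∀ P ∈ Q, |D.fr j P - w| ≤ 220 / D.sc P.1 := by
    intro P hP
    have hs := D.sc_pos P.1
    have h1 := D.abs_fr_le i j P T.2.2 _ (hT P hP).2.2
    have h2 : |D.κ i j / D.sc P.1| ≤ 200 / D.sc P.1 := by
      rw [abs_div, abs_of_pos hs]
      have := D.hκ2 i j hij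
      gcongr
      exact this
    have h3 := abs_add_le (D.fr j P - D.a j * T.2.2 - D.κ i j / D.sc P.1) (D.κ i j / D.sc P.1)
    rw [sub_add_cancel] at h3
    have e : 220 / D.sc P.1 = 2 * (10 / D.sc P.1) + 200 / D.sc P.1 := by ring
    rw [e]
    linarith
  have hdiff : ∀ P ∈ Q, ‖D.co j f P - D.co j g P‖ ≤ E P := fun P hP =>
    herr f hf ρ hρc hρ0 w _ _ _ (D.sc_pos _) (hfr P hP) (hρ1 P hP)
  have hmeas : ∀ P, Measurable fun z => ρ z * br 4 (D.sc P.1) (D.yy P - z) := by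
    intro P
    have := hρc.measurable
    have h2 := (br_continuous 4 (D.sc_pos P.1)).measurable
    fun_prop
  have hρbr : ∀ P ∈ Q, ∀ z, ρ z * br 4 (D.sc P.1) (D.yy P - z) ≤
      D.sc P.1 * br 2 (D.sc P.1) (D.yy P - z) := by
    intro P hP z
    have hs := D.sc_pos P.1
    have h1 := hρ1 P hP z
    rw [br_sub_comm 4, br_sub_comm 2, show 4 = 2 + 2 from rfl, br_add, ← mul_assoc]
    refine mul_le_mul_of_nonneg_right ?_ (br_nonneg _ hs _)
    have h2 := mul_br_two_le hs (hρ0 z) h1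
    have h3 : min (ρ z / D.sc P.1) (D.sc P.1 / ρ z) ≤ 1 := by
      rcases le_total (ρ z) (D.sc P.1) with h | h
      · exact (min_le_left _ _).trans ((div_le_one hs).2 h)
      · exact (min_le_right _ _).trans ((div_le_one (hρ0 z)).2 h)
    have h4 : ρ z * br 2 (D.sc P.1) (z - D.yy P) =
        D.sc P.1 * (ρ z / D.sc P.1 * br 2 (D.sc P.1) (z - D.yy P)) := by field_simp
    rw [h4]
    exact mul_le_of_le_one_right hs.le (h2.trans h3)
  have hfi : ∀ P ∈ Q, Integrable fun z => ‖f z‖ * (ρ z * br 4 (D.sc P.1) (D.yy P - z)) := by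
    intro P hP
    obtain ⟨B, hB⟩ := hf.2.1
    refine hf.integrable_of_bound (B := B * (D.sc P.1 * 1)) (hf.1.norm.mul (hmeas P)) (fun z => ?_)
      (fun z hz => by simp [hz])
    have hs := D.sc_pos P.1
    have := br_nonneg 4 hs (D.yy P - z)
    have hz := hρ0 z
    rw [abs_of_nonneg (by positivity)]
    refine mul_le_mul (hB z) ((hρbr P hP z).trans ?_) (by positivity) ((norm_nonneg _).trans (hB z))
    have := br_le_one 2 hs (D.yy P - z)
    gcongr
  have hfi2 : ∀ P, Integrable fun z => ‖f z‖ * br 2 (D.sc P.1) (D.yy P - z) := by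
    intro P
    have hs := D.sc_pos P.1
    obtain ⟨B, hB⟩ := hf.2.1
    have h2 := (br_continuous 2 hs).measurable
    refine hf.integrable_of_bound (B := B) (hf.1.norm.mul (by fun_prop)) (fun z => ?_)
      (fun z hz => by simp [hz])
    rw [abs_of_nonneg (mul_nonneg (norm_nonneg _) (br_nonneg _ hs _))]
    exact (mul_le_of_le_one_right (norm_nonneg _) (br_le_one _ hs _)).trans (hB z)
  have hE' : ∀ P, E P = C1 * ((D.sc P.1)⁻¹ * (D.sc P.1)⁻¹ *
      ∫ z, ‖f z‖ * (ρ z * br 4 (D.sc P.1) (D.yy P - z))) := by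
    intro P
    rw [hE, ← integral_const_mul ((D.sc P.1)⁻¹ * (D.sc P.1)⁻¹)]
    simp only
    congr 2
    ext z
    ring
  have hE0 : ∀ P, 0 ≤ E P := by
    intro P
    rw [hE']
    have hs := D.sc_pos P.1
    have : 0 ≤ ∫ z, ‖f z‖ * (ρ z * br 4 (D.sc P.1) (D.yy P - z)) :=
      integral_nonneg fun z => mul_nonneg (norm_nonneg _) (mul_nonneg (hρ0 z).le (br_nonneg _ hs _))
    positivity
  have hEle : ∀ P ∈ Q, E P ≤ C1 * 8 * l := by
    intro P hP
    have hs := D.sc_pos P.1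
    rw [hE', mul_assoc C1]
    refine mul_le_mul_of_nonneg_left ?_ hC1.le
    have h1 : ∫ z, ‖f z‖ * (ρ z * br 4 (D.sc P.1) (D.yy P - z)) ≤
        ∫ z, D.sc P.1 * (‖f z‖ * br 2 (D.sc P.1) (D.yy P - z)) := by
      refine integral_mono (hfi P hP) ((hfi2 P).const_mul _) fun z => ?_
      have := mul_le_mul_of_nonneg_left (hρbr P hP z) (norm_nonneg (f z))
      simp only
      linarith
    rw [integral_const_mul] at h1
    have h2 := integral_mul_br_le hf hs hl (hQ P hP)
    calc _ ≤ (D.sc P.1)⁻¹ * (D.sc P.1)⁻¹ * (D.sc P.1 * (8 * l * D.sc P.1)) := by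
          gcongr
          exact h1.trans (by gcongr)
      _ = _ := by field_simp
  have hEsum : ∑ P ∈ Q, D.sc P.1 * E P ≤ C1 * C2 * 3 * l * D.sc T.1 := by
    have e : ∀ P ∈ Q, D.sc P.1 * E P =
        C1 * ∫ z, ‖f z‖ * (ρ z / D.sc P.1 * br 4 (D.sc P.1) (D.yy P - z)) := by
      intro P _
      have hs := D.sc_pos P.1
      rw [hE', ← integral_const_mul, ← mul_assoc, mul_comm (D.sc P.1), mul_assoc, ← integral_const_mul]
      congr 2
      ext z
      field_simp
    have hi : ∀ P ∈ Q, Integrable fun z => ‖f z‖ * (ρ z / D.sc P.1 * br 4 (D.sc P.1) (D.yy P - z)) := by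
      intro P hP
      convert (hfi P hP).const_mul (D.sc P.1)⁻¹ using 2 with z
      ring
    rw [Finset.sum_congr rfl e, ← Finset.mul_sum, ← integral_finsetSum _ hi]
    have h1 : ∫ z, ∑ P ∈ Q, ‖f z‖ * (ρ z / D.sc P.1 * br 4 (D.sc P.1) (D.yy P - z)) ≤
        ∫ z, ‖f z‖ * C2 := by
      refine integral_mono (integrable_finsetSum _ hi) (hf.integrable.norm.mul_const _) fun z => ?_
      simp only
      rw [← Finset.mul_sum]
      exact mul_le_mul_of_nonneg_left (hpt D i T Q hT z (ρ z) (hρ0 z) fun P hP => hρ1 P hP z)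
        (norm_nonneg _)
    have h2 : ∫ z, ‖f z‖ ≤ l * (3 * D.sc T.1) := by
      refine le_trans (le_of_eq ?_) (hQ P0 hP0 (3 * D.sc T.1)
        (by have := D.sc_mono (hT P0 hP0).1; linarith))
      symm
      refine setIntegral_eq_integral_of_forall_compl_eq_zero fun z hz => ?_
      rw [Metric.mem_closedBall, Real.dist_eq] at hz
      rw [h0 z, norm_zero]
      have := hyc P0 hP0
      have := abs_sub_le z c (D.yy P0)
      rw [abs_sub_comm c] at this
      linarith
    rw [integral_mul_const] at h1
    calc _ ≤ C1 * (l * (3 * D.sc T.1) * C2) := by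
          gcongr
          exact h1.trans (by gcongr)
      _ = _ := by ring
  have hcg : ∀ P ∈ Q, ‖D.co j g P‖ ≤ C5 * l := by
    intro P hP
    have h1 := hco D j f hf l hl Q hQ P hP 0 le_rfl (fun x hx => absurd hx (not_lt.2 (abs_nonneg _)))
    have h2 := hdiff P hP
    have h3 := hEle P hP
    have h4 := br_le_one 0 (D.sc_pos P.1) 0
    have h5 : C4 * l * br 0 (D.sc P.1) 0 ≤ C4 * l := mul_le_of_le_one_right (by positivity) h4
    have h6 := norm_sub_norm_le (D.co j g P) (D.co j f P)
    rw [norm_sub_rev] at h6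
    rw [hC5, add_mul]
    linarith
  have hg2 : ∫ x, ‖g x‖ ^ 2 ≤ 96 * l ^ 2 * D.sc T.1 := by
    have e : ∫ x, ‖g x‖ ^ 2 = ∫ x in Metric.closedBall c (3 * D.sc T.1), ‖g x‖ ^ 2 := by
      symm
      refine setIntegral_eq_integral_of_forall_compl_eq_zero fun z hz => ?_
      rw [Metric.mem_closedBall, Real.dist_eq] at hz
      rw [hgs z (by linarith)]
      simp
    rw [e]
    have h1 : ∫ x in Metric.closedBall c (3 * D.sc T.1), ‖g x‖ ^ 2 ≤
        ∫ x in Metric.closedBall c (3 * D.sc T.1), (4 * l) ^ 2 := by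
      refine setIntegral_mono_on hgn.integrable_sq.integrableOn (integrableOn_const (by
        rw [Real.volume_closedBall]; exact ENNReal.ofReal_ne_top))
        Metric.isClosed_closedBall.measurableSet fun x _ => ?_
      exact pow_le_pow_left₀ (norm_nonneg _) (hgb x) 2
    refine h1.trans (le_of_eq ?_)
    rw [setIntegral_const, measureReal_def, Real.volume_closedBall,
      ENNReal.toReal_ofReal (by positivity), smul_eq_mul]
    ring
  have hB := hbes D j g hgn Q {0} (fun _ => 0) (fun _ => T) i (C5 * l) (by positivity)
    (fun P _ => Finset.mem_singleton_self _) hT hcg (fun P hP P' hP' hk hn => by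
      exfalso
      obtain ⟨s, hs, hs1⟩ : ∃ s : ℝ, s * D.κ i j = |D.κ i j| ∧ |s| ≤ 1 := by
        rcases abs_cases (D.κ i j) with h | h
        · exact ⟨1, by rw [h.1, one_mul], by simp⟩
        · exact ⟨-1, by rw [h.1, neg_one_mul], by simp⟩
      have h1 := (D.freq_sep hij hs hs1 (hT P hP).2.2 (hT P' hP').2.2 hk hn).1
      have : 0 < 70 / D.sc P'.1 := div_pos (by norm_num) (D.sc_pos _)
      linarith)
  rw [Finset.sum_singleton] at hB
  have hX : ∑ P ∈ Q, D.sc P.1 * ‖D.co j g P‖ ^ 2 ≤ C3 * (96 * l ^ 2 * D.sc T.1) +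
      (C5 * l) ^ 2 * D.sc T.1 := by
    have hX0 : 0 ≤ ∑ P ∈ Q, D.sc P.1 * ‖D.co j g P‖ ^ 2 :=
      Finset.sum_nonneg fun P _ => mul_nonneg (D.sc_pos _).le (by positivity)
    refine le_add_of_sq_le (by positivity) (by positivity) (hB.trans ?_)
    gcongr
  have hE2 : ∑ P ∈ Q, D.sc P.1 * E P ^ 2 ≤ C1 * 8 * l * (C1 * C2 * 3 * l * D.sc T.1) := by
    refine le_trans ?_ (mul_le_mul_of_nonneg_left hEsum (by positivity))
    rw [Finset.mul_sum]
    refine Finset.sum_le_sum fun P hP => ?_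
    have := mul_le_mul_of_nonneg_left (hEle P hP) (mul_nonneg (D.sc_pos P.1).le (hE0 P))
    linarith
  have hfin : ∀ P ∈ Q, D.sc P.1 * ‖D.co j f P‖ ^ 2 ≤
      2 * (D.sc P.1 * E P ^ 2) + 2 * (D.sc P.1 * ‖D.co j g P‖ ^ 2) := by
    intro P hP
    have hs := D.sc_pos P.1
    have h1 : ‖D.co j f P‖ ≤ E P + ‖D.co j g P‖ := by
      have := norm_sub_norm_le (D.co j f P) (D.co j g P)
      linarith [hdiff P hP]
    have h2 := pow_le_pow_left₀ (norm_nonneg _) h1 2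
    have h3 : (E P + ‖D.co j g P‖) ^ 2 ≤ 2 * E P ^ 2 + 2 * ‖D.co j g P‖ ^ 2 := by
      nlinarith [sq_nonneg (E P - ‖D.co j g P‖)]
    nlinarith
  refine (Finset.sum_le_sum hfin).trans ?_
  rw [Finset.sum_add_distrib, ← Finset.mul_sum, ← Finset.mul_sum]
  calc _ ≤ 2 * (C1 * 8 * l * (C1 * C2 * 3 * l * D.sc T.1)) + 2 * (C3 * (96 * l ^ 2 * D.sc T.1) +
      (C5 * l) ^ 2 * D.sc T.1) := by gcongr
    _ = _ := by ring

/-- The size bound. -/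
lemma size_bound (N : ℕ) : ∃ C : ℝ, 0 < C ∧ ∀ (D : Par) (j : Fin 3) (f : ℝ → ℂ), Nice f →
    ∀ (l : ℝ), 0 ≤ l → ∀ (Q : Finset Tile), D.Dens f Q l → ∀ e : ℕ,
    (e = 0 ∨ ∀ P ∈ Q, ∀ x, |D.yy P - x| < 2 ^ e * D.sc P.1 → f x = 0) →
    D.SizeLE j Q (fun P => ‖D.co j f P‖) (C * (l / 2 ^ (N * e))) := by
  obtain ⟨C1, hC1, h1⟩ := tree_vanish N
  obtain ⟨C2, hC2, h2⟩ := tree_near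
  obtain ⟨C3, hC3, h3⟩ := tree_far
  refine ⟨C1 + (2 * C2 + 2 * C3) + 1, by positivity, fun D j f hf l hl Q hQ e he i hij T => ?_⟩
  set Q' := Q.filter fun P => D.inTree i T P with hQ'
  have hT : ∀ P ∈ Q', D.inTree i T P := fun P hP => (Finset.mem_filter.1 hP).2
  have hd : D.Dens f Q' l := hQ.mono (Finset.filter_subset _ _)
  have hK := D.sc_pos T.1
  rw [mul_pow]
  have hCC : ∀ x : ℝ, 0 ≤ x → x ≤ C1 + (2 * C2 + 2 * C3) →
      ∑ P ∈ Q', D.sc P.1 * ‖D.co j f P‖ ^ 2 ≤ x * (l / 2 ^ (N * e)) ^ 2 * D.sc T.1 →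
      ∑ P ∈ Q', D.sc P.1 * ‖D.co j f P‖ ^ 2 ≤
        (C1 + (2 * C2 + 2 * C3) + 1) ^ 2 * (l / 2 ^ (N * e)) ^ 2 * D.sc T.1 := by
    intro x hx0 hx h
    refine h.trans ?_
    gcongr
    nlinarith
  rcases Nat.eq_zero_or_pos e with rfl | hpos
  · refine hCC (2 * C2 + 2 * C3) (by positivity) (by linarith) ?_
    simp only [mul_zero, pow_zero, div_one]
    set A : Set ℝ := Metric.closedBall (D.yv T.1 T.2.1) (2 * D.sc T.1) with hA
    have hmA : MeasurableSet A := Metric.isClosed_closedBall.measurableSet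
    have hmem : ∀ x, x ∈ A ↔ |x - D.yv T.1 T.2.1| ≤ 2 * D.sc T.1 := fun x => by
      rw [hA, Metric.mem_closedBall, Real.dist_eq]
    have n1 := hf.indicator hmA
    have n2 := hf.indicator hmA.compl
    have k1 := h2 D j i hij T _ n1 l hl Q' (hd.of_norm_le hf (norm_indicator_le_norm_self f)) hT
      (fun x hx => indicator_of_notMem (by rw [hmem]; exact not_le.2 hx) _)
    have k2 := h3 D j i T _ n2 l hl Q' (hd.of_norm_le hf (norm_indicator_le_norm_self f)) hT
      (fun x hx => indicator_of_notMem (by rw [mem_compl_iff, hmem, not_not]; exact hx) _)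
    have hadd : ∀ P, D.co j f P = D.co j (A.indicator f) P + D.co j (Aᶜ.indicator f) P := by
      intro P
      obtain ⟨B, hB⟩ := pk_bound_bounded (D.sc_pos P.1) (D.fr j P) (D.yy P)
      have hm := (pk_continuous (D.sc_pos P.1) (D.fr j P) (D.yy P)).measurable
      unfold Par.co
      rw [← integral_add (n1.mul hm hB).integrable (n2.mul hm hB).integrable]
      refine integral_congr_ae (ae_of_all _ fun x => ?_)
      simp only
      rw [← add_mul, ← congrFun (Set.indicator_self_add_compl A f) x, Pi.add_apply]
    have h4 : ∀ P ∈ Q', D.sc P.1 * ‖D.co j f P‖ ^ 2 ≤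
        2 * (D.sc P.1 * ‖D.co j (A.indicator f) P‖ ^ 2) +
        2 * (D.sc P.1 * ‖D.co j (Aᶜ.indicator f) P‖ ^ 2) := by
      intro P _
      have hs := D.sc_pos P.1
      rw [hadd]
      have h5 := pow_le_pow_left₀ (norm_nonneg _)
        (norm_add_le (D.co j (A.indicator f) P) (D.co j (Aᶜ.indicator f) P)) 2
      nlinarith [sq_nonneg (‖D.co j (A.indicator f) P‖ - ‖D.co j (Aᶜ.indicator f) P‖)]
    refine (Finset.sum_le_sum h4).trans ?_
    rw [Finset.sum_add_distrib, ← Finset.mul_sum, ← Finset.mul_sum]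
    linarith
  · refine hCC C1 hC1.le (by linarith) ?_
    rcases he with h | h
    · omega
    · exact h1 D j i T f hf l hl Q' hd hT e hpos fun P hP => h P (Finset.filter_subset _ _ hP)

lemma setIntegral_biUnion_le {ι : Type*} (S : Finset ι) (A : ι → Set ℝ) {B : Set ℝ} {g : ℝ → ℝ}
    (hA : ∀ i ∈ S, MeasurableSet (A i)) (hB : B ⊆ ⋃ i ∈ S, A i) (hg : Integrable g)
    (h0 : ∀ x, 0 ≤ g x) (hBm : MeasurableSet B) : ∫ x in B, g x ≤ ∑ i ∈ S, ∫ x in A i, g x := by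
  have e : ∀ i ∈ S, ∫ x in A i, g x = ∫ x, (A i).indicator g x := fun i hi =>
    (integral_indicator (hA i hi)).symm
  rw [Finset.sum_congr rfl e, ← integral_finsetSum _ fun i hi => hg.indicator (hA i hi),
    ← integral_indicator hBm]
  refine integral_mono (hg.indicator hBm)
    (integrable_finsetSum _ fun i hi => hg.indicator (hA i hi)) fun x => ?_
  have hn : ∀ i ∈ S, 0 ≤ (A i).indicator g x := fun i _ => indicator_nonneg (fun _ _ => h0 _) _
  by_cases hx : x ∈ B
  · obtain ⟨i, hi, hxi⟩ := mem_iUnion₂.1 (hB hx)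
    rw [indicator_of_mem hx]
    refine le_trans (le_of_eq ?_) (Finset.single_le_sum hn hi)
    rw [indicator_of_mem hxi]
  · rw [indicator_of_notMem hx]
    exact Finset.sum_nonneg hn

lemma vitali_finite (Q : Finset Tile) (y r : Tile → ℝ) : ∃ u ⊆ Q,
    ((u : Set Tile).PairwiseDisjoint fun P => Metric.closedBall (y P) (r P)) ∧
    ∀ P ∈ Q, ∃ P' ∈ u, Metric.closedBall (y P) (r P) ⊆ Metric.closedBall (y P') (5 * r P') := by
  obtain ⟨R, hR⟩ := (Q.image r).bddAbove
  obtain ⟨u, hu, h1, h2⟩ := Vitali.exists_disjoint_subfamily_covering_enlargement_closedBall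
    (Q : Set Tile) y r R (fun a ha => hR (Finset.mem_coe.2 (Finset.mem_image_of_mem r ha))) 5 (by norm_num)
  have hfin : u.Finite := Q.finite_toSet.subset hu
  refine ⟨hfin.toFinset, fun P hP => hu (hfin.mem_toFinset.1 hP), ?_, fun P hP => ?_⟩
  · rwa [hfin.coe_toFinset]
  · obtain ⟨b, hb, hb2⟩ := h2 P hP
    exact ⟨b, hfin.mem_toFinset.2 hb, hb2⟩

namespace Par

/-- The union of the intervals around the tiles of `Q`, enlarged by `c`. -/
def rg (D : Par) (Q : Finset Tile) (c : ℝ) : Set ℝ :=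
  ⋃ P ∈ Q, Metric.closedBall (D.yy P) (c * D.sc P.1)

variable (D : Par)

lemma rg_measurable (Q : Finset Tile) (c : ℝ) : MeasurableSet (D.rg Q c) :=
  Finset.measurableSet_biUnion _ fun _ _ => Metric.isClosed_closedBall.measurableSet

lemma rg_ne_top (Q : Finset Tile) (c : ℝ) : volume (D.rg Q c) ≠ ⊤ := by
  refine ((measure_biUnion_finset_le Q _).trans_lt ?_).ne
  refine ENNReal.sum_lt_top.2 fun P _ => ?_
  rw [Real.volume_closedBall]
  exact ENNReal.ofReal_lt_top

lemma rg_integral_le {f : ℝ → ℂ} (hf : Nice f) {Q : Finset Tile} {l : ℝ} (hl : 0 ≤ l)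
    (hd : D.Dens f Q l) {c : ℝ} (hc : 1 ≤ c) :
    ∫ x in D.rg Q c, ‖f x‖ ≤ 5 * c * l * volume.real (D.rg Q 1) := by
  obtain ⟨u, huQ, hdis, hcov⟩ := vitali_finite Q D.yy fun P => c * D.sc P.1
  have h1 : D.rg Q c ⊆ ⋃ P ∈ u, Metric.closedBall (D.yy P) (5 * (c * D.sc P.1)) := by
    refine iUnion₂_subset fun P hP => ?_
    obtain ⟨P', hP', h⟩ := hcov P hP
    exact h.trans (subset_biUnion_of_mem (u := fun P => Metric.closedBall (D.yy P) (5 * (c * D.sc P.1))) hP')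
  refine (setIntegral_biUnion_le u _ (fun _ _ => Metric.isClosed_closedBall.measurableSet) h1
    hf.integrable.norm (fun _ => norm_nonneg _) (D.rg_measurable Q c)).trans ?_
  have h2 : ∀ P ∈ u, ∫ x in Metric.closedBall (D.yy P) (5 * (c * D.sc P.1)), ‖f x‖ ≤
      5 * c * l * D.sc P.1 := by
    intro P hP
    have hs := D.sc_pos P.1
    refine (hd P (huQ hP) _ ?_).trans (le_of_eq (by ring))
    nlinarith
  refine (Finset.sum_le_sum h2).trans ?_
  rw [← Finset.mul_sum]
  refine mul_le_mul_of_nonneg_left ?_ (by positivity)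
  have h3 : ∑ P ∈ u, D.sc P.1 ≤
      ∑ P ∈ u, volume.real (Metric.closedBall (D.yy P) (1 * D.sc P.1)) := by
    refine Finset.sum_le_sum fun P _ => ?_
    have hs := D.sc_pos P.1
    rw [measureReal_def, Real.volume_closedBall, ENNReal.toReal_ofReal (by positivity)]
    linarith
  refine h3.trans ?_
  have hdj : (u : Set Tile).PairwiseDisjoint
      fun P => Metric.closedBall (D.yy P) (1 * D.sc P.1) := by
    intro a ha b hb hab
    refine (hdis ha hb hab).mono ?_ ?_ <;> refine Metric.closedBall_subset_closedBall ?_ <;>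
      exact mul_le_mul_of_nonneg_right hc (D.sc_pos _).le
  have hnt : ∀ P ∈ u, volume (Metric.closedBall (D.yy P) (1 * D.sc P.1)) ≠ ⊤ := by
    intro P _
    rw [Real.volume_closedBall]; exact ENNReal.ofReal_ne_top
  rw [← measureReal_biUnion_finset hdj (fun _ _ => Metric.isClosed_closedBall.measurableSet) hnt]
  refine measureReal_mono ?_ (D.rg_ne_top Q 1)
  exact biUnion_subset_biUnion_left fun P hP => huQ hP

lemma rg_measure_le {f : ℝ → ℂ} (hf : Nice f) {Q : Finset Tile} {δ : ℝ} (hδ : 0 < δ)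
    (h : ∀ P ∈ Q, ∃ r, D.sc P.1 ≤ r ∧ δ * r < ∫ x in Metric.closedBall (D.yy P) r, ‖f x‖) :
    δ * volume.real (D.rg Q 1) ≤ 10 * ∫ x, ‖f x‖ := by
  choose! r hr1 hr2 using h
  obtain ⟨u, huQ, hdis, hcov⟩ := vitali_finite Q D.yy r
  have h1 : D.rg Q 1 ⊆ ⋃ P ∈ u, Metric.closedBall (D.yy P) (5 * r P) := by
    refine iUnion₂_subset fun P hP => ?_
    obtain ⟨P', hP', h⟩ := hcov P hP
    refine (Metric.closedBall_subset_closedBall ?_).trans (h.trans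
      (subset_biUnion_of_mem (u := fun P => Metric.closedBall (D.yy P) (5 * r P)) hP'))
    rw [one_mul]; exact hr1 P hP
  have h2 : volume.real (D.rg Q 1) ≤ ∑ P ∈ u, volume.real (Metric.closedBall (D.yy P) (5 * r P)) := by
    refine (measureReal_mono h1 ?_).trans (measureReal_biUnion_finset_le _ _)
    refine ((measure_biUnion_finset_le u _).trans_lt (ENNReal.sum_lt_top.2 fun P _ => ?_)).ne
    rw [Real.volume_closedBall]
    exact ENNReal.ofReal_lt_top
  have h3 : ∀ P ∈ u, δ * volume.real (Metric.closedBall (D.yy P) (5 * r P)) ≤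
      10 * ∫ x in Metric.closedBall (D.yy P) (r P), ‖f x‖ := by
    intro P hP
    have hs := D.sc_pos P.1
    have := hr1 P (huQ hP)
    have := hr2 P (huQ hP)
    rw [measureReal_def, Real.volume_closedBall, ENNReal.toReal_ofReal (by linarith)]
    linarith
  calc _ ≤ ∑ P ∈ u, δ * volume.real (Metric.closedBall (D.yy P) (5 * r P)) := by
        rw [← Finset.mul_sum]; gcongr
    _ ≤ 10 * ∑ P ∈ u, ∫ x in Metric.closedBall (D.yy P) (r P), ‖f x‖ := by
        rw [Finset.mul_sum]; exact Finset.sum_le_sum h3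
    _ ≤ _ := by
        gcongr
        have := sum_setIntegral_le u (fun P => Metric.closedBall (D.yy P) (r P)) (B := univ)
          (fun _ _ => Metric.isClosed_closedBall.measurableSet) hdis (fun _ _ => subset_univ _)
          hf.integrable.norm.integrableOn fun x => norm_nonneg (f x)
        rwa [setIntegral_univ] at this

/-- The piece of `f` at distance about `2 ^ d` from the tiles of `Q`. -/
noncomputable def shell (Q : Finset Tile) (f : ℝ → ℂ) (d : ℕ) : ℝ → ℂ :=
  (if d = 0 then D.rg Q 1 else D.rg Q (2 ^ d) \ D.rg Q (2 ^ (d - 1))).indicator f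

lemma rg_mono (Q : Finset Tile) {c c' : ℝ} (h : c ≤ c') : D.rg Q c ⊆ D.rg Q c' :=
  iUnion₂_mono fun P _ => Metric.closedBall_subset_closedBall
    (mul_le_mul_of_nonneg_right h (D.sc_pos P.1).le)

lemma sum_shell (Q : Finset Tile) (f : ℝ → ℂ) (M : ℕ) (x : ℝ) :
    ∑ d ∈ Finset.range (M + 1), D.shell Q f d x = (D.rg Q (2 ^ M)).indicator f x := by
  induction M with
  | zero => simp [shell]
  | succ M ih =>
    rw [Finset.sum_range_succ, ih, shell, if_neg (Nat.succ_ne_zero M), Nat.add_sub_cancel]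
    have hsub : D.rg Q (2 ^ M) ⊆ D.rg Q (2 ^ (M + 1)) :=
      D.rg_mono Q (pow_le_pow_right₀ one_le_two (Nat.le_succ M))
    have := congrFun (indicator_union_of_disjoint
      (disjoint_sdiff_right (s := D.rg Q (2 ^ M)) (t := D.rg Q (2 ^ (M + 1)))) f) x
    rw [union_sdiff_cancel hsub] at this
    exact this.symm

lemma shell_nice {f : ℝ → ℂ} (hf : Nice f) (Q : Finset Tile) (d : ℕ) : Nice (D.shell Q f d) := by
  refine hf.indicator ?_
  split_ifs
  · exact D.rg_measurable _ _
  · exact (D.rg_measurable _ _).diff (D.rg_measurable _ _)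

lemma norm_shell_le (Q : Finset Tile) (f : ℝ → ℂ) (d : ℕ) (x : ℝ) : ‖D.shell Q f d x‖ ≤ ‖f x‖ :=
  norm_indicator_le_norm_self _ _

lemma shell_support (Q : Finset Tile) (f : ℝ → ℂ) (d : ℕ) (x : ℝ) (h : x ∉ D.rg Q (2 ^ d)) :
    D.shell Q f d x = 0 := by
  refine indicator_of_notMem (fun hx => h ?_) _
  split_ifs at hx with h0
  · rw [h0, pow_zero]; exact hx
  · exact hx.1

lemma shell_vanish (Q : Finset Tile) (f : ℝ → ℂ) (d : ℕ) : d - 1 = 0 ∨ ∀ P ∈ Q, ∀ x,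
    |D.yy P - x| < 2 ^ (d - 1) * D.sc P.1 → D.shell Q f d x = 0 := by
  rcases Nat.eq_zero_or_pos d with h | h
  · left; omega
  · right
    intro P hP x hx
    refine indicator_of_notMem (fun hh => ?_) _
    rw [if_neg (by omega)] at hh
    apply hh.2
    refine mem_iUnion₂.2 ⟨P, hP, ?_⟩
    rw [Metric.mem_closedBall, Real.dist_eq, abs_sub_comm]
    exact hx.le

lemma shell_energy {f : ℝ → ℂ} (hf : Nice f) (h1 : ∀ x, ‖f x‖ ≤ 1) {Q : Finset Tile} {l : ℝ}
    (hl : 0 ≤ l) (hd : D.Dens f Q l) (d : ℕ) :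
    ∫ x, ‖D.shell Q f d x‖ ^ 2 ≤ 5 * 2 ^ d * l * volume.real (D.rg Q 1) := by
  refine le_trans ?_ (D.rg_integral_le hf hl hd (one_le_pow₀ one_le_two))
  rw [← integral_indicator (D.rg_measurable _ _)]
  refine integral_mono (D.shell_nice hf Q d).integrable_sq
    (hf.integrable.norm.indicator (D.rg_measurable _ _)) fun x => ?_
  by_cases hx : x ∈ D.rg Q (2 ^ d)
  · simp only [indicator_of_mem hx]
    have := D.norm_shell_le Q f d x
    have := h1 x
    nlinarith [norm_nonneg (D.shell Q f d x)]
  · simp only [indicator_of_notMem hx, D.shell_support Q f d x hx]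
    simp

lemma norm_co_le_sum_shell (j : Fin 3) {f : ℝ → ℂ} (hf : Nice f) {Q : Finset Tile} (hQ : Q.Nonempty) :
    ∃ M : ℕ, ∀ P, ‖D.co j f P‖ ≤ ∑ d ∈ Finset.range (M + 1), ‖D.co j (D.shell Q f d) P‖ := by
  obtain ⟨R, hR⟩ := hf.2.2
  obtain ⟨P0, hP0⟩ := hQ
  have hs := D.sc_pos P0.1
  obtain ⟨M, hM⟩ : ∃ M : ℕ, (R + |D.yy P0|) / D.sc P0.1 ≤ 2 ^ M :=
    (pow_unbounded_of_one_lt _ one_lt_two).imp fun _ h => h.le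
  rw [div_le_iff₀ hs] at hM
  refine ⟨M, fun P => ?_⟩
  have e : D.co j f P = ∑ d ∈ Finset.range (M + 1), D.co j (D.shell Q f d) P := by
    obtain ⟨B, hB⟩ := pk_bound_bounded (D.sc_pos P.1) (D.fr j P) (D.yy P)
    have hm := (pk_continuous (D.sc_pos P.1) (D.fr j P) (D.yy P)).measurable
    unfold co
    rw [← integral_finsetSum _ fun d _ => ((D.shell_nice hf Q d).mul hm hB).integrable]
    refine integral_congr_ae (ae_of_all _ fun x => ?_)
    simp only
    rw [← Finset.sum_mul, D.sum_shell]
    congr 1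
    by_cases hx : x ∈ D.rg Q (2 ^ M)
    · rw [indicator_of_mem hx]
    · rw [indicator_of_notMem hx]
      apply hR
      by_contra! h
      apply hx
      refine mem_iUnion₂.2 ⟨P0, hP0, ?_⟩
      rw [Metric.mem_closedBall, Real.dist_eq]
      have := abs_sub x (D.yy P0)
      linarith
  rw [e]
  exact norm_sum_le _ _

end Par

lemma shell_factor_le {θ C l M : ℝ} {N B d e e' : ℕ} (h0 : 0 < θ) (h1 : θ < 1) (hC : 0 < C)
    (hl : 0 < l) (hM : 0 < M) (hN : (B : ℝ) + 2 ≤ N * θ) (hd : d ≤ e' + 1) (he : e ≤ e') :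
    (C * (l / 2 ^ (N * e'))) ^ θ * (√(5 * 2 ^ d * l * M)) ^ (1 - θ) ≤
      (20 * C ^ θ * l ^ ((1 + θ) / 2) * M ^ ((1 - θ) / 2) * (1 / 2) ^ (B * e)) * (1 / 2) ^ d := by
  have e1 : (C * (l / 2 ^ (N * e'))) ^ θ = C ^ θ * l ^ θ * (2 : ℝ) ^ (-(N * θ * e')) := by
    rw [mul_rpow hC.le (by positivity), div_rpow hl.le (by positivity), ← rpow_natCast, ← rpow_mul two_pos.le,
      rpow_neg two_pos.le, mul_assoc, div_eq_mul_inv]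
    congr 4
    push_cast; ring
  have e2 : (√(5 * 2 ^ d * l * M)) ^ (1 - θ) =
      (5 * 2 ^ d : ℝ) ^ ((1 - θ) / 2) * l ^ ((1 - θ) / 2) * M ^ ((1 - θ) / 2) := by
    rw [sqrt_eq_rpow, ← rpow_mul (by positivity), mul_rpow (by positivity) hM.le,
      mul_rpow (by positivity) hl.le]
    ring_nf
  have e3 : (5 * 2 ^ d : ℝ) ^ ((1 - θ) / 2) ≤ 5 * 2 ^ d := by
    have : (1 : ℝ) ≤ 5 * 2 ^ d := by
      have : (1 : ℝ) ≤ 2 ^ d := one_le_pow₀ one_le_two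
      linarith
    calc (5 * 2 ^ d : ℝ) ^ ((1 - θ) / 2) ≤ (5 * 2 ^ d : ℝ) ^ (1 : ℝ) :=
          rpow_le_rpow_of_exponent_le this (by linarith)
      _ = _ := rpow_one _
  have e4 : (2 : ℝ) ^ (-(N * θ * e')) ≤ 4 * ((1 / 2) ^ (B * e) * ((1 / 2) ^ d * (1 / 2) ^ d)) := by
    have : -((N : ℝ) * θ * e') ≤ 2 - (B * e + (d + d)) := by
      have hd' : (d : ℝ) ≤ e' + 1 := by exact_mod_cast hd
      have he' : (e : ℝ) ≤ e' := by exact_mod_cast he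
      have := mul_le_mul_of_nonneg_right hN (Nat.cast_nonneg (α := ℝ) e')
      have := mul_le_mul_of_nonneg_left he' (Nat.cast_nonneg (α := ℝ) B)
      nlinarith
    refine (rpow_le_rpow_of_exponent_le one_le_two this).trans (le_of_eq ?_)
    rw [rpow_sub two_pos, ← pow_add, ← pow_add, one_div, inv_pow, ← rpow_natCast 2 (B * e + _)]
    push_cast
    rw [div_eq_mul_inv]
    norm_num
  have e5 : l ^ ((1 + θ) / 2) = l ^ θ * l ^ ((1 - θ) / 2) := by
    rw [← rpow_add hl]; ring_nf
  have e6 : (2 : ℝ) ^ d * (1 / 2) ^ d = 1 := by rw [← mul_pow]; norm_num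
  rw [e1, e2, e5]
  calc C ^ θ * l ^ θ * (2 : ℝ) ^ (-(N * θ * e')) *
        ((5 * 2 ^ d : ℝ) ^ ((1 - θ) / 2) * l ^ ((1 - θ) / 2) * M ^ ((1 - θ) / 2))
      ≤ C ^ θ * l ^ θ * (4 * ((1 / 2) ^ (B * e) * ((1 / 2) ^ d * (1 / 2) ^ d))) *
        ((5 * 2 ^ d) * l ^ ((1 - θ) / 2) * M ^ ((1 - θ) / 2)) := by
        have : 0 ≤ l ^ ((1 - θ) / 2) := rpow_nonneg hl.le _
        have : 0 ≤ M ^ ((1 - θ) / 2) := rpow_nonneg hM.le _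
        have : 0 ≤ C ^ θ * l ^ θ := mul_nonneg (rpow_nonneg hC.le _) (rpow_nonneg hl.le _)
        gcongr
    _ = (20 * C ^ θ * (l ^ θ * l ^ ((1 - θ) / 2)) * M ^ ((1 - θ) / 2) * (1 / 2) ^ (B * e)) *
        (1 / 2) ^ d * ((2 : ℝ) ^ d * (1 / 2) ^ d) := by ring
    _ = _ := by rw [e6, mul_one]

lemma sum_half_pow_le (K : ℕ) : ∑ d ∈ Finset.range K, (1 / 2 : ℝ) ^ d ≤ 2 := by
  have := (summable_geometric_two).sum_le_tsum (Finset.range K) (fun _ _ => by positivity)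
  rwa [tsum_geometric_two] at this

namespace Par

lemma tri_eq_prod (D : Par) (f : Fin 3 → ℝ → ℂ) (Q : Finset Tile) :
    D.tri f Q = ∑ P ∈ Q, D.sc P.1 * ∏ j, ‖D.co j (f j) P‖ := by
  simp only [tri, Fin.prod_univ_three]

lemma rg_pos (D : Par) {Q : Finset Tile} (hQ : Q.Nonempty) : 0 < volume.real (D.rg Q 1) := by
  obtain ⟨P, hP⟩ := hQ
  have hs := D.sc_pos P.1
  have h : volume.real (Metric.closedBall (D.yy P) (1 * D.sc P.1)) ≤ volume.real (D.rg Q 1) :=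
    measureReal_mono (subset_biUnion_of_mem (u := fun P => Metric.closedBall (D.yy P) (1 * D.sc P.1)) hP)
      (D.rg_ne_top Q 1)
  rw [measureReal_def, Real.volume_closedBall, ENNReal.toReal_ofReal (by positivity)] at h
  linarith

lemma tri_le_shell (D : Par) {f : Fin 3 → ℝ → ℂ} (hf : ∀ j, Nice (f j)) {Q : Finset Tile}
    (hQ : Q.Nonempty) : ∃ M : ℕ, D.tri f Q ≤ ∑ d ∈ Fintype.piFinset fun _ : Fin 3 => Finset.range M,
      D.tri (fun j => D.shell Q (f j) (d j)) Q := by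
  choose M hM using fun j => D.norm_co_le_sum_shell j (hf j) hQ
  refine ⟨∑ j, M j + 1, ?_⟩
  simp only [tri_eq_prod]
  rw [Finset.sum_comm]
  refine Finset.sum_le_sum fun P _ => ?_
  rw [← Finset.mul_sum,
    ← Finset.prod_univ_sum (fun _ : Fin 3 => Finset.range (∑ j, M j + 1))
      (fun j d => ‖D.co j (D.shell Q (f j) d) P‖)]
  refine mul_le_mul_of_nonneg_left ?_ (D.sc_pos _).le
  refine Finset.prod_le_prod (fun _ _ => norm_nonneg _) fun j _ => (hM j P).trans ?_
  refine Finset.sum_le_sum_of_subset_of_nonneg (Finset.range_subset_range.2 ?_) fun _ _ _ => norm_nonneg _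
  have := Finset.single_le_sum (f := M) (fun _ _ => Nat.zero_le _) (Finset.mem_univ j)
  omega

lemma class_bound (B : ℕ) (θ : Fin 3 → ℝ) (h0 : ∀ j, 0 < θ j) (h1 : ∀ j, θ j < 1)
    (hθ : θ 0 + θ 1 + θ 2 = 1) : ∃ C : ℝ, 0 < C ∧ ∀ (D : Par) (f : Fin 3 → ℝ → ℂ),
    (∀ j, Nice (f j)) → (∀ j x, ‖f j x‖ ≤ 1) → ∀ (l : Fin 3 → ℝ), (∀ j, 0 < l j) →
    ∀ (Q : Finset Tile), (∀ j, D.Dens (f j) Q (l j)) → ∀ e : ℕ,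
    (e = 0 ∨ ∀ P ∈ Q, ∀ x, |D.yy P - x| < 2 ^ e * D.sc P.1 → f 2 x = 0) →
    D.tri f Q ≤ C * (volume.real (D.rg Q 1) * (1 / 2) ^ (B * e) * ∏ j, l j ^ ((1 + θ j) / 2)) := by
  obtain ⟨C1, hC1, hse⟩ := size_energy θ h0 h1 hθ
  obtain ⟨N, hN⟩ : ∃ N : ℕ, ∀ j, (B : ℝ) + 2 ≤ N * θ j := by
    obtain ⟨N, hN⟩ := exists_nat_ge (∑ j, ((B : ℝ) + 2) / θ j)
    refine ⟨N, fun j => ?_⟩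
    rw [← div_le_iff₀ (h0 j)]
    exact (Finset.single_le_sum (f := fun j => ((B : ℝ) + 2) / θ j)
      (fun i _ => div_nonneg (by positivity) (h0 i).le) (Finset.mem_univ j)).trans hN
  obtain ⟨C2, hC2, hsb⟩ := size_bound N
  refine ⟨C1 * (∏ j, (20 * C2 ^ θ j)) * 8, by positivity, fun D f hf hf1 l hl Q hd e he => ?_⟩
  rcases Q.eq_empty_or_nonempty with rfl | hQ
  · simp only [tri, Finset.sum_empty]
    have := Finset.prod_nonneg (s := Finset.univ) fun j _ => rpow_nonneg (hl j).le ((1 + θ j) / 2)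
    positivity
  set M := volume.real (D.rg Q 1) with hM
  have hM0 : 0 < M := D.rg_pos hQ
  obtain ⟨K, hK⟩ := D.tri_le_shell hf hQ
  refine hK.trans ?_
  set e0 : Fin 3 → ℕ := fun j => if j = 2 then e else 0 with he0
  set X : Fin 3 → ℝ := fun j => 20 * C2 ^ θ j * l j ^ ((1 + θ j) / 2) * M ^ ((1 - θ j) / 2) *
    (1 / 2) ^ (B * e0 j) with hX
  have hX0 : ∀ j, 0 ≤ X j := fun j => by
    have := rpow_nonneg (hl j).le ((1 + θ j) / 2)
    positivity
  have key : ∀ d : Fin 3 → ℕ, D.tri (fun j => D.shell Q (f j) (d j)) Q ≤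
      C1 * ∏ j, (X j * (1 / 2) ^ d j) := by
    intro d
    have hshd : ∀ j, D.Dens (D.shell Q (f j) (d j)) Q (l j) := fun j =>
      (hd j).of_norm_le (hf j) fun x => D.norm_shell_le Q (f j) _ x
    refine (hse D _ (fun j => D.shell_nice (hf j) Q _)
      (fun j => C2 * (l j / 2 ^ (N * max (d j - 1) (e0 j)))) (fun j => √(5 * 2 ^ d j * l j * M))
      (fun j => by have := hl j; positivity) (fun j => by have := hl j; positivity) (fun j => ?_) Q
      (fun j => ?_)).trans ?_
    · rw [sq_sqrt (by have := hl j; positivity)]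
      exact D.shell_energy (hf j) (hf1 j) (hl j).le (hd j) _
    · refine hsb D j _ (D.shell_nice (hf j) Q _) _ (hl j).le Q (hshd j) _ ?_
      rcases le_total (e0 j) (d j - 1) with h | h
      · rw [max_eq_left h]; exact D.shell_vanish Q (f j) (d j)
      · rw [max_eq_right h]
        by_cases hj : j = 2
        · subst hj
          simp only [he0, if_true]
          refine he.imp id fun h P hP x hx => ?_
          have := D.norm_shell_le Q (f 2) (d 2) x
          rw [h P hP x hx, norm_zero] at this
          exact norm_le_zero_iff.1 this
        · left; simp [he0, hj]
    · refine mul_le_mul_of_nonneg_left ?_ hC1.le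
      refine Finset.prod_le_prod (fun j _ => by have := hl j; positivity) fun j _ => ?_
      exact shell_factor_le (h0 j) (h1 j) hC2 (hl j) hM0 (hN j) (by omega) (le_max_right _ _)
  refine (Finset.sum_le_sum fun d _ => key d).trans ?_
  rw [← Finset.mul_sum, ← Finset.prod_univ_sum (fun _ : Fin 3 => Finset.range K)
      (fun j d => X j * (1 / 2) ^ d)]
  have h2 : ∏ j, ∑ d ∈ Finset.range K, X j * (1 / 2) ^ d ≤ ∏ j, X j * 2 := by
    refine Finset.prod_le_prod (fun j _ => Finset.sum_nonneg fun d _ => mul_nonneg (hX0 j) (by positivity))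
      fun j _ => ?_
    rw [← Finset.mul_sum]
    exact mul_le_mul_of_nonneg_left (sum_half_pow_le K) (hX0 j)
  refine (mul_le_mul_of_nonneg_left h2 hC1.le).trans (le_of_eq ?_)
  have h3 : ∏ j, M ^ ((1 - θ j) / 2) = M := by
    rw [Fin.prod_univ_three, ← rpow_add hM0, ← rpow_add hM0]
    rw [show (1 - θ 0) / 2 + (1 - θ 1) / 2 + (1 - θ 2) / 2 = 1 by linarith, rpow_one]
  have h4 : ∏ j, (1 / 2 : ℝ) ^ (B * e0 j) = (1 / 2) ^ (B * e) := by
    rw [Fin.prod_univ_three]; simp [he0]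
  simp only [hX, Finset.prod_mul_distrib, h3, h4]
  simp
  ring

end Par

lemma exists_exponents {α0 α1 : ℝ} (h0 : 0 < α0) (h0' : α0 < 1) (h1 : 0 < α1) (h1' : α1 < 1)
    (h : α0 + α1 < 3 / 2) : ∃ θ β : Fin 3 → ℝ, (∀ j, 0 < θ j) ∧ θ 0 + θ 1 + θ 2 = 1 ∧
      (∀ j, 0 ≤ β j) ∧ β 0 + β 1 + β 2 = 1 ∧ β 0 ≤ α0 ∧ β 1 ≤ α1 ∧
      α0 < (1 + θ 0) / 2 ∧ α1 < (1 + θ 1) / 2 ∧ β 2 < (1 + θ 2) / 2 ∧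
      α0 + α1 - (β 0 + β 1) ≤ 1 := by
  set L0 := max 0 (2 * α0 - 1) with hL0
  set L1 := max 0 (2 * α1 - 1) with hL1
  set L2 := max 0 (1 - 2 * (α0 + α1)) with hL2
  have a0 : 0 ≤ L0 := le_max_left _ _
  have a1 : 0 ≤ L1 := le_max_left _ _
  have a2 : 0 ≤ L2 := le_max_left _ _
  have b0 : 2 * α0 - 1 ≤ L0 := le_max_right _ _
  have b1 : 2 * α1 - 1 ≤ L1 := le_max_right _ _
  have b2 : 1 - 2 * (α0 + α1) ≤ L2 := le_max_right _ _
  have hs : L0 + L1 + L2 < 1 := by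
    rcases max_choice 0 (2 * α0 - 1) with e0 | e0 <;>
    rcases max_choice 0 (2 * α1 - 1) with e1 | e1 <;>
    rcases max_choice 0 (1 - 2 * (α0 + α1)) with e2 | e2 <;>
    rw [← hL0] at e0 <;> rw [← hL1] at e1 <;> rw [← hL2] at e2 <;> linarith
  set w := (1 - (L0 + L1 + L2)) / 3 with hw
  have hw0 : 0 < w := by rw [hw]; linarith
  set s := max 1 (α0 + α1) with hs'
  have s1 : 1 ≤ s := le_max_left _ _
  have s2 : α0 + α1 ≤ s := le_max_right _ _
  have s0 : 0 < s := by linarith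
  refine ⟨![L0 + w, L1 + w, L2 + w], ![α0 / s, α1 / s, 1 - (α0 + α1) / s], ?_, ?_, ?_, ?_, ?_, ?_,
    ?_, ?_, ?_, ?_⟩
  · intro j; fin_cases j <;> simp <;> linarith
  · simp; rw [hw]; ring
  · have : (α0 + α1) / s ≤ 1 := (div_le_one s0).2 s2
    intro j; fin_cases j <;> simp <;> first | positivity | linarith
  · simp; ring
  · simpa using div_le_self h0.le s1
  · simpa using div_le_self h1.le s1
  · simp; linarith
  · simp; linarith
  · simp only [Matrix.cons_val]
    rcases max_choice 1 (α0 + α1) with e | e <;> rw [← hs'] at e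
    · rw [e, div_one]; linarith
    · rw [e, div_self (by linarith)]; linarith
  · simp only [Matrix.cons_val]
    rw [← add_div]
    rcases max_choice 1 (α0 + α1) with e | e <;> rw [← hs'] at e
    · rw [e, div_one]; linarith
    · rw [e, div_self (by linarith)]; linarith

lemma class_arith {α0 α1 κ : ℝ} {θ β : Fin 3 → ℝ} (hβ : ∀ j, 0 ≤ β j) (hβ1 : β 0 + β 1 + β 2 = 1)
    (hb0 : β 0 ≤ α0) (hb1 : β 1 ≤ α1) (hκ : 1 ≤ κ) (hβ2 : α0 + α1 - (β 0 + β 1) ≤ 1) :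
    ∃ C : ℝ, 0 < C ∧ ∀ (δ F : Fin 3 → ℝ) (M : ℝ) (e : ℕ),
      (∀ j, 0 < δ j) → (∀ j, 0 < F j) → 0 < M → (∀ j, δ j * M ≤ 10 * F j) →
      (∀ j, j ≠ 2 → δ j ≤ κ * 2 ^ e * (F j / F 2)) →
      M * (1 / 2) ^ (2 * e) * ∏ j, (2 * δ j) ^ ((1 + θ j) / 2) ≤
        C * (F 0 ^ α0 * F 1 ^ α1 * F 2 ^ (1 - α0 - α1)) * ((1 / 2) ^ e *
          (δ 0 ^ ((1 + θ 0) / 2 - α0) * δ 1 ^ ((1 + θ 1) / 2 - α1) * δ 2 ^ ((1 + θ 2) / 2 - β 2))) := by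
  refine ⟨exp (log 2 * ((1 + θ 0) / 2) + log 2 * ((1 + θ 1) / 2) + log 2 * ((1 + θ 2) / 2) + log 10 +
    (α0 + α1 - (β 0 + β 1)) * log κ), exp_pos _, fun δ F M e hδ hF hM h1 h2 => ?_⟩
  have hM' : M = exp (log M) := (exp_log hM).symm
  have p1 : ∀ j, log (δ j) + log M ≤ log 10 + log (F j) := fun j => by
    rw [← log_mul (hδ j).ne' hM.ne', ← log_mul (by norm_num) (hF j).ne']
    exact log_le_log (mul_pos (hδ j) hM) (h1 j)
  have p2 : ∀ j, j ≠ 2 → log (δ j) ≤ log κ + e * log 2 + (log (F j) - log (F 2)) := fun j hj => by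
    rw [← log_div (hF j).ne' (hF 2).ne', ← log_pow, ← log_mul (by positivity) (by positivity),
      ← log_mul (by positivity) (by have := hF j; have := hF 2; positivity)]
    exact log_le_log (hδ j) (h2 j hj)
  have hh : ∀ n : ℕ, (1 / 2 : ℝ) ^ n = exp (-(n * log 2)) := fun n => by
    rw [exp_neg, mul_comm, exp_mul, exp_log two_pos, rpow_natCast]; simp
  have q : ∀ j, (2 * δ j) ^ ((1 + θ j) / 2) = exp ((log 2 + log (δ j)) * ((1 + θ j) / 2)) := fun j => by
    rw [rpow_def_of_pos (mul_pos two_pos (hδ j)), log_mul two_ne_zero (hδ j).ne']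
  rw [Fin.prod_univ_three, q, q, q, hh, hh, hM', rpow_def_of_pos (hF 0), rpow_def_of_pos (hF 1),
    rpow_def_of_pos (hF 2), rpow_def_of_pos (hδ 0), rpow_def_of_pos (hδ 1), rpow_def_of_pos (hδ 2)]
  simp only [← exp_add]
  rw [exp_le_exp]
  have r0 := mul_le_mul_of_nonneg_left (p1 0) (hβ 0)
  have r1 := mul_le_mul_of_nonneg_left (p1 1) (hβ 1)
  have r2 := mul_le_mul_of_nonneg_left (p1 2) (hβ 2)
  have t0 := mul_le_mul_of_nonneg_left (p2 0 (by decide)) (sub_nonneg.2 hb0)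
  have t1 := mul_le_mul_of_nonneg_left (p2 1 (by decide)) (sub_nonneg.2 hb1)
  have hl2 : 0 ≤ e * log 2 := mul_nonneg (Nat.cast_nonneg _) (log_nonneg one_le_two)
  have u := mul_le_mul_of_nonneg_right hβ2 hl2
  have e2 : β 2 = 1 - β 0 - β 1 := by linarith
  rw [e2] at r2 ⊢
  push_cast
  nlinarith

namespace Par
variable (D : Par)

lemma co_eq_zero {j : Fin 3} {f : ℝ → ℂ} (hf : Nice f) (h : ∫ x, ‖f x‖ = 0) (P : Tile) :
    D.co j f P = 0 := by
  rw [integral_eq_zero_iff_of_nonneg (fun _ => norm_nonneg _) hf.integrable.norm] at h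
  refine integral_eq_zero_of_ae ?_
  filter_upwards [h] with x hx
  simp at hx
  simp [hx]

lemma tri_eq_zero {f : Fin 3 → ℝ → ℂ} (hf : ∀ j, Nice (f j)) {j : Fin 3} (h : ∫ x, ‖f j x‖ = 0)
    (Q : Finset Tile) : D.tri f Q = 0 := by
  refine Finset.sum_eq_zero fun P _ => ?_
  have := D.co_eq_zero (j := j) (hf j) h P
  fin_cases j <;> simp at this <;> simp [this]

lemma exists_dens_index {f : ℝ → ℂ} (hf : Nice f) (h1 : ∀ x, ‖f x‖ ≤ 1) (h : ∫ x, ‖f x‖ ≠ 0)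
    (P : Tile) : ∃ n : ℕ, (∃ r, D.sc P.1 ≤ r ∧
        (1 / 2) ^ n * r < ∫ x in Metric.closedBall (D.yy P) r, ‖f x‖) ∧
      ∀ r, D.sc P.1 ≤ r → ∫ x in Metric.closedBall (D.yy P) r, ‖f x‖ ≤ 2 * (1 / 2) ^ n * r := by
  have hs := D.sc_pos P.1
  have hex : ∃ n : ℕ, ∃ r, D.sc P.1 ≤ r ∧
        (1 / 2) ^ n * r < ∫ x in Metric.closedBall (D.yy P) r, ‖f x‖ := by
    obtain ⟨R, hR⟩ := hf.2.2
    set r := max (D.sc P.1) (|R| + |D.yy P|) with hr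
    have hr1 : D.sc P.1 ≤ r := le_max_left _ _
    have hr0 : 0 < r := hs.trans_le hr1
    have e : ∫ x in Metric.closedBall (D.yy P) r, ‖f x‖ = ∫ x, ‖f x‖ := by
      refine setIntegral_eq_integral_of_forall_compl_eq_zero fun x hx => ?_
      rw [norm_eq_zero]
      apply hR
      rw [Metric.mem_closedBall, Real.dist_eq, not_le] at hx
      have := abs_sub x (D.yy P)
      have : |R| + |D.yy P| ≤ r := le_max_right _ _
      have := le_abs_self R
      linarith
    have hp : 0 < ∫ x, ‖f x‖ := lt_of_le_of_ne (integral_nonneg fun _ => norm_nonneg _) (Ne.symm h)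
    obtain ⟨n, hn⟩ := exists_pow_lt_of_lt_one (div_pos hp hr0) (by norm_num : (1 / 2 : ℝ) < 1)
    refine ⟨n, r, hr1, ?_⟩
    rw [e]
    exact (lt_div_iff₀ hr0).1 hn
  refine ⟨Nat.find hex, Nat.find_spec hex, fun r hr => ?_⟩
  have hr0 : 0 < r := hs.trans_le hr
  rcases Nat.eq_zero_or_pos (Nat.find hex) with h0 | h0
  · rw [h0, pow_zero]
    have : ∫ x in Metric.closedBall (D.yy P) r, ‖f x‖ ≤ ∫ x in Metric.closedBall (D.yy P) r, (1 : ℝ) := by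
      refine integral_mono (hf.integrableOn_norm _) ?_ h1
      exact integrableOn_const (by rw [Real.volume_closedBall]; exact ENNReal.ofReal_ne_top)
    refine this.trans (le_of_eq ?_)
    rw [setIntegral_const, measureReal_def, Real.volume_closedBall, ENNReal.toReal_ofReal (by positivity)]
    simp
  · have := Nat.find_min hex (m := Nat.find hex - 1) (by omega)
    push Not at this
    refine (this r hr).trans (le_of_eq ?_)
    congr 1
    rw [← pow_sub_one_mul h0.ne' (1 / 2 : ℝ)]
    ring

lemma exists_whitney_index {Ω : Set ℝ} (h : Ωᶜ.Nonempty) (P : Tile) :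
    ∃ e : ℕ, (∃ x ∉ Ω, |D.yy P - x| < 2 ^ (e + 1) * D.sc P.1) ∧
      (e = 0 ∨ ∀ x, |D.yy P - x| < 2 ^ e * D.sc P.1 → x ∈ Ω) := by
  have hs := D.sc_pos P.1
  have hex : ∃ e : ℕ, ∃ x ∉ Ω, |D.yy P - x| < 2 ^ (e + 1) * D.sc P.1 := by
    obtain ⟨x, hx⟩ := h
    obtain ⟨e, he⟩ := pow_unbounded_of_one_lt (|D.yy P - x| / D.sc P.1) (by norm_num : (1 : ℝ) < 2)
    refine ⟨e, x, hx, ?_⟩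
    rw [div_lt_iff₀ hs] at he
    refine he.trans_le ?_
    gcongr
    · norm_num
    · omega
  refine ⟨Nat.find hex, Nat.find_spec hex, ?_⟩
  rcases Nat.eq_zero_or_pos (Nat.find hex) with h0 | h0
  · exact Or.inl h0
  · right
    intro x hx
    have := Nat.find_min hex (m := Nat.find hex - 1) (by omega)
    push Not at this
    by_contra hxΩ
    have := this x hxΩ
    rw [Nat.sub_add_cancel h0] at this
    linarith

end Par

lemma sum_pow_le {ρ : ℝ} (h0 : 0 ≤ ρ) (h1 : ρ < 1) (K : ℕ) :
    ∑ d ∈ Finset.range K, ρ ^ d ≤ (1 - ρ)⁻¹ := by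
  have := (summable_geometric_of_lt_one h0 h1).sum_le_tsum (Finset.range K) (fun _ _ => by positivity)
  rwa [tsum_geometric_of_lt_one h0 h1] at this

/-- Restricted weak type estimate for tiles. -/
lemma rwt_tiles {α0 α1 κ : ℝ} (h0 : 0 < α0) (h0' : α0 < 1) (h1 : 0 < α1) (h1' : α1 < 1)
    (h : α0 + α1 < 3 / 2) (hκ : 1 ≤ κ) : ∃ C : ℝ, 0 < C ∧ ∀ (D : Par) (f : Fin 3 → ℝ → ℂ)
    (F : Fin 3 → ℝ) (Ω : Set ℝ), (∀ j, Nice (f j)) → (∀ j x, ‖f j x‖ ≤ 1) → (∀ j, 0 < F j) →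
    (∀ j, ∫ x, ‖f j x‖ ≤ F j) → (∀ x ∈ Ω, f 2 x = 0) →
    (∀ j, j ≠ 2 → ∀ x ∉ Ω, ∀ r, 0 < r → ∫ y in Metric.closedBall x r, ‖f j y‖ ≤ κ * (F j / F 2) * r) →
    ∀ Q, D.tri f Q ≤ C * (F 0 ^ α0 * F 1 ^ α1 * F 2 ^ (1 - α0 - α1)) := by
  obtain ⟨θ, β, hθ0, hθ, hβ0, hβ, hb0, hb1, hg0, hg1, hg2, hβ2⟩ := exists_exponents h0 h0' h1 h1' h
  have hθ1 : ∀ j, θ j < 1 := fun j => by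
    have := hθ0 0; have := hθ0 1; have := hθ0 2
    fin_cases j <;> simp <;> linarith
  obtain ⟨C1, hC1, hcb⟩ := Par.class_bound 2 θ hθ0 hθ1 hθ
  obtain ⟨C2, hC2, har⟩ := class_arith (κ := 3 * κ) (θ := θ) hβ0 hβ hb0 hb1 (by linarith) hβ2
  set g : Fin 3 → ℝ := ![(1 + θ 0) / 2 - α0, (1 + θ 1) / 2 - α1, (1 + θ 2) / 2 - β 2] with hg
  have hgpos : ∀ j, 0 < g j := by intro j; fin_cases j <;> simp [hg] <;> linarith
  set ρ : Fin 3 → ℝ := fun j => (1 / 2 : ℝ) ^ g j with hρ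
  have hρ0 : ∀ j, 0 < ρ j := fun j => rpow_pos_of_pos (by norm_num) _
  have hρ1 : ∀ j, ρ j < 1 := fun j => rpow_lt_one (by norm_num) (by norm_num) (hgpos j)
  have hρ1' : ∀ j, 0 < (1 - ρ j)⁻¹ := fun j => inv_pos.2 (sub_pos.2 (hρ1 j))
  refine ⟨C1 * C2 * ((∏ j, (1 - ρ j)⁻¹) * 2), mul_pos (mul_pos hC1 hC2) (mul_pos
    (Finset.prod_pos fun j _ => hρ1' j) two_pos), fun D f F Ω hf hf1 hF hfF hΩ hmax Q => ?_⟩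
  set W := F 0 ^ α0 * F 1 ^ α1 * F 2 ^ (1 - α0 - α1) with hW
  have hW0 : 0 < W := by
    have := hF 0; have := hF 1; have := hF 2
    positivity
  have hC0 : 0 < C1 * C2 * ((∏ j, (1 - ρ j)⁻¹) * 2) := mul_pos (mul_pos hC1 hC2) (mul_pos
    (Finset.prod_pos fun j _ => hρ1' j) two_pos)
  by_cases hz : ∃ j, ∫ x, ‖f j x‖ = 0
  · obtain ⟨j, hj⟩ := hz
    rw [D.tri_eq_zero hf hj]
    positivity
  push Not at hz
  have hΩne : Ωᶜ.Nonempty := by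
    by_contra! hne
    rw [compl_empty_iff] at hne
    apply hz 2
    rw [hne] at hΩ
    simp [fun x => hΩ x (mem_univ x)]
  choose n hn1 hn2 using fun j => D.exists_dens_index (hf j) (hf1 j) (hz j)
  choose e he1 he2 using D.exists_whitney_index hΩne
  set c : Tile → (Fin 3 → ℕ) × ℕ := fun P => (fun j => n j P, e P) with hc
  obtain ⟨K, hK⟩ : ∃ K, ∀ P ∈ Q, (∀ j, n j P < K) ∧ e P < K := by
    refine ⟨∑ P ∈ Q, (∑ j, n j P + e P) + 1, fun P hP => ?_⟩
    have := Finset.single_le_sum (f := fun P => ∑ j, n j P + e P) (fun _ _ => Nat.zero_le _) hP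
    refine ⟨fun j => ?_, by omega⟩
    have := Finset.single_le_sum (f := fun j => n j P) (fun _ _ => Nat.zero_le _) (Finset.mem_univ j)
    omega
  set t := (Fintype.piFinset fun _ : Fin 3 => Finset.range K) ×ˢ Finset.range K with ht
  have hmaps : ∀ P ∈ Q, c P ∈ t := fun P hP => by
    simp only [ht, hc, Finset.mem_product, Fintype.mem_piFinset, Finset.mem_range]
    exact hK P hP
  have hcls : ∀ y ∈ t, D.tri f (Q.filter fun P => c P = y) ≤
      C1 * C2 * W * ((∏ j, ρ j ^ y.1 j) * (1 / 2) ^ y.2) := by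
    rintro ⟨m, d⟩ -
    set Q' := Q.filter fun P => c P = (m, d) with hQ'
    have hmem : ∀ P ∈ Q', (∀ j, n j P = m j) ∧ e P = d := by
      intro P hP
      have := (Finset.mem_filter.1 hP).2
      simp only [hc, Prod.mk.injEq] at this
      exact ⟨fun j => congrFun this.1 j, this.2⟩
    rcases Q'.eq_empty_or_nonempty with hemp | hne
    · rw [hemp]
      simp only [Par.tri, Finset.sum_empty]
      have := Finset.prod_nonneg (s := Finset.univ) fun j _ => pow_nonneg (hρ0 j).le (m j)
      positivity
    obtain ⟨P0, hP0⟩ := hne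
    have hM0 := D.rg_pos ⟨P0, hP0⟩
    have b1 := hcb D f hf hf1 (fun j => 2 * (1 / 2) ^ m j) (fun j => by positivity) Q'
      (fun j P hP r hr => by
        have := hn2 j P r hr
        rwa [(hmem P hP).1 j] at this) d (by
        by_cases hd : d = 0
        · exact Or.inl hd
        · right
          intro P hP x hx
          rcases he2 P with h3 | h3
          · exact absurd ((hmem P hP).2.symm.trans h3) hd
          · rw [(hmem P hP).2] at h3
            exact hΩ x (h3 x hx))
    have b2 := har (fun j => (1 / 2) ^ m j) F _ d (fun j => by positivity) hF hM0
      (fun j => by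
        refine (D.rg_measure_le (hf j) (by positivity) fun P hP => ?_).trans
          (mul_le_mul_of_nonneg_left (hfF j) (by norm_num))
        have := hn1 j P
        rwa [(hmem P hP).1 j] at this)
      (fun j hj => by
        obtain ⟨r, hr1, hr2⟩ := hn1 j P0
        obtain ⟨x, hx1, hx2⟩ := he1 P0
        rw [(hmem P0 hP0).1 j] at hr2
        rw [(hmem P0 hP0).2] at hx2
        have hs := D.sc_pos P0.1
        have hr0 : 0 < r := hs.trans_le hr1
        have hFF : 0 < F j / F 2 := div_pos (hF j) (hF 2)
        have hsub : Metric.closedBall (D.yy P0) r ⊆ Metric.closedBall x (r + 2 ^ (d + 1) * D.sc P0.1) := by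
          refine Metric.closedBall_subset_closedBall' ?_
          rw [Real.dist_eq]
          linarith
        have h5 := setIntegral_mono_set ((hf j).integrableOn_norm
          (Metric.closedBall x (r + 2 ^ (d + 1) * D.sc P0.1))) (ae_of_all _ fun _ => norm_nonneg _)
          hsub.eventuallyLE
        have h6 := hmax j hj x hx1 (r + 2 ^ (d + 1) * D.sc P0.1) (by positivity)
        have h7 : r + 2 ^ (d + 1) * D.sc P0.1 ≤ 3 * 2 ^ d * r := by
          have : (1 : ℝ) ≤ 2 ^ d := one_le_pow₀ one_le_two
          rw [pow_succ]
          nlinarith [mul_le_mul_of_nonneg_left hr1 (by positivity : (0 : ℝ) ≤ 2 ^ d)]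
        have h8 := mul_le_mul_of_nonneg_left h7 (by positivity : 0 ≤ κ * (F j / F 2))
        have h9 := (hr2.le.trans (h5.trans h6)).trans h8
        refine le_of_mul_le_mul_right (h9.trans (le_of_eq ?_)) hr0
        ring)
    refine b1.trans ((mul_le_mul_of_nonneg_left b2 hC1.le).trans (le_of_eq ?_))
    have hpow : ∀ j, ((1 / 2 : ℝ) ^ m j) ^ g j = ρ j ^ m j := fun j => by
      rw [← rpow_natCast, ← rpow_natCast, ← rpow_mul (by norm_num), ← rpow_mul (by norm_num), mul_comm]
    rw [Fin.prod_univ_three, ← hpow, ← hpow, ← hpow]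
    simp only [hg, Matrix.cons_val, hW]
    ring
  have hsum : D.tri f Q = ∑ y ∈ t, D.tri f (Q.filter fun P => c P = y) :=
    (Finset.sum_fiberwise_of_maps_to hmaps _).symm
  rw [hsum]
  refine (Finset.sum_le_sum hcls).trans ?_
  rw [← Finset.mul_sum, ht, Finset.sum_product]
  simp only [← Finset.mul_sum]
  rw [← Finset.sum_mul, ← Finset.prod_univ_sum (fun _ : Fin 3 => Finset.range K) (fun j d => ρ j ^ d)]
  have hA : ∏ j, ∑ d ∈ Finset.range K, ρ j ^ d ≤ ∏ j, (1 - ρ j)⁻¹ :=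
    Finset.prod_le_prod (fun j _ => Finset.sum_nonneg fun d _ => pow_nonneg (hρ0 j).le _)
      fun j _ => sum_pow_le (hρ0 j).le (hρ1 j) K
  have hB := mul_le_mul hA (sum_half_pow_le K) (Finset.sum_nonneg fun d _ => by positivity)
    (Finset.prod_nonneg fun j _ => (hρ1' j).le)
  refine (mul_le_mul_of_nonneg_left hB (by positivity)).trans (le_of_eq (by ring))

/-- Frequency data of a trilinear form. -/
structure Sym where
  a : Fin 3 → ℝ
  b : Fin 3 → ℝ
  ha1 : ∀ j, 1 ≤ |a j|
  ha2 : ∀ j, |a j| ≤ 2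
  hκ1 : ∀ i j, i ≠ j → 100 ≤ |b j - a j * b i / a i|
  hκ2 : ∀ i j, i ≠ j → |b j - a j * b i / a i| ≤ 200

namespace Sym

variable (G : Sym)

/-- The wave packet at `z = (t, η, y)` in slot `j`. -/
noncomputable def pkz (j : Fin 3) (z : ℝ × ℝ × ℝ) (x : ℝ) : ℂ :=
  pk z.1 (G.a j * z.2.1 + G.b j / z.1) z.2.2 x

/-- The wave packet coefficient of `f`. -/
noncomputable def cf (j : Fin 3) (f : ℝ → ℂ) (z : ℝ × ℝ × ℝ) : ℂ := ∫ x, f x * G.pkz j z x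

/-- Truncated measure on the space of wave packets. -/
noncomputable def mK (R : ℝ) : Measure (ℝ × ℝ × ℝ) :=
  (volume.restrict (Icc (1 / R) R)).prod ((volume.restrict (Icc (-R) R)).prod volume)

/-- The truncated model operator. -/
noncomputable def T (R : ℝ) (f g : ℝ → ℂ) (x : ℝ) : ℂ :=
  ∫ z, G.cf 0 f z * G.cf 1 g z * G.pkz 2 z x ∂mK R

/-- Permutation of the slots. -/
def perm (σ : Equiv.Perm (Fin 3)) : Sym where
  a := G.a ∘ σ
  b := G.b ∘ σ
  ha1 j := G.ha1 (σ j)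
  ha2 j := G.ha2 (σ j)
  hκ1 i j h := G.hκ1 (σ i) (σ j) (σ.injective.ne h)
  hκ2 i j h := G.hκ2 (σ i) (σ j) (σ.injective.ne h)

lemma perm_cf (σ : Equiv.Perm (Fin 3)) (j : Fin 3) : (G.perm σ).cf j = G.cf (σ j) := rfl
lemma perm_pkz (σ : Equiv.Perm (Fin 3)) (j : Fin 3) : (G.perm σ).pkz j = G.pkz (σ j) := rfl

instance (R : ℝ) : SFinite (mK R) := by unfold mK; infer_instance

lemma mK_eq (R : ℝ) : mK R = volume.restrict (Icc (1 / R) R ×ˢ (Icc (-R) R ×ˢ univ)) := by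
  unfold mK
  nth_rewrite 3 [← Measure.restrict_univ (μ := volume)]
  rw [Measure.prod_restrict, Measure.prod_restrict]
  rfl

lemma mK_ae (R : ℝ) : ∀ᵐ z ∂mK R, z.1 ∈ Icc (1 / R) R ∧ z.2.1 ∈ Icc (-R) R := by
  rw [mK_eq]
  filter_upwards [ae_restrict_mem (measurableSet_Icc.prod (measurableSet_Icc.prod MeasurableSet.univ))]
    with z hz
  exact ⟨hz.1, hz.2.1⟩

lemma pkz_measurable (j : Fin 3) : Measurable fun w : (ℝ × ℝ × ℝ) × ℝ => G.pkz j w.1 w.2 := by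
  have := psi_differentiable.continuous.measurable
  unfold pkz pk
  fun_prop

lemma pkz_measurable_left (j : Fin 3) (x : ℝ) : Measurable fun z => G.pkz j z x :=
  Measurable.comp (g := fun w : (ℝ × ℝ × ℝ) × ℝ => G.pkz j w.1 w.2) (f := fun z => (z, x))
    (G.pkz_measurable j) (measurable_id.prodMk measurable_const)

lemma pkz_measurable_right (j : Fin 3) (z : ℝ × ℝ × ℝ) : Measurable (G.pkz j z) :=
  Measurable.comp (g := fun w : (ℝ × ℝ × ℝ) × ℝ => G.pkz j w.1 w.2) (f := fun x => (z, x))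
    (G.pkz_measurable j) (measurable_const.prodMk measurable_id)

lemma pkz_bound {R : ℝ} (hR : 1 ≤ R) (j : Fin 3) : ∃ C : ℝ, 0 < C ∧ ∀ᵐ z ∂mK R, ∀ x,
    ‖G.pkz j z x‖ ≤ C * br 2 R (z.2.2 - x) := by
  obtain ⟨C, hC, h⟩ := pk_bound 2
  refine ⟨C * R, by positivity, ?_⟩
  filter_upwards [mK_ae R] with z hz x
  have hz0 : 0 < z.1 := lt_of_lt_of_le (by positivity) hz.1.1
  refine (h z.1 _ z.2.2 x hz0).trans ?_
  rw [mul_assoc]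
  refine mul_le_mul_of_nonneg_left ?_ hC.le
  refine mul_le_mul ?_ (br_mono_scale 2 hz0 hz.1.2 _) (br_nonneg _ hz0 _) (by positivity)
  rw [inv_le_comm₀ hz0 (by positivity), ← one_div]
  exact hz.1.1

lemma pkz_bounded {R : ℝ} (hR : 1 ≤ R) (j : Fin 3) : ∃ C : ℝ, 0 < C ∧ ∀ᵐ z ∂mK R, ∀ x,
    ‖G.pkz j z x‖ ≤ C := by
  obtain ⟨C, hC, h⟩ := G.pkz_bound hR j
  refine ⟨C, hC, ?_⟩
  filter_upwards [h] with z hz x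
  refine (hz x).trans (mul_le_of_le_one_right hC.le (br_le_one _ (by positivity) _))

lemma br_integrable_mK {R : ℝ} (hR : 1 ≤ R) (x : ℝ) : Integrable (fun z => br 2 R (z.2.2 - x)) (mK R) := by
  have h1 := br_integrable_sub (by positivity : (0 : ℝ) < R) x
  have h2 : Integrable (fun _ : ℝ => (1 : ℝ)) (volume.restrict (Icc (-R) R)) := integrable_const _
  have h3 : Integrable (fun _ : ℝ => (1 : ℝ)) (volume.restrict (Icc (1 / R) R)) := integrable_const _
  have := h3.mul_prod (h2.mul_prod h1)
  simp only [one_mul] at this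
  exact this

lemma br_integral_mK {R : ℝ} (hR : 1 ≤ R) (x : ℝ) : ∫ z, br 2 R (z.2.2 - x) ∂mK R =
    (volume.real (Icc (1 / R) R)) * (volume.real (Icc (-R) R) * (R * I0)) := by
  have h := integral_prod_mul (μ := volume.restrict (Icc (1 / R) R))
    (ν := (volume.restrict (Icc (-R) R)).prod (volume : Measure ℝ)) (fun _ => (1 : ℝ))
    (fun w => br 2 R (w.2 - x))
  have h' := integral_prod_mul (μ := volume.restrict (Icc (-R) R)) (ν := (volume : Measure ℝ))
    (fun _ => (1 : ℝ)) (fun y => br 2 R (y - x))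
  rw [br_integral_sub (by positivity)] at h'
  simp only [one_mul, integral_const, smul_eq_mul, mul_one] at h h'
  rw [h'] at h
  unfold mK
  rw [h]
  simp [Measure.real]

variable {G}

lemma pkz_prod_integrable {R : ℝ} (hR : 1 ≤ R) (j : Fin 3) {f : ℝ → ℂ} (hf : Integrable f) :
    Integrable (fun w : (ℝ × ℝ × ℝ) × ℝ => f w.2 * G.pkz j w.1 w.2) ((mK R).prod volume) := by
  obtain ⟨C, hC, h⟩ := G.pkz_bound hR j
  have hm : AEStronglyMeasurable (fun w : (ℝ × ℝ × ℝ) × ℝ => f w.2 * G.pkz j w.1 w.2)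
      ((mK R).prod volume) :=
    hf.1.comp_snd.mul (G.pkz_measurable j).aestronglyMeasurable
  rw [integrable_prod_iff' hm]
  have h1 : ∀ x, Integrable (fun z => f x * G.pkz j z x) (mK R) := fun x => by
    refine Integrable.const_mul (((br_integrable_mK hR x).const_mul C).mono'
      (G.pkz_measurable_left j x).aestronglyMeasurable ?_) _
    filter_upwards [h] with z hz using hz x
  refine ⟨ae_of_all _ h1, ?_⟩
  refine (hf.norm.mul_const (C * ((volume.real (Icc (1 / R) R)) *
    (volume.real (Icc (-R) R) * (R * I0))))).mono' hm.norm.prod_swap.integral_prod_right' ?_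
  refine ae_of_all _ fun x => ?_
  rw [norm_of_nonneg (integral_nonneg fun _ => norm_nonneg _)]
  simp only [norm_mul]
  rw [integral_const_mul]
  refine mul_le_mul_of_nonneg_left ?_ (norm_nonneg _)
  rw [← br_integral_mK hR x, ← integral_const_mul]
  refine integral_mono_of_nonneg (ae_of_all _ fun _ => norm_nonneg _)
    ((br_integrable_mK hR x).const_mul C) ?_
  filter_upwards [h] with z hz using hz x

lemma cf_integrable {R : ℝ} (hR : 1 ≤ R) (j : Fin 3) {f : ℝ → ℂ} (hf : Integrable f) :
    Integrable (G.cf j f) (mK R) := (pkz_prod_integrable hR j hf).integral_prod_left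

lemma mul_pkz_integrable {R : ℝ} (hR : 1 ≤ R) (j : Fin 3) {f : ℝ → ℂ} (hf : Integrable f) :
    ∀ᵐ z ∂mK R, Integrable fun x => f x * G.pkz j z x := by
  obtain ⟨C, hC, h⟩ := G.pkz_bounded hR j
  filter_upwards [h] with z hz
  exact hf.mul_bdd (c := C) (G.pkz_measurable_right j z).aestronglyMeasurable (ae_of_all _ hz)

lemma cf_bound {R : ℝ} (hR : 1 ≤ R) (j : Fin 3) : ∃ C : ℝ, 0 < C ∧ ∀ f : ℝ → ℂ, Integrable f →
    ∀ᵐ z ∂mK R, ‖G.cf j f z‖ ≤ C * ∫ x, ‖f x‖ := by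
  obtain ⟨C, hC, h⟩ := G.pkz_bounded hR j
  refine ⟨C, hC, fun f hf => ?_⟩
  filter_upwards [h] with z hz
  rw [mul_comm, ← integral_mul_const]
  refine norm_integral_le_of_norm_le (hf.norm.mul_const C) (ae_of_all _ fun x => ?_)
  rw [norm_mul]
  exact mul_le_mul_of_nonneg_left (hz x) (norm_nonneg _)

lemma cf_mul_integrable {R : ℝ} (hR : 1 ≤ R) (i j : Fin 3) {f g : ℝ → ℂ} (hf : Integrable f)
    (hg : Integrable g) : Integrable (fun z => G.cf i f z * G.cf j g z) (mK R) := by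
  obtain ⟨C, hC, h⟩ := G.cf_bound hR j
  exact (cf_integrable hR i hf).mul_bdd (cf_integrable hR j hg).1 (h g hg)

lemma T_integrand_integrable {R : ℝ} (hR : 1 ≤ R) {f g : ℝ → ℂ} (hf : Integrable f)
    (hg : Integrable g) (x : ℝ) : Integrable (fun z => G.cf 0 f z * G.cf 1 g z * G.pkz 2 z x) (mK R) := by
  obtain ⟨C, hC, h⟩ := G.pkz_bounded hR 2
  exact (cf_mul_integrable hR 0 1 hf hg).mul_bdd (c := C) (G.pkz_measurable_left 2 x).aestronglyMeasurable
    (by filter_upwards [h] with z hz using hz x)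

lemma cf_add {R : ℝ} (hR : 1 ≤ R) (j : Fin 3) {f g : ℝ → ℂ} (hf : Integrable f) (hg : Integrable g) :
    G.cf j (f + g) =ᵐ[mK R] G.cf j f + G.cf j g := by
  filter_upwards [mul_pkz_integrable (G := G) hR j hf, mul_pkz_integrable (G := G) hR j hg] with z h1 h2
  simp only [cf, Pi.add_apply, add_mul]
  exact integral_add h1 h2

lemma cf_smul (j : Fin 3) (c : ℂ) (f : ℝ → ℂ) : G.cf j (c • f) = c • G.cf j f := by
  ext z
  simp only [cf, Pi.smul_apply, smul_eq_mul, mul_assoc]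
  exact integral_const_mul _ _

lemma T_add_left {R : ℝ} (hR : 1 ≤ R) {f f' g : ℝ → ℂ} (hf : Integrable f) (hf' : Integrable f')
    (hg : Integrable g) : G.T R (f + f') g = G.T R f g + G.T R f' g := by
  ext x
  simp only [T, Pi.add_apply]
  rw [← integral_add (T_integrand_integrable hR hf hg x) (T_integrand_integrable hR hf' hg x)]
  refine integral_congr_ae ?_
  filter_upwards [cf_add (G := G) hR 0 hf hf'] with z hz
  rw [hz]
  simp only [Pi.add_apply]
  ring

lemma T_add_right {R : ℝ} (hR : 1 ≤ R) {f g g' : ℝ → ℂ} (hf : Integrable f) (hg : Integrable g)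
    (hg' : Integrable g') : G.T R f (g + g') = G.T R f g + G.T R f g' := by
  ext x
  simp only [T, Pi.add_apply]
  rw [← integral_add (T_integrand_integrable hR hf hg x) (T_integrand_integrable hR hf hg' x)]
  refine integral_congr_ae ?_
  filter_upwards [cf_add (G := G) hR 1 hg hg'] with z hz
  rw [hz]
  simp only [Pi.add_apply]
  ring

lemma T_smul_left (R : ℝ) (c : ℂ) (f g : ℝ → ℂ) : G.T R (c • f) g = c • G.T R f g := by
  ext x
  simp only [T, cf_smul, Pi.smul_apply, smul_eq_mul]
  rw [← integral_const_mul]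
  simp only [mul_assoc]

lemma T_smul_right (R : ℝ) (c : ℂ) (f g : ℝ → ℂ) : G.T R f (c • g) = c • G.T R f g := by
  ext x
  simp only [T, cf_smul, Pi.smul_apply, smul_eq_mul]
  rw [← integral_const_mul]
  congr 1; ext z; ring

lemma T_bound {R : ℝ} (hR : 1 ≤ R) : ∃ C : ℝ, 0 < C ∧ ∀ f g : ℝ → ℂ, Integrable f → Integrable g →
    ∀ x, ‖G.T R f g x‖ ≤ C * ((∫ x, ‖f x‖) * ∫ x, ‖g x‖) := by
  obtain ⟨C0, hC0, h0⟩ := G.cf_bound hR 0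
  obtain ⟨C1, hC1, h1⟩ := G.cf_bound hR 1
  obtain ⟨C2, hC2, h2⟩ := G.pkz_bound hR 2
  set V := (volume.real (Icc (1 / R) R)) * (volume.real (Icc (-R) R) * (R * I0)) with hV
  have hV0 : 0 ≤ V := by have := I0_nonneg; positivity
  refine ⟨C0 * C1 * C2 * V + 1, by positivity, fun f g hf hg x => ?_⟩
  have A : 0 ≤ ∫ x, ‖f x‖ := integral_nonneg fun _ => norm_nonneg _
  have B : 0 ≤ ∫ x, ‖g x‖ := integral_nonneg fun _ => norm_nonneg _
  have : ‖G.T R f g x‖ ≤ ∫ z, (C0 * ∫ x, ‖f x‖) * (C1 * ∫ x, ‖g x‖) * C2 * br 2 R (z.2.2 - x) ∂mK R := by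
    refine norm_integral_le_of_norm_le ((br_integrable_mK hR x).const_mul _) ?_
    filter_upwards [h0 f hf, h1 g hg, h2] with z a0 a1 a2
    rw [norm_mul, norm_mul, mul_assoc _ C2]
    exact mul_le_mul (mul_le_mul a0 a1 (norm_nonneg _) (by positivity)) (a2 x) (norm_nonneg _) (by positivity)
  refine this.trans ?_
  rw [integral_const_mul, br_integral_mK hR]
  have := mul_nonneg A B
  nlinarith

lemma T_prod_integrable {R : ℝ} (hR : 1 ≤ R) {f g h : ℝ → ℂ} (hf : Integrable f) (hg : Integrable g)
    (hh : Integrable h) : Integrable (fun w : (ℝ × ℝ × ℝ) × ℝ =>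
      G.cf 0 f w.1 * G.cf 1 g w.1 * G.pkz 2 w.1 w.2 * h w.2) ((mK R).prod volume) := by
  obtain ⟨C, hC, hb⟩ := G.cf_bound hR 0
  obtain ⟨C1, hC1, hb1⟩ := G.cf_bound hR 1
  have h1 := pkz_prod_integrable (G := G) hR 2 hh
  have h2 : Integrable (fun w : (ℝ × ℝ × ℝ) × ℝ => (h w.2 * G.pkz 2 w.1 w.2) *
      (G.cf 0 f w.1 * G.cf 1 g w.1)) ((mK R).prod volume) := by
    refine h1.mul_bdd (c := (C * ∫ x, ‖f x‖) * (C1 * ∫ x, ‖g x‖))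
      (cf_mul_integrable hR 0 1 hf hg).1.comp_fst ?_
    have := (Measure.quasiMeasurePreserving_fst (μ := mK R) (ν := (volume : Measure ℝ))).ae
      ((hb f hf).and (hb1 g hg))
    filter_upwards [this] with w hw
    rw [norm_mul]
    exact mul_le_mul hw.1 hw.2 (norm_nonneg _) ((norm_nonneg _).trans hw.1)
  refine h2.congr (ae_of_all _ fun w => ?_)
  simp only
  ring

lemma T_mul_integral {R : ℝ} (hR : 1 ≤ R) {f g h : ℝ → ℂ} (hf : Integrable f) (hg : Integrable g)
    (hh : Integrable h) : ∫ x, G.T R f g x * h x =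
      ∫ z, G.cf 0 f z * G.cf 1 g z * G.cf 2 h z ∂mK R := by
  have := integral_integral_swap (f := fun z x => G.cf 0 f z * G.cf 1 g z * G.pkz 2 z x * h x)
    (T_prod_integrable (G := G) hR hf hg hh)
  simp only [T, ← integral_mul_const]
  rw [← this]
  congr 1; ext z
  rw [show G.cf 2 h z = ∫ x, h x * G.pkz 2 z x from rfl, ← integral_const_mul]
  refine integral_congr_ae (ae_of_all _ fun x => ?_)
  ring

/-- The adjoint of the model operator in the first slot. -/
lemma T_adjoint {R : ℝ} (hR : 1 ≤ R) {f g h : ℝ → ℂ} (hf : Integrable f) (hg : Integrable g)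
    (hh : Integrable h) : ∫ x, G.T R f g x * h x =
      ∫ x, (G.perm (Equiv.swap 0 2)).T R h g x * f x := by
  rw [T_mul_integral hR hf hg hh, T_mul_integral hR hh hg hf]
  simp only [perm_cf]
  congr 1; ext z
  simp [Equiv.swap_apply_def]
  ring

/-- Exchanging the two arguments. -/
lemma T_swap (R : ℝ) (f g : ℝ → ℂ) : G.T R f g = (G.perm (Equiv.swap 0 1)).T R g f := by
  ext x
  simp only [T, perm_cf, perm_pkz]
  congr 1; ext z
  simp only [Equiv.swap_apply_left, Equiv.swap_apply_right, Equiv.swap_apply_of_ne_of_ne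
    (show (2 : Fin 3) ≠ 0 by decide) (show (2 : Fin 3) ≠ 1 by decide)]
  ring

end Sym

lemma lintegral_affine {c : ℝ} (hc : 0 < c) (d : ℝ) (H : ℝ → ℝ≥0∞) :
    ∫⁻ x, H x = ENNReal.ofReal c * ∫⁻ u, H (c * u + d) := by
  have h1 := (Homeomorph.mulLeft₀ c hc.ne').measurableEmbedding.lintegral_map
    (μ := volume) fun x => H (x + d)
  have h2 := Real.smul_map_volume_mul_left hc.ne'
  rw [abs_of_pos hc] at h2
  calc ∫⁻ x, H x = ∫⁻ x, H (x + d) := (lintegral_add_right_eq_self H d).symm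
    _ = ∫⁻ x, H (x + d) ∂(ENNReal.ofReal c • Measure.map (c * ·) volume) := by rw [h2]
    _ = _ := by
      rw [lintegral_smul_measure, smul_eq_mul]
      congr 1

lemma setLIntegral_affine {c : ℝ} (hc : 0 < c) (d s s' : ℝ) (H : ℝ → ℝ≥0∞) :
    ∫⁻ x in Ico (c * s + d) (c * s' + d), H x =
      ENNReal.ofReal c * ∫⁻ u in Ico s s', H (c * u + d) := by
  rw [← lintegral_indicator measurableSet_Ico, ← lintegral_indicator measurableSet_Ico,
    lintegral_affine hc d]
  congr 2; ext u
  by_cases hu : u ∈ Ico s s'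
  · rw [indicator_of_mem hu, indicator_of_mem]
    simp only [mem_Ico, add_le_add_iff_right, add_lt_add_iff_right, mul_le_mul_iff_right₀ hc,
      mul_lt_mul_iff_right₀ hc]
    exact hu
  · rw [indicator_of_notMem hu, indicator_of_notMem]
    simp only [mem_Ico, add_le_add_iff_right, add_lt_add_iff_right, mul_le_mul_iff_right₀ hc,
      mul_lt_mul_iff_right₀ hc]
    exact hu

/-- The fundamental box of the averaging parameters. -/
def ubox : Set (ℝ × ℝ × ℝ) := Ico 1 2 ×ˢ (Ico 0 1 ×ˢ Ico 0 1)

/-- The box of the tile `(k, n, m)`. -/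
def tbox (P : Tile) : Set (ℝ × ℝ × ℝ) :=
  Ico (2 ^ P.1 * 1 + 0) (2 ^ P.1 * 2 + 0) ×ˢ
    (Ico (1 * 0 + (P.2.2 : ℝ)) (1 * 1 + P.2.2) ×ˢ Ico (1 * 0 + (P.2.1 : ℝ)) (1 * 1 + P.2.1))

lemma volume_ubox : volume ubox = 1 := by
  unfold ubox
  rw [Measure.volume_eq_prod, Measure.prod_prod, Measure.volume_eq_prod, Measure.prod_prod]
  simp only [Real.volume_Ico]
  norm_num

lemma setLIntegral_prod3 (A B C : Set ℝ) {H : ℝ × ℝ × ℝ → ℝ≥0∞} (hH : Measurable H) :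
    ∫⁻ z in A ×ˢ (B ×ˢ C), H z = ∫⁻ x in A, ∫⁻ y in B, ∫⁻ w in C, H (x, y, w) := by
  rw [Measure.volume_eq_prod, ← Measure.prod_restrict, lintegral_prod _ hH.aemeasurable]
  congr 1; ext x
  rw [Measure.volume_eq_prod, ← Measure.prod_restrict, lintegral_prod]
  exact (hH.comp (measurable_const.prodMk measurable_id)).aemeasurable

lemma setLIntegral_tbox (P : Tile) {H : ℝ × ℝ × ℝ → ℝ≥0∞} (hH : Measurable H) :
    ∫⁻ z in tbox P, H z = ∫⁻ u in ubox, ENNReal.ofReal (2 ^ P.1) *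
      H (2 ^ P.1 * u.1, u.2.1 + P.2.2, u.2.2 + P.2.1) := by
  have hm : Measurable fun u : ℝ × ℝ × ℝ => H (2 ^ P.1 * u.1, u.2.1 + P.2.2, u.2.2 + P.2.1) :=
    hH.comp (by fun_prop)
  unfold tbox ubox
  rw [setLIntegral_prod3 _ _ _ hH, lintegral_const_mul _ hm, setLIntegral_prod3 _ _ _ hm,
    setLIntegral_affine (by positivity)]
  simp only [setLIntegral_affine one_pos]
  simp

lemma mem_tbox (z : ℝ × ℝ × ℝ) (hz : 0 < z.1) : ∃ P, z ∈ tbox P := by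
  refine ⟨(Int.log 2 z.1, ⌊z.2.2⌋, ⌊z.2.1⌋), ⟨⟨?_, ?_⟩, ⟨?_, ?_⟩, ⟨?_, ?_⟩⟩⟩
  · simpa using Int.zpow_log_le_self (b := 2) one_lt_two hz
  · have := Int.lt_zpow_succ_log_self (b := 2) one_lt_two z.1
    rw [zpow_add_one₀ (by norm_num)] at this
    simpa using this
  · simpa using Int.floor_le z.2.1
  · have := Int.lt_floor_add_one z.2.1
    linarith
  · simpa using Int.floor_le z.2.2
  · have := Int.lt_floor_add_one z.2.2
    linarith

lemma lintegral_le_of_tiles {H : ℝ × ℝ × ℝ → ℝ≥0∞} (hH : Measurable H) {K : ℝ≥0∞}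
    (h : ∀ u ∈ ubox, ∀ Q : Finset Tile, ∑ P ∈ Q, ENNReal.ofReal (2 ^ P.1) *
      H (2 ^ P.1 * u.1, u.2.1 + P.2.2, u.2.2 + P.2.1) ≤ K) :
    ∫⁻ z in Ioi 0 ×ˢ (univ ×ˢ univ), H z ≤ K := by
  have h1 : (Ioi 0 ×ˢ (univ ×ˢ univ) : Set (ℝ × ℝ × ℝ)) ⊆ ⋃ P, tbox P := fun z hz =>
    mem_iUnion.2 (mem_tbox z hz.1)
  refine (lintegral_mono_set h1).trans ((lintegral_iUnion_le _ _).trans ?_)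
  simp only [setLIntegral_tbox _ hH]
  rw [← lintegral_tsum]
  · calc _ ≤ ∫⁻ _ in ubox, K := by
          refine setLIntegral_mono measurable_const fun u hu => ?_
          rw [ENNReal.tsum_eq_iSup_sum]
          exact iSup_le fun Q => h u hu Q
      _ = K := by rw [setLIntegral_const, volume_ubox, mul_one]
  · intro P
    refine ((hH.comp ?_).const_mul _).aemeasurable
    fun_prop

namespace Sym
variable (G : Sym)

/-- The discrete model with parameters `u`. -/
def par (u : ℝ × ℝ × ℝ) (hu : u ∈ ubox) : Par where
  a := G.a
  b := G.b
  τ := u.1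
  μ := u.2.1
  ν := u.2.2
  ha1 := G.ha1
  ha2 := G.ha2
  hκ1 := G.hκ1
  hκ2 := G.hκ2
  hτ := by linarith [hu.1.1]
  hν0 := hu.2.2.1
  hν1 := hu.2.2.2

lemma cf_par (u : ℝ × ℝ × ℝ) (hu : u ∈ ubox) (j : Fin 3) (f : ℝ → ℂ) (P : Tile) :
    G.cf j f (2 ^ P.1 * u.1, (u.2.1 + P.2.2) / (2 ^ P.1 * u.1), 2 ^ P.1 * u.1 * (u.2.2 + P.2.1)) =
      (G.par u hu).co j f P := by
  have e : (2 : ℝ) ^ P.1 * u.1 = (G.par u hu).sc P.1 := by simp [par, Par.sc, mul_comm]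
  unfold cf Par.co pkz
  refine integral_congr_ae (ae_of_all _ fun x => ?_)
  simp only
  rw [e]
  congr 2
  · unfold Par.fr
    simp only [par]
    ring
  · unfold Par.yy Par.yv
    simp only [par]
    ring

lemma cf_measurable (j : Fin 3) {f : ℝ → ℂ} (hf : Measurable f) : Measurable (G.cf j f) := by
  have : StronglyMeasurable (fun w : (ℝ × ℝ × ℝ) × ℝ => f w.2 * G.pkz j w.1 w.2) :=
    ((hf.comp measurable_snd).mul (G.pkz_measurable j)).stronglyMeasurable
  exact this.integral_prod_right'.measurable

lemma lintegral_cf_le {f : Fin 3 → ℝ → ℂ} (hf : ∀ j, Measurable (f j)) {K : ℝ} (R : ℝ) (hR : 0 < R)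
    (h : ∀ u hu Q, (G.par u hu).tri f Q ≤ K) :
    ∫⁻ z, ‖G.cf 0 (f 0) z * G.cf 1 (f 1) z * G.cf 2 (f 2) z‖ₑ ∂mK R ≤ ENNReal.ofReal K := by
  set Φ : ℝ × ℝ × ℝ → ℝ≥0∞ := fun z => ‖G.cf 0 (f 0) z * G.cf 1 (f 1) z * G.cf 2 (f 2) z‖ₑ with hΦ
  have hΦm : Measurable Φ := (((G.cf_measurable 0 (hf 0)).mul (G.cf_measurable 1 (hf 1))).mul
    (G.cf_measurable 2 (hf 2))).enorm
  have hm : Measurable fun z : ℝ × ℝ × ℝ => Φ (z.1, z.2.1 / z.1, z.1 * z.2.2) :=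
    hΦm.comp (by fun_prop)
  have e1 : ∫⁻ z in Ioi 0 ×ˢ (univ ×ˢ univ), Φ z =
      ∫⁻ z in Ioi 0 ×ˢ (univ ×ˢ univ), Φ (z.1, z.2.1 / z.1, z.1 * z.2.2) := by
    rw [setLIntegral_prod3 _ _ _ hΦm, setLIntegral_prod3 _ _ _ hm]
    refine setLIntegral_congr_fun measurableSet_Ioi fun t ht => ?_
    simp only [Measure.restrict_univ]
    have ht0 : (0 : ℝ) < t := ht
    rw [lintegral_affine (inv_pos.2 ht0) 0]
    simp only [lintegral_affine ht0 0 (fun y => Φ (t, _, y)), add_zero]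
    rw [lintegral_const_mul', ← mul_assoc, ← ENNReal.ofReal_mul (by positivity), inv_mul_cancel₀ ht0.ne',
      ENNReal.ofReal_one, one_mul]
    · simp only [div_eq_inv_mul]
    · exact ENNReal.ofReal_ne_top
  have e2 : ∫⁻ z, Φ z ∂mK R ≤ ∫⁻ z in Ioi 0 ×ˢ (univ ×ˢ univ), Φ z := by
    rw [mK_eq]
    refine lintegral_mono_set (prod_mono (fun t ht => ?_) (prod_mono (subset_univ _) (subset_univ _)))
    exact lt_of_lt_of_le (by positivity) ht.1
  refine e2.trans (e1.le.trans (lintegral_le_of_tiles hm fun u hu Q => ?_))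
  refine le_trans ?_ (ENNReal.ofReal_le_ofReal (h u hu Q))
  unfold Par.tri
  rw [ENNReal.ofReal_sum_of_nonneg fun P _ => (G.par u hu).tri_term_nonneg f P]
  refine Finset.sum_le_sum fun P _ => ?_
  simp only [hΦ, G.cf_par u hu]
  rw [ENNReal.ofReal_mul ((G.par u hu).sc_pos _).le, ← norm_mul, ← norm_mul, ofReal_norm]
  gcongr
  simp only [Par.sc, par]
  have : (0 : ℝ) < 2 ^ P.1 := by positivity
  nlinarith [hu.1.1]

end Sym

/-- The Hardy-Littlewood maximal theorem in the form of an exceptional set. -/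
lemma weak_maximal {f : ℝ → ℂ} (hf : Nice f) {l : ℝ} (hl : 0 < l) : ∃ Ω : Set ℝ, MeasurableSet Ω ∧
    volume Ω ≤ ENNReal.ofReal (10 * (∫ x, ‖f x‖) / l) ∧
    ∀ x ∉ Ω, ∀ r, 0 < r → ∫ y in Metric.closedBall x r, ‖f y‖ ≤ l * r := by
  set S : Set ℝ := {x | ∃ r, 0 < r ∧ l * r < ∫ y in Metric.closedBall x r, ‖f y‖} with hS
  choose! r hr using fun x (hx : x ∈ S) => hx
  obtain ⟨u, huS, hdisj, hcov⟩ := Vitali.exists_disjoint_subfamily_covering_enlargement_closedBall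
    S id r ((∫ x, ‖f x‖) / l) (fun x hx => by
      rw [le_div_iff₀ hl, mul_comm]
      exact (hr x hx).2.le.trans (setIntegral_le_integral hf.integrable.norm
        (ae_of_all _ fun x => norm_nonneg _))) 5 (by norm_num)
  simp only [id] at hdisj hcov
  have huc : u.Countable := hdisj.countable_of_nonempty_interior fun x hx => by
    rw [interior_closedBall _ (hr x (huS hx)).1.ne']
    exact ⟨x, Metric.mem_ball_self (hr x (huS hx)).1⟩
  refine ⟨⋃ b ∈ u, Metric.closedBall b (5 * r b), MeasurableSet.biUnion huc
    fun b _ => Metric.isClosed_closedBall.measurableSet, ?_, ?_⟩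
  · refine (measure_biUnion_le _ huc _).trans ?_
    have h1 : ∀ b : u, volume (Metric.closedBall (b : ℝ) (5 * r b)) ≤
        ENNReal.ofReal (10 / l) * ∫⁻ y in Metric.closedBall (b : ℝ) (r b), ‖f y‖ₑ := by
      intro b
      rw [Real.volume_closedBall, ← ofReal_integral_norm_eq_lintegral_enorm
        hf.integrable.integrableOn, ← ENNReal.ofReal_mul (by positivity)]
      apply ENNReal.ofReal_le_ofReal
      have := (hr b (huS b.2)).2.le
      rw [div_mul_eq_mul_div, le_div_iff₀ hl]
      linarith
    refine (ENNReal.tsum_le_tsum h1).trans ?_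
    rw [ENNReal.tsum_mul_left, ← lintegral_biUnion huc
      (fun b _ => Metric.isClosed_closedBall.measurableSet) hdisj,
      show 10 * (∫ x, ‖f x‖) / l = 10 / l * ∫ x, ‖f x‖ by ring, ENNReal.ofReal_mul (by positivity),
      ofReal_integral_norm_eq_lintegral_enorm hf.integrable]
    gcongr
    exact Measure.restrict_le_self
  · intro x hx s hs
    by_contra! h
    obtain ⟨b, hb, hsub⟩ := hcov x ⟨s, hs, h⟩
    exact hx (mem_iUnion₂.2 ⟨b, hb, hsub (Metric.mem_closedBall_self (hr x ⟨s, hs, h⟩).1.le)⟩)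

namespace Sym

variable {G : Sym}

lemma T_measurable (R : ℝ) {f g : ℝ → ℂ} (hf : Measurable f) (hg : Measurable g) :
    Measurable (G.T R f g) := by
  have : StronglyMeasurable (fun w : ℝ × (ℝ × ℝ × ℝ) =>
      G.cf 0 f w.2 * G.cf 1 g w.2 * G.pkz 2 w.2 w.1) :=
    ((((G.cf_measurable 0 hf).comp measurable_snd).mul ((G.cf_measurable 1 hg).comp measurable_snd)).mul
    ((G.pkz_measurable 2).comp measurable_swap)).stronglyMeasurable
  exact this.integral_prod_right'.measurable

lemma tri_bound {α0 α1 κ : ℝ} (h0 : 0 < α0) (h0' : α0 < 1) (h1 : 0 < α1) (h1' : α1 < 1)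
    (h : α0 + α1 < 3 / 2) (hκ : 1 ≤ κ) : ∃ C : ℝ, 0 < C ∧ ∀ (G : Sym) (R : ℝ), 1 ≤ R →
    ∀ (f : Fin 3 → ℝ → ℂ) (F : Fin 3 → ℝ) (Ω : Set ℝ), (∀ j, Nice (f j)) → (∀ j x, ‖f j x‖ ≤ 1) →
    (∀ j, 0 < F j) → (∀ j, ∫ x, ‖f j x‖ ≤ F j) → (∀ x ∈ Ω, f 2 x = 0) →
    (∀ j, j ≠ 2 → ∀ x ∉ Ω, ∀ r, 0 < r → ∫ y in Metric.closedBall x r, ‖f j y‖ ≤ κ * (F j / F 2) * r) →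
    ‖∫ x, G.T R (f 0) (f 1) x * f 2 x‖ ≤ C * (F 0 ^ α0 * F 1 ^ α1 * F 2 ^ (1 - α0 - α1)) := by
  obtain ⟨C, hC, hb⟩ := rwt_tiles h0 h0' h1 h1' h hκ
  refine ⟨C, hC, fun G R hR f F Ω hf hf1 hF hF1 hΩ hd => ?_⟩
  rw [T_mul_integral hR (hf 0).integrable (hf 1).integrable (hf 2).integrable]
  have h := lintegral_cf_le (G := G) (fun j => (hf j).1) R (by linarith)
    fun u hu Q => hb (G.par u hu) f F Ω hf hf1 hF hF1 hΩ hd Q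
  refine (norm_integral_le_lintegral_norm _).trans ?_
  refine ENNReal.toReal_le_of_le_ofReal ?_ (by simpa only [ofReal_norm] using h)
  have := hF 0; have := hF 1; have := hF 2
  positivity

/-- The restricted weak type estimate. -/
lemma weak_type {α0 α1 : ℝ} (h0 : 0 < α0) (h0' : α0 < 1) (h1 : 0 < α1) (h1' : α1 < 1)
    (h : α0 + α1 < 3 / 2) : ∃ C : ℝ, 0 < C ∧ ∀ (G : Sym) (R : ℝ), 1 ≤ R →
    ∀ (f g : ℝ → ℂ) (F0 F1 : ℝ), Nice f → Nice g → (∀ x, ‖f x‖ ≤ 1) → (∀ x, ‖g x‖ ≤ 1) →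
    ∫ x, ‖f x‖ ≤ F0 → ∫ x, ‖g x‖ ≤ F1 → ∀ l, 0 < l → ∀ E : Set ℝ, MeasurableSet E →
    Bornology.IsBounded E → (∀ x ∈ E, l ≤ ‖G.T R f g x‖) →
    l * volume.real E ^ (α0 + α1) ≤ C * (F0 ^ α0 * F1 ^ α1) := by
  obtain ⟨C, hC, hb⟩ := tri_bound h0 h0' h1 h1' h (κ := 40) (by norm_num)
  have key : ∀ (G : Sym) (R : ℝ), 1 ≤ R →
      ∀ (f g : ℝ → ℂ) (F0 F1 : ℝ), Nice f → Nice g → (∀ x, ‖f x‖ ≤ 1) → (∀ x, ‖g x‖ ≤ 1) →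
      ∫ x, ‖f x‖ ≤ F0 → ∫ x, ‖g x‖ ≤ F1 → 0 < F0 → 0 < F1 → ∀ l, 0 < l → ∀ E : Set ℝ, MeasurableSet E →
      Bornology.IsBounded E → (∀ x ∈ E, l ≤ ‖G.T R f g x‖) →
      l * volume.real E ^ (α0 + α1) ≤ 2 * C * (F0 ^ α0 * F1 ^ α1) := by
    intro G R hR f g F0 F1 hf hg hf1 hg1 hF0 hF1 hp0 hp1 l hl E hE hEb hlE
    rcases eq_or_lt_of_le (measureReal_nonneg : 0 ≤ volume.real E) with hz | hV
    · rw [← hz, zero_rpow (by linarith)]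
      have : 0 ≤ 2 * C * (F0 ^ α0 * F1 ^ α1) := by positivity
      simpa using this
    set V := volume.real E with hVdef
    have hEfin : volume E ≠ ⊤ := hEb.measure_lt_top.ne
    obtain ⟨Ω0, hm0, hv0, hd0⟩ := weak_maximal hf (l := 40 * (F0 / V)) (by positivity)
    obtain ⟨Ω1, hm1, hv1, hd1⟩ := weak_maximal hg (l := 40 * (F1 / V)) (by positivity)
    have hv : ∀ {Ω : Set ℝ} {I F : ℝ}, 0 < F → I ≤ F →
        volume Ω ≤ ENNReal.ofReal (10 * I / (40 * (F / V))) → volume Ω ≤ ENNReal.ofReal (V / 4) := by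
      intro Ω I F hF hI h
      refine h.trans (ENNReal.ofReal_le_ofReal ?_)
      rw [div_le_iff₀ (by positivity)]
      field_simp
      linarith
    have hΩv : volume.real (Ω0 ∪ Ω1) ≤ V / 2 := by
      refine ENNReal.toReal_le_of_le_ofReal (by positivity) ((measure_union_le _ _).trans ?_)
      rw [show V / 2 = V / 4 + V / 4 by ring, ENNReal.ofReal_add (by positivity) (by positivity)]
      exact add_le_add (hv hp0 hF0 hv0) (hv hp1 hF1 hv1)
    set Ω := Ω0 ∪ Ω1 with hΩ
    have hΩm : MeasurableSet Ω := hm0.union hm1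
    have hΩfin : volume Ω ≠ ⊤ := by
      refine ((measure_union_le _ _).trans_lt (ENNReal.add_lt_top.2 ⟨?_, ?_⟩)).ne
      · exact hv0.trans_lt ENNReal.ofReal_lt_top
      · exact hv1.trans_lt ENNReal.ofReal_lt_top
    have hTm := T_measurable (G := G) R hf.1 hg.1
    set φ : ℝ → ℂ := fun x => conj (G.T R f g x) / ‖G.T R f g x‖ with hφ
    have hφm : Measurable φ := by
      have : Measurable fun x => conj (G.T R f g x) := Complex.continuous_conj.measurable.comp hTm
      exact this.div (Complex.measurable_ofReal.comp hTm.norm)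
    have hφ1 : ∀ x, ‖φ x‖ ≤ 1 := fun x => by
      simp only [hφ, norm_div, RCLike.norm_conj, Complex.norm_real, norm_norm]
      exact div_self_le_one _
    have hTφ : ∀ x, G.T R f g x * φ x = (‖G.T R f g x‖ : ℂ) := fun x => by
      simp only [hφ]
      by_cases hx : G.T R f g x = 0
      · simp [hx]
      have : (‖G.T R f g x‖ : ℂ) ≠ 0 := by simpa using hx
      rw [mul_div_assoc', Complex.mul_conj, div_eq_iff this, Complex.normSq_eq_norm_sq]
      push_cast
      ring
    have hEΩ : MeasurableSet (E \ Ω) := hE.diff hΩm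
    set h2 : ℝ → ℂ := (E \ Ω).indicator φ with hh2
    have hh2n : Nice h2 := by
      obtain ⟨B, hB⟩ := hEb.exists_norm_le
      refine ⟨hφm.indicator hEΩ, ⟨1, fun x => (norm_indicator_le_norm_self _ _).trans (hφ1 x)⟩, B,
        fun x hx => ?_⟩
      rw [hh2, indicator_of_notMem]
      exact fun h => absurd (hB x h.1) (by simpa using hx)
    have hh21 : ∀ x, ‖h2 x‖ ≤ 1 := fun x => (norm_indicator_le_norm_self _ _).trans (hφ1 x)
    have hEΩv : volume (E \ Ω) ≠ ⊤ := measure_ne_top_of_subset sdiff_subset hEfin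
    have hh2i : ∫ x, ‖h2 x‖ ≤ V := by
      have : ∀ x, ‖h2 x‖ = (E \ Ω).indicator (fun x => ‖φ x‖) x := fun x => norm_indicator_eq_indicator_norm _ _
      simp only [this]
      rw [integral_indicator hEΩ]
      have hle : ∫ x in E \ Ω, ‖φ x‖ ≤ ∫ x in E \ Ω, (1 : ℝ) := by
        refine integral_mono_of_nonneg (ae_of_all _ fun x => norm_nonneg _) ?_ (ae_of_all _ hφ1)
        exact integrableOn_const hEΩv
      refine hle.trans ?_
      rw [setIntegral_const, smul_eq_mul, mul_one]
      exact measureReal_mono sdiff_subset hEfin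
    have hB := hb G R hR ![f, g, h2] ![F0, F1, V] Ω
      (by intro j; fin_cases j; exacts [hf, hg, hh2n])
      (by intro j; fin_cases j; exacts [hf1, hg1, hh21])
      (by intro j; fin_cases j; exacts [hp0, hp1, hV])
      (by intro j; fin_cases j; exacts [hF0, hF1, hh2i])
      (fun x hx => by
        change h2 x = 0
        rw [hh2, indicator_of_notMem]
        exact fun h => h.2 hx)
      (by
        intro j hj x hx r hr
        fin_cases j
        · exact hd0 x (fun h => hx (Or.inl h)) r hr
        · exact hd1 x (fun h => hx (Or.inr h)) r hr
        · exact absurd rfl hj)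
    have hB' : ‖∫ x, G.T R f g x * h2 x‖ ≤ C * (F0 ^ α0 * F1 ^ α1 * V ^ (1 - α0 - α1)) := hB
    have hInt : ∫ x, G.T R f g x * h2 x = ((∫ x in E \ Ω, ‖G.T R f g x‖ : ℝ) : ℂ) := by
      rw [← integral_complex_ofReal, ← integral_indicator hEΩ]
      refine integral_congr_ae (ae_of_all _ fun x => ?_)
      by_cases hx : x ∈ E \ Ω
      · simp only [hh2, indicator_of_mem hx, hTφ]
      · simp only [hh2, indicator_of_notMem hx, mul_zero]
    have hlow : l * (V / 2) ≤ ∫ x in E \ Ω, ‖G.T R f g x‖ := by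
      obtain ⟨C', hC', hTb⟩ := T_bound (G := G) hR
      have hi : IntegrableOn (fun x => ‖G.T R f g x‖) (E \ Ω) := by
        refine Measure.integrableOn_of_bounded hEΩv hTm.norm.aestronglyMeasurable
          (M := C' * ((∫ x, ‖f x‖) * ∫ x, ‖g x‖)) (ae_of_all _ fun x => ?_)
        rw [norm_norm]
        exact hTb f g hf.integrable hg.integrable x
      have h1 : ∫ x in E \ Ω, l ≤ ∫ x in E \ Ω, ‖G.T R f g x‖ :=
        setIntegral_mono_on (integrableOn_const hEΩv) hi hEΩ fun x hx => hlE x hx.1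
      rw [setIntegral_const, smul_eq_mul] at h1
      have h3 : V ≤ volume.real (E \ Ω) + volume.real Ω := by
        rw [hVdef]
        refine (measureReal_mono ?_ ?_).trans (measureReal_union_le _ _)
        · intro x hx
          by_cases h : x ∈ Ω
          exacts [Or.inr h, Or.inl ⟨hx, h⟩]
        · exact (measure_union_lt_top hEΩv.lt_top hΩfin.lt_top).ne
      have : V / 2 ≤ volume.real (E \ Ω) := by linarith
      nlinarith
    rw [hInt, Complex.norm_real, norm_of_nonneg (by
      exact integral_nonneg fun x => norm_nonneg _)] at hB'
    have hfin : l * V ≤ 2 * C * (F0 ^ α0 * F1 ^ α1) * V ^ (1 - α0 - α1) := by linarith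
    have hVe : V = V ^ (α0 + α1) * V ^ (1 - α0 - α1) := by
      rw [← rpow_add hV]
      ring_nf
      rw [rpow_one]
    rw [hVe, ← mul_assoc] at hfin
    simp only [← hVe] at hfin
    exact le_of_mul_le_mul_right hfin (rpow_pos_of_pos hV _)
  refine ⟨2 * C, by positivity, fun G R hR f g F0 F1 hf hg hf1 hg1 hF0 hF1 l hl E hE hEb hlE => ?_⟩
  have hn0 : 0 ≤ F0 := (integral_nonneg fun _ => norm_nonneg _).trans hF0
  have hn1 : 0 ≤ F1 := (integral_nonneg fun _ => norm_nonneg _).trans hF1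
  have hlim : Filter.Tendsto (fun e : ℝ => 2 * C * ((F0 + e) ^ α0 * (F1 + e) ^ α1)) (nhdsWithin 0 (Ioi 0))
      (nhds (2 * C * (F0 ^ α0 * F1 ^ α1))) := by
    have : Continuous fun e : ℝ => 2 * C * ((F0 + e) ^ α0 * (F1 + e) ^ α1) := by
      have h2 : Continuous fun e : ℝ => (F0 + e) ^ α0 :=
        (continuous_const.add continuous_id).rpow_const fun _ => Or.inr h0.le
      have h3 : Continuous fun e : ℝ => (F1 + e) ^ α1 :=
        (continuous_const.add continuous_id).rpow_const fun _ => Or.inr h1.le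
      exact continuous_const.mul (h2.mul h3)
    have h4 := (this.tendsto 0).mono_left (nhdsWithin_le_nhds (s := Ioi 0))
    simpa using h4
  refine ge_of_tendsto hlim ?_
  filter_upwards [self_mem_nhdsWithin] with e he
  have he' : 0 < e := he
  exact key G R hR f g (F0 + e) (F1 + e) hf hg hf1 hg1 (by linarith) (by linarith) (by linarith)
    (by linarith) l hl E hE hEb hlE

end Sym

lemma exists_sum_decay {c s : ℝ} (hc : 0 < c) (hs : 0 < s) : ∃ A : ℝ, 1 ≤ A ∧ ∀ (K : Finset ℤ) (t : ℝ),
    ∑ k ∈ K, (2 : ℝ) ^ (-c * |t - k * s|) ≤ A := by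
  set ρ : ℝ := 2 ^ (-c * s) with hρ
  have hρ0 : 0 < ρ := by positivity
  have hρ1 : ρ < 1 := rpow_lt_one_of_one_lt_of_neg (by norm_num) (by nlinarith)
  have hsum : Summable fun j : ℤ => ρ ^ j.natAbs := by
    have h1 := summable_geometric_of_lt_one hρ0.le hρ1
    refine Summable.of_nat_of_neg (by simpa using h1) (by simpa using h1)
  refine ⟨max 1 (2 ^ (c * s) * ∑' j : ℤ, ρ ^ j.natAbs), le_max_left _ _, fun K t => ?_⟩
  refine le_trans ?_ (le_max_right _ _)
  set n : ℤ := ⌊t / s⌋ with hn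
  have hterm : ∀ k : ℤ, (2 : ℝ) ^ (-c * |t - k * s|) ≤ 2 ^ (c * s) * ρ ^ (k - n).natAbs := by
    intro k
    rw [hρ, ← rpow_natCast, ← rpow_mul (by norm_num), ← rpow_add (by norm_num)]
    apply rpow_le_rpow_of_exponent_le (by norm_num)
    rw [Nat.cast_natAbs]
    push_cast
    have h1 : |(k : ℝ) - n| * s ≤ |t - k * s| + s := by
      have e : ((k : ℝ) - n) * s = -(t - k * s) + (t - n * s) := by ring
      rw [← abs_of_pos hs, ← abs_mul, abs_of_pos hs, e]
      refine (abs_add_le _ _).trans ?_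
      rw [abs_neg]
      gcongr
      have h2 := Int.floor_le (t / s)
      have h3 := Int.lt_floor_add_one (t / s)
      rw [le_div_iff₀ hs] at h2
      rw [div_lt_iff₀ hs] at h3
      rw [abs_le]
      constructor <;> nlinarith
    nlinarith
  calc ∑ k ∈ K, (2 : ℝ) ^ (-c * |t - k * s|) ≤ ∑ k ∈ K, 2 ^ (c * s) * ρ ^ (k - n).natAbs :=
        Finset.sum_le_sum fun k _ => hterm k
    _ = 2 ^ (c * s) * ∑ k ∈ K, ρ ^ (k - n).natAbs := by rw [Finset.mul_sum]
    _ ≤ _ := by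
        gcongr
        have h2 : Summable fun k : ℤ => ρ ^ (k - n).natAbs :=
          hsum.comp_injective (sub_left_injective (b := n))
        refine (h2.sum_le_tsum K fun _ _ => by positivity).trans (le_of_eq ?_)
        exact (Equiv.subRight n).tsum_eq fun j : ℤ => ρ ^ j.natAbs

/-- Arithmetic of one term of the interpolation argument. -/
lemma interp_term {p q r ε : ℝ} (hp : 0 < p) (hq : 0 < q) (h : 1 / r = 1 / p + 1 / q) (hr : 0 < r)
    (hε : 0 < ε) (hε1 : 2 * ε < 1 / r) (hr2 : 1 / r + 2 * ε ≤ 2) {C A : ℝ} (hC : 1 ≤ C) (hA : 1 ≤ A)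
    {V a b e1 e2 : ℝ} (hV : 0 ≤ V) (ha : 0 ≤ a) (hb : 0 ≤ b) (m k l : ℤ)
    (he1 : e1 = ε ∨ e1 = -ε) (he2 : e2 = ε ∨ e2 = -ε)
    (hs1 : e1 * (m * r - k * p) = -ε * |m * r - k * p|)
    (hs2 : e2 * (m * r - l * q) = -ε * |m * r - l * q|)
    (hw : (A⁻¹ * (2 ^ (-(ε / 2) * |m * r - k * p|) * 2 ^ (-(ε / 2) * |m * r - l * q|)) * 2 ^ (m : ℝ)) *
      V ^ (1 / p + e1 + (1 / q + e2)) ≤ C * (2 ^ (k : ℝ) * 2 ^ (l : ℝ)) *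
        ((a * 2 ^ (-k * p)) ^ (1 / p + e1) * (b * 2 ^ (-l * q)) ^ (1 / q + e2))) 
    (hα0 : 0 ≤ 1 / p + e1) (hα1 : 0 ≤ 1 / q + e2) :
    2 ^ (m * r) * V ≤ (C * A) ^ (1 / (1 / r - 2 * ε)) *
      (2 ^ (-(ε / 4) * |m * r - k * p|) * 2 ^ (-(ε / 4) * |m * r - l * q|)) * (a + b) := by
  set u := m * r - k * p with hu
  set v := m * r - l * q with hv
  set s := 1 / p + e1 + (1 / q + e2) with hs
  have hs' : s = 1 / r + e1 + e2 := by rw [h, hs]; ring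
  have hsl : 1 / r - 2 * ε ≤ s := by rcases he1 with rfl | rfl <;> rcases he2 with rfl | rfl <;> linarith
  have hsu : s ≤ 2 := by rcases he1 with rfl | rfl <;> rcases he2 with rfl | rfl <;> linarith
  have hs0 : 0 < s := by linarith
  have hCA : 1 ≤ C * A := one_le_mul_of_one_le_of_one_le hC hA
  have hab : 0 ≤ a + b := by positivity
  have h1 : (a * 2 ^ (-k * p)) ^ (1 / p + e1) ≤ (a + b) ^ (1 / p + e1) * 2 ^ (-k * p * (1 / p + e1)) := by
    rw [mul_rpow ha (by positivity), ← rpow_mul (by norm_num)]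
    gcongr
    linarith
  have h2 : (b * 2 ^ (-l * q)) ^ (1 / q + e2) ≤ (a + b) ^ (1 / q + e2) * 2 ^ (-l * q * (1 / q + e2)) := by
    rw [mul_rpow hb (by positivity), ← rpow_mul (by norm_num)]
    gcongr
    linarith
  have h3 : V ^ s ≤ (C * A) * (a + b) ^ s * 2 ^ ((ε / 2) * |u| + (ε / 2) * |v| - m + k + l +
      -k * p * (1 / p + e1) + -l * q * (1 / q + e2)) := by
    have e1' : A⁻¹ * (2 ^ (-(ε / 2) * |u|) * 2 ^ (-(ε / 2) * |v|)) * 2 ^ (m : ℝ) =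
        A⁻¹ * 2 ^ (-((ε / 2) * |u| + (ε / 2) * |v| - m)) := by
      rw [mul_assoc, ← rpow_add (by norm_num), ← rpow_add (by norm_num)]
      ring_nf
    rw [e1', mul_assoc, rpow_neg (by norm_num), ← mul_assoc, ← mul_inv, inv_mul_le_iff₀ (by positivity)] at hw
    refine hw.trans ?_
    calc _ ≤ A * 2 ^ ((ε / 2) * |u| + (ε / 2) * |v| - m) * (C * (2 ^ (k : ℝ) * 2 ^ (l : ℝ)) *
          (((a + b) ^ (1 / p + e1) * 2 ^ (-k * p * (1 / p + e1))) *
          ((a + b) ^ (1 / q + e2) * 2 ^ (-l * q * (1 / q + e2))))) := by gcongr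
      _ = _ := by
        rw [hs, rpow_add_of_nonneg hab hα0 hα1]
        simp only [rpow_add (show (0 : ℝ) < 2 by norm_num)]
        ring
  have h4 : (2 ^ (m * r) * V) ^ s ≤ ((C * A) ^ (1 / s) *
      (2 ^ (-(ε / 4) * |u|) * 2 ^ (-(ε / 4) * |v|)) * (a + b)) ^ s := by
    rw [mul_rpow (by positivity) hV, mul_rpow (by positivity) hab, mul_rpow (by positivity) (by positivity),
      ← rpow_mul (by positivity) (1 / s), one_div_mul_cancel hs0.ne', rpow_one, ← rpow_add (by norm_num),
      ← rpow_mul (by norm_num), ← rpow_mul (by norm_num)]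
    calc _ ≤ 2 ^ (m * r * s) * ((C * A) * (a + b) ^ s * 2 ^ ((ε / 2) * |u| + (ε / 2) * |v| - m + k + l +
      -k * p * (1 / p + e1) + -l * q * (1 / q + e2))) := by gcongr
      _ = C * A * 2 ^ (-(ε / 2) * |u| + -(ε / 2) * |v|) * (a + b) ^ s := by
        have : m * r * s + ((ε / 2) * |u| + (ε / 2) * |v| - m + k + l +
            -k * p * (1 / p + e1) + -l * q * (1 / q + e2)) = -(ε / 2) * |u| + -(ε / 2) * |v| := by
          have e3 : (m : ℝ) * r * (1 / r) = m := by field_simp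
          have e4 : (k : ℝ) * p * (1 / p) = k := by field_simp
          have e5 : (l : ℝ) * q * (1 / q) = l := by field_simp
          rw [hs']
          have e6 : m * r * (1 / r + e1 + e2) = m + (m * r) * e1 + (m * r) * e2 := by linear_combination e3
          rw [e6]
          linear_combination -e4 - e5 + hs1 + hs2
        rw [← this, rpow_add (show (0 : ℝ) < 2 by norm_num) (m * r * s)]
        ring
      _ ≤ _ := by
        gcongr
        · norm_num
        · have := abs_nonneg u
          have := abs_nonneg v
          have h7 : 0 ≤ ε * (|u| + |v|) := by positivity
          nlinarith
  refine ((rpow_le_rpow_iff (by positivity) (by positivity) hs0).1 h4).trans ?_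
  gcongr

/-- Bilinear Marcinkiewicz interpolation for finite sums. -/
lemma interp_core {p q r ε : ℝ} (hp : 0 < p) (hq : 0 < q) (hpqr : 1 / r = 1 / p + 1 / q) (hr : 0 < r)
    (hε : 0 < ε) (hε1 : 2 * ε < 1 / r) (hεp : ε ≤ 1 / p) (hεq : ε ≤ 1 / q) (hr2 : 1 / r + 2 * ε ≤ 2)
    {C : ℝ} (hC : 1 ≤ C) : ∃ C' : ℝ, 0 < C' ∧ ∀ (K L : Finset ℤ) (h : ℤ → ℤ → ℝ → ℂ) (a b : ℤ → ℝ)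
    (S : Set ℝ), (∀ k l, Measurable (h k l)) → (∀ k, 0 ≤ a k) → (∀ l, 0 ≤ b l) → MeasurableSet S →
    Bornology.IsBounded S → (∀ e1 e2, (e1 = ε ∨ e1 = -ε) → (e2 = ε ∨ e2 = -ε) → ∀ k l, ∀ t, 0 < t →
      ∀ E : Set ℝ, MeasurableSet E → Bornology.IsBounded E → (∀ x ∈ E, t ≤ ‖h k l x‖) →
      t * volume.real E ^ (1 / p + e1 + (1 / q + e2)) ≤ C * (2 ^ (k : ℝ) * 2 ^ (l : ℝ)) *
        ((a k * 2 ^ (-k * p)) ^ (1 / p + e1) * (b l * 2 ^ (-l * q)) ^ (1 / q + e2))) →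
    ∫⁻ x in S, ‖∑ k ∈ K, ∑ l ∈ L, h k l x‖ₑ ^ r ≤ ENNReal.ofReal (C' * (∑ k ∈ K, a k + ∑ l ∈ L, b l)) := by
  obtain ⟨A1, hA1, hs1⟩ := exists_sum_decay (c := ε / 2) (s := p) (by positivity) hp
  obtain ⟨A2, hA2, hs2⟩ := exists_sum_decay (c := ε / 2) (s := q) (by positivity) hq
  obtain ⟨A3, hA3, hs3⟩ := exists_sum_decay (c := ε / 4) (s := p) (by positivity) hp
  obtain ⟨A4, hA4, hs4⟩ := exists_sum_decay (c := ε / 4) (s := q) (by positivity) hq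
  obtain ⟨A5, hA5, hs5⟩ := exists_sum_decay (c := ε / 4) (s := r) (by positivity) hr
  set B := (C * (A1 * A2)) ^ (1 / (1 / r - 2 * ε)) with hB
  refine ⟨2 ^ r * (B * (A5 * (A3 + A4))), by positivity, fun K L h a b S hm ha hb hS hSb hw => ?_⟩
  set H : ℝ → ℂ := fun x => ∑ k ∈ K, ∑ l ∈ L, h k l x with hH
  have hHm : Measurable H := Finset.measurable_fun_sum _ fun k _ => Finset.measurable_fun_sum _ fun l _ => hm k l
  set E : ℤ → Set ℝ := fun m => S ∩ {x | (2 : ℝ) ^ m < ‖H x‖ ∧ ‖H x‖ ≤ 2 ^ (m + 1)} with hE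
  have hEm : ∀ m, MeasurableSet (E m) := fun m => hS.inter
    ((measurableSet_lt measurable_const hHm.norm).inter (measurableSet_le hHm.norm measurable_const))
  set w : ℤ → ℤ → ℤ → ℝ := fun m k l =>
    2 ^ (-(ε / 4) * |m * r - k * p|) * 2 ^ (-(ε / 4) * |m * r - l * q|) with hwdef
  have hEle : ∀ m : ℤ, 2 ^ (m * r) * volume.real (E m) ≤ ∑ k ∈ K, ∑ l ∈ L, B * w m k l * (a k + b l) := by
    intro m
    set c : ℤ → ℤ → ℝ := fun k l => (A1 * A2)⁻¹ * (2 ^ (-(ε / 2) * |m * r - k * p|) *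
      2 ^ (-(ε / 2) * |m * r - l * q|)) * 2 ^ (m : ℝ) with hc
    set D : ℤ → ℤ → Set ℝ := fun k l => E m ∩ {x | c k l ≤ ‖h k l x‖} with hD
    have hDm : ∀ k l, MeasurableSet (D k l) := fun k l =>
      (hEm m).inter (measurableSet_le measurable_const (hm k l).norm)
    have hDb : ∀ k l, Bornology.IsBounded (D k l) := fun k l =>
      hSb.subset (inter_subset_left.trans inter_subset_left)
    have hcov : E m ⊆ ⋃ z ∈ K ×ˢ L, D z.1 z.2 := by
      intro x hx
      by_contra hn
      have hlt : ∀ k ∈ K, ∀ l ∈ L, ‖h k l x‖ ≤ c k l := by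
        intro k hk l hl
        by_contra! hcon
        exact hn (mem_iUnion₂.2 ⟨(k, l), Finset.mk_mem_product hk hl, hx, hcon.le⟩)
      have h1 : ‖H x‖ ≤ ∑ k ∈ K, ∑ l ∈ L, c k l :=
        (norm_sum_le _ _).trans (Finset.sum_le_sum fun k hk => (norm_sum_le _ _).trans
          (Finset.sum_le_sum fun l hl => hlt k hk l hl))
      have h2 : ∑ k ∈ K, ∑ l ∈ L, c k l = (A1 * A2)⁻¹ * 2 ^ (m : ℝ) *
          ((∑ k ∈ K, 2 ^ (-(ε / 2) * |m * r - k * p|)) * ∑ l ∈ L, 2 ^ (-(ε / 2) * |m * r - l * q|)) := by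
        rw [Finset.sum_mul_sum, Finset.mul_sum]
        refine Finset.sum_congr rfl fun k _ => ?_
        rw [Finset.mul_sum]
        refine Finset.sum_congr rfl fun l _ => ?_
        simp only [hc]
        ring
      have h3 : ∑ k ∈ K, ∑ l ∈ L, c k l ≤ 2 ^ (m : ℝ) := by
        rw [h2]
        have : (∑ k ∈ K, (2 : ℝ) ^ (-(ε / 2) * |m * r - k * p|)) *
            ∑ l ∈ L, (2 : ℝ) ^ (-(ε / 2) * |m * r - l * q|) ≤ A1 * A2 :=
          mul_le_mul (hs1 K _) (hs2 L _) (Finset.sum_nonneg fun _ _ => by positivity) (by positivity)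
        calc _ ≤ (A1 * A2)⁻¹ * 2 ^ (m : ℝ) * (A1 * A2) := by gcongr
          _ = _ := by field_simp
      rw [rpow_intCast] at h3
      exact absurd hx.2.1 (not_lt.2 (h1.trans h3))
    have hfin : ∀ k l, volume (D k l) ≠ ⊤ := fun k l => (hDb k l).measure_lt_top.ne
    have h1 : volume.real (E m) ≤ ∑ z ∈ K ×ˢ L, volume.real (D z.1 z.2) := by
      refine (measureReal_mono hcov ?_).trans (measureReal_biUnion_finset_le _ _)
      exact (measure_biUnion_lt_top (K ×ˢ L).finite_toSet fun z _ => (hfin z.1 z.2).lt_top).ne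
    calc 2 ^ (m * r) * volume.real (E m) ≤ 2 ^ (m * r) * ∑ z ∈ K ×ˢ L, volume.real (D z.1 z.2) := by gcongr
      _ = ∑ k ∈ K, ∑ l ∈ L, 2 ^ (m * r) * volume.real (D k l) := by
        rw [Finset.sum_product, Finset.mul_sum]
        exact Finset.sum_congr rfl fun k _ => Finset.mul_sum _ _ _
      _ ≤ _ := by
        refine Finset.sum_le_sum fun k _ => Finset.sum_le_sum fun l _ => ?_
        have hsgn : ∀ u : ℝ, ∃ e, (e = ε ∨ e = -ε) ∧ e * u = -ε * |u| := by
          intro u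
          rcases le_total 0 u with hu | hu
          · exact ⟨-ε, Or.inr rfl, by rw [abs_of_nonneg hu]⟩
          · exact ⟨ε, Or.inl rfl, by rw [abs_of_nonpos hu]; ring⟩
        obtain ⟨e1, he1, hes1⟩ := hsgn (m * r - k * p)
        obtain ⟨e2, he2, hes2⟩ := hsgn (m * r - l * q)
        have h0 : 0 ≤ 1 / p + e1 := by rcases he1 with rfl | rfl <;> linarith
        have h0' : 0 ≤ 1 / q + e2 := by rcases he2 with rfl | rfl <;> linarith
        exact interp_term hp hq hpqr hr hε hε1 hr2 hC (one_le_mul_of_one_le_of_one_le hA1 hA2)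
          measureReal_nonneg (ha k) (hb l) m k l he1 he2 hes1 hes2
          (hw e1 e2 he1 he2 k l _ (by positivity) (D k l) (hDm k l) (hDb k l) fun x hx => hx.2) h0 h0'
  have hsumE : ∀ M : Finset ℤ, ∑ m ∈ M, 2 ^ (m * r) * volume.real (E m) ≤
      B * (A5 * (A3 + A4)) * (∑ k ∈ K, a k + ∑ l ∈ L, b l) := by
    intro M
    have hw0 : ∀ m k l, 0 ≤ w m k l := fun m k l => by simp only [hwdef]; positivity
    have hwk : ∀ k, ∑ m ∈ M, ∑ l ∈ L, w m k l ≤ A5 * (A3 + A4) := by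
      intro k
      have : ∀ m ∈ M, ∑ l ∈ L, w m k l ≤ 2 ^ (-(ε / 4) * |k * p - m * r|) * A4 := by
        intro m _
        simp only [hwdef]
        rw [← Finset.mul_sum, abs_sub_comm]
        gcongr
        exact hs4 L _
      refine (Finset.sum_le_sum this).trans ?_
      rw [← Finset.sum_mul]
      exact mul_le_mul (hs5 M _) (by linarith) (by linarith) (by linarith)
    have hwl : ∀ l, ∑ m ∈ M, ∑ k ∈ K, w m k l ≤ A5 * (A3 + A4) := by
      intro l
      have : ∀ m ∈ M, ∑ k ∈ K, w m k l ≤ A3 * 2 ^ (-(ε / 4) * |l * q - m * r|) := by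
        intro m _
        simp only [hwdef]
        rw [← Finset.sum_mul, abs_sub_comm (l * q)]
        gcongr
        exact hs3 K _
      refine (Finset.sum_le_sum this).trans ?_
      rw [← Finset.mul_sum, mul_comm]
      exact mul_le_mul (hs5 M _) (by linarith) (by linarith) (by linarith)
    calc _ ≤ ∑ m ∈ M, ∑ k ∈ K, ∑ l ∈ L, B * w m k l * (a k + b l) := Finset.sum_le_sum fun m _ => hEle m
      _ = B * (∑ k ∈ K, a k * ∑ m ∈ M, ∑ l ∈ L, w m k l) +
          B * (∑ l ∈ L, b l * ∑ m ∈ M, ∑ k ∈ K, w m k l) := by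
        have e1 : ∑ k ∈ K, a k * ∑ m ∈ M, ∑ l ∈ L, w m k l = ∑ m ∈ M, ∑ k ∈ K, ∑ l ∈ L, a k * w m k l := by
          rw [Finset.sum_comm (s := M)]
          simp only [Finset.mul_sum]
        have e2 : ∑ l ∈ L, b l * ∑ m ∈ M, ∑ k ∈ K, w m k l = ∑ m ∈ M, ∑ k ∈ K, ∑ l ∈ L, b l * w m k l := by
          simp only [Finset.mul_sum]
          rw [Finset.sum_comm]
          exact Finset.sum_congr rfl fun m _ => Finset.sum_comm
        rw [e1, e2, ← mul_add, ← Finset.sum_add_distrib, Finset.mul_sum]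
        refine Finset.sum_congr rfl fun m _ => ?_
        rw [← Finset.sum_add_distrib, Finset.mul_sum]
        refine Finset.sum_congr rfl fun k _ => ?_
        rw [← Finset.sum_add_distrib, Finset.mul_sum]
        exact Finset.sum_congr rfl fun l _ => by ring
      _ ≤ B * (∑ k ∈ K, a k * (A5 * (A3 + A4))) + B * (∑ l ∈ L, b l * (A5 * (A3 + A4))) := by
        gcongr with k _ l _
        · exact ha k
        · exact hwk k
        · exact hb l
        · exact hwl l
      _ = _ := by
        rw [← Finset.sum_mul, ← Finset.sum_mul]
        ring
  have hpt : ∀ x ∈ S, ‖H x‖ₑ ^ r ≤ ∑' m : ℤ, (E m).indicator (fun _ => ENNReal.ofReal (2 ^ r * 2 ^ (m * r))) x := by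
    intro x hx
    rcases eq_or_ne (H x) 0 with h0 | h0
    · simp [h0, hr]
    obtain ⟨m, hm1, hm2⟩ := exists_mem_Ioc_zpow (norm_pos_iff.2 h0) (one_lt_two : (1 : ℝ) < 2)
    refine le_trans ?_ (ENNReal.le_tsum m)
    rw [indicator_of_mem (show x ∈ E m from ⟨hx, hm1, hm2⟩), ← ofReal_norm,
      ENNReal.ofReal_rpow_of_nonneg (norm_nonneg _) hr.le]
    apply ENNReal.ofReal_le_ofReal
    refine (rpow_le_rpow (norm_nonneg _) hm2 hr.le).trans (le_of_eq ?_)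
    rw [← rpow_intCast, ← rpow_mul (by norm_num), ← rpow_add (by norm_num)]
    push_cast
    ring_nf
  refine (setLIntegral_mono' hS hpt).trans ((setLIntegral_le_lintegral _ _).trans ?_)
  rw [lintegral_tsum fun m => (measurable_const.indicator (hEm m)).aemeasurable, ENNReal.tsum_eq_iSup_sum]
  refine iSup_le fun M => ?_
  simp only [lintegral_indicator_const (hEm _)]
  have hEf : ∀ m, volume (E m) = ENNReal.ofReal (volume.real (E m)) := fun m =>
    (ofReal_measureReal (hSb.subset inter_subset_left).measure_lt_top.ne).symm
  simp only [hEf]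
  simp only [← ENNReal.ofReal_mul (show (0 : ℝ) ≤ 2 ^ r * 2 ^ (_ * r) by positivity)]
  rw [← ENNReal.ofReal_sum_of_nonneg fun m _ => by positivity]
  apply ENNReal.ofReal_le_ofReal
  simp only [mul_assoc]
  rw [← Finset.mul_sum]
  gcongr
  have := hsumE M
  simpa only [mul_assoc] using this

lemma Nice.const_smul {f : ℝ → ℂ} (hf : Nice f) (c : ℂ) : Nice (c • f) := by
  have := hf.mul (g := fun _ => c) measurable_const (B := ‖c‖) fun _ => le_rfl
  convert this using 1
  ext x
  simp [mul_comm]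

lemma Nice.integrable_rpow {f : ℝ → ℂ} (hf : Nice f) {p : ℝ} (hp : 0 < p) :
    Integrable fun x => ‖f x‖ ^ p := by
  obtain ⟨B, hB⟩ := hf.2.1
  refine hf.integrable_of_bound (hf.1.norm.pow_const p) (B := B ^ p) (fun x => ?_)
    (fun x h => by simp [h, hp.ne'])
  rw [abs_of_nonneg (by positivity)]
  exact rpow_le_rpow (norm_nonneg _) (hB x) hp.le

/-- Fatou's lemma for uniformly bounded integrals. -/
lemma lintegral_le_of_tendsto {α : Type*} [MeasurableSpace α] {μ : Measure α} {H : ℕ → α → ℝ≥0∞}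
    {h : α → ℝ≥0∞} {K : ℝ≥0∞} (hm : ∀ n, AEMeasurable (H n) μ)
    (hlim : ∀ᵐ x ∂μ, Filter.Tendsto (fun n => H n x) Filter.atTop (nhds (h x)))
    (hK : ∀ n, ∫⁻ x, H n x ∂μ ≤ K) : ∫⁻ x, h x ∂μ ≤ K := by
  have h1 : ∫⁻ x, h x ∂μ = ∫⁻ x, Filter.liminf (fun n => H n x) Filter.atTop ∂μ :=
    lintegral_congr_ae (hlim.mono fun x hx => hx.liminf_eq.symm)
  rw [h1]
  refine (lintegral_liminf_le' hm).trans ?_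
  refine (Filter.liminf_le_liminf (Filter.Eventually.of_forall hK)).trans ?_
  simp

/-- The set where `‖f‖` is comparable to `2 ^ k`. -/
def lset (f : ℝ → ℂ) (k : ℤ) : Set ℝ := {x | (2 : ℝ) ^ k < ‖f x‖ ∧ ‖f x‖ ≤ 2 ^ (k + 1)}

lemma lset_measurable {f : ℝ → ℂ} (hf : Measurable f) (k : ℤ) : MeasurableSet (lset f k) :=
  (measurableSet_lt measurable_const hf.norm).inter (measurableSet_le hf.norm measurable_const)

lemma lset_unique {f : ℝ → ℂ} {x : ℝ} {k l : ℤ} (hk : x ∈ lset f k) (hl : x ∈ lset f l) : k = l := by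
  have h1 : (2 : ℝ) ^ k < 2 ^ (l + 1) := hk.1.trans_le hl.2
  have h2 : (2 : ℝ) ^ l < 2 ^ (k + 1) := hl.1.trans_le hk.2
  rw [zpow_lt_zpow_iff_right₀ (by norm_num)] at h1 h2
  omega

lemma exists_lset {f : ℝ → ℂ} {x : ℝ} (h : f x ≠ 0) : ∃ k, x ∈ lset f k :=
  exists_mem_Ioc_zpow (norm_pos_iff.2 h) one_lt_two

lemma sum_lset {M : Type*} [AddCommMonoid M] (f : ℝ → ℂ) (x : ℝ) (K : Finset ℤ) (F : ℤ → M) :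
    ∑ k ∈ K, (lset f k).indicator (fun _ => F k) x = 0 ∨
    ∃ k ∈ K, x ∈ lset f k ∧ ∑ k ∈ K, (lset f k).indicator (fun _ => F k) x = F k := by
  by_cases h : ∃ k ∈ K, x ∈ lset f k
  · obtain ⟨k, hk, hx⟩ := h
    refine Or.inr ⟨k, hk, hx, ?_⟩
    rw [Finset.sum_eq_single_of_mem k hk, indicator_of_mem hx]
    intro l _ hl
    exact indicator_of_notMem (fun h => hl (lset_unique h hx)) _
  · push Not at h
    exact Or.inl (Finset.sum_eq_zero fun k hk => indicator_of_notMem (h k hk) _)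

/-- Truncation of `f` to finitely many level sets. -/
noncomputable def ltr (f : ℝ → ℂ) (K : Finset ℤ) (x : ℝ) : ℂ := ∑ k ∈ K, (lset f k).indicator f x

lemma ltr_eq (f : ℝ → ℂ) (K : Finset ℤ) (x : ℝ) :
    ltr f K x = ∑ k ∈ K, (lset f k).indicator (fun _ => f x) x := by
  unfold ltr
  refine Finset.sum_congr rfl fun k _ => ?_
  by_cases h : x ∈ lset f k <;> simp [h]

lemma norm_ltr_le (f : ℝ → ℂ) (K : Finset ℤ) (x : ℝ) : ‖ltr f K x‖ ≤ ‖f x‖ := by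
  rw [ltr_eq]
  rcases sum_lset f x K fun _ => f x with h | ⟨k, -, -, h⟩ <;> rw [h]
  simp

lemma ltr_tendsto (f : ℝ → ℂ) (x : ℝ) :
    Filter.Tendsto (fun n : ℕ => ltr f (Finset.Icc (-(n : ℤ)) n) x) Filter.atTop (nhds (f x)) := by
  by_cases h0 : f x = 0
  · have : ∀ K, ltr f K x = 0 := fun K => by
      have := norm_ltr_le f K x
      rw [h0, norm_zero] at this
      exact norm_le_zero_iff.1 this
    simp [this, h0]
  · obtain ⟨k, hk⟩ := exists_lset h0
    refine tendsto_const_nhds.congr' ?_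
    filter_upwards [Filter.eventually_ge_atTop k.natAbs] with n hn
    unfold ltr
    rw [Finset.sum_eq_single_of_mem k (by rw [Finset.mem_Icc]; omega), indicator_of_mem hk]
    intro l _ hl
    exact indicator_of_notMem (fun h => hl (lset_unique h hk)) _

lemma volume_lset_ne_top {f : ℝ → ℂ} (hf : Nice f) (k : ℤ) : volume (lset f k) ≠ ⊤ := by
  obtain ⟨R, hR⟩ := hf.2.2
  refine measure_ne_top_of_subset (s := Icc (-R) R) ?_ (measure_Icc_lt_top (μ := volume)).ne
  intro x hx
  rw [mem_Icc, ← abs_le]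
  by_contra! h
  have := hx.1
  rw [hR x h, norm_zero] at this
  exact absurd this (not_lt.2 (by positivity))

lemma sum_lset_le {f : ℝ → ℂ} (hf : Nice f) {p : ℝ} (hp : 0 < p) (K : Finset ℤ) :
    ∑ k ∈ K, 2 ^ (k * p) * volume.real (lset f k) ≤ ∫ x, ‖f x‖ ^ p := by
  have hfin := volume_lset_ne_top hf
  have h1 : ∀ k : ℤ, 2 ^ (k * p) * volume.real (lset f k) =
      ∫ x, (lset f k).indicator (fun _ => (2 : ℝ) ^ (k * p)) x := fun k => by
    rw [integral_indicator_const _ (lset_measurable hf.1 k), smul_eq_mul, mul_comm]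
  have h2 : ∀ k : ℤ, Integrable ((lset f k).indicator fun _ => (2 : ℝ) ^ (k * p)) := fun k =>
    (integrable_indicator_iff (lset_measurable hf.1 k)).2 (integrableOn_const (hfin k))
  simp only [h1]
  rw [← integral_finsetSum _ fun k _ => h2 k]
  refine integral_mono (integrable_finsetSum _ fun k _ => h2 k) (hf.integrable_rpow hp) fun x => ?_
  rcases sum_lset f x K fun k => (2 : ℝ) ^ (k * p) with h | ⟨k, -, hx, h⟩ <;> rw [h]
  · positivity
  · rw [rpow_mul (by norm_num), rpow_intCast]
    exact rpow_le_rpow (by positivity) hx.1.le hp.le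

lemma integral_lset_le {f : ℝ → ℂ} (hf : Nice f) (k : ℤ) : ∫ x, ‖(lset f k).indicator f x‖ ≤
    2 ^ ((k : ℝ) + 1) * volume.real (lset f k) := by
  have hfin := volume_lset_ne_top hf k
  have hm := lset_measurable hf.1 k
  calc ∫ x, ‖(lset f k).indicator f x‖ ≤ ∫ x, (lset f k).indicator (fun _ => (2 : ℝ) ^ ((k : ℝ) + 1)) x := by
        refine integral_mono (hf.indicator hm).integrable.norm
          ((integrable_indicator_iff hm).2 (integrableOn_const hfin)) fun x => ?_
        by_cases hx : x ∈ lset f k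
        · simp only [indicator_of_mem hx]
          have := hx.2
          rwa [← rpow_intCast, Int.cast_add, Int.cast_one] at this
        · simp [indicator_of_notMem hx]
    _ = _ := by rw [integral_indicator_const _ hm, smul_eq_mul, mul_comm]

namespace Sym

variable {G : Sym}

lemma T_zero_left (R : ℝ) (g : ℝ → ℂ) : G.T R 0 g = 0 := by
  have := T_smul_left (G := G) R 0 0 g
  simpa using this

lemma T_zero_right (R : ℝ) (f : ℝ → ℂ) : G.T R f 0 = 0 := by
  have := T_smul_right (G := G) R 0 f 0
  simpa using this

lemma T_sum_left {R : ℝ} (hR : 1 ≤ R) {κ : Type*} (K : Finset κ) {f : κ → ℝ → ℂ} {g : ℝ → ℂ}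
    (hf : ∀ k, Integrable (f k)) (hg : Integrable g) :
    G.T R (∑ k ∈ K, f k) g = ∑ k ∈ K, G.T R (f k) g := by
  induction K using Finset.induction_on with
  | empty => simp [T_zero_left]
  | insert k K hk ih => rw [Finset.sum_insert hk, Finset.sum_insert hk,
      T_add_left hR (hf k) (integrable_finsetSum' _ fun k _ => hf k) hg, ih]

lemma T_sum_right {R : ℝ} (hR : 1 ≤ R) {κ : Type*} (K : Finset κ) {f : ℝ → ℂ} {g : κ → ℝ → ℂ}
    (hf : Integrable f) (hg : ∀ k, Integrable (g k)) :
    G.T R f (∑ k ∈ K, g k) = ∑ k ∈ K, G.T R f (g k) := by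
  induction K using Finset.induction_on with
  | empty => simp [T_zero_right]
  | insert k K hk ih => rw [Finset.sum_insert hk, Finset.sum_insert hk,
      T_add_right hR hf (hg k) (integrable_finsetSum' _ fun k _ => hg k), ih]

lemma T_tendsto {R : ℝ} (hR : 1 ≤ R) {f g : ℝ → ℂ} {fn gn : ℕ → ℝ → ℂ} (hf : Integrable f)
    (hg : Integrable g) (hfn : ∀ n, AEStronglyMeasurable (fn n)) (hgn : ∀ n, AEStronglyMeasurable (gn n))
    (hf1 : ∀ n x, ‖fn n x‖ ≤ ‖f x‖) (hg1 : ∀ n x, ‖gn n x‖ ≤ ‖g x‖)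
    (hf2 : ∀ x, Filter.Tendsto (fun n => fn n x) Filter.atTop (nhds (f x)))
    (hg2 : ∀ x, Filter.Tendsto (fun n => gn n x) Filter.atTop (nhds (g x))) (x : ℝ) :
    Filter.Tendsto (fun n => G.T R (fn n) (gn n) x) Filter.atTop (nhds (G.T R f g x)) := by
  have aux : ∀ {h : ℝ → ℂ} {hn : ℕ → ℝ → ℂ}, Integrable h → (∀ n, AEStronglyMeasurable (hn n)) →
      (∀ n x, ‖hn n x‖ ≤ ‖h x‖) → (∀ x, Filter.Tendsto (fun n => hn n x) Filter.atTop (nhds (h x))) →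
      (∀ n, Integrable (hn n)) ∧
      Filter.Tendsto (fun n => ∫ x, ‖(hn n - h) x‖) Filter.atTop (nhds 0) := by
    intro h hn hh hm h1 h2
    refine ⟨fun n => hh.mono (hm n) (ae_of_all _ (h1 n)), ?_⟩
    have := tendsto_integral_of_dominated_convergence (F := fun n x => ‖(hn n - h) x‖) (f := fun _ => (0 : ℝ))
      (μ := volume) (fun x => 2 * ‖h x‖) (fun n => ((hm n).sub hh.1).norm) (hh.norm.const_mul 2)
      (fun n => ae_of_all _ fun x => by
        rw [norm_norm, Pi.sub_apply]
        refine (norm_sub_le _ _).trans ?_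
        linarith [h1 n x])
      (ae_of_all _ fun x => by
        have := ((h2 x).sub_const (h x)).norm
        simpa using this)
    simpa using this
  obtain ⟨hfi, hft⟩ := aux hf hfn hf1 hf2
  obtain ⟨hgi, hgt⟩ := aux hg hgn hg1 hg2
  obtain ⟨C, hC, hb⟩ := T_bound (G := G) hR
  rw [tendsto_iff_norm_sub_tendsto_zero]
  refine squeeze_zero (fun _ => norm_nonneg _) (g := fun n => C * ((∫ x, ‖(fn n - f) x‖) * ∫ x, ‖g x‖) +
    C * ((∫ x, ‖f x‖) * ∫ x, ‖(gn n - g) x‖)) (fun n => ?_) ?_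
  · have e1 : G.T R (fn n) (gn n) = G.T R (fn n - f) (gn n) + G.T R f (gn n) := by
      rw [← T_add_left hR ((hfi n).sub hf) hf (hgi n), sub_add_cancel]
    have e2 : G.T R f (gn n) = G.T R f (gn n - g) + G.T R f g := by
      rw [← T_add_right hR hf ((hgi n).sub hg) hg, sub_add_cancel]
    have e3 : G.T R (fn n) (gn n) x - G.T R f g x = G.T R (fn n - f) (gn n) x + G.T R f (gn n - g) x := by
      rw [e1, e2]
      simp only [Pi.add_apply]
      ring
    rw [e3]
    refine (norm_add_le _ _).trans (add_le_add ((hb _ _ ((hfi n).sub hf) (hgi n) x).trans ?_)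
      (hb _ _ hf ((hgi n).sub hg) x))
    have := integral_mono (hgi n).norm hg.norm (hg1 n)
    gcongr
  · have := ((hft.mul_const (∫ x, ‖g x‖)).const_mul C).add ((hgt.const_mul (∫ x, ‖f x‖)).const_mul C)
    simpa using this

lemma weak_type_scaled {α0 α1 : ℝ} (h0 : 0 < α0) (h0' : α0 < 1) (h1 : 0 < α1) (h1' : α1 < 1)
    (h : α0 + α1 < 3 / 2) : ∃ C : ℝ, 0 < C ∧ ∀ (G : Sym) (R : ℝ), 1 ≤ R →
    ∀ (f g : ℝ → ℂ) (A B F0 F1 : ℝ), 0 < A → 0 < B → Nice f → Nice g → (∀ x, ‖f x‖ ≤ A) → (∀ x, ‖g x‖ ≤ B) →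
    ∫ x, ‖f x‖ ≤ A * F0 → ∫ x, ‖g x‖ ≤ B * F1 → ∀ l, 0 < l → ∀ E : Set ℝ, MeasurableSet E →
    Bornology.IsBounded E → (∀ x ∈ E, l ≤ ‖G.T R f g x‖) →
    l * volume.real E ^ (α0 + α1) ≤ C * (A * B) * (F0 ^ α0 * F1 ^ α1) := by
  obtain ⟨C, hC, hw⟩ := weak_type h0 h0' h1 h1' h
  refine ⟨C, hC, fun G R hR f g A B F0 F1 hA hB hf hg hfA hgB hF0 hF1 l hl E hE hEb hlE => ?_⟩
  have aux : ∀ {f : ℝ → ℂ} {A F : ℝ}, 0 < A → (∀ x, ‖f x‖ ≤ A) → ∫ x, ‖f x‖ ≤ A * F →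
      (∀ x, ‖(((A⁻¹ : ℝ) : ℂ) • f) x‖ ≤ 1) ∧ ∫ x, ‖(((A⁻¹ : ℝ) : ℂ) • f) x‖ ≤ F := by
    intro f A F hA h1 h2
    have e : ∀ x, ‖(((A⁻¹ : ℝ) : ℂ) • f) x‖ = A⁻¹ * ‖f x‖ := fun x => by
      rw [Pi.smul_apply, norm_smul, Complex.norm_real, norm_of_nonneg (by positivity)]
    simp only [e]
    refine ⟨fun x => ?_, ?_⟩
    · rw [inv_mul_le_iff₀ hA, mul_one]
      exact h1 x
    · rw [integral_const_mul, inv_mul_le_iff₀ hA]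
      exact h2
  obtain ⟨a1, a2⟩ := aux hA hfA hF0
  obtain ⟨b1, b2⟩ := aux hB hgB hF1
  have := hw G R hR _ _ F0 F1 (hf.const_smul _) (hg.const_smul _) a1 b1 a2 b2 (l / (A * B)) (by positivity)
    E hE hEb (fun x hx => by
      rw [T_smul_left, T_smul_right, Pi.smul_apply, Pi.smul_apply, norm_smul, norm_smul, Complex.norm_real,
        Complex.norm_real, norm_of_nonneg (by positivity), norm_of_nonneg (by positivity),
        div_le_iff₀ (by positivity)]
      calc l ≤ ‖G.T R f g x‖ := hlE x hx
        _ = _ := by field_simp)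
  rw [div_mul_eq_mul_div, div_le_iff₀ (by positivity)] at this
  linarith

lemma strong_type_add {p q r : ℝ} (hp : 1 < p) (hq : 1 < q) (hpqr : 1 / r = 1 / p + 1 / q)
    (hr : 1 / r < 3 / 2) : ∃ C : ℝ, 0 < C ∧ ∀ (G : Sym) (R : ℝ), 1 ≤ R → ∀ f g : ℝ → ℂ, Nice f → Nice g →
    ∫⁻ x, ‖G.T R f g x‖ₑ ^ r ≤ ENNReal.ofReal (C * ((∫ x, ‖f x‖ ^ p) + ∫ x, ‖g x‖ ^ q)) := by
  have hp0 : 0 < 1 / p := by positivity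
  have hq0 : 0 < 1 / q := by positivity
  have hp1 : 1 / p < 1 := by rw [div_lt_one (by linarith)]; exact hp
  have hq1 : 1 / q < 1 := by rw [div_lt_one (by linarith)]; exact hq
  have hr0 : 0 < r := by
    have : 0 < 1 / r := by linarith
    exact one_div_pos.1 this
  obtain ⟨ε, hε, hε1, hε2, hε3, hε4, hε5⟩ : ∃ ε, 0 < ε ∧ 2 * ε < 1 / p ∧ 2 * ε < 1 / q ∧
      2 * ε < 1 - 1 / p ∧ 2 * ε < 1 - 1 / q ∧ 2 * ε < 3 / 2 - 1 / r := by
    refine ⟨min (min (1 / p) (1 / q)) (min (min (1 - 1 / p) (1 - 1 / q)) (3 / 2 - 1 / r)) / 3, ?_, ?_, ?_, ?_, ?_, ?_⟩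
    · have : 0 < 1 - 1 / p := by linarith
      have : 0 < 1 - 1 / q := by linarith
      have : 0 < 3 / 2 - 1 / r := by linarith
      positivity
    all_goals
      have h1 := min_le_left (min (1 / p) (1 / q)) (min (min (1 - 1 / p) (1 - 1 / q)) (3 / 2 - 1 / r))
      have h2 := min_le_right (min (1 / p) (1 / q)) (min (min (1 - 1 / p) (1 - 1 / q)) (3 / 2 - 1 / r))
      have h3 := min_le_left (1 / p) (1 / q)
      have h4 := min_le_right (1 / p) (1 / q)
      have h5 := min_le_left (min (1 - 1 / p) (1 - 1 / q)) (3 / 2 - 1 / r)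
      have h6 := min_le_right (min (1 - 1 / p) (1 - 1 / q)) (3 / 2 - 1 / r)
      have h7 := min_le_left (1 - 1 / p) (1 - 1 / q)
      have h8 := min_le_right (1 - 1 / p) (1 - 1 / q)
      linarith
  have hW : ∀ e1 e2, (e1 = ε ∨ e1 = -ε) → (e2 = ε ∨ e2 = -ε) → ∃ C : ℝ, 0 < C ∧ ∀ (G : Sym) (R : ℝ), 1 ≤ R →
      ∀ (f g : ℝ → ℂ) (A B F0 F1 : ℝ), 0 < A → 0 < B → Nice f → Nice g → (∀ x, ‖f x‖ ≤ A) → (∀ x, ‖g x‖ ≤ B) →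
      ∫ x, ‖f x‖ ≤ A * F0 → ∫ x, ‖g x‖ ≤ B * F1 → ∀ l, 0 < l → ∀ E : Set ℝ, MeasurableSet E →
      Bornology.IsBounded E → (∀ x ∈ E, l ≤ ‖G.T R f g x‖) →
      l * volume.real E ^ (1 / p + e1 + (1 / q + e2)) ≤ C * (A * B) * (F0 ^ (1 / p + e1) * F1 ^ (1 / q + e2)) := by
    intro e1 e2 he1 he2
    apply weak_type_scaled <;> rcases he1 with rfl | rfl <;> rcases he2 with rfl | rfl <;> linarith
  choose! Cw hCw hw using hW
  set C0 := 1 + 4 * (Cw ε ε + Cw ε (-ε) + Cw (-ε) ε + Cw (-ε) (-ε)) with hC0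
  have q1 := hCw ε ε (Or.inl rfl) (Or.inl rfl)
  have q2 := hCw ε (-ε) (Or.inl rfl) (Or.inr rfl)
  have q3 := hCw (-ε) ε (Or.inr rfl) (Or.inl rfl)
  have q4 := hCw (-ε) (-ε) (Or.inr rfl) (Or.inr rfl)
  have hCle : ∀ e1 e2, (e1 = ε ∨ e1 = -ε) → (e2 = ε ∨ e2 = -ε) → 4 * Cw e1 e2 ≤ C0 := by
    intro e1 e2 he1 he2
    rcases he1 with rfl | rfl <;> rcases he2 with rfl | rfl <;> linarith
  obtain ⟨C', hC', hcore⟩ := interp_core (p := p) (q := q) (r := r) (ε := ε) (by linarith) (by linarith) hpqr hr0 hε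
    (by linarith) (by linarith) (by linarith) (by linarith) (C := C0) (by linarith)
  refine ⟨C', hC', fun G R hR f g hf hg => ?_⟩
  set K : ℕ → Finset ℤ := fun n => Finset.Icc (-(n : ℤ)) n with hK
  set fl : ℤ → ℝ → ℂ := fun k => (lset f k).indicator f with hfl
  set gl : ℤ → ℝ → ℂ := fun k => (lset g k).indicator g with hgl
  have hfln : ∀ k, Nice (fl k) := fun k => hf.indicator (lset_measurable hf.1 k)
  have hgln : ∀ k, Nice (gl k) := fun k => hg.indicator (lset_measurable hg.1 k)
  have hfs : ∀ n, ltr f (K n) = ∑ k ∈ K n, fl k := fun n => by ext x; simp [ltr, hfl]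
  have hgs : ∀ n, ltr g (K n) = ∑ k ∈ K n, gl k := fun n => by ext x; simp [ltr, hgl]
  have hTn : ∀ n, G.T R (ltr f (K n)) (ltr g (K n)) = fun x => ∑ k ∈ K n, ∑ l ∈ K n, G.T R (fl k) (gl l) x := by
    intro n
    rw [hfs, hgs, T_sum_left hR _ (fun k => (hfln k).integrable)
      (integrable_finsetSum' _ fun k _ => (hgln k).integrable)]
    ext x
    rw [Finset.sum_apply]
    refine Finset.sum_congr rfl fun k _ => ?_
    rw [T_sum_right hR _ (hfln k).integrable fun k => (hgln k).integrable, Finset.sum_apply]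
  have hTm : ∀ n, Measurable (G.T R (ltr f (K n)) (ltr g (K n))) := fun n => by
    rw [hTn]
    exact Finset.measurable_fun_sum _ fun k _ => Finset.measurable_fun_sum _ fun l _ =>
      T_measurable R (hfln k).1 (hgln l).1
  refine lintegral_le_of_tendsto (H := fun n => (Metric.closedBall 0 (n : ℝ)).indicator fun x =>
    ‖G.T R (ltr f (K n)) (ltr g (K n)) x‖ₑ ^ r)
    (fun n => (((hTm n).enorm.pow_const r).indicator Metric.isClosed_closedBall.measurableSet).aemeasurable)
    (ae_of_all _ fun x => ?_) fun n => ?_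
  · have h1 := T_tendsto (G := G) hR hf.integrable hg.integrable (fn := fun n => ltr f (K n))
      (gn := fun n => ltr g (K n))
      (fun n => by rw [hfs]; exact (integrable_finsetSum' _ fun k _ => (hfln k).integrable).1)
      (fun n => by rw [hgs]; exact (integrable_finsetSum' _ fun k _ => (hgln k).integrable).1)
      (fun n x => norm_ltr_le f _ x) (fun n x => norm_ltr_le g _ x) (ltr_tendsto f) (ltr_tendsto g) x
    have h2 := ((ENNReal.continuous_rpow_const (y := r)).tendsto _).comp h1.enorm
    refine h2.congr' ?_
    filter_upwards [Filter.eventually_ge_atTop ⌈|x|⌉₊] with n hn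
    rw [indicator_of_mem]
    · rfl
    · rw [mem_closedBall_zero_iff, norm_eq_abs]
      exact (Nat.le_ceil _).trans (by exact_mod_cast hn)
  · rw [lintegral_indicator Metric.isClosed_closedBall.measurableSet]
    have hc := hcore (K n) (K n) (fun k l => G.T R (fl k) (gl l)) (fun k => 2 ^ (k * p) * volume.real (lset f k))
      (fun k => 2 ^ (k * q) * volume.real (lset g k)) (Metric.closedBall 0 (n : ℝ))
      (fun k l => T_measurable R (hfln k).1 (hgln l).1) (fun k => by positivity) (fun k => by positivity)
      Metric.isClosed_closedBall.measurableSet Metric.isBounded_closedBall ?_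
    · rw [hTn]
      refine hc.trans (ENNReal.ofReal_le_ofReal ?_)
      gcongr
      · exact sum_lset_le hf (by linarith) _
      · exact sum_lset_le hg (by linarith) _
    · intro e1 e2 he1 he2 k l t ht E hE hEb htE
      have hlev : ∀ {f : ℝ → ℂ} (k : ℤ) (x : ℝ), ‖(lset f k).indicator f x‖ ≤ 2 ^ ((k : ℝ) + 1) := by
        intro f k x
        by_cases hx : x ∈ lset f k
        · simp only [indicator_of_mem hx]
          have := hx.2
          rwa [← rpow_intCast, Int.cast_add, Int.cast_one] at this
        · rw [indicator_of_notMem hx, norm_zero]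
          positivity
      have h1 := hw e1 e2 he1 he2 G R hR (fl k) (gl l) (2 ^ ((k : ℝ) + 1)) (2 ^ ((l : ℝ) + 1))
        (volume.real (lset f k)) (volume.real (lset g l)) (by positivity) (by positivity) (hfln k) (hgln l)
        (hlev k) (hlev l) (integral_lset_le hf k) (integral_lset_le hg l) t ht E hE hEb htE
      have e3 : ∀ (k : ℤ) (p V : ℝ), 2 ^ (k * p) * V * 2 ^ (-k * p) = V := by
        intro k p V
        rw [mul_right_comm, ← rpow_add (by norm_num)]
        simp
      rw [e3, e3]
      refine h1.trans ?_
      rw [rpow_add_one (by norm_num), rpow_add_one (by norm_num)]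
      have h4 := hCle e1 e2 he1 he2
      calc _ = (4 * Cw e1 e2) * (2 ^ (k : ℝ) * 2 ^ (l : ℝ)) *
            (volume.real (lset f k) ^ (1 / p + e1) * volume.real (lset g l) ^ (1 / q + e2)) := by ring
        _ ≤ _ := by gcongr

/-- Strong type bounds for the model operators, uniformly in the truncation. -/
lemma strong_type {p q r : ℝ} (hp : 1 < p) (hq : 1 < q) (hpqr : 1 / r = 1 / p + 1 / q)
    (hr : 1 / r < 3 / 2) : ∃ C : ℝ, 0 < C ∧ ∀ (G : Sym) (R : ℝ), 1 ≤ R → ∀ f g : ℝ → ℂ, Nice f → Nice g →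
    ∫⁻ x, ‖G.T R f g x‖ₑ ^ r ≤
      ENNReal.ofReal (C * ((∫ x, ‖f x‖ ^ p) ^ (r / p) * (∫ x, ‖g x‖ ^ q) ^ (r / q))) := by
  obtain ⟨C, hC, hb⟩ := strong_type_add hp hq hpqr hr
  have hp0 : 0 < 1 / p := by positivity
  have hq0 : 0 < 1 / q := by positivity
  have hr0 : 0 < r := by
    have : 0 < 1 / r := by linarith
    exact one_div_pos.1 this
  refine ⟨2 * C, by positivity, fun G R hR f g hf hg => ?_⟩
  have hz : ∀ {f : ℝ → ℂ} {p : ℝ}, 1 < p → Nice f → ∫ x, ‖f x‖ ^ p = 0 → f =ᵐ[volume] 0 := by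
    intro f p hp hf h
    rw [integral_eq_zero_iff_of_nonneg (fun x => by positivity) (hf.integrable_rpow (by linarith))] at h
    filter_upwards [h] with x hx
    simpa [rpow_eq_zero (norm_nonneg _) (show p ≠ 0 by linarith)] using hx
  obtain ⟨C1, hC1, hTb⟩ := T_bound (G := G) hR
  have hzero : (∫ x, ‖f x‖) * (∫ x, ‖g x‖) = 0 → ∫⁻ x, ‖G.T R f g x‖ₑ ^ r = 0 := by
    intro h
    have : ∀ x, G.T R f g x = 0 := fun x => by
      have := hTb f g hf.integrable hg.integrable x
      rw [h, mul_zero] at this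
      exact norm_le_zero_iff.1 this
    simp [this, hr0]
  rcases eq_or_lt_of_le (integral_nonneg (μ := volume) fun x => by positivity : 0 ≤ ∫ x, ‖f x‖ ^ p) with hf0 | hf0
  · rw [hzero]
    · exact zero_le
    · rw [integral_congr_ae ((hz hp hf hf0.symm).mono fun x hx => by simp [hx] : (fun x => ‖f x‖) =ᵐ[volume] 0)]
      simp
  rcases eq_or_lt_of_le (integral_nonneg (μ := volume) fun x => by positivity : 0 ≤ ∫ x, ‖g x‖ ^ q) with hg0 | hg0
  · rw [hzero]
    · exact zero_le
    · rw [integral_congr_ae ((hz hq hg hg0.symm).mono fun x hx => by simp [hx] : (fun x => ‖g x‖) =ᵐ[volume] 0)]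
      simp
  set X := ∫ x, ‖f x‖ ^ p with hX
  set Y := ∫ x, ‖g x‖ ^ q with hY
  set a : ℝ := X ^ (-1 / p) with ha
  set b : ℝ := Y ^ (-1 / q) with hb'
  have ha0 : 0 < a := rpow_pos_of_pos hf0 _
  have hb0 : 0 < b := rpow_pos_of_pos hg0 _
  have hn : ∀ {f : ℝ → ℂ} {p : ℝ}, 1 < p → 0 < ∫ x, ‖f x‖ ^ p →
      ∫ x, ‖((((∫ x, ‖f x‖ ^ p) ^ (-1 / p) : ℝ) : ℂ) • f) x‖ ^ p = 1 := by
    intro f p hp h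
    have hp' : p ≠ 0 := by linarith
    have e : ∀ x, ‖((((∫ x, ‖f x‖ ^ p) ^ (-1 / p) : ℝ) : ℂ) • f) x‖ ^ p = (∫ x, ‖f x‖ ^ p)⁻¹ * ‖f x‖ ^ p := by
      intro x
      rw [Pi.smul_apply, norm_smul, Complex.norm_real, norm_of_nonneg (by positivity),
        mul_rpow (by positivity) (norm_nonneg _), ← rpow_mul h.le, div_mul_cancel₀ _ hp', rpow_neg_one]
    simp only [e]
    rw [integral_const_mul, inv_mul_cancel₀ h.ne']
  have h1 := hb G R hR _ _ (hf.const_smul (a : ℂ)) (hg.const_smul (b : ℂ))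
  rw [hn hp hf0, hn hq hg0] at h1
  have e2 : ∀ x, ‖G.T R ((a : ℂ) • f) ((b : ℂ) • g) x‖ₑ ^ r = ENNReal.ofReal ((a * b) ^ r) * ‖G.T R f g x‖ₑ ^ r := by
    intro x
    rw [T_smul_left, T_smul_right, Pi.smul_apply, Pi.smul_apply, smul_smul, ← Complex.ofReal_mul, enorm_smul,
      ENNReal.mul_rpow_of_nonneg _ _ hr0.le, ← ENNReal.ofReal_rpow_of_nonneg (by positivity) hr0.le, ← ofReal_norm,
      Complex.norm_real, norm_of_nonneg (by positivity)]
  simp only [e2] at h1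
  rw [lintegral_const_mul' _ _ ENNReal.ofReal_ne_top] at h1
  have e3 : X ^ (r / p) * Y ^ (r / q) = ((a * b) ^ r)⁻¹ := by
    rw [mul_rpow ha0.le hb0.le, ha, hb', ← rpow_mul hf0.le, ← rpow_mul hg0.le, mul_inv, ← rpow_neg hf0.le,
      ← rpow_neg hg0.le]
    congr 2 <;> ring
  rw [e3, ← div_eq_mul_inv, ENNReal.ofReal_div_of_pos (by positivity), ENNReal.le_div_iff_mul_le (by left; simp; positivity)
    (by left; exact ENNReal.ofReal_ne_top), mul_comm]
  refine h1.trans (le_of_eq ?_)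
  ring_nf

end Sym

section Signs

variable {ι V : Type*}

/-- Average over the subsets of `s`. -/
noncomputable def av (s : Finset ι) (F : Finset ι → ℝ) : ℝ := (2 ^ s.card)⁻¹ * ∑ t ∈ s.powerset, F t

/-- The signed sum with sign `1` on `t` and `-1` off `t`. -/
noncomputable def rad [AddCommGroup V] (s t : Finset ι) (a : ι → V) : V :=
  ∑ n ∈ s, if n ∈ t then a n else -a n

lemma av_empty (F : Finset ι → ℝ) : av ∅ F = F ∅ := by simp [av]

lemma av_insert {b : ι} {s : Finset ι} (hb : b ∉ s) (F : Finset ι → ℝ) :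
    av (insert b s) F = av s fun t => (F t + F (insert b t)) / 2 := by
  unfold av
  rw [Finset.sum_powerset_insert hb, Finset.card_insert_of_notMem hb, ← Finset.sum_add_distrib,
    ← Finset.sum_div, pow_succ, mul_inv]
  ring

lemma rad_insert_off [AddCommGroup V] {b : ι} {s t : Finset ι} (hb : b ∉ s) (ht : t ∈ s.powerset) (a : ι → V) :
    rad (insert b s) t a = rad s t a - a b := by
  have : b ∉ t := fun h => hb (Finset.mem_powerset.1 ht h)
  rw [rad, Finset.sum_insert hb, if_neg this, rad]
  abel

lemma rad_insert_on [AddCommGroup V] {b : ι} {s t : Finset ι} (hb : b ∉ s) (a : ι → V) :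
    rad (insert b s) (insert b t) a = rad s t a + a b := by
  rw [rad, Finset.sum_insert hb, if_pos (Finset.mem_insert_self _ _), rad, add_comm]
  congr 1
  refine Finset.sum_congr rfl fun n hn => ?_
  have : n ≠ b := fun h => hb (h ▸ hn)
  simp [Finset.mem_insert, this]

lemma av_mono {s : Finset ι} {F H : Finset ι → ℝ} (h : ∀ t ∈ s.powerset, F t ≤ H t) : av s F ≤ av s H :=
  mul_le_mul_of_nonneg_left (Finset.sum_le_sum h) (by positivity)

lemma av_congr {s : Finset ι} {F H : Finset ι → ℝ} (h : ∀ t ∈ s.powerset, F t = H t) : av s F = av s H := by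
  unfold av
  rw [Finset.sum_congr rfl h]

lemma av_add (s : Finset ι) (F H : Finset ι → ℝ) : av s (fun t => F t + H t) = av s F + av s H := by
  unfold av
  rw [Finset.sum_add_distrib, mul_add]

lemma av_mul (s : Finset ι) (F : Finset ι → ℝ) (c : ℝ) : av s (fun t => F t * c) = av s F * c := by
  unfold av
  rw [← Finset.sum_mul, mul_assoc]

lemma av_const (s : Finset ι) (c : ℝ) : av s (fun _ => c) = c := by
  unfold av
  rw [Finset.sum_const, Finset.card_powerset, nsmul_eq_mul]
  push_cast
  field_simp

lemma av_nonneg {s : Finset ι} {F : Finset ι → ℝ} (h : ∀ t, 0 ≤ F t) : 0 ≤ av s F :=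
  mul_nonneg (by positivity) (Finset.sum_nonneg fun t _ => h t)

variable [NormedAddCommGroup V] [InnerProductSpace ℝ V]

lemma av_rad_sq (s : Finset ι) (a : ι → V) : av s (fun t => ‖rad s t a‖ ^ 2) = ∑ n ∈ s, ‖a n‖ ^ 2 := by
  induction s using Finset.induction_on with
  | empty => simp [av_empty, rad]
  | insert b s hb ih =>
    rw [av_insert hb, Finset.sum_insert hb, ← ih, add_comm, ← av_const s (‖a b‖ ^ 2), ← av_add]
    refine av_congr fun t ht => ?_
    rw [rad_insert_off hb ht, rad_insert_on hb, norm_add_sq_real, norm_sub_sq_real]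
    ring

lemma av_rad_four (s : Finset ι) (a : ι → V) :
    av s (fun t => ‖rad s t a‖ ^ 4) ≤ 3 * (∑ n ∈ s, ‖a n‖ ^ 2) ^ 2 := by
  induction s using Finset.induction_on with
  | empty => simp [av_empty, rad]
  | insert b s hb ih =>
    rw [av_insert hb, Finset.sum_insert hb]
    have h1 : av s (fun t => (‖rad (insert b s) t a‖ ^ 4 + ‖rad (insert b s) (insert b t) a‖ ^ 4) / 2) ≤
        av s (fun t => (‖rad s t a‖ ^ 4 + ‖rad s t a‖ ^ 2 * (6 * ‖a b‖ ^ 2)) + ‖a b‖ ^ 4) := by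
      refine av_mono fun t ht => ?_
      have e : ∀ x : ℝ, x ^ 4 = (x ^ 2) ^ 2 := fun x => by ring
      rw [rad_insert_off hb ht, rad_insert_on hb, e ‖rad s t a - a b‖, e ‖rad s t a + a b‖,
        norm_add_sq_real, norm_sub_sq_real]
      have := abs_real_inner_le_norm (rad s t a) (a b)
      have h2 := sq_le_sq' (neg_le_of_abs_le this) (le_of_abs_le this)
      nlinarith
    rw [av_add, av_add, av_mul, av_const, av_rad_sq] at h1
    have : 0 ≤ ∑ n ∈ s, ‖a n‖ ^ 2 := by positivity
    nlinarith [sq_nonneg (‖a b‖ ^ 2)]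

lemma av_exp_rad (s : Finset ι) (a : ι → ℝ) :
    av s (fun t => exp (rad s t a)) ≤ exp ((∑ n ∈ s, a n ^ 2) / 2) := by
  induction s using Finset.induction_on with
  | empty => simp [av_empty, rad]
  | insert b s hb ih =>
    rw [av_insert hb, Finset.sum_insert hb]
    have h1 : av s (fun t => (exp (rad (insert b s) t a) + exp (rad (insert b s) (insert b t) a)) / 2) =
        av s (fun t => exp (rad s t a)) * cosh (a b) := by
      rw [← av_mul]
      refine av_congr fun t ht => ?_
      rw [rad_insert_off hb ht, rad_insert_on hb, cosh_eq, exp_add, sub_eq_add_neg, exp_add]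
      ring
    rw [h1, add_div, exp_add, mul_comm]
    exact mul_le_mul (cosh_le_exp_half_sq _) ih (av_nonneg fun _ => (exp_pos _).le) (exp_pos _).le

lemma map_rad {V W : Type*} [AddCommGroup V] [AddCommGroup W] (L : V →+ W) (s t : Finset ι) (a : ι → V) :
    L (rad s t a) = rad s t fun n => L (a n) := by
  unfold rad
  rw [map_sum]
  refine Finset.sum_congr rfl fun n _ => ?_
  split_ifs <;> simp

lemma rpow_le_exp {p x : ℝ} (hp : 0 < p) (hx : 0 ≤ x) : x ^ p ≤ p ^ p * exp x := by
  have h1 : x ≤ p * exp (x / p) := by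
    have := add_one_le_exp (x / p)
    calc x = p * (x / p) := by field_simp
      _ ≤ p * exp (x / p) := by gcongr; linarith
  refine (rpow_le_rpow hx h1 hp.le).trans (le_of_eq ?_)
  rw [mul_rpow hp.le (exp_pos _).le, ← exp_mul]
  field_simp

lemma av_rad_rpow {p : ℝ} (hp : 0 < p) (s : Finset ι) (a : ι → ℂ) :
    av s (fun t => ‖rad s t a‖ ^ p) ≤ 4 * exp 2 * p ^ p * (∑ n ∈ s, ‖a n‖ ^ 2) ^ (p / 2) := by
  rcases (Finset.sum_nonneg fun n (_ : n ∈ s) => sq_nonneg ‖a n‖).eq_or_lt with h0 | h0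
  · rw [← h0, zero_rpow (by positivity), mul_zero]
    rw [eq_comm, Finset.sum_eq_zero_iff_of_nonneg fun _ _ => by positivity] at h0
    rw [← av_const s 0]
    refine av_mono fun t _ => ?_
    have : rad s t a = 0 := Finset.sum_eq_zero fun n hn => by
      have : a n = 0 := by simpa using h0 n hn
      simp [this]
    simp [this, zero_rpow hp.ne']
  set σ := √(∑ n ∈ s, ‖a n‖ ^ 2) with hσ
  have hσ0 : 0 < σ := sqrt_pos.2 h0
  have hσ2 : σ ^ 2 = ∑ n ∈ s, ‖a n‖ ^ 2 := sq_sqrt h0.le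
  have key : ∀ L : ℂ →+ ℝ, (∀ z, |L z| ≤ ‖z‖) → ∀ c : ℝ, c ^ 2 = 4 →
      av s (fun t => exp (c * (L (rad s t a) / σ))) ≤ exp 2 := by
    intro L hL c hc
    have := av_exp_rad s fun n => c * (L (a n) / σ)
    have e : ∀ t, rad s t (fun n => c * (L (a n) / σ)) = c * (L (rad s t a) / σ) := fun t => by
      have := map_rad (AddMonoidHom.mulLeft (c / σ)) s t fun n => L (a n)
      rw [map_rad L]
      simp only [AddMonoidHom.coe_mulLeft] at this
      rw [show (c * (rad s t (fun n => L (a n)) / σ)) = c / σ * rad s t (fun n => L (a n)) by ring, this]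
      congr 1
      ext n
      ring
    simp only [e] at this
    refine this.trans (exp_le_exp.2 ?_)
    simp only [mul_pow, div_pow, hc]
    rw [← Finset.mul_sum, ← Finset.sum_div, hσ2]
    have : (∑ n ∈ s, L (a n) ^ 2) / (∑ n ∈ s, ‖a n‖ ^ 2) ≤ 1 := by
      rw [div_le_one h0]
      refine Finset.sum_le_sum fun n _ => ?_
      rw [← sq_abs]
      have := hL (a n)
      gcongr
    linarith
  have hre := key Complex.reAddGroupHom Complex.abs_re_le_norm
  have him := key Complex.imAddGroupHom Complex.abs_im_le_norm
  have k1 := hre 2 (by norm_num)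
  have k2 := hre (-2) (by norm_num)
  have k3 := him 2 (by norm_num)
  have k4 := him (-2) (by norm_num)
  rw [← hσ2, ← rpow_natCast σ 2, ← rpow_mul hσ0.le, Nat.cast_ofNat, mul_div_cancel₀ p two_ne_zero]
  have hmain : av s (fun t => ‖rad s t a‖ ^ p) ≤ av s (fun t =>
      (exp (2 * (Complex.reAddGroupHom (rad s t a) / σ)) + exp (-2 * (Complex.reAddGroupHom (rad s t a) / σ))
      + exp (2 * (Complex.imAddGroupHom (rad s t a) / σ)) + exp (-2 * (Complex.imAddGroupHom (rad s t a) / σ)))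
      * (p ^ p * σ ^ p)) := by
    refine av_mono fun t _ => ?_
    have h1 : ‖rad s t a‖ ^ p = (‖rad s t a‖ / σ) ^ p * σ ^ p := by
      rw [div_rpow (norm_nonneg _) hσ0.le]
      field_simp
    rw [h1, ← mul_assoc]
    refine mul_le_mul_of_nonneg_right ?_ (by positivity)
    refine (rpow_le_exp hp (by positivity)).trans ?_
    rw [mul_comm]
    refine mul_le_mul_of_nonneg_right ?_ (by positivity)
    change _ ≤ exp (2 * ((rad s t a).re / σ)) + exp (-2 * ((rad s t a).re / σ)) +
      exp (2 * ((rad s t a).im / σ)) + exp (-2 * ((rad s t a).im / σ))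
    have h2 := Complex.norm_le_abs_re_add_abs_im (rad s t a)
    have h3 : exp (‖rad s t a‖ / σ) ≤ exp |(rad s t a).re / σ| * exp |(rad s t a).im / σ| := by
      rw [← exp_add, exp_le_exp, abs_div, abs_div, abs_of_pos hσ0, ← add_div]
      gcongr
    have h4 : ∀ u : ℝ, exp |u| ^ 2 ≤ exp (2 * u) + exp (-2 * u) := fun u => by
      rw [← exp_nat_mul, Nat.cast_ofNat]
      rcases abs_cases u with h | h <;> rw [h.1]
      · linarith [exp_pos (-2 * u)]
      · rw [show 2 * -u = -2 * u by ring]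
        linarith [exp_pos (2 * u)]
    nlinarith [h4 ((rad s t a).re / σ), h4 ((rad s t a).im / σ), sq_nonneg (exp |(rad s t a).re / σ|),
      sq_nonneg (exp |(rad s t a).im / σ|), sq_nonneg (exp |(rad s t a).re / σ| - exp |(rad s t a).im / σ|)]
  refine hmain.trans ?_
  rw [av_mul, av_add, av_add, av_add]
  have : 0 ≤ p ^ p * σ ^ p := by positivity
  calc _ ≤ (exp 2 + exp 2 + exp 2 + exp 2) * (p ^ p * σ ^ p) := by gcongr
    _ = _ := by ring

lemma av_bilinear_sq (s : Finset ι) (a : ι → ι → ℂ) :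
    av s (fun t' => av s fun t => ‖rad s t fun n => rad s t' (a n)‖ ^ 2) = ∑ n ∈ s, ∑ m ∈ s, ‖a n m‖ ^ 2 := by
  simp only [av_rad_sq]
  simp only [← av_rad_sq s (a _)]
  unfold av
  rw [Finset.sum_comm, Finset.mul_sum]

lemma av_bilinear_four (s : Finset ι) (a : ι → ι → ℂ) :
    av s (fun t' => av s fun t => ‖rad s t fun n => rad s t' (a n)‖ ^ 4) ≤
      9 * (∑ n ∈ s, ∑ m ∈ s, ‖a n m‖ ^ 2) ^ 2 := by
  let b : ι → EuclideanSpace ℂ s := fun m => WithLp.toLp 2 fun n => a n m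
  let _ : InnerProductSpace ℝ (EuclideanSpace ℂ s) := InnerProductSpace.rclikeToReal ℂ _
  have hb : ∀ m, ‖b m‖ ^ 2 = ∑ n ∈ s, ‖a n m‖ ^ 2 := fun m => by
    rw [EuclideanSpace.norm_sq_eq, ← Finset.sum_coe_sort s fun n => ‖a n m‖ ^ 2]
  have hr : ∀ t', ‖rad s t' b‖ ^ 2 = ∑ n ∈ s, ‖rad s t' (a n)‖ ^ 2 := fun t' => by
    rw [EuclideanSpace.norm_sq_eq, ← Finset.sum_coe_sort s fun n => ‖rad s t' (a n)‖ ^ 2]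
    refine Finset.sum_congr rfl fun n _ => ?_
    congr 2
    exact map_rad (EuclideanSpace.proj (𝕜 := ℂ) n : EuclideanSpace ℂ s →L[ℂ] ℂ).toLinearMap.toAddMonoidHom s t' b
  have h1 := av_rad_four s b
  have e : ∀ t', ‖rad s t' b‖ ^ 4 = (∑ n ∈ s, ‖rad s t' (a n)‖ ^ 2) ^ 2 := fun t' => by
    rw [← hr]
    ring
  simp only [e, hb] at h1
  rw [Finset.sum_comm] at h1
  have h2 := av_mono (s := s) fun t' _ => av_rad_four s fun n => rad s t' (a n)
  simp only [mul_comm (3 : ℝ)] at h2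
  rw [av_mul] at h2
  linarith

lemma av_bilinear_lower {r : ℝ} (hr : 0 < r) (s : Finset ι) (a : ι → ι → ℂ) :
    (∑ n ∈ s, ‖a n n‖ ^ 2) ^ (r / 2) ≤ 144 * 2 ^ r *
      av s (fun t' => av s fun t => ‖rad s t fun n => rad s t' (a n)‖ ^ r) := by
  set D := ∑ n ∈ s, ∑ m ∈ s, ‖a n m‖ ^ 2 with hD
  have hle : ∑ n ∈ s, ‖a n n‖ ^ 2 ≤ D := Finset.sum_le_sum fun n hn =>
    Finset.single_le_sum (f := fun m => ‖a n m‖ ^ 2) (fun _ _ => by positivity) hn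
  refine (rpow_le_rpow (by positivity) hle (by positivity)).trans ?_
  have hD0 : 0 ≤ D := by positivity
  rcases hD0.eq_or_lt with h0 | h0
  · rw [← h0, zero_rpow (by positivity)]
    exact mul_nonneg (by positivity) (av_nonneg fun _ => av_nonneg fun _ => by positivity)
  have hσ0 := sqrt_pos.2 h0
  set σ := √D with hσ
  have hσ2 : σ ^ 2 = D := sq_sqrt h0.le
  have hDr : D ^ (r / 2) = σ ^ r := by
    rw [← hσ2, ← rpow_natCast σ 2, ← rpow_mul hσ0.le, Nat.cast_ofNat, mul_div_cancel₀ r two_ne_zero]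
  have hpt : ∀ x : ℝ, 0 ≤ x → x ^ 2 ≤ (D / 4 + x ^ 4 * (18 * D)⁻¹) + x ^ r * (18 * 2 ^ r * D / σ ^ r) := by
    intro x hx
    by_cases h1 : x ≤ σ / 2
    · have : x ^ 2 ≤ (σ / 2) ^ 2 := by gcongr
      have h2 : 0 ≤ x ^ 4 * (18 * D)⁻¹ := by positivity
      have h3 : 0 ≤ x ^ r * (18 * 2 ^ r * D / σ ^ r) := by positivity
      nlinarith
    by_cases h2 : x ^ 2 ≤ 18 * D
    · have h3 : (1 : ℝ) ≤ (x / (σ / 2)) ^ r := by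
        refine one_le_rpow ?_ hr.le
        rw [one_le_div (by positivity)]
        linarith
      have h4 : x ^ r * (18 * 2 ^ r * D / σ ^ r) = 18 * D * (x / (σ / 2)) ^ r := by
        rw [div_rpow hx (by positivity), div_rpow hσ0.le (by norm_num)]
        field_simp
      have h5 : 0 ≤ x ^ 4 * (18 * D)⁻¹ := by positivity
      rw [h4]
      nlinarith
    · have h3 : 0 ≤ x ^ r * (18 * 2 ^ r * D / σ ^ r) := by positivity
      have h4 : x ^ 2 ≤ x ^ 4 * (18 * D)⁻¹ := by
        rw [← div_eq_mul_inv, le_div_iff₀ (by positivity)]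
        push Not at h2
        nlinarith [sq_nonneg x]
      linarith
  have h1 : av s (fun t' => av s fun t => ‖rad s t fun n => rad s t' (a n)‖ ^ 2) ≤
      av s (fun t' => av s fun t => (D / 4 + ‖rad s t fun n => rad s t' (a n)‖ ^ 4 * (18 * D)⁻¹) +
        ‖rad s t fun n => rad s t' (a n)‖ ^ r * (18 * 2 ^ r * D / σ ^ r)) :=
    av_mono fun _ _ => av_mono fun _ _ => hpt _ (norm_nonneg _)
  simp only [av_add, av_mul, av_const, av_bilinear_sq] at h1
  have h2 := av_bilinear_four s a
  rw [← hD] at h1 h2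
  rw [hDr]
  set X := av s (fun t' => av s fun t => ‖rad s t fun n => rad s t' (a n)‖ ^ r)
  set Y := av s (fun t' => av s fun t => ‖rad s t fun n => rad s t' (a n)‖ ^ 4)
  have h3 : Y * (18 * D)⁻¹ ≤ D / 2 := by
    rw [← div_eq_mul_inv, div_le_iff₀ (by positivity)]
    nlinarith
  have h4 : D / 4 ≤ X * (18 * 2 ^ r * D / σ ^ r) := by linarith
  have h5 : 0 < σ ^ r := by positivity
  rw [mul_div_assoc', le_div_iff₀ h5] at h4
  have : σ ^ r * D ≤ (144 * 2 ^ r * X) * D := by nlinarith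
  exact le_of_mul_le_mul_right this h0

end Signs

variable {ι : Type*}

/-- The square function of a finite family. -/
noncomputable def sqf (s : Finset ι) (f : ι → ℝ → ℂ) (x : ℝ) : ℝ := √(∑ n ∈ s, ‖f n x‖ ^ 2)

lemma sqf_nonneg (s : Finset ι) (f : ι → ℝ → ℂ) (x : ℝ) : 0 ≤ sqf s f x := sqrt_nonneg _

lemma sqf_sq (s : Finset ι) (f : ι → ℝ → ℂ) (x : ℝ) : sqf s f x ^ 2 = ∑ n ∈ s, ‖f n x‖ ^ 2 :=
  sq_sqrt (by positivity)

lemma sqf_rpow (s : Finset ι) (f : ι → ℝ → ℂ) (x p : ℝ) :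
    sqf s f x ^ p = (∑ n ∈ s, ‖f n x‖ ^ 2) ^ (p / 2) := by
  unfold sqf
  rw [sqrt_eq_rpow, ← rpow_mul (by positivity)]
  congr 1
  ring

lemma le_sqf {s : Finset ι} (f : ι → ℝ → ℂ) (x : ℝ) {n : ι} (hn : n ∈ s) : ‖f n x‖ ≤ sqf s f x := by
  refine le_sqrt_of_sq_le ?_
  exact Finset.single_le_sum (f := fun n => ‖f n x‖ ^ 2) (fun _ _ => by positivity) hn

lemma sqf_le_sum (s : Finset ι) (f : ι → ℝ → ℂ) (x : ℝ) : sqf s f x ≤ ∑ n ∈ s, ‖f n x‖ := by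
  refine sqrt_le_iff.2 ⟨by positivity, ?_⟩
  exact Finset.sum_sq_le_sq_sum_of_nonneg fun _ _ => norm_nonneg _

lemma sqf_measurable {s : Finset ι} {f : ι → ℝ → ℂ} (hf : ∀ n ∈ s, Measurable (f n)) :
    Measurable (sqf s f) := by
  refine Measurable.sqrt (Finset.measurable_fun_sum _ fun n hn => ?_)
  exact (hf n hn).norm.pow_const 2

lemma sqf_nice {s : Finset ι} {f : ι → ℝ → ℂ} (hf : ∀ n, Nice (f n)) :
    Nice fun x => ((sqf s f x : ℝ) : ℂ) := by
  choose h1 h2 h3 using hf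
  choose B hB using h2
  choose R hR using h3
  refine ⟨Complex.measurable_ofReal.comp (sqf_measurable fun n _ => h1 n), ⟨∑ n ∈ s, B n, fun x => ?_⟩,
    ∑ n ∈ s, |R n|, fun x hx => ?_⟩
  · rw [Complex.norm_real, norm_of_nonneg (sqf_nonneg _ _ _)]
    exact (sqf_le_sum _ _ _).trans (Finset.sum_le_sum fun n _ => hB n x)
  · have : sqf s f x = 0 := by
      refine le_antisymm ((sqf_le_sum _ _ _).trans (le_of_eq (Finset.sum_eq_zero fun n hn => ?_)))
        (sqf_nonneg _ _ _)
      rw [hR n x, norm_zero]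
      refine lt_of_le_of_lt ((le_abs_self _).trans ?_) hx
      exact Finset.single_le_sum (f := fun n => |R n|) (fun _ _ => abs_nonneg _) hn
    simp [this]

lemma sqf_integrable_rpow {s : Finset ι} {f : ι → ℝ → ℂ} (hf : ∀ n, Nice (f n)) {p : ℝ} (hp : 0 < p) :
    Integrable fun x => sqf s f x ^ p := by
  have := (sqf_nice (s := s) hf).integrable_rpow hp
  simpa only [Complex.norm_real, norm_of_nonneg (sqf_nonneg _ _ _)] using this

lemma rad_apply (s t : Finset ι) (f : ι → ℝ → ℂ) (x : ℝ) :
    rad s t f x = rad s t fun n => f n x := by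
  simp only [rad, Finset.sum_apply]
  refine Finset.sum_congr rfl fun n _ => ?_
  split_ifs <;> rfl

lemma Nice.zero : Nice 0 := ⟨measurable_const, ⟨0, fun x => by simp⟩, 0, fun x _ => rfl⟩

lemma Nice.neg {f : ℝ → ℂ} (hf : Nice f) : Nice (-f) := by
  simpa using hf.const_smul (-1)

lemma Nice.sum {s : Finset ι} {f : ι → ℝ → ℂ} (hf : ∀ n, Nice (f n)) : Nice (∑ n ∈ s, f n) := by
  induction s using Finset.induction_on with
  | empty => simpa using Nice.zero
  | insert b s hb ih =>
    rw [Finset.sum_insert hb]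
    exact (hf b).add ih

lemma rad_nice (s t : Finset ι) {f : ι → ℝ → ℂ} (hf : ∀ n, Nice (f n)) : Nice (rad s t f) := by
  refine Nice.sum fun n => ?_
  split_ifs
  · exact hf n
  · exact (hf n).neg

lemma Sym.T_rad {G : Sym} {R : ℝ} (hR : 1 ≤ R) (s t t' : Finset ι) {f g : ι → ℝ → ℂ}
    (hf : ∀ n, Nice (f n)) (hg : ∀ n, Nice (g n)) (x : ℝ) :
    G.T R (rad s t f) (rad s t' g) x = rad s t fun n => rad s t' fun m => G.T R (f n) (g m) x := by
  have hn : ∀ (t : Finset ι) (f : ι → ℝ → ℂ), (∀ n, Nice (f n)) → ∀ n,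
      Integrable (if n ∈ t then f n else -f n) := fun t f hf n => by
    split_ifs
    · exact (hf n).integrable
    · exact (hf n).neg.integrable
  have e1 : G.T R (rad s t f) (rad s t' g) = rad s t fun n => G.T R (f n) (rad s t' g) := by
    have := Sym.T_sum_left (G := G) hR s (hn t f hf) (rad_nice s t' hg).integrable
    refine this.trans (Finset.sum_congr rfl fun n _ => ?_)
    split_ifs
    · rfl
    · simpa using Sym.T_smul_left (G := G) R (-1) (f n) (rad s t' g)
  have e2 : ∀ n, G.T R (f n) (rad s t' g) = rad s t' fun m => G.T R (f n) (g m) := fun n => by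
    have := Sym.T_sum_right (G := G) hR s (hf n).integrable (hn t' g hg)
    refine this.trans (Finset.sum_congr rfl fun m _ => ?_)
    split_ifs
    · rfl
    · simpa using Sym.T_smul_right (G := G) R (-1) (f n) (g m)
  rw [e1, rad_apply]
  congr 1
  ext n
  rw [e2, rad_apply]

lemma av_rpow_le {s : Finset ι} {F : Finset ι → ℝ} (hF : ∀ t, 0 ≤ F t) {α : ℝ} (h0 : 0 < α) (h1 : α ≤ 1) :
    av s (fun t => F t ^ α) ≤ av s F ^ α := by
  have := rpow_arith_mean_le_arith_mean_rpow s.powerset (fun _ => ((2 : ℝ) ^ s.card)⁻¹) (fun t => F t ^ α)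
    (fun _ _ => by positivity) (by
      rw [Finset.sum_const, Finset.card_powerset, nsmul_eq_mul]
      push_cast
      field_simp) (fun t _ => rpow_nonneg (hF t) _) (one_le_one_div h0 h1)
  have e : ∀ t, (F t ^ α) ^ (1 / α) = F t := fun t => by
    rw [← rpow_mul (hF t), mul_one_div_cancel h0.ne', rpow_one]
  simp only [e, ← Finset.mul_sum] at this
  change av s (fun t => F t ^ α) ^ (1 / α) ≤ av s F at this
  have h2 : 0 ≤ av s fun t => F t ^ α := av_nonneg fun t => rpow_nonneg (hF t) _
  have h3 := rpow_le_rpow (rpow_nonneg h2 _) this h0.le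
  rwa [← rpow_mul h2, one_div_mul_cancel h0.ne', rpow_one] at h3

lemma av_integral_rad_le (s : Finset ι) {f : ι → ℝ → ℂ} (hf : ∀ n, Nice (f n)) {p : ℝ} (hp : 0 < p) :
    av s (fun t => ∫ x, ‖rad s t f x‖ ^ p) ≤ 4 * exp 2 * p ^ p * ∫ x, sqf s f x ^ p := by
  have hi : ∀ t, Integrable fun x => ‖rad s t f x‖ ^ p := fun t => (rad_nice s t hf).integrable_rpow hp
  have h1 : av s (fun t => ∫ x, ‖rad s t f x‖ ^ p) = ∫ x, av s fun t => ‖rad s t f x‖ ^ p := by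
    unfold av
    rw [integral_const_mul, integral_finsetSum _ fun t _ => hi t]
  rw [h1, ← integral_const_mul]
  refine integral_mono ?_ ((sqf_integrable_rpow hf hp).const_mul _) fun x => ?_
  · exact (integrable_finsetSum _ fun t _ => hi t).const_mul _
  · simp only [rad_apply, sqf_rpow]
    exact av_rad_rpow hp s fun n => f n x

lemma ofReal_av (s : Finset ι) {F : Finset ι → ℝ} (hF : ∀ t, 0 ≤ F t) :
    ENNReal.ofReal (av s F) = ENNReal.ofReal (2 ^ s.card)⁻¹ * ∑ t ∈ s.powerset, ENNReal.ofReal (F t) := by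
  unfold av
  rw [ENNReal.ofReal_mul (by positivity), ENNReal.ofReal_sum_of_nonneg fun t _ => hF t]

lemma vector_type {p q r : ℝ} (hp : 1 < p) (hq : 1 < q) (hpqr : 1 / r = 1 / p + 1 / q)
    (hr : 1 / r < 3 / 2) : ∃ C : ℝ, 0 < C ∧ ∀ (G : Sym) (R : ℝ), 1 ≤ R → ∀ (s : Finset ι) (f g : ι → ℝ → ℂ),
    (∀ n, Nice (f n)) → (∀ n, Nice (g n)) →
    ∫⁻ x, ENNReal.ofReal (sqf s (fun n => G.T R (f n) (g n)) x ^ r) ≤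
      ENNReal.ofReal (C * ((∫ x, sqf s f x ^ p) ^ (r / p) * (∫ x, sqf s g x ^ q) ^ (r / q))) := by
  obtain ⟨C, hC, h⟩ := Sym.strong_type hp hq hpqr hr
  have hp0 : 0 < p := by linarith
  have hq0 : 0 < q := by linarith
  have hr0 : 0 < r := by
    rw [← one_div_pos, hpqr]
    positivity
  have hrp : r / p ≤ 1 := by
    rw [div_le_one hp0, ← one_div_le_one_div hp0 hr0, hpqr]
    linarith [one_div_pos.2 hq0]
  have hrq : r / q ≤ 1 := by
    rw [div_le_one hq0, ← one_div_le_one_div hq0 hr0, hpqr]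
    linarith [one_div_pos.2 hp0]
  set K := 144 * (2 : ℝ) ^ r with hK
  set P := 4 * exp 2 * p ^ p with hP
  set Q := 4 * exp 2 * q ^ q with hQ
  have hK0 : 0 < K := by positivity
  have hP0 : 0 < P := by positivity
  have hQ0 : 0 < Q := by positivity
  refine ⟨K * C * (P ^ (r / p) * Q ^ (r / q)), by positivity, fun G R hR s f g hf hg => ?_⟩
  set X : Finset ι → Finset ι → ℝ → ℝ := fun t' t x => ‖G.T R (rad s t f) (rad s t' g) x‖ ^ r with hX
  have hXm : ∀ t' t, Measurable fun x => ENNReal.ofReal (X t' t x) := fun t' t =>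
    ((G.T_measurable R (rad_nice s t hf).1 (rad_nice s t' hg).1).norm.pow_const r).ennreal_ofReal
  have hX0 : ∀ t' t x, 0 ≤ X t' t x := fun _ _ _ => rpow_nonneg (norm_nonneg _) _
  set A : Finset ι → ℝ := fun t => ∫ x, ‖rad s t f x‖ ^ p with hA
  set B : Finset ι → ℝ := fun t => ∫ x, ‖rad s t g x‖ ^ q with hB
  have hA0 : ∀ t, 0 ≤ A t := fun t => integral_nonneg fun _ => rpow_nonneg (norm_nonneg _) _
  have hB0 : ∀ t, 0 ≤ B t := fun t => integral_nonneg fun _ => rpow_nonneg (norm_nonneg _) _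
  have hpt : ∀ x, sqf s (fun n => G.T R (f n) (g n)) x ^ r ≤ K * av s fun t' => av s fun t => X t' t x := by
    intro x
    rw [sqf_rpow]
    have := av_bilinear_lower hr0 s fun n m => G.T R (f n) (g m) x
    simpa only [hX, Sym.T_rad hR s _ _ hf hg x] using this
  have hone : ∀ t' t, ∫⁻ x, ENNReal.ofReal (X t' t x) ≤
      ENNReal.ofReal (A t ^ (r / p) * C * B t' ^ (r / q)) := by
    intro t' t
    have := h G R hR _ _ (rad_nice s t hf) (rad_nice s t' hg)
    refine le_trans (le_of_eq ?_) (this.trans (le_of_eq ?_))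
    · refine lintegral_congr fun x => ?_
      rw [← ofReal_norm, ENNReal.ofReal_rpow_of_nonneg (norm_nonneg _) hr0.le]
    · congr 1
      ring
  calc ∫⁻ x, ENNReal.ofReal (sqf s (fun n => G.T R (f n) (g n)) x ^ r)
      ≤ ∫⁻ x, ENNReal.ofReal (K * av s fun t' => av s fun t => X t' t x) :=
        lintegral_mono fun x => ENNReal.ofReal_le_ofReal (hpt x)
    _ = ENNReal.ofReal K * (ENNReal.ofReal (2 ^ s.card)⁻¹ * ∑ t' ∈ s.powerset,
          (ENNReal.ofReal (2 ^ s.card)⁻¹ * ∑ t ∈ s.powerset, ∫⁻ x, ENNReal.ofReal (X t' t x))) := by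
        have e : ∀ x, ENNReal.ofReal (K * av s fun t' => av s fun t => X t' t x) =
            ENNReal.ofReal K * (ENNReal.ofReal (2 ^ s.card)⁻¹ * ∑ t' ∈ s.powerset,
          (ENNReal.ofReal (2 ^ s.card)⁻¹ * ∑ t ∈ s.powerset, ENNReal.ofReal (X t' t x))) := fun x => by
          rw [ENNReal.ofReal_mul hK0.le, ofReal_av s fun t' => av_nonneg fun t => hX0 t' t x]
          simp only [ofReal_av s fun t => hX0 _ t x]
        have hm1 : ∀ t', Measurable fun x => ∑ t ∈ s.powerset, ENNReal.ofReal (X t' t x) := fun t' =>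
          Finset.measurable_fun_sum _ fun t _ => hXm t' t
        simp only [e]
        rw [lintegral_const_mul' _ _ ENNReal.ofReal_ne_top, lintegral_const_mul' _ _ ENNReal.ofReal_ne_top,
          lintegral_finsetSum _ fun t' _ => (hm1 t').const_mul _]
        congr 3
        ext t'
        rw [lintegral_const_mul' _ _ ENNReal.ofReal_ne_top, lintegral_finsetSum _ fun t _ => hXm t' t]
    _ ≤ ENNReal.ofReal K * (ENNReal.ofReal (2 ^ s.card)⁻¹ * ∑ t' ∈ s.powerset,
          (ENNReal.ofReal (2 ^ s.card)⁻¹ * ∑ t ∈ s.powerset,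
            ENNReal.ofReal (A t ^ (r / p) * C * B t' ^ (r / q)))) := by
        gcongr with t' _ t _
        exact hone t' t
    _ = ENNReal.ofReal (K * av s fun t' => av s fun t => A t ^ (r / p) * C * B t' ^ (r / q)) := by
        have h0 : ∀ t' t, 0 ≤ A t ^ (r / p) * C * B t' ^ (r / q) := fun t' t =>
          mul_nonneg (mul_nonneg (rpow_nonneg (hA0 t) _) hC.le) (rpow_nonneg (hB0 t') _)
        rw [ENNReal.ofReal_mul hK0.le, ofReal_av s fun t' => av_nonneg fun t => h0 t' t]
        simp only [ofReal_av s fun t => h0 _ t]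
    _ ≤ _ := by
        refine ENNReal.ofReal_le_ofReal ?_
        have e : (av s fun t' => av s fun t => A t ^ (r / p) * C * B t' ^ (r / q)) =
            (av s fun t => A t ^ (r / p)) * C * av s fun t' => B t' ^ (r / q) := by
          simp only [av_mul]
          rw [mul_comm _ (av s fun t' => B t' ^ (r / q)), ← av_mul s fun t' => B t' ^ (r / q)]
          exact av_congr fun t' _ => mul_comm _ _
        have hIp : 0 ≤ ∫ x, sqf s f x ^ p := integral_nonneg fun x => rpow_nonneg (sqf_nonneg _ _ _) _
        have hIq : 0 ≤ ∫ x, sqf s g x ^ q := integral_nonneg fun x => rpow_nonneg (sqf_nonneg _ _ _) _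
        have k1 : (av s fun t => A t ^ (r / p)) ≤ P ^ (r / p) * (∫ x, sqf s f x ^ p) ^ (r / p) := by
          rw [← mul_rpow hP0.le hIp]
          refine (av_rpow_le hA0 (by positivity) hrp).trans ?_
          exact rpow_le_rpow (av_nonneg hA0) (av_integral_rad_le s hf hp0) (by positivity)
        have k2 : (av s fun t => B t ^ (r / q)) ≤ Q ^ (r / q) * (∫ x, sqf s g x ^ q) ^ (r / q) := by
          rw [← mul_rpow hQ0.le hIq]
          refine (av_rpow_le hB0 (by positivity) hrq).trans ?_
          exact rpow_le_rpow (av_nonneg hB0) (av_integral_rad_le s hg hq0) (by positivity)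
        rw [e]
        have k3 : 0 ≤ av s fun t => B t ^ (r / q) := av_nonneg fun t => rpow_nonneg (hB0 t) _
        calc _ ≤ K * (P ^ (r / p) * (∫ x, sqf s f x ^ p) ^ (r / p) * C *
              (Q ^ (r / q) * (∫ x, sqf s g x ^ q) ^ (r / q))) := by gcongr
          _ = _ := by ring

lemma ofReal_sqf_lintegral {s : Finset ι} {f : ι → ℝ → ℂ} {p : ℝ} {K : ℝ} (hf : ∀ n ∈ s, Measurable (f n))
    (h : ∫⁻ x, ENNReal.ofReal (sqf s f x ^ p) ≤ ENNReal.ofReal K) (hK : 0 ≤ K) :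
    Integrable (fun x => sqf s f x ^ p) ∧ ∫ x, sqf s f x ^ p ≤ K := by
  have h0 : ∀ x, 0 ≤ sqf s f x ^ p := fun x => rpow_nonneg (sqf_nonneg _ _ _) _
  have hm : Measurable fun x => sqf s f x ^ p := (sqf_measurable hf).pow_const p
  have hi : Integrable fun x => sqf s f x ^ p := by
    refine ⟨hm.aestronglyMeasurable, ?_⟩
    rw [hasFiniteIntegral_iff_ofReal (ae_of_all _ h0)]
    exact h.trans_lt ENNReal.ofReal_lt_top
  refine ⟨hi, ?_⟩
  rw [← ofReal_integral_eq_lintegral_ofReal hi (ae_of_all _ h0)] at h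
  exact (ENNReal.ofReal_le_ofReal_iff hK).1 h

lemma vector_type_top {q : ℝ} (hq : 1 < q) : ∃ C : ℝ, 0 < C ∧ ∀ (G : Sym) (R : ℝ), 1 ≤ R →
    ∀ (s : Finset ι) (f g : ι → ℝ → ℂ), (∀ n, Nice (f n)) → (∀ n, Nice (g n)) → ∀ A : ℝ, 0 ≤ A →
    (∀ᵐ x, sqf s f x ≤ A) → ∫⁻ x, ENNReal.ofReal (sqf s (fun n => G.T R (f n) (g n)) x ^ q) ≤
      ENNReal.ofReal ((C * A) ^ q * ∫ x, sqf s g x ^ q) := by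
  have hq0 : 0 < q := by linarith
  have hq1 : 0 < q - 1 := by linarith
  set p := q / (q - 1) with hpdef
  have hp : 1 < p := by rw [hpdef, one_lt_div hq1]; linarith
  have hp0 : 0 < p := by linarith
  have hpq : 1 / (1 : ℝ) = 1 / p + 1 / q := by
    rw [hpdef]
    field_simp
    ring
  obtain ⟨C, hC, h⟩ := vector_type (ι := ι) hp hq hpq (by norm_num)
  refine ⟨C, hC, fun G R hR s f g hf hg A hA hfA => ?_⟩
  set T : ι → ℝ → ℂ := fun n => G.T R (f n) (g n) with hT
  have hTm : ∀ n, Measurable (T n) := fun n => G.T_measurable R (hf n).1 (hg n).1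
  have hTb : ∃ M : ℝ, ∀ n ∈ s, ∀ x, ‖T n x‖ ≤ M := by
    obtain ⟨C', hC', hb⟩ := Sym.T_bound (G := G) hR
    refine ⟨∑ n ∈ s, C' * ((∫ x, ‖f n x‖) * ∫ x, ‖g n x‖), fun n hn x => ?_⟩
    refine (hb _ _ (hf n).integrable (hg n).integrable x).trans ?_
    exact Finset.single_le_sum (f := fun n => C' * ((∫ x, ‖f n x‖) * ∫ x, ‖g n x‖))
      (fun n _ => mul_nonneg hC'.le (mul_nonneg (integral_nonneg fun _ => norm_nonneg _)
        (integral_nonneg fun _ => norm_nonneg _))) hn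
  obtain ⟨M, hM⟩ := hTb
  set W := sqf s T with hW
  have hWm : Measurable W := sqf_measurable fun n _ => hTm n
  have hW0 : ∀ x, 0 ≤ W x := sqf_nonneg s T
  have hWM : ∀ x, W x ≤ s.card * M := fun x => by
    refine (sqf_le_sum s T x).trans ((Finset.sum_le_sum fun n hn => hM n hn x).trans (le_of_eq ?_))
    simp
  set Gq := ∫ x, sqf s g x ^ q with hGq
  have hGq0 : 0 ≤ Gq := integral_nonneg fun x => rpow_nonneg (sqf_nonneg _ _ _) _
  have main : ∀ N : ℕ, ∫⁻ x, ENNReal.ofReal ((Icc (-N : ℝ) N).indicator (fun x => W x ^ q) x) ≤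
      ENNReal.ofReal ((C * A) ^ q * Gq) := by
    intro N
    set B := Icc (-N : ℝ) N with hB
    have hBm : MeasurableSet B := measurableSet_Icc
    set h' : ι → ℝ → ℂ := fun n => if n ∈ s then
      B.indicator (fun x => conj (T n x) * ((W x ^ (q - 2) : ℝ) : ℂ)) else 0 with hh'
    have hn0 : ∀ n ∈ s, ∀ x, ‖T n x‖ * W x ^ (q - 2) ≤ W x ^ (q - 1) := by
      intro n hn x
      have h1 := le_sqf T x hn
      rcases (hW0 x).eq_or_lt with h0 | h0
      · have : ‖T n x‖ = 0 := le_antisymm (h1.trans h0.symm.le) (norm_nonneg _)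
        rw [this, zero_mul]
        exact rpow_nonneg (hW0 x) _
      · rw [show q - 1 = 1 + (q - 2) by ring, rpow_add h0, rpow_one]
        gcongr
    have hnice : ∀ n, Nice (h' n) := by
      intro n
      by_cases hn : n ∈ s
      · simp only [hh', if_pos hn]
        have hmm : Measurable fun x => conj (T n x) * ((W x ^ (q - 2) : ℝ) : ℂ) := by
          have := hTm n
          refine Measurable.mul ?_ ?_
          · exact Complex.continuous_conj.measurable.comp this
          · exact Complex.measurable_ofReal.comp (hWm.pow_const _)
        refine ⟨hmm.indicator hBm, ⟨(s.card * M) ^ (q - 1), fun x => ?_⟩, N, fun x hx => ?_⟩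
        · refine (norm_indicator_le_norm_self _ x).trans ?_
          rw [norm_mul, RCLike.norm_conj, Complex.norm_real, norm_of_nonneg (rpow_nonneg (hW0 x) _)]
          exact (hn0 n hn x).trans (rpow_le_rpow (hW0 x) (hWM x) hq1.le)
        · refine indicator_of_notMem (fun hx' => ?_) _
          rw [hB, mem_Icc, ← abs_le] at hx'
          linarith
      · simp only [hh', if_neg hn]
        exact Nice.zero
    have hsq : ∀ x, sqf s h' x ≤ B.indicator (fun x => W x ^ (q - 1)) x := by
      intro x
      by_cases hx : x ∈ B
      · rw [indicator_of_mem hx]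
        have e : sqf s h' x = W x * W x ^ (q - 2) := by
          have : ∑ n ∈ s, ‖h' n x‖ ^ 2 = (∑ n ∈ s, ‖T n x‖ ^ 2) * (W x ^ (q - 2)) ^ 2 := by
            rw [Finset.sum_mul]
            refine Finset.sum_congr rfl fun n hn => ?_
            simp only [hh', if_pos hn, indicator_of_mem hx]
            rw [norm_mul, RCLike.norm_conj, Complex.norm_real, norm_of_nonneg (rpow_nonneg (hW0 x) _), mul_pow]
          rw [sqf, this, sqrt_mul (by positivity), sqrt_sq (rpow_nonneg (hW0 x) _)]
          rfl
        rw [e]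
        rcases (hW0 x).eq_or_lt with h0 | h0
        · rw [← h0, zero_mul]
          exact rpow_nonneg le_rfl _
        · rw [show q - 1 = 1 + (q - 2) by ring, rpow_add h0, rpow_one]
      · rw [indicator_of_notMem hx]
        refine (sqf_le_sum _ _ _).trans (le_of_eq (Finset.sum_eq_zero fun n hn => ?_))
        simp only [hh', if_pos hn, indicator_of_notMem hx, norm_zero]
    have hJn : Nice fun x => ((B.indicator (fun x => W x ^ q) x : ℝ) : ℂ) := by
      refine ⟨Complex.measurable_ofReal.comp ((hWm.pow_const q).indicator hBm),
        ⟨(s.card * M) ^ q, fun x => ?_⟩, N, fun x hx => ?_⟩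
      · rw [Complex.norm_real]
        refine (norm_indicator_le_norm_self _ x).trans ?_
        rw [norm_of_nonneg (rpow_nonneg (hW0 x) _)]
        exact rpow_le_rpow (hW0 x) (hWM x) hq0.le
      · have hx2 : x ∉ B := fun hx' => ?_
        · simp only [indicator_of_notMem hx2, Complex.ofReal_zero]
        rw [hB, mem_Icc, ← abs_le] at hx'
        linarith
    set J := ∫ x, B.indicator (fun x => W x ^ q) x with hJ
    have hJpt0 : ∀ x, 0 ≤ B.indicator (fun x => W x ^ q) x := fun x =>
      indicator_nonneg (fun x _ => rpow_nonneg (hW0 x) _) x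
    have hJ0 : 0 ≤ J := integral_nonneg hJpt0
    have hJint : Integrable (B.indicator fun x => W x ^ q) := by
      have := hJn.integrable.re
      simpa using this
    set G' := G.perm (Equiv.swap 0 2) with hG'
    set S : ι → ℝ → ℂ := fun n => G'.T R (h' n) (g n) with hS
    have hSm : ∀ n, Measurable (S n) := fun n => G'.T_measurable R (hnice n).1 (hg n).1
    have hIp : ∫ x, sqf s h' x ^ p ≤ J := by
      refine integral_mono (sqf_integrable_rpow hnice hp0) hJint fun x => ?_
      refine (rpow_le_rpow (sqf_nonneg _ _ _) (hsq x) hp0.le).trans ?_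
      by_cases hx : x ∈ B
      · rw [indicator_of_mem hx, indicator_of_mem hx, ← rpow_mul (hW0 x), hpdef, mul_div_cancel₀ _ hq1.ne']
      · rw [indicator_of_notMem hx, indicator_of_notMem hx, zero_rpow hp0.ne']
    have hIp0 : 0 ≤ ∫ x, sqf s h' x ^ p := integral_nonneg fun x => rpow_nonneg (sqf_nonneg _ _ _) _
    have hS1 := h G' R hR s h' g hnice hg
    obtain ⟨hSi, hSle⟩ := ofReal_sqf_lintegral (fun n _ => hSm n) hS1 (by positivity)
    simp only [rpow_one] at hSi hSle
    have hcplx : (J : ℂ) = ∫ x, ∑ n ∈ s, S n x * f n x := by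
      have hi1 : ∀ n, Integrable fun x => T n x * h' n x := fun n => by
        by_cases hn : n ∈ s
        · simpa only [mul_comm] using ((hnice n).mul (hTm n) (hM n hn)).integrable
        · simp only [hh', if_neg hn, Pi.zero_apply, mul_zero]
          exact integrable_zero _ _ _
      have hi2 : ∀ n ∈ s, Integrable fun x => S n x * f n x := fun n hn => by
        obtain ⟨C', -, hb⟩ := Sym.T_bound (G := G') hR
        simpa only [mul_comm] using ((hf n).mul (hSm n) (hb _ _ (hnice n).integrable
          (hg n).integrable)).integrable
      rw [integral_finsetSum _ hi2]
      have : ∀ n, ∫ x, S n x * f n x = ∫ x, T n x * h' n x := fun n =>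
        (Sym.T_adjoint hR (hf n).integrable (hg n).integrable (hnice n).integrable).symm
      simp only [this]
      rw [← integral_finsetSum _ fun n _ => hi1 n, hJ, ← integral_complex_ofReal]
      refine integral_congr_ae (ae_of_all _ fun x => ?_)
      simp only
      by_cases hx : x ∈ B
      · rw [indicator_of_mem hx]
        have e : ∀ n ∈ s, T n x * h' n x = ((‖T n x‖ ^ 2 * W x ^ (q - 2) : ℝ) : ℂ) := fun n hn => by
          simp only [hh', if_pos hn, indicator_of_mem hx]
          rw [← mul_assoc, RCLike.mul_conj]
          push_cast
          rfl
        rw [Finset.sum_congr rfl e, ← Complex.ofReal_sum, ← Finset.sum_mul, ← sqf_sq, ← hW]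
        congr 1
        rcases (hW0 x).eq_or_lt with h0 | h0
        · rw [← h0, zero_rpow hq0.ne']
          ring
        · rw [← rpow_natCast, ← rpow_add h0]
          congr 1
          push_cast
          ring
      · rw [indicator_of_notMem hx, Complex.ofReal_zero, eq_comm]
        refine Finset.sum_eq_zero fun n hn => ?_
        simp only [hh', if_pos hn, indicator_of_notMem hx, mul_zero]
    have hJle : J ≤ A * ∫ x, sqf s S x := by
      have h1 : J = ‖(J : ℂ)‖ := by rw [Complex.norm_real, norm_of_nonneg hJ0]
      rw [h1, hcplx, ← integral_const_mul]
      refine norm_integral_le_of_norm_le (hSi.const_mul A) ?_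
      filter_upwards [hfA] with x hx
      refine (norm_sum_le _ _).trans ?_
      simp only [norm_mul]
      refine (sum_mul_le_sqrt_mul_sqrt s (fun n => ‖S n x‖) fun n => ‖f n x‖).trans ?_
      rw [mul_comm]
      exact mul_le_mul_of_nonneg_right hx (sqrt_nonneg _)
    have hfin : J ≤ (C * A) ^ q * Gq := by
      rcases hJ0.eq_or_lt with h0 | h0
      · rw [← h0]
        positivity
      have h1 : J ≤ A * (C * (J ^ (1 / p) * Gq ^ (1 / q))) := by
        refine hJle.trans (mul_le_mul_of_nonneg_left (hSle.trans ?_) hA)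
        gcongr
      have h2 : J = J ^ (1 / p) * J ^ (1 / q) := by
        rw [← rpow_add h0, ← hpq, div_one, rpow_one]
      have h3 : J ^ (1 / q) ≤ C * A * Gq ^ (1 / q) := by
        have h4 : 0 < J ^ (1 / p) := rpow_pos_of_pos h0 _
        refine le_of_mul_le_mul_left ?_ h4
        rw [← h2]
        linarith
      have h5 := rpow_le_rpow (rpow_nonneg hJ0 _) h3 hq0.le
      rw [mul_rpow (by positivity) (by positivity), ← rpow_mul hJ0, ← rpow_mul hGq0,
        one_div_mul_cancel hq0.ne', rpow_one, rpow_one] at h5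
      exact h5
    rw [← ofReal_integral_eq_lintegral_ofReal hJint (ae_of_all _ hJpt0)]
    exact ENNReal.ofReal_le_ofReal hfin
  refine lintegral_le_of_tendsto (fun N => ?_) (ae_of_all _ fun x => ?_) main
  · exact ((hWm.pow_const q).indicator measurableSet_Icc).ennreal_ofReal.aemeasurable
  · refine tendsto_const_nhds.congr' ?_
    obtain ⟨N, hN⟩ := exists_nat_ge |x|
    filter_upwards [Filter.eventually_ge_atTop N] with n hn
    rw [indicator_of_mem]
    rw [mem_Icc, ← abs_le]
    exact hN.trans (by exact_mod_cast hn)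

lemma eLpNorm_eq_lintegral_ofReal {u : ℝ → ℝ} (hu : ∀ x, 0 ≤ u x) {r : ℝ≥0∞} (h0 : r ≠ 0) (ht : r ≠ ⊤) :
    eLpNorm u r = (∫⁻ x, ENNReal.ofReal (u x ^ r.toReal)) ^ (1 / r.toReal) := by
  rw [eLpNorm_eq_lintegral_rpow_enorm_toReal h0 ht]
  congr 2
  ext x
  rw [← ofReal_norm, norm_of_nonneg (hu x), ENNReal.ofReal_rpow_of_nonneg (hu x) ENNReal.toReal_nonneg]

lemma eLpNorm_sqf {s : Finset ι} {f : ι → ℝ → ℂ} (hf : ∀ n, Nice (f n)) {p : ℝ≥0∞} (h0 : p ≠ 0) (ht : p ≠ ⊤) :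
    eLpNorm (sqf s f) p = ENNReal.ofReal ((∫ x, sqf s f x ^ p.toReal) ^ (1 / p.toReal)) := by
  have hp := ENNReal.toReal_pos h0 ht
  have hpos : ∀ x, 0 ≤ sqf s f x ^ p.toReal := fun x => rpow_nonneg (sqf_nonneg _ _ _) _
  rw [eLpNorm_eq_lintegral_ofReal (sqf_nonneg s f) h0 ht,
    ← ofReal_integral_eq_lintegral_ofReal (sqf_integrable_rpow hf hp) (ae_of_all _ hpos),
    ENNReal.ofReal_rpow_of_nonneg (integral_nonneg hpos) (by positivity)]

lemma eLpNorm_le_of_lintegral {u : ℝ → ℝ} (hu : ∀ x, 0 ≤ u x) {r : ℝ≥0∞} (h0 : r ≠ 0) (ht : r ≠ ⊤) {K : ℝ}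
    (hK : 0 ≤ K) (h : ∫⁻ x, ENNReal.ofReal (u x ^ r.toReal) ≤ ENNReal.ofReal K) :
    eLpNorm u r ≤ ENNReal.ofReal (K ^ (1 / r.toReal)) := by
  rw [eLpNorm_eq_lintegral_ofReal hu h0 ht]
  refine (ENNReal.rpow_le_rpow h (by positivity)).trans (le_of_eq ?_)
  exact ENNReal.ofReal_rpow_of_nonneg hK (by positivity)

lemma vector_elp_top {q : ℝ≥0∞} (hq : 1 < q) (hqt : q ≠ ⊤) : ∃ C : ℝ, 0 < C ∧ ∀ (G : Sym) (R : ℝ), 1 ≤ R →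
    ∀ (s : Finset ι) (f g : ι → ℝ → ℂ), (∀ n, Nice (f n)) → (∀ n, Nice (g n)) →
    eLpNorm (sqf s fun n => G.T R (f n) (g n)) q ≤
      ENNReal.ofReal C * eLpNorm (sqf s f) ⊤ * eLpNorm (sqf s g) q := by
  have hq0 : q ≠ 0 := (zero_lt_one.trans hq).ne'
  have hq1 : 1 < q.toReal := by
    rw [← ENNReal.toReal_one]
    exact (ENNReal.toReal_lt_toReal (by simp) hqt).2 hq
  have hq2 : 0 < q.toReal := by linarith
  obtain ⟨C, hC, h⟩ := vector_type_top (ι := ι) hq1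
  refine ⟨C, hC, fun G R hR s f g hf hg => ?_⟩
  obtain ⟨B, hB⟩ := (sqf_nice (s := s) hf).2.1
  have hfin : eLpNorm (sqf s f) ⊤ ≠ ⊤ := by
    refine ((eLpNormEssSup_le_of_ae_bound (C := B) (ae_of_all _ fun x => ?_)).trans_lt ENNReal.ofReal_lt_top).ne
    simpa using hB x
  set A := (eLpNorm (sqf s f) ⊤).toReal with hA
  have hAe : ∀ᵐ x, sqf s f x ≤ A := by
    filter_upwards [enorm_ae_le_eLpNormEssSup (sqf s f) volume] with x hx
    have := (ENNReal.toReal_le_toReal (by simp) hfin).2 hx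
    rwa [toReal_enorm, norm_of_nonneg (sqf_nonneg _ _ _)] at this
  have hA0 : 0 ≤ A := ENNReal.toReal_nonneg
  have hI0 : 0 ≤ ∫ x, sqf s g x ^ q.toReal := integral_nonneg fun x => rpow_nonneg (sqf_nonneg _ _ _) _
  refine (eLpNorm_le_of_lintegral (sqf_nonneg _ _) hq0 hqt (by positivity)
    (h G R hR s f g hf hg A hA0 hAe)).trans (le_of_eq ?_)
  rw [eLpNorm_sqf hg hq0 hqt, ← ENNReal.ofReal_toReal hfin, ← ENNReal.ofReal_mul hC.le,
    ← ENNReal.ofReal_mul (by positivity), mul_rpow (by positivity) hI0, ← rpow_mul (by positivity),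
    mul_one_div_cancel hq2.ne', rpow_one]

/-- The vector-valued estimate for the truncated model operators. -/
theorem vector_elp {p q r : ℝ≥0∞} (hp : 1 < p) (hq : 1 < q)
    (hr : 1 / r = 1 / p + 1 / q) (hr0 : 0 < 1 / r) (hr1 : 1 / r < 3 / 2) :
    ∃ C : ℝ, 0 < C ∧ ∀ (G : Sym) (R : ℝ), 1 ≤ R →
    ∀ (s : Finset ι) (f g : ι → ℝ → ℂ), (∀ n, Nice (f n)) → (∀ n, Nice (g n)) →
    eLpNorm (sqf s fun n => G.T R (f n) (g n)) r ≤
      ENNReal.ofReal C * eLpNorm (sqf s f) p * eLpNorm (sqf s g) q := by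
  have hp0 : p ≠ 0 := (zero_lt_one.trans hp).ne'
  have hq0 : q ≠ 0 := (zero_lt_one.trans hq).ne'
  by_cases hpt : p = ⊤
  · subst hpt
    have hrq : r = q := by simpa using hr
    subst hrq
    exact vector_elp_top hq (by rintro rfl; simp at hr0)
  by_cases hqt : q = ⊤
  · subst hqt
    have hrp : r = p := by simpa using hr
    subst hrp
    obtain ⟨C, hC, h⟩ := vector_elp_top (ι := ι) hp hpt
    refine ⟨C, hC, fun G R hR s f g hf hg => ?_⟩
    have := h (G.perm (Equiv.swap 0 1)) R hR s g f hg hf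
    simp only [← Sym.T_swap] at this
    refine this.trans (le_of_eq ?_)
    ring
  have hrt : r ≠ ⊤ := by rintro rfl; simp at hr0
  have hr00 : r ≠ 0 := by
    rintro rfl
    simp at hr1
  have toR : ∀ {t : ℝ≥0∞}, 1 < t → t ≠ ⊤ → 1 < t.toReal := fun {t} h1 ht => by
    rw [← ENNReal.toReal_one]
    exact (ENNReal.toReal_lt_toReal (by simp) ht).2 h1
  have hp1 := toR hp hpt
  have hq1 := toR hq hqt
  have hrpos := ENNReal.toReal_pos hr00 hrt
  have hpqr : 1 / r.toReal = 1 / p.toReal + 1 / q.toReal := by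
    have := congrArg ENNReal.toReal hr
    rw [ENNReal.toReal_add (by simpa using hp0) (by simpa using hq0)] at this
    simpa using this
  have hr2 : 1 / r.toReal < 3 / 2 := by
    have := (ENNReal.toReal_lt_toReal (by simpa using hr00) (by simp [ENNReal.div_eq_top])).2 hr1
    simpa using this
  obtain ⟨C, hC, h⟩ := vector_type (ι := ι) hp1 hq1 hpqr hr2
  refine ⟨C ^ (1 / r.toReal), by positivity, fun G R hR s f g hf hg => ?_⟩
  have hI0 : 0 ≤ ∫ x, sqf s f x ^ p.toReal := integral_nonneg fun x => rpow_nonneg (sqf_nonneg _ _ _) _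
  have hJ0 : 0 ≤ ∫ x, sqf s g x ^ q.toReal := integral_nonneg fun x => rpow_nonneg (sqf_nonneg _ _ _) _
  refine (eLpNorm_le_of_lintegral (sqf_nonneg _ _) hr00 hrt (by positivity)
    (h G R hR s f g hf hg)).trans (le_of_eq ?_)
  rw [eLpNorm_sqf hf hp0 hpt, eLpNorm_sqf hg hq0 hqt, ← ENNReal.ofReal_mul (by positivity),
    ← ENNReal.ofReal_mul (by positivity), mul_rpow hC.le (by positivity), mul_rpow (by positivity) (by positivity),
    ← rpow_mul hI0, ← rpow_mul hJ0, mul_assoc]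
  congr 4 <;> field_simp

/-- The character `e^{2πiu}`. -/
noncomputable def ee (u : ℝ) : ℂ := Complex.exp (((2 * π * u : ℝ) : ℂ) * Complex.I)

lemma norm_ee (u : ℝ) : ‖ee u‖ = 1 := Complex.norm_exp_ofReal_mul_I _

lemma ee_add (u v : ℝ) : ee (u + v) = ee u * ee v := by
  unfold ee
  rw [← Complex.exp_add]
  push_cast
  ring_nf

@[fun_prop]
lemma ee_continuous : Continuous ee := by unfold ee; fun_prop

lemma FT_eq (f : ℝ → ℂ) : FT f = 𝓕 f := by
  ext ξ
  rw [Real.fourier_real_eq_integral_exp_smul]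
  rfl

lemma FT_eq_ee (f : ℝ → ℂ) (ξ : ℝ) : FT f ξ = ∫ t, ee (-(t * ξ)) * f t := by
  unfold FT ee
  refine integral_congr_ae (ae_of_all _ fun t => ?_)
  simp only
  congr 3
  push_cast
  ring

lemma apk_eq (t ξ y w : ℝ) : apk t ξ y w = chi (t * (w - ξ)) * ee (w * y) := by
  unfold apk ee
  rw [mul_assoc (2 * π)]

lemma integral_mul_pk {f : ℝ → ℂ} (hf : Integrable f) {t : ℝ} (ht : 0 < t) (ξ y : ℝ) :
    ∫ x, f x * pk t ξ y x = ∫ w, FT f w * apk t ξ y w := by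
  have h := VectorFourier.integral_fourierIntegral_smul_eq_flip (μ := volume) (ν := volume)
    (e := 𝐞) (L := innerₗ ℝ) Real.continuous_fourierChar continuous_inner hf (apk_integrable ht ξ y)
  rw [FT_eq]
  simp only [smul_eq_mul] at h
  rw [flip_innerₗ] at h
  refine Eq.trans ?_ h.symm
  refine integral_congr_ae (ae_of_all _ fun x => ?_)
  simp only
  rw [← pk_eq_fourier ht]
  rfl

lemma integral_ee_mul_pk {t : ℝ} (ht : 0 < t) (ξ s x : ℝ) :
    ∫ y, ee (s * y) * pk t ξ y x = chi (t * (-s - ξ)) * ee (x * s) := by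
  have h1 : ∀ y, ee (s * y) * pk t ξ y x =
      (fun u => ee (-(u * s)) * 𝓕 (apk t ξ (-x)) u) (-y) := fun y => by
    simp only
    rw [pk_eq_fourier ht]
    unfold pk
    rw [show -x - -y = y - x by ring, show -(-y * s) = s * y by ring]
  simp_rw [h1]
  rw [integral_neg_eq_self (f := fun u => ee (-(u * s)) * 𝓕 (apk t ξ (-x)) u), ← FT_eq_ee, FT_eq]
  have h2 : 𝓕⁻ (𝓕 (apk t ξ (-x))) = apk t ξ (-x) :=
    Continuous.fourierInv_fourier_eq (apk_contDiff t ξ (-x)).continuous (apk_integrable ht ξ _)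
      (by
        have : 𝓕 (apk t ξ (-x)) = pk t ξ (-x) := by ext u; exact pk_eq_fourier ht ξ _ u
        rw [this]; exact pk_integrable ht ξ _)
  have h3 := congrFun h2 (-s)
  rw [Real.fourierInv_eq_fourier_neg, neg_neg] at h3
  rw [h3, apk_eq, show -s * -x = x * s by ring]

lemma integral_triple {A₁ A₂ P : ℝ → ℂ} (h₁ : Integrable A₁) (h₂ : Integrable A₂) (hP : Integrable P) :
    ∫ y, (∫ w, A₁ w * ee (w * y)) * (∫ v, A₂ v * ee (v * y)) * P y =
      ∫ p : ℝ × ℝ, A₁ p.1 * A₂ p.2 * ∫ y, ee ((p.1 + p.2) * y) * P y := by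
  have h : Integrable (fun q : ℝ × (ℝ × ℝ) => ee ((q.2.1 + q.2.2) * q.1) * (P q.1 * (A₁ q.2.1 * A₂ q.2.2)))
      (volume.prod volume) := by
    refine Integrable.bdd_mul (c := 1) (hP.mul_prod (h₁.mul_prod h₂)) ?_ (ae_of_all _ fun q => (norm_ee _).le)
    exact Continuous.aestronglyMeasurable (by fun_prop)
  calc _ = ∫ y, ∫ p : ℝ × ℝ, ee ((p.1 + p.2) * y) * (P y * (A₁ p.1 * A₂ p.2)) := by
        refine integral_congr_ae (ae_of_all _ fun y => ?_)
        simp only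
        rw [← integral_prod_mul, ← integral_mul_const]
        refine integral_congr_ae (ae_of_all _ fun p => ?_)
        simp only
        rw [add_mul, ee_add]
        ring
    _ = _ := by
        rw [integral_integral_swap (f := fun y (p : ℝ × ℝ) => ee ((p.1 + p.2) * y) * (P y * (A₁ p.1 * A₂ p.2))) h]
        refine integral_congr_ae (ae_of_all _ fun p => ?_)
        simp only
        rw [← integral_const_mul]
        refine integral_congr_ae (ae_of_all _ fun y => ?_)
        simp only
        ring

/-- The frequency data leading to the bilinear Hilbert transform. -/
noncomputable def mainSym : Sym where
  a := ![1, 1, -2]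
  b := ![-100, 100, 0]
  ha1 j := by fin_cases j <;> norm_num
  ha2 j := by fin_cases j <;> norm_num
  hκ1 i j h := by fin_cases i <;> fin_cases j <;> first | exact absurd rfl h | norm_num
  hκ2 i j h := by fin_cases i <;> fin_cases j <;> first | exact absurd rfl h | norm_num

/-- The symbol of a single scale and frequency, as a function of `z = (t, η)`. -/
noncomputable def W (ξ z : ℝ × ℝ) : ℝ :=
  chi (z.1 * (ξ.1 - z.2) + 100) * chi (z.1 * (ξ.2 - z.2) - 100) * chi (z.1 * (2 * z.2 - ξ.1 - ξ.2))

lemma W_continuous : Continuous fun q : (ℝ × ℝ) × (ℝ × ℝ) => W q.1 q.2 := by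
  have := chi_continuous
  unfold W
  fun_prop

lemma W_nonneg (ξ z : ℝ × ℝ) : 0 ≤ W ξ z :=
  mul_nonneg (mul_nonneg (chi_nonneg _) (chi_nonneg _)) (chi_nonneg _)

lemma W_le_one (ξ z : ℝ × ℝ) : W ξ z ≤ 1 :=
  mul_le_one₀ (mul_le_one₀ (chi_le_one _) (chi_nonneg _) (chi_le_one _)) (chi_nonneg _) (chi_le_one _)

/-- The box of scales and frequencies. -/
noncomputable def bK (R : ℝ) : Measure (ℝ × ℝ) :=
  (volume.restrict (Icc (1 / R) R)).prod (volume.restrict (Icc (-R) R))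

instance (R : ℝ) : IsFiniteMeasure (bK R) := by unfold bK; infer_instance

lemma bK_eq (R : ℝ) : bK R = volume.restrict (Icc (1 / R) R ×ˢ Icc (-R) R) := by
  unfold bK
  rw [Measure.prod_restrict]
  rfl

lemma mainSym_integral {f g : ℝ → ℂ} (hf : Integrable f) (hg : Integrable g) (hf' : Integrable (FT f))
    (hg' : Integrable (FT g)) (x t η : ℝ) (ht : 0 < t) :
    ∫ y, mainSym.cf 0 f (t, η, y) * mainSym.cf 1 g (t, η, y) * mainSym.pkz 2 (t, η, y) x =
      ∫ p : ℝ × ℝ, W p (t, η) * (ee (x * (p.1 + p.2)) * FT f p.1 * FT g p.2) := by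
  have hb : ∀ (u : ℝ → ℂ), Integrable u → ∀ ξ, Integrable fun w => u w * (chi (t * (w - ξ)) : ℂ) := by
    intro u hu ξ
    refine hu.mul_bdd (c := 1) ?_ (ae_of_all _ fun w => ?_)
    · have := chi_continuous
      exact Continuous.aestronglyMeasurable (by fun_prop)
    · rw [Complex.norm_real, Real.norm_of_nonneg (chi_nonneg _)]
      exact chi_le_one _
  have hc : ∀ (j : Fin 3) (u : ℝ → ℂ), Integrable u → ∀ y, mainSym.cf j u (t, η, y) =
      ∫ w, FT u w * (chi (t * (w - (mainSym.a j * η + mainSym.b j / t))) : ℂ) * ee (w * y) := by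
    intro j u hu y
    refine (integral_mul_pk hu ht _ y).trans (integral_congr_ae (ae_of_all _ fun w => ?_))
    simp only
    rw [apk_eq, mul_assoc]
  have hP : Integrable fun y => mainSym.pkz 2 (t, η, y) x := by
    have h := (pk_integrable ht (mainSym.a 2 * η + mainSym.b 2 / t) (-x)).comp_neg
    refine h.congr (ae_of_all _ fun y => ?_)
    simp only [Sym.pkz, pk]
    rw [show -x - -y = y - x by ring]
  simp_rw [hc 0 f hf, hc 1 g hg]
  rw [integral_triple (hb _ hf' _) (hb _ hg' _) hP]
  refine integral_congr_ae (ae_of_all _ fun p => ?_)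
  simp only
  have := integral_ee_mul_pk ht (mainSym.a 2 * η + mainSym.b 2 / t) (p.1 + p.2) x
  simp only [Sym.pkz] at this ⊢
  rw [this]
  simp only [mainSym, W, Matrix.cons_val_zero, Matrix.cons_val_one, Matrix.cons_val]
  rw [show t * (p.1 - (1 * η + -100 / t)) = t * (p.1 - η) + 100 by field_simp; ring,
    show t * (p.2 - (1 * η + 100 / t)) = t * (p.2 - η) - 100 by field_simp; ring,
    show t * (-(p.1 + p.2) - (-2 * η + 0 / t)) = t * (2 * η - p.1 - p.2) by ring]
  push_cast
  ring

/-- The symbol of the truncated operator. -/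
noncomputable def mR (R : ℝ) (ξ : ℝ × ℝ) : ℝ := ∫ z, W ξ z ∂bK R

lemma mainSym_T {R : ℝ} (hR : 1 ≤ R) {f g : ℝ → ℂ} (hf : Integrable f) (hg : Integrable g)
    (hf' : Integrable (FT f)) (hg' : Integrable (FT g)) (x : ℝ) :
    mainSym.T R f g x = ∫ p : ℝ × ℝ, mR R p * (ee (x * (p.1 + p.2)) * FT f p.1 * FT g p.2) := by
  have hI : Integrable (fun q : (ℝ × ℝ) × (ℝ × ℝ) =>
      (W q.2 q.1 : ℂ) * (ee (x * (q.2.1 + q.2.2)) * FT f q.2.1 * FT g q.2.2)) ((bK R).prod volume) := by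
    refine Integrable.bdd_mul (c := 1) ?_ ?_ (ae_of_all _ fun q => ?_)
    · have h1 : Integrable (fun p : ℝ × ℝ => ee (x * (p.1 + p.2)) * FT f p.1 * FT g p.2) := by
        simp_rw [mul_assoc]
        exact Integrable.bdd_mul (c := 1) (hf'.mul_prod hg')
          (Continuous.aestronglyMeasurable (by fun_prop)) (ae_of_all _ fun q => (norm_ee _).le)
      exact h1.comp_snd _
    · refine Continuous.aestronglyMeasurable (Complex.continuous_ofReal.comp ?_)
      exact W_continuous.comp continuous_swap
    · rw [Complex.norm_real, Real.norm_of_nonneg (W_nonneg _ _)]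
      exact W_le_one _ _
  unfold Sym.T
  have h0 := Sym.T_integrand_integrable (G := mainSym) hR hf hg x
  have h1 : ∀ᵐ t ∂volume.restrict (Icc (1 / R) R), 0 < t := by
    filter_upwards [ae_restrict_mem measurableSet_Icc] with t ht
    exact lt_of_lt_of_le (by positivity) ht.1
  calc _ = ∫ t in Icc (1 / R) R, ∫ η in Icc (-R) R, ∫ p : ℝ × ℝ,
          (W p (t, η) : ℂ) * (ee (x * (p.1 + p.2)) * FT f p.1 * FT g p.2) := by
        unfold Sym.mK at h0 ⊢
        rw [integral_prod _ h0]
        refine integral_congr_ae ?_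
        filter_upwards [h0.prod_right_ae, h1] with t ht ht0
        rw [integral_prod _ ht]
        exact integral_congr_ae (ae_of_all _ fun η => mainSym_integral hf hg hf' hg' x t η ht0)
    _ = ∫ z, (∫ p : ℝ × ℝ, (W p z : ℂ) * (ee (x * (p.1 + p.2)) * FT f p.1 * FT g p.2)) ∂bK R := by
        have h2 := hI.integral_prod_left
        unfold bK at h2 ⊢
        exact (integral_prod _ h2).symm
    _ = _ := by
        refine (integral_integral_swap (f := fun z (p : ℝ × ℝ) =>
          (W p z : ℂ) * (ee (x * (p.1 + p.2)) * FT f p.1 * FT g p.2)) hI).trans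
          (integral_congr_ae (ae_of_all _ fun p => ?_))
        simp only
        rw [integral_mul_const, integral_complex_ofReal, mR]

lemma W_ne_zero {ξ z : ℝ × ℝ} (h : W ξ z ≠ 0) :
    |z.1 * (ξ.1 - z.2) + 100| < 1 ∧ |z.1 * (ξ.2 - z.2) - 100| < 1 := by
  by_contra! hc
  refine h ?_
  unfold W
  by_cases h1 : |z.1 * (ξ.1 - z.2) + 100| < 1
  · rw [chi_eq_zero (hc h1)]; ring
  · rw [chi_eq_zero (not_lt.1 h1)]; ring

lemma mR_eq_zero {R : ℝ} (hR : 1 ≤ R) {ξ : ℝ × ℝ} (h : ξ.2 - ξ.1 ≤ 0) : mR R ξ = 0 := by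
  unfold mR
  rw [bK_eq]
  refine setIntegral_eq_zero_of_forall_eq_zero fun z hz => ?_
  by_contra hW
  obtain ⟨h1, h2⟩ := W_ne_zero hW
  rw [abs_lt] at h1 h2
  have hz0 : 0 < z.1 := lt_of_lt_of_le (by positivity) hz.1.1
  nlinarith

lemma W_scaling {ξ : ℝ × ℝ} (h : 0 < ξ.2 - ξ.1) (z : ℝ × ℝ) : W ξ z =
    W (-1 / 2, 1 / 2) (z.1 * (ξ.2 - ξ.1), (z.2 - (ξ.1 + ξ.2) / 2) / (ξ.2 - ξ.1)) := by
  unfold W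
  congr 1
  · congr 1
    · congr 1
      field_simp
      ring
    · congr 1
      field_simp
      ring
  · congr 1
    field_simp
    ring

lemma W_support {ξ z : ℝ × ℝ} (h : 0 < ξ.2 - ξ.1) (hW : W ξ z ≠ 0) :
    z ∈ Icc (198 / (ξ.2 - ξ.1)) (202 / (ξ.2 - ξ.1)) ×ˢ
      Icc ((ξ.1 + ξ.2) / 2 - (ξ.2 - ξ.1)) ((ξ.1 + ξ.2) / 2 + (ξ.2 - ξ.1)) := by
  obtain ⟨h1, h2⟩ := W_ne_zero hW
  rw [abs_lt] at h1 h2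
  have h3 : 198 / (ξ.2 - ξ.1) ≤ z.1 := by rw [div_le_iff₀ h]; nlinarith
  have h4 : z.1 ≤ 202 / (ξ.2 - ξ.1) := by rw [le_div_iff₀ h]; nlinarith
  have h0 : 0 < z.1 := lt_of_lt_of_le (by positivity) h3
  rw [div_le_iff₀ h] at h3
  refine ⟨⟨by rwa [div_le_iff₀ h], h4⟩, ?_, ?_⟩
  · by_contra! hc
    nlinarith [mul_lt_mul_of_pos_left hc h0]
  · by_contra! hc
    nlinarith [mul_lt_mul_of_pos_left hc h0]

lemma W_continuous_right (ξ : ℝ × ℝ) : Continuous (W ξ) := W_continuous.comp (by fun_prop : Continuous fun z => (ξ, z))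

lemma W_hasCompactSupport {ξ : ℝ × ℝ} (h : 0 < ξ.2 - ξ.1) : HasCompactSupport (W ξ) :=
  HasCompactSupport.of_support_subset_isCompact (isCompact_Icc.prod isCompact_Icc) fun _ hz => W_support h hz

lemma W_integrable {ξ : ℝ × ℝ} (h : 0 < ξ.2 - ξ.1) : Integrable (W ξ) :=
  (W_continuous_right ξ).integrable_of_hasCompactSupport (W_hasCompactSupport h)

/-- The value of the limiting symbol. -/
noncomputable def Cw : ℝ := ∫ z, W (-1 / 2, 1 / 2) z

lemma Cw_pos : 0 < Cw := by
  refine (W_continuous_right _).integral_pos_of_hasCompactSupport_nonneg_nonzero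
    (W_hasCompactSupport (by norm_num)) (fun z => W_nonneg _ z) (x := (200, 0)) ?_
  norm_num [W, chi_zero]

lemma integral_W {ξ : ℝ × ℝ} (h : 0 < ξ.2 - ξ.1) : ∫ z, W ξ z = Cw := by
  have h1 := W_integrable h
  have h2 := W_integrable (ξ := (-1 / 2, 1 / 2)) (by norm_num)
  unfold Cw
  rw [Measure.volume_eq_prod] at h1 h2 ⊢
  rw [integral_prod _ h1, integral_prod _ h2]
  have h3 : ∀ t, ∫ η, W ξ (t, η) =
      (ξ.2 - ξ.1) * (fun u => ∫ η, W (-1 / 2, 1 / 2) (u, η)) (t * (ξ.2 - ξ.1)) := fun t => by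
    simp_rw [W_scaling h]
    rw [integral_sub_right_eq_self (μ := volume)
      (fun η => W (-1 / 2, 1 / 2) (t * (ξ.2 - ξ.1), η / (ξ.2 - ξ.1))) ((ξ.1 + ξ.2) / 2),
      Measure.integral_comp_div (fun η => W (-1 / 2, 1 / 2) (t * (ξ.2 - ξ.1), η)) (ξ.2 - ξ.1),
      abs_of_pos h, smul_eq_mul]
  simp_rw [h3]
  rw [integral_const_mul, Measure.integral_comp_mul_right (fun u => ∫ η, W (-1 / 2, 1 / 2) (u, η)),
    abs_of_pos (inv_pos.2 h), smul_eq_mul, mul_inv_cancel_left₀ h.ne']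

lemma mR_nonneg (R : ℝ) (ξ : ℝ × ℝ) : 0 ≤ mR R ξ := integral_nonneg fun z => W_nonneg _ z

lemma mR_le {R : ℝ} (hR : 1 ≤ R) (ξ : ℝ × ℝ) : mR R ξ ≤ Cw := by
  rcases le_or_gt (ξ.2 - ξ.1) 0 with h | h
  · rw [mR_eq_zero hR h]
    exact Cw_pos.le
  · rw [← integral_W h, mR, bK_eq]
    exact setIntegral_le_integral (W_integrable h) (ae_of_all _ fun z => W_nonneg _ z)

lemma mR_tendsto (ξ : ℝ × ℝ) : Filter.Tendsto (fun n : ℕ => mR (n + 1) ξ) Filter.atTop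
    (nhds (Cw * (Ioi (0 : ℝ)).indicator 1 (ξ.2 - ξ.1))) := by
  rcases le_or_gt (ξ.2 - ξ.1) 0 with h | h
  · rw [indicator_of_notMem (by simpa using h), mul_zero]
    refine tendsto_const_nhds.congr fun n => (mR_eq_zero (by linarith [n.cast_nonneg (α := ℝ)]) h).symm
  · rw [indicator_of_mem (by exact h), Pi.one_apply, mul_one]
    set δ := ξ.2 - ξ.1 with hδ
    obtain ⟨N, hN⟩ := exists_nat_ge (202 / δ + δ + |(ξ.1 + ξ.2) / 2|)
    refine tendsto_const_nhds.congr' ?_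
    filter_upwards [Filter.eventually_ge_atTop N] with n hn
    rw [← integral_W h, mR, bK_eq]
    symm
    refine setIntegral_eq_integral_of_forall_compl_eq_zero fun z hz => ?_
    by_contra hW
    refine hz ?_
    obtain ⟨⟨h1, h2⟩, h3, h4⟩ := W_support h hW
    rw [← hδ] at h1 h2 h3 h4
    have hn' : (N : ℝ) ≤ n := by exact_mod_cast hn
    have h5 : 0 < 202 / δ := by positivity
    have h6 := abs_le.1 (le_refl |(ξ.1 + ξ.2) / 2|)
    refine ⟨⟨?_, by linarith⟩, by linarith, by linarith⟩
    refine le_trans ?_ h1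
    rw [div_le_div_iff₀ (by positivity) h]
    nlinarith [abs_nonneg ((ξ.1 + ξ.2) / 2)]

lemma biMul_eq (A : Set ℝ) (f g : ℝ → ℂ) (x : ℝ) : biMul A f g x =
    ∫ ξ : ℝ × ℝ, (A.indicator 1 (ξ.2 - ξ.1) : ℝ) * (ee (x * (ξ.1 + ξ.2)) * FT f ξ.1 * FT g ξ.2) := by
  unfold biMul ee
  refine integral_congr_ae (ae_of_all _ fun ξ => ?_)
  simp only
  rw [← mul_assoc (2 * π)]
  by_cases h : ξ.2 - ξ.1 ∈ A <;> simp only [h, indicator_of_mem, indicator_of_notMem, not_false_eq_true,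
    Pi.one_apply, Complex.ofReal_one, Complex.ofReal_zero, mul_one, one_mul, mul_zero, zero_mul]

/-- Continuous functions which are integrable together with their Fourier transform. -/
structure Good (f : ℝ → ℂ) : Prop where
  cont : Continuous f
  int : Integrable f
  ft : Integrable (FT f)

lemma Good.integrable_symbol {f g : ℝ → ℂ} (hf : Good f) (hg : Good g) (x : ℝ) :
    Integrable fun p : ℝ × ℝ => ee (x * (p.1 + p.2)) * FT f p.1 * FT g p.2 := by
  simp_rw [mul_assoc]
  exact Integrable.bdd_mul (c := 1) (hf.ft.mul_prod hg.ft)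
    (Continuous.aestronglyMeasurable (by fun_prop)) (ae_of_all _ fun q => (norm_ee _).le)

lemma T_tendsto_biMul {f g : ℝ → ℂ} (hf : Good f) (hg : Good g) (x : ℝ) :
    Filter.Tendsto (fun n : ℕ => mainSym.T (n + 1) f g x) Filter.atTop
      (nhds (Cw * biMul (Ioi 0) f g x)) := by
  have h1 : ∀ n : ℕ, (1 : ℝ) ≤ n + 1 := fun n => by linarith [n.cast_nonneg (α := ℝ)]
  simp_rw [fun n => mainSym_T (h1 n) hf.int hg.int hf.ft hg.ft x]
  rw [biMul_eq, ← integral_const_mul]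
  have hI := hf.integrable_symbol hg x
  refine tendsto_integral_of_dominated_convergence _ (fun n => ?_) (hI.norm.const_mul Cw)
    (fun n => ae_of_all _ fun p => ?_) (ae_of_all _ fun p => ?_)
  · have h2 : StronglyMeasurable (mR (n + 1)) :=
      W_continuous.stronglyMeasurable.integral_prod_right' (ν := bK (n + 1))
    exact (Complex.continuous_ofReal.comp_stronglyMeasurable h2).aestronglyMeasurable.mul
      hI.aestronglyMeasurable
  · rw [norm_mul, Complex.norm_real, Real.norm_of_nonneg (mR_nonneg _ _)]
    exact mul_le_mul_of_nonneg_right (mR_le (h1 n) p) (norm_nonneg _)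
  · rw [← mul_assoc, ← Complex.ofReal_mul]
    exact (Complex.continuous_ofReal.continuousAt.tendsto.comp (mR_tendsto p)).mul_const _

lemma sqf_tendsto {s : Finset ι} {u : ℕ → ι → ℝ → ℂ} {v : ι → ℝ → ℂ} {x : ℝ}
    (h : ∀ n, Filter.Tendsto (fun m => u m n x) Filter.atTop (nhds (v n x))) :
    Filter.Tendsto (fun m => sqf s (u m) x) Filter.atTop (nhds (sqf s v x)) :=
  (continuous_sqrt.tendsto _).comp (tendsto_finsetSum _ fun n _ => (h n).norm.pow 2)

lemma sqf_mono {s : Finset ι} {u v : ι → ℝ → ℂ} {x : ℝ} (h : ∀ n, ‖u n x‖ ≤ ‖v n x‖) :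
    sqf s u x ≤ sqf s v x :=
  sqrt_le_sqrt (Finset.sum_le_sum fun n _ => pow_le_pow_left₀ (norm_nonneg _) (h n) 2)

lemma eLpNorm_sqf_mono {s : Finset ι} {u v : ι → ℝ → ℂ} (h : ∀ n x, ‖u n x‖ ≤ ‖v n x‖) (p : ℝ≥0∞) :
    eLpNorm (sqf s u) p ≤ eLpNorm (sqf s v) p := by
  refine eLpNorm_mono fun x => ?_
  rw [norm_of_nonneg (sqf_nonneg _ _ _), norm_of_nonneg (sqf_nonneg _ _ _)]
  exact sqf_mono fun n => h n x

lemma sqf_const_mul (s : Finset ι) (c : ℂ) (u : ι → ℝ → ℂ) (x : ℝ) :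
    sqf s (fun n x => c * u n x) x = ‖c‖ * sqf s u x := by
  unfold sqf
  simp_rw [norm_mul, mul_pow, ← Finset.mul_sum]
  rw [sqrt_mul (by positivity), sqrt_sq (norm_nonneg _)]

/-- The restriction of `f` to `[-m, m]`. -/
noncomputable def cutoff (m : ℕ) (f : ℝ → ℂ) : ℝ → ℂ := (Icc (-(m : ℝ)) m).indicator f

lemma norm_cutoff_le (m : ℕ) (f : ℝ → ℂ) (x : ℝ) : ‖cutoff m f x‖ ≤ ‖f x‖ := norm_indicator_le_norm_self _ _

lemma Good.cutoff_nice {f : ℝ → ℂ} (hf : Good f) (m : ℕ) : Nice (cutoff m f) := by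
  refine ⟨hf.cont.measurable.indicator measurableSet_Icc, ?_, m, fun x hx => ?_⟩
  · obtain ⟨B, hB⟩ := isCompact_Icc.exists_bound_of_continuousOn (s := Icc (-(m : ℝ)) m) hf.cont.continuousOn
    refine ⟨max B 0, fun x => ?_⟩
    by_cases hx : x ∈ Icc (-(m : ℝ)) m
    · exact (norm_cutoff_le m f x).trans ((hB x hx).trans (le_max_left _ _))
    · simp [cutoff, hx]
  · exact indicator_of_notMem (s := Icc (-(m : ℝ)) m) (fun h => absurd (abs_le.2 h) (not_le.2 hx)) f

lemma cutoff_tendsto (f : ℝ → ℂ) (x : ℝ) :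
    Filter.Tendsto (fun m => cutoff m f x) Filter.atTop (nhds (f x)) := by
  obtain ⟨N, hN⟩ := exists_nat_ge |x|
  refine tendsto_const_nhds.congr' ?_
  filter_upwards [Filter.eventually_ge_atTop N] with m hm
  have : (N : ℝ) ≤ m := by exact_mod_cast hm
  exact (indicator_of_mem (s := Icc (-(m : ℝ)) m) (abs_le.1 (hN.trans this)) f).symm

/-- The vector-valued estimate for the bilinear multiplier of a half-line. -/
theorem vector_halfline {p q r : ℝ≥0∞} (hp : 1 < p) (hq : 1 < q)
    (hr : 1 / r = 1 / p + 1 / q) (hr0 : 0 < 1 / r) (hr1 : 1 / r < 3 / 2) :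
    ∃ C : ℝ, 0 < C ∧ ∀ (s : Finset ι) (f g : ι → ℝ → ℂ), (∀ n, Good (f n)) → (∀ n, Good (g n)) →
    eLpNorm (sqf s fun n => biMul (Ioi 0) (f n) (g n)) r ≤
      ENNReal.ofReal C * eLpNorm (sqf s f) p * eLpNorm (sqf s g) q := by
  obtain ⟨C, hC, h⟩ := vector_elp (ι := ι) hp hq hr hr0 hr1
  refine ⟨Cw⁻¹ * C, mul_pos (inv_pos.2 Cw_pos) hC, fun s f g hf hg => ?_⟩
  have h1 : ∀ n : ℕ, (1 : ℝ) ≤ n + 1 := fun n => by linarith [n.cast_nonneg (α := ℝ)]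
  have hT : ∀ k : ℕ, eLpNorm (sqf s fun n => mainSym.T (k + 1) (f n) (g n)) r ≤
      ENNReal.ofReal C * eLpNorm (sqf s f) p * eLpNorm (sqf s g) q := by
    intro k
    refine Lp.eLpNorm_le_of_ae_tendsto (u := Filter.atTop) (f := fun m => sqf s fun n => mainSym.T (k + 1) (cutoff m (f n)) (cutoff m (g n)))
      (.of_forall fun m => ?_) (fun m => (sqf_measurable fun n _ => ?_).aestronglyMeasurable)
      (ae_of_all _ fun x => sqf_tendsto fun n => ?_)
    rotate_left
    · exact Sym.T_measurable _ ((hf n).cutoff_nice m).1 ((hg n).cutoff_nice m).1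
    · exact Sym.T_tendsto (h1 k) (hf n).int (hg n).int
        (fun m => ((hf n).cutoff_nice m).1.aestronglyMeasurable)
        (fun m => ((hg n).cutoff_nice m).1.aestronglyMeasurable) (fun m => norm_cutoff_le m _)
        (fun m => norm_cutoff_le m _) (cutoff_tendsto _) (cutoff_tendsto _) x
    · refine (h mainSym _ (h1 k) s _ _ (fun n => (hf n).cutoff_nice m) fun n => (hg n).cutoff_nice m).trans ?_
      exact mul_le_mul' (mul_le_mul_right (eLpNorm_sqf_mono (fun n => norm_cutoff_le m _) p) _)
        (eLpNorm_sqf_mono (fun n => norm_cutoff_le m _) q)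
  refine Lp.eLpNorm_le_of_ae_tendsto (u := Filter.atTop)
    (f := fun k : ℕ => sqf s fun n x => (Cw⁻¹ : ℂ) * mainSym.T (k + 1) (f n) (g n) x)
    (.of_forall fun k => ?_) (fun k => (sqf_measurable fun n _ => ?_).aestronglyMeasurable)
    (ae_of_all _ fun x => sqf_tendsto fun n => ?_)
  rotate_left
  · exact (Sym.T_measurable _ (hf n).cont.measurable (hg n).cont.measurable).const_mul _
  · have := (T_tendsto_biMul (hf n) (hg n) x).const_mul (Cw⁻¹ : ℂ)
    rwa [inv_mul_cancel_left₀ (by exact_mod_cast Cw_pos.ne')] at this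
  · have : (sqf s fun n x => (Cw⁻¹ : ℂ) * mainSym.T (k + 1) (f n) (g n) x) =
        Cw⁻¹ • sqf s fun n => mainSym.T (k + 1) (f n) (g n) := by
      ext x
      rw [sqf_const_mul, Pi.smul_apply, smul_eq_mul, ← Complex.ofReal_inv, Complex.norm_real,
        norm_of_nonneg (inv_nonneg.2 Cw_pos.le)]
    rw [this, eLpNorm_const_smul, ENNReal.ofReal_mul (inv_nonneg.2 Cw_pos.le),
      Real.enorm_of_nonneg (inv_nonneg.2 Cw_pos.le), mul_assoc, mul_assoc, ← mul_assoc (ENNReal.ofReal C)]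
    exact mul_le_mul_right (hT k) _

/-- Modulation of `f` by the frequency `-a`. -/
noncomputable def modul (a : ℝ) (f : ℝ → ℂ) (t : ℝ) : ℂ := ee (-(t * a)) * f t

lemma norm_modul (a : ℝ) (f : ℝ → ℂ) (t : ℝ) : ‖modul a f t‖ = ‖f t‖ := by
  rw [modul, norm_mul, norm_ee, one_mul]

lemma FT_modul (a : ℝ) (f : ℝ → ℂ) (ξ : ℝ) : FT (modul a f) ξ = FT f (ξ + a) := by
  rw [FT_eq_ee, FT_eq_ee]
  refine integral_congr_ae (ae_of_all _ fun t => ?_)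
  simp only [modul]
  rw [← mul_assoc, ← ee_add]
  ring_nf

lemma Good.modul {f : ℝ → ℂ} (hf : Good f) (a : ℝ) : Good (modul a f) where
  cont := by
    have := hf.cont
    unfold BHT.modul
    fun_prop
  int := by
    refine Integrable.bdd_mul (c := 1) hf.int ?_ (ae_of_all _ fun q => (norm_ee _).le)
    exact Continuous.aestronglyMeasurable (by fun_prop)
  ft := by
    have : FT (BHT.modul a f) = fun ξ => FT f (ξ + a) := funext (FT_modul a f)
    rw [this]
    exact hf.ft.comp_add_right a

lemma good_schwartz (F : 𝓢(ℝ, ℂ)) : Good F :=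
  ⟨F.continuous, F.integrable, by rw [FT_eq, ← SchwartzMap.fourier_coe]; exact SchwartzMap.integrable _⟩

lemma norm_biMul_Ioi (a : ℝ) (f g : ℝ → ℂ) (x : ℝ) :
    ‖biMul (Ioi 0) f (modul a g) x‖ = ‖biMul (Ioi a) f g x‖ := by
  have h : biMul (Ioi a) f g x = ee (x * a) * biMul (Ioi 0) f (modul a g) x := by
    rw [biMul_eq, biMul_eq, ← integral_const_mul, ← integral_add_right_eq_self _ ((0 : ℝ), a)]
    refine integral_congr_ae (ae_of_all _ fun ξ => ?_)
    simp only [Prod.fst_add, Prod.snd_add, add_zero, FT_modul]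
    have h1 : (Ioi a).indicator (1 : ℝ → ℝ) (ξ.2 + a - ξ.1) = (Ioi 0).indicator 1 (ξ.2 - ξ.1) := by
      simp only [indicator, mem_Ioi]
      congr 1
      rw [eq_iff_iff]
      constructor <;> intro h <;> linarith
    rw [h1, show x * (ξ.1 + (ξ.2 + a)) = x * a + x * (ξ.1 + ξ.2) by ring, ee_add]
    ring
  rw [h, norm_mul, norm_ee, one_mul]

lemma ae_sub_ne (c : ℝ) : ∀ᵐ ξ : ℝ × ℝ, ξ.2 - ξ.1 ≠ c := by
  rw [ae_iff]
  simp only [ne_eq, not_not]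
  rw [Measure.volume_eq_prod, Measure.measure_prod_null (measurableSet_eq_fun (by fun_prop) measurable_const)]
  refine ae_of_all _ fun x => ?_
  have : Prod.mk x ⁻¹' {ξ : ℝ × ℝ | ξ.2 - ξ.1 = c} = {x + c} := by
    ext y
    simp only [mem_preimage, mem_ofPred_eq, mem_singleton_iff]
    constructor <;> intro h <;> linarith
  simp only [Pi.zero_apply]
  rw [this]
  simp

lemma biMul_symbol_integrable {A : Set ℝ} (hA : MeasurableSet A) {f g : ℝ → ℂ} (hf : Good f) (hg : Good g)
    (x : ℝ) : Integrable fun ξ : ℝ × ℝ =>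
      (A.indicator 1 (ξ.2 - ξ.1) : ℝ) * (ee (x * (ξ.1 + ξ.2)) * FT f ξ.1 * FT g ξ.2) := by
  refine Integrable.bdd_mul (c := 1) (hf.integrable_symbol hg x) ?_ (ae_of_all _ fun ξ => ?_)
  · refine (Complex.measurable_ofReal.comp ?_).aestronglyMeasurable
    exact (measurable_one.indicator hA).comp (by fun_prop)
  · rw [Complex.norm_real]
    exact (norm_indicator_le_norm_self _ _).trans (by simp)

lemma biMul_measurable {A : Set ℝ} (hA : MeasurableSet A) {f g : ℝ → ℂ} (hf : Good f) (hg : Good g) :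
    Measurable (biMul A f g) := by
  have hc : ∀ {u : ℝ → ℂ}, Good u → Measurable (FT u) := fun {u} hu => by
    have : StronglyMeasurable fun w : ℝ × ℝ => ee (-(w.2 * w.1)) * u w.2 := by
      have := hu.cont
      exact Continuous.stronglyMeasurable (by fun_prop)
    simpa only [← FT_eq_ee] using (this.integral_prod_right' (ν := volume)).measurable
  have h1 := hc hf
  have h2 := hc hg
  have h3 : Measurable (A.indicator (1 : ℝ → ℝ)) := measurable_one.indicator hA
  have h4 := ee_continuous.measurable
  have : StronglyMeasurable fun w : ℝ × (ℝ × ℝ) => (A.indicator 1 (w.2.2 - w.2.1) : ℝ) *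
      (ee (w.1 * (w.2.1 + w.2.2)) * FT f w.2.1 * FT g w.2.2) := by
    refine Measurable.stronglyMeasurable ?_
    refine Measurable.mul (Complex.measurable_ofReal.comp (h3.comp (by fun_prop))) (by fun_prop)
  have h := (this.integral_prod_right' (ν := volume)).measurable
  simp only [← biMul_eq] at h
  exact h

lemma biMul_bounded {J : Set ℝ} (hJ : J.OrdConnected) (h1 : BddBelow J) (h2 : BddAbove J) :
    ∃ a b : ℝ, ∀ {f g : ℝ → ℂ}, Good f → Good g → ∀ x,
      biMul J f g x = biMul (Ioi a) f g x - biMul (Ioi b) f g x := by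
  obtain ⟨a, b, h⟩ : ∃ a b : ℝ, ∀ y, y ≠ a → y ≠ b →
      J.indicator (1 : ℝ → ℝ) y = (Ioi a).indicator 1 y - (Ioi b).indicator 1 y := by
    rcases J.eq_empty_or_nonempty with rfl | hne
    · exact ⟨0, 0, fun y _ _ => by simp⟩
    refine ⟨sInf J, sSup J, fun y ha hb => ?_⟩
    have h3 : sInf J ≤ sSup J := csInf_le_csSup hne h1 h2
    by_cases hy : y ∈ J
    · have h4 : sInf J < y := lt_of_le_of_ne (csInf_le h1 hy) ha.symm
      have h5 : y < sSup J := lt_of_le_of_ne (le_csSup h2 hy) hb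
      simp [hy, h4, h5.le]
    · have h4 : y < sInf J ∨ sSup J < y := by
        by_contra! hc
        obtain ⟨u, hu, hu'⟩ := exists_lt_of_csInf_lt hne (lt_of_le_of_ne hc.1 ha.symm)
        obtain ⟨v, hv, hv'⟩ := exists_lt_of_lt_csSup hne (lt_of_le_of_ne hc.2 hb)
        exact hy (hJ.out hu hv ⟨hu'.le, hv'.le⟩)
      rcases h4 with h4 | h4
      · simp [hy, h4.le, (h4.trans_le h3).le]
      · simp [hy, h4, h3.trans_lt h4]
  refine ⟨a, b, fun {f g} hf hg x => ?_⟩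
  rw [biMul_eq, biMul_eq, biMul_eq, ← integral_sub (biMul_symbol_integrable measurableSet_Ioi hf hg x)
    (biMul_symbol_integrable measurableSet_Ioi hf hg x)]
  refine integral_congr_ae ?_
  filter_upwards [ae_sub_ne a, ae_sub_ne b] with ξ ha hb
  rw [h _ ha hb]
  push_cast
  ring

lemma biMul_tendsto {A : Set ℝ} (hA : MeasurableSet A) {f g : ℝ → ℂ} (hf : Good f) (hg : Good g) (x : ℝ) :
    Filter.Tendsto (fun m : ℕ => biMul (A ∩ Icc (-(m : ℝ)) m) f g x) Filter.atTop (nhds (biMul A f g x)) := by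
  simp_rw [biMul_eq]
  have hI := hf.integrable_symbol hg x
  refine tendsto_integral_of_dominated_convergence _ (fun n =>
    (biMul_symbol_integrable (hA.inter measurableSet_Icc) hf hg x).aestronglyMeasurable) hI.norm
    (fun n => ae_of_all _ fun p => ?_) (ae_of_all _ fun p => ?_)
  · rw [norm_mul, Complex.norm_real]
    refine mul_le_of_le_one_left (norm_nonneg _) ?_
    exact (norm_indicator_le_norm_self _ _).trans (by simp)
  · refine Filter.Tendsto.mul_const _ ((Complex.continuous_ofReal.tendsto _).comp ?_)
    obtain ⟨N, hN⟩ := exists_nat_ge |p.2 - p.1|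
    refine tendsto_const_nhds.congr' ?_
    filter_upwards [Filter.eventually_ge_atTop N] with m hm
    have hm' : (N : ℝ) ≤ m := by exact_mod_cast hm
    have : p.2 - p.1 ∈ Icc (-(m : ℝ)) m := abs_le.1 (hN.trans hm')
    simp only [indicator, mem_inter_iff, this, and_true]

lemma sum_product_bool (s : Finset ι) (u : ι × Bool → ℝ) :
    ∑ n ∈ s ×ˢ (Finset.univ : Finset Bool), u n = ∑ n ∈ s, (u (n, true) + u (n, false)) := by
  rw [Finset.sum_product]
  simp

lemma sqf_le_two_mul {s : Finset ι} {κ : Type*} {s' : Finset κ} {u : ι → ℝ → ℂ} {v : κ → ℝ → ℂ}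
    (h : ∀ x, ∑ n ∈ s, ‖u n x‖ ^ 2 ≤ 4 * ∑ n ∈ s', ‖v n x‖ ^ 2) (p : ℝ≥0∞) :
    eLpNorm (sqf s u) p ≤ ENNReal.ofReal 2 * eLpNorm (sqf s' v) p := by
  refine eLpNorm_le_mul_eLpNorm_of_ae_le_mul (ae_of_all _ fun x => ?_) p
  rw [norm_of_nonneg (sqf_nonneg _ _ _), norm_of_nonneg (sqf_nonneg _ _ _)]
  unfold sqf
  refine sqrt_le_iff.2 ⟨by positivity, (h x).trans_eq ?_⟩
  rw [mul_pow, sq_sqrt (Finset.sum_nonneg fun n _ => by positivity)]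
  norm_num

/-- The vector-valued estimate for bilinear multipliers of intervals. -/
theorem vector_interval {p q r : ℝ≥0∞} (hp : 1 < p) (hq : 1 < q)
    (hr : 1 / r = 1 / p + 1 / q) (hr0 : 0 < 1 / r) (hr1 : 1 / r < 3 / 2) :
    ∃ C : ℝ, 0 < C ∧ ∀ I : ι → Set ℝ, (∀ n, (I n).OrdConnected) → ∀ (s : Finset ι) (f g : ι → ℝ → ℂ),
    (∀ n, Good (f n)) → (∀ n, Good (g n)) →
    eLpNorm (sqf s fun n => biMul (I n) (f n) (g n)) r ≤
      ENNReal.ofReal C * eLpNorm (sqf s f) p * eLpNorm (sqf s g) q := by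
  obtain ⟨C, hC, h⟩ := vector_halfline (ι := ι × Bool) hp hq hr hr0 hr1
  refine ⟨2 * (C * 2 * 2), by positivity, fun I hI s f g hf hg => ?_⟩
  refine Lp.eLpNorm_le_of_ae_tendsto (u := Filter.atTop)
    (f := fun m : ℕ => sqf s fun n => biMul (I n ∩ Icc (-(m : ℝ)) m) (f n) (g n))
    (.of_forall fun m => ?_) (fun m => (sqf_measurable fun n _ => biMul_measurable
      ((hI n).measurableSet.inter measurableSet_Icc) (hf n) (hg n)).aestronglyMeasurable)
    (ae_of_all _ fun x => sqf_tendsto fun n => biMul_tendsto (hI n).measurableSet (hf n) (hg n) x)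
  choose a b hab using fun n => biMul_bounded ((hI n).inter (ordConnected_Icc (a := -(m : ℝ)) (b := m)))
    (bddBelow_Icc.mono inter_subset_right) (bddAbove_Icc.mono inter_subset_right)
  have h1 := h (s ×ˢ Finset.univ) (fun n => f n.1) (fun n => modul (if n.2 then a n.1 else b n.1) (g n.1))
    (fun n => hf n.1) fun n => (hg n.1).modul _
  have h2 := sqf_le_two_mul (s := s) (s' := s ×ˢ (Finset.univ : Finset Bool))
    (u := fun n => biMul (I n ∩ Icc (-(m : ℝ)) m) (f n) (g n))
    (v := fun n => biMul (Ioi 0) (f n.1) (modul (if n.2 then a n.1 else b n.1) (g n.1))) (fun x => by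
      rw [sum_product_bool, Finset.mul_sum]
      refine Finset.sum_le_sum fun n _ => ?_
      simp only [norm_biMul_Ioi, if_true, Bool.false_eq_true, if_false]
      rw [hab n (hf n) (hg n)]
      have := pow_le_pow_left₀ (norm_nonneg _) (norm_sub_le (biMul (Ioi (a n)) (f n) (g n) x)
        (biMul (Ioi (b n)) (f n) (g n) x)) 2
      nlinarith [sq_nonneg (‖biMul (Ioi (a n)) (f n) (g n) x‖ - ‖biMul (Ioi (b n)) (f n) (g n) x‖),
        sq_nonneg ‖biMul (Ioi (a n)) (f n) (g n) x‖, sq_nonneg ‖biMul (Ioi (b n)) (f n) (g n) x‖]) r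
  have h3 : ∀ (u : ι → ℝ → ℂ) (v : ι × Bool → ℝ → ℂ), (∀ n x, ‖v n x‖ = ‖u n.1 x‖) → ∀ p,
      eLpNorm (sqf (s ×ˢ Finset.univ) v) p ≤ ENNReal.ofReal 2 * eLpNorm (sqf s u) p := fun u v huv p =>
    sqf_le_two_mul (fun x => by
      rw [sum_product_bool, Finset.mul_sum]
      refine Finset.sum_le_sum fun n _ => ?_
      rw [huv, huv]
      nlinarith [sq_nonneg ‖u n x‖]) p
  refine h2.trans ((mul_le_mul_right (h1.trans (mul_le_mul' (mul_le_mul_right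
    (h3 f _ (fun n x => rfl) p) _) (h3 g _ (fun n x => norm_modul _ _ _) q))) _).trans_eq ?_)
  rw [ENNReal.ofReal_mul (by norm_num), ENNReal.ofReal_mul (by positivity), ENNReal.ofReal_mul hC.le]
  ring

lemma biMul_zero_left (A : Set ℝ) (g : ℝ → ℂ) (x : ℝ) : biMul A 0 g x = 0 := by
  simp [biMul, FT]

lemma sqrt_tsum_eq_sqf {s : Finset ι} {u : ι → ℝ → ℂ} (h : ∀ n ∉ s, ∀ x, u n x = 0) :
    (fun x => √(∑' n, ‖u n x‖ ^ 2)) = sqf s u := by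
  ext x
  unfold sqf
  rw [tsum_eq_sum fun n hn => by simp [h n hn x]]

end BHT

/-- **fully vector-valued estimate.** For `1 < p, q ≤ ∞`,
`1/r = 1/p + 1/q` with `0 < 1/r < 3/2`, an arbitrary sequence of intervals `(I_n)`,
and sequences of Schwartz functions `(f_n)`, `(g_n)`,
`‖(Σ_n |π_{I_n}(f_n, g_n)|²)^{1/2}‖_r ≲ ‖(Σ_n |f_n|²)^{1/2}‖_p ‖(Σ_n |g_n|²)^{1/2}‖_q`. -/
theorem bilinear_square_function_fully_vector_valued
    (p q r : ℝ≥0∞) (hp : 1 < p) (hq : 1 < q)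
    (hr : 1 / r = 1 / p + 1 / q) (hr0 : 0 < 1 / r) (hr1 : 1 / r < 3 / 2) :
    ∃ C : ℝ, 0 < C ∧ ∀ I : ℤ → Set ℝ, (∀ n : ℤ, (I n).OrdConnected) →
      ∀ F G : ℤ → SchwartzMap ℝ ℂ,
      (Function.support F).Finite → (Function.support G).Finite →
        eLpNorm (fun x : ℝ =>
            Real.sqrt (∑' n : ℤ, ‖biMul (I n) (⇑(F n)) (⇑(G n)) x‖ ^ 2)) r volume ≤
          ENNReal.ofReal C *
            eLpNorm (fun x : ℝ => Real.sqrt (∑' n : ℤ, ‖F n x‖ ^ 2)) p volume *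
            eLpNorm (fun x : ℝ => Real.sqrt (∑' n : ℤ, ‖G n x‖ ^ 2)) q volume := by
  obtain ⟨C, hC, h⟩ := BHT.vector_interval (ι := ℤ) hp hq hr hr0 hr1
  refine ⟨C, hC, fun I hI F G hF hG => ?_⟩
  have h1 : ∀ n ∉ hF.toFinset ∪ hG.toFinset, F n = 0 ∧ G n = 0 := fun n hn => by
    simpa [not_or] using hn
  rw [BHT.sqrt_tsum_eq_sqf (s := hF.toFinset ∪ hG.toFinset) (u := fun n => biMul (I n) (F n) (G n))
      (fun n hn x => by
        rw [(h1 n hn).1]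
        exact BHT.biMul_zero_left _ _ _),
    BHT.sqrt_tsum_eq_sqf (s := hF.toFinset ∪ hG.toFinset) (u := fun n => F n) (fun n hn x => by
      rw [(h1 n hn).1]
      rfl),
    BHT.sqrt_tsum_eq_sqf (s := hF.toFinset ∪ hG.toFinset) (u := fun n => G n) (fun n hn x => by
      rw [(h1 n hn).2]
      rfl)]
  exact h I hI _ _ _ (fun n => BHT.good_schwartz _) fun n => BHT.good_schwartz _
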